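/- Proposition (summability of the return time). For every f ∈ Bimod, the first return time N⁰ to 𝕀 is integrable over 𝕀 with respect to the Lebesgue measure λ (equivalently, Σ_{J∈𝒩⁰} N⁰(J)|J| < ∞, where 𝒩⁰ is the partition of 𝕀 modulo λ into maximal intervals on which N⁰ is finite and constant) if and only if both conditions (C⁻) and (C⁺) are satisfied. -/

import Mathlib

open MeasureTheory Set Filter
open scoped ENNReal

noncomputable section

/-- Iterated fractional parts in the continued fraction algorithm:
`cfFrac ρ 0 = ρ - ⌊ρ⌋` and `cfFrac ρ (k+1) = 1/(cfFrac ρ k) - ⌊1/(cfFrac ρ k)⌋`. -/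
noncomputable def cfFrac (ρ : ℝ) : ℕ → ℝ
  | 0 => Int.fract ρ
  | n + 1 => Int.fract (1 / cfFrac ρ n)

/-- Partial quotients `a_k` of the continued fraction expansion of `ρ`. -/
noncomputable def cfA (ρ : ℝ) : ℕ → ℤ
  | 0 => ⌊ρ⌋
  | n + 1 => ⌊1 / cfFrac ρ n⌋

/-- Denominators `q_k` of the convergents of `ρ`:
`q_0 = 1`, `q_1 = a_1` (since `q_{-1} = 0`), `q_{k+1} = a_{k+1} q_k + q_{k-1}`. -/
noncomputable def cfQ (ρ : ℝ) : ℕ → ℕ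
  | 0 => 1
  | 1 => (cfA ρ 1).toNat
  | n + 2 => (cfA ρ (n + 2)).toNat * cfQ ρ (n + 1) + cfQ ρ n
/-- The class `Bimod` of degree one bimodal circle endomorphisms, given by the
circle map `f : 𝕋¹ → 𝕋¹` together with a lift `F : ℝ → ℝ` (`π ∘ F = f ∘ π`,
`F(x+1) = F(x)+1`), satisfying (A1) (`C²`, bimodal with non-flat critical points
`c̃⁺ < c̃⁻` of orders `ℓ⁺, ℓ⁻`), (A2) (the rotation numbers of the upper and lower
maps `F₊, F₋` are irrational) and (A3) (all periodic orbits are hyperbolic repelling). -/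
structure BimodData where
  /-- the lift -/
  F : ℝ → ℝ
  /-- the circle endomorphism -/
  f : UnitAddCircle → UnitAddCircle
  /-- lift of the critical point `c⁺` -/
  ctp : ℝ
  /-- lift of the critical point `c⁻` -/
  ctm : ℝ
  /-- `d̃⁺`, the second preimage of the critical value of `c⁺` -/
  dtp : ℝ
  /-- `d̃⁻`, the second preimage of the critical value of `c⁻` -/
  dtm : ℝ
  /-- the non-flatness order `ℓ⁺` -/
  lp : ℝ
  /-- the non-flatness order `ℓ⁻` -/
  lm : ℝ
  /-- the upper map `F₊` (a monotone degree one lift) -/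
  Fp : CircleDeg1Lift
  /-- the lower map `F₋` (a monotone degree one lift) -/
  Fm : CircleDeg1Lift
  /-- the diffeomorphism `ψ⁺` -/
  psip : ℝ → ℝ
  /-- the diffeomorphism `ψ⁻` -/
  psim : ℝ → ℝ
  hf : ∀ x : ℝ, f ((x : ℝ) : UnitAddCircle) = ((F x : ℝ) : UnitAddCircle)
  h0 : 0 < ctp
  h1 : ctp < ctm
  h2 : ctm < 1
  hlift : ∀ x, F (x + 1) = F x + 1
  hC2 : ContDiff ℝ 2 F
  hdecr : ∀ x ∈ Set.Ioo ctp ctm, deriv F x < 0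
  hincr : ∀ x ∈ Set.Ioo ctm (ctp + 1), 0 < deriv F x
  hlp : 1 < lp
  hlm : 1 < lm
  hpsipC2 : ContDiff ℝ 2 psip
  hpsipBij : Function.Bijective psip
  hpsipD : ∀ x, deriv psip x ≠ 0
  hpsip0 : psip ctp = 0
  hpsipEq : ∀ᶠ x in nhds ctp, F x = F ctp - |psip x| ^ lp
  hpsimC2 : ContDiff ℝ 2 psim
  hpsimBij : Function.Bijective psim
  hpsimD : ∀ x, deriv psim x ≠ 0
  hpsim0 : psim ctm = 0
  hpsimEq : ∀ᶠ x in nhds ctm, F x = F ctm + |psim x| ^ lm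
  hdtp : dtp ∈ Set.Ioo ctm (ctp + 1)
  hdtpF : F dtp = F ctp
  hFp1 : ∀ x ∈ Set.Icc ctp dtp, Fp x = F ctp
  hFp2 : ∀ x ∈ Set.Icc dtp (ctp + 1), Fp x = F x
  hdtm : dtm ∈ Set.Ioo (ctm - 1) ctp
  hdtmF : F dtm = F ctm
  hFm1 : ∀ x ∈ Set.Icc dtm ctm, Fm x = F ctm
  hFm2 : ∀ x ∈ Set.Icc ctm (dtm + 1), Fm x = F x
  hirrp : Irrational Fp.translationNumber
  hirrm : Irrational Fm.translationNumber
  hA3 : ∀ (x : ℝ) (n : ℕ), 1 ≤ n → (∃ m : ℤ, F^[n] x = x + (m : ℝ)) →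
    1 < |deriv (F^[n]) x|

namespace BimodData

/-- The critical point `c⁺ = π(c̃⁺)`. -/
noncomputable def cp (B : BimodData) : UnitAddCircle := ((B.ctp : ℝ) : UnitAddCircle)

/-- The critical point `c⁻ = π(c̃⁻)`. -/
noncomputable def cm (B : BimodData) : UnitAddCircle := ((B.ctm : ℝ) : UnitAddCircle)

/-- The interval `𝕀 = π([c̃⁺, c̃⁻])` on which `f` is decreasing. -/
def II (B : BimodData) : Set UnitAddCircle :=
  (fun x : ℝ => ((x : ℝ) : UnitAddCircle)) '' Set.Icc B.ctp B.ctm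

/-- The upper rotation number `ρ⁺`. -/
noncomputable def rhop (B : BimodData) : ℝ := B.Fp.translationNumber

/-- The lower rotation number `ρ⁻`. -/
noncomputable def rhom (B : BimodData) : ℝ := B.Fm.translationNumber

/-- Condition (C⁻): `Σ_{k≥0} q⁻_{2k+1} · d(f^{q⁻_{2k}}(c⁻), c⁻) < ∞`. -/
def CondCm (B : BimodData) : Prop :=
  Summable fun k : ℕ =>
    (cfQ B.rhom (2 * k + 1) : ℝ) * dist (B.f^[cfQ B.rhom (2 * k)] B.cm) B.cm

/-- Condition (C⁺): `Σ_{k≥1} q⁺_{2k} · d(f^{q⁺_{2k-1}}(c⁺), c⁺) < ∞`. -/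
def CondCp (B : BimodData) : Prop :=
  Summable fun k : ℕ =>
    (cfQ B.rhop (2 * k + 2) : ℝ) * dist (B.f^[cfQ B.rhop (2 * k + 1)] B.cp) B.cp

end BimodData

/-- The set of times `n ≥ 1` at which the orbit of `x` lies in `𝕀`. -/
def BimodData.returnSet (B : BimodData) (x : UnitAddCircle) : Set ℕ :=
  {n : ℕ | 1 ≤ n ∧ B.f^[n] x ∈ B.II}

/-- The first entry time `N⁰(x)` to `𝕀` (equal to `0` when the orbit of `x`
never enters `𝕀`). -/
noncomputable def BimodData.N0 (B : BimodData) (x : UnitAddCircle) : ℕ :=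
  sInf (B.returnSet x)

/-- The first entry map `T⁰(x) = f^{N⁰(x)}(x)` to `𝕀` (the first return map on `𝕀`). -/
noncomputable def BimodData.T0 (B : BimodData) (x : UnitAddCircle) : UnitAddCircle :=
  B.f^[B.N0 x] x

/-- The first entry time to `𝕀` with value `∞` when the orbit never enters `𝕀`. -/
noncomputable def BimodData.N0e (B : BimodData) (x : UnitAddCircle) : ℝ≥0∞ :=
  open scoped Classical in
  if (B.returnSet x).Nonempty then ((sInf (B.returnSet x) : ℕ) : ℝ≥0∞) else ⊤

/-- The cross ratio of four points `s < x < y < t` of the line. -/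
def crossRatio (s x y t : ℝ) : ℝ := (y - x) * (t - s) / ((x - s) * (t - y))

/-- The data of a lift `F` increasing on `[a,b]` and decreasing on `[b-1,a]`, with its lower
and upper maps `Fm`, `Fp`, and the analytic estimates used in the sequel. The data is symmetric
under conjugation by `x ↦ -x`. -/
structure Lorenz where
  F : ℝ → ℝ
  a : ℝ
  b : ℝ
  d : ℝ
  e : ℝ
  Fm : ℝ → ℝ
  Fp : ℝ → ℝ
  rm : ℝ
  rp : ℝ
  hab : a < b
  hba : b < a + 1
  per : ∀ x, F (x + 1) = F x + 1
  hC1 : ContDiff ℝ 1 F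
  dpos : ∀ x ∈ Ioo a b, 0 < deriv F x
  dneg : ∀ x ∈ Ioo (b - 1) a, deriv F x < 0
  hd1 : a - 1 < d
  hd2 : d < b - 1
  hdF : F d = F a
  he1 : a < e
  he2 : e < b
  heF : F e = F b - 1
  Fm_mono : Monotone Fm
  Fm_per : ∀ x, Fm (x + 1) = Fm x + 1
  Fm_le : ∀ x, Fm x ≤ F x
  Fm_eq : ∀ x ∈ Icc a (d + 1), Fm x = F x
  Fm_flat : ∀ x ∈ Icc d a, Fm x = F a
  rm_irr : Irrational rm
  rm_lt : ∀ (n : ℕ) (m : ℤ), (m : ℝ) < n * rm → ∀ x, x + m < Fm^[n] x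
  lt_rm : ∀ (n : ℕ) (m : ℤ), (n : ℝ) * rm < m → ∀ x, Fm^[n] x < x + m
  Fp_mono : Monotone Fp
  Fp_per : ∀ x, Fp (x + 1) = Fp x + 1
  le_Fp : ∀ x, F x ≤ Fp x
  Fp_eq : ∀ x ∈ Icc e b, Fp x = F x
  Fp_flat : ∀ x ∈ Icc b (e + 1), Fp x = F b
  rp_irr : Irrational rp
  rp_lt : ∀ (n : ℕ) (m : ℤ), (m : ℝ) < n * rp → ∀ x, x + m < Fp^[n] x
  lt_rp : ∀ (n : ℕ) (m : ℤ), (n : ℝ) * rp < m → ∀ x, Fp^[n] x < x + m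
  C : ℝ
  hC : 0 ≤ C
  crL : ∀ s x y t, a ≤ s → s < x → x < y → y < t → t ≤ b →
    crossRatio s x y t ≤ Real.exp (C * (y - s)) * crossRatio (F s) (F x) (F y) (F t)
  crR : ∀ s x y t, a ≤ s → s < x → x < y → y < t → t ≤ b →
    crossRatio s x y t ≤ Real.exp (C * (t - x)) * crossRatio (F s) (F x) (F y) (F t)
  distort : ∀ δ > 0, ∃ Λ ≥ 0, ∀ x ∈ Icc (a + δ) (b - δ), ∀ y ∈ Icc (a + δ) (b - δ),
    deriv F x ≤ Real.exp (Λ * |x - y|) * deriv F y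
  la : ℝ
  hla : 1 < la
  powa : ∃ c₁ > 0, ∃ c₂ > 0, ∀ s ∈ Icc 0 (b - a),
    c₁ * s ^ la ≤ F (a + s) - F a ∧ F (a + s) - F a ≤ c₂ * s ^ la
  lb : ℝ
  hlb : 1 < lb
  powb : ∃ c₁ > 0, ∃ c₂ > 0, ∀ s ∈ Icc 0 (b - a),
    c₁ * s ^ lb ≤ F b - F (b - s) ∧ F b - F (b - s) ≤ c₂ * s ^ lb
  twina : ∃ s₀ > 0, ∃ K > 0, ∃ τ : ℝ → ℝ, s₀ ≤ a - (b - 1) ∧ τ a = a ∧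
    (∀ x ∈ Icc (a - s₀) a, τ x ∈ Icc a b ∧ F (τ x) = F x) ∧
    ∀ x ∈ Icc (a - s₀) a, ∀ y ∈ Icc (a - s₀) a, x ≤ y →
      τ x - τ y ≤ K * (y - x) ∧ y - x ≤ K * (τ x - τ y)
  twinb : ∃ s₀ > 0, ∃ K > 0, ∃ τ : ℝ → ℝ, s₀ ≤ a + 1 - b ∧ τ b = b ∧
    (∀ x ∈ Icc b (b + s₀), τ x ∈ Icc a b ∧ F (τ x) = F x) ∧
    ∀ x ∈ Icc b (b + s₀), ∀ y ∈ Icc b (b + s₀), x ≤ y →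
      τ x - τ y ≤ K * (y - x) ∧ y - x ≤ K * (τ x - τ y)
  repel : ∀ (x : ℝ) (n : ℕ) (m : ℤ), 1 ≤ n → F^[n] x = x + m → 1 < |deriv (F^[n]) x|

namespace Lorenz
variable (L : Lorenz)

theorem iter_neg (G : ℝ → ℝ) (n : ℕ) (x : ℝ) :
    (fun x => -G (-x))^[n] x = -G^[n] (-x) := by
  induction n generalizing x with
  | zero => simp
  | succ n ih => simp [Function.iterate_succ_apply, ih]

theorem crossRatio_neg (s x y t : ℝ) :
    crossRatio (-t) (-y) (-x) (-s) = crossRatio s x y t := by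
  unfold crossRatio
  rw [show -s - -t = t - s by ring, show -x - -y = y - x by ring,
    show -y - -t = t - y by ring, show -s - -x = x - s by ring, mul_comm (x - s)]

/-- The conjugate of the data by `x ↦ -x`. -/
def refl : Lorenz where
  F := fun x => -L.F (-x)
  a := -L.b
  b := -L.a
  d := -L.e - 1
  e := -L.d - 1
  Fm := fun x => -L.Fp (-x)
  Fp := fun x => -L.Fm (-x)
  rm := -L.rp
  rp := -L.rm
  hab := by linarith [L.hab]
  hba := by linarith [L.hba]
  per x := by
    have := L.per (-(x + 1))
    rw [show -(x + 1) + 1 = -x by ring] at this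
    linarith
  hC1 := (L.hC1.comp contDiff_neg).neg
  dpos x hx := by
    have h : deriv (fun x => -L.F (-x)) x = deriv L.F (-x) := by
      rw [deriv.fun_neg, deriv_comp_neg]; simp
    rw [h]; exact L.dpos _ ⟨by linarith [hx.2], by linarith [hx.1]⟩
  dneg x hx := by
    have h : deriv (fun x => -L.F (-x)) x = deriv L.F (-x) := by
      rw [deriv.fun_neg, deriv_comp_neg]; simp
    have hp : deriv L.F (-x) = deriv L.F (-x - 1) := by
      have : (fun y => L.F (y + 1)) = fun y => L.F y + 1 := funext L.per
      have h2 := congrFun (congrArg deriv this) (-x - 1)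
      rw [deriv_comp_add_const, deriv_add_const] at h2
      simpa using h2
    rw [h, hp]; exact L.dneg _ ⟨by linarith [hx.2], by linarith [hx.1]⟩
  hd1 := by linarith [L.he2]
  hd2 := by linarith [L.he1]
  hdF := by
    have := L.per L.e
    simp only [neg_neg, neg_sub, sub_neg_eq_add]
    rw [add_comm, this, L.heF]; ring
  he1 := by linarith [L.hd2]
  he2 := by linarith [L.hd1]
  heF := by
    have := L.per L.d
    simp only [neg_neg, neg_sub, sub_neg_eq_add]
    rw [add_comm, this, L.hdF]; ring
  Fm_mono x y h := by simpa using L.Fp_mono (neg_le_neg h)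
  Fm_per x := by
    have := L.Fp_per (-(x + 1))
    rw [show -(x + 1) + 1 = -x by ring] at this
    linarith
  Fm_le x := by simpa using L.le_Fp (-x)
  Fm_eq x hx := by
    simp only [neg_inj]; exact L.Fp_eq _ ⟨by linarith [hx.2], by linarith [hx.1]⟩
  Fm_flat x hx := by
    simp only [neg_inj, neg_neg]; exact L.Fp_flat _ ⟨by linarith [hx.2], by linarith [hx.1]⟩
  rm_irr := L.rp_irr.neg
  rm_lt n m h x := by
    have := L.lt_rp n (-m) (by push_cast; linarith) (-x)
    rw [iter_neg]; push_cast at this; linarith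
  lt_rm n m h x := by
    have := L.rp_lt n (-m) (by push_cast; linarith) (-x)
    rw [iter_neg]; push_cast at this; linarith
  Fp_mono x y h := by simpa using L.Fm_mono (neg_le_neg h)
  Fp_per x := by
    have := L.Fm_per (-(x + 1))
    rw [show -(x + 1) + 1 = -x by ring] at this
    linarith
  le_Fp x := by simpa using L.Fm_le (-x)
  Fp_eq x hx := by
    simp only [neg_inj]; exact L.Fm_eq _ ⟨by linarith [hx.2], by linarith [hx.1]⟩
  Fp_flat x hx := by
    simp only [neg_inj, neg_neg]; exact L.Fm_flat _ ⟨by linarith [hx.2], by linarith [hx.1]⟩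
  rp_irr := L.rm_irr.neg
  rp_lt n m h x := by
    have := L.lt_rm n (-m) (by push_cast; linarith) (-x)
    rw [iter_neg]; push_cast at this; linarith
  lt_rp n m h x := by
    have := L.rm_lt n (-m) (by push_cast; linarith) (-x)
    rw [iter_neg]; push_cast at this; linarith
  C := L.C
  hC := L.hC
  crL s x y t h1 h2 h3 h4 h5 := by
    have := L.crR (-t) (-y) (-x) (-s) (by linarith) (by linarith) (by linarith) (by linarith)
      (by linarith)
    rw [crossRatio_neg] at this
    rw [← crossRatio_neg (-L.F (-s))]
    simpa [sub_eq_add_neg, add_comm] using this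
  crR s x y t h1 h2 h3 h4 h5 := by
    have := L.crL (-t) (-y) (-x) (-s) (by linarith) (by linarith) (by linarith) (by linarith)
      (by linarith)
    rw [crossRatio_neg] at this
    rw [← crossRatio_neg (-L.F (-s))]
    simpa [sub_eq_add_neg, add_comm] using this
  distort δ hδ := by
    obtain ⟨Λ, h0, h⟩ := L.distort δ hδ
    refine ⟨Λ, h0, fun x hx y hy => ?_⟩
    have hh : ∀ x, deriv (fun x => -L.F (-x)) x = deriv L.F (-x) := by
      intro x; rw [deriv.fun_neg, deriv_comp_neg]; simp
    rw [hh, hh]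
    have := h (-x) ⟨by linarith [hx.2], by linarith [hx.1]⟩ (-y)
      ⟨by linarith [hy.2], by linarith [hy.1]⟩
    rwa [show -x - -y = -(x - y) by ring, abs_neg] at this
  la := L.lb
  hla := L.hlb
  powa := by
    obtain ⟨c₁, h1, c₂, h2, h⟩ := L.powb
    refine ⟨c₁, h1, c₂, h2, fun s hs => ?_⟩
    have := h s ⟨hs.1, by linarith [hs.2]⟩
    simp only [neg_neg, neg_add, ← sub_eq_add_neg]
    constructor <;> linarith
  lb := L.la
  hlb := L.hla
  powb := by
    obtain ⟨c₁, h1, c₂, h2, h⟩ := L.powa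
    refine ⟨c₁, h1, c₂, h2, fun s hs => ?_⟩
    have := h s ⟨hs.1, by linarith [hs.2]⟩
    simp only [neg_neg, neg_sub, sub_neg_eq_add]
    rw [add_comm s]
    constructor <;> linarith
  twina := by
    obtain ⟨s₀, h0, K, hK, τ, h1, h2, h3, h4⟩ := L.twinb
    refine ⟨s₀, h0, K, hK, fun x => -τ (-x), by linarith, by simp [h2], fun x hx => ?_,
      fun x hx y hy hxy => ?_⟩
    · have := h3 (-x) ⟨by linarith [hx.2], by linarith [hx.1]⟩
      exact ⟨⟨by linarith [this.1.2], by linarith [this.1.1]⟩, by simp [this.2]⟩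
    · have := h4 (-y) ⟨by linarith [hy.2], by linarith [hy.1]⟩ (-x)
        ⟨by linarith [hx.2], by linarith [hx.1]⟩ (by linarith)
      rw [show -x - -y = y - x by ring] at this
      rw [show -τ (-x) - -τ (-y) = τ (-y) - τ (-x) by ring]; exact this
  twinb := by
    obtain ⟨s₀, h0, K, hK, τ, h1, h2, h3, h4⟩ := L.twina
    refine ⟨s₀, h0, K, hK, fun x => -τ (-x), by linarith, by simp [h2], fun x hx => ?_,
      fun x hx y hy hxy => ?_⟩
    · have := h3 (-x) ⟨by linarith [hx.2], by linarith [hx.1]⟩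
      exact ⟨⟨by linarith [this.1.2], by linarith [this.1.1]⟩, by simp [this.2]⟩
    · have := h4 (-y) ⟨by linarith [hy.2], by linarith [hy.1]⟩ (-x)
        ⟨by linarith [hx.2], by linarith [hx.1]⟩ (by linarith)
      rw [show -x - -y = y - x by ring] at this
      rw [show -τ (-x) - -τ (-y) = τ (-y) - τ (-x) by ring]; exact this
  repel x n m hn h := by
    rw [iter_neg] at h
    have := L.repel (-x) n (-m) hn (by push_cast; linarith)
    have h2 : (fun x => -L.F (-x))^[n] = fun x => -L.F^[n] (-x) := funext fun x => iter_neg _ _ _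
    have h3 : deriv (fun x => -L.F^[n] (-x)) x = deriv (L.F^[n]) (-x) := by
      rw [deriv.fun_neg, deriv_comp_neg]; simp
    rw [h2, h3]; exact this

end Lorenz

theorem iter_add_int {G : ℝ → ℝ} (h : ∀ x, G (x + 1) = G x + 1) (n : ℕ) (x : ℝ) (m : ℤ) :
    G^[n] (x + m) = G^[n] x + m := by
  have h1 : ∀ (m : ℤ) x, G (x + m) = G x + m := by
    intro m
    induction m using Int.induction_on with
    | zero => simp
    | succ k ih => intro x; push_cast; rw [← add_assoc, h, ← add_assoc]; congr 1; exact_mod_cast ih x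
    | pred k ih =>
      intro x
      have e1 := h (x + (-(k : ℤ) - 1 : ℤ))
      have e2 := ih x
      push_cast at *
      rw [show x + (-(k : ℝ) - 1) + 1 = x + -(k : ℝ) by ring, e2] at e1
      linarith
  induction n generalizing x with
  | zero => simp
  | succ n ih => rw [Function.iterate_succ_apply, h1, ih, Function.iterate_succ_apply]

theorem iter_mono_nat {G : ℝ → ℝ} (h : Monotone G) (n : ℕ) : Monotone (G^[n]) := h.iterate n

namespace Lorenz
variable (L : Lorenz)

theorem per_int (x : ℝ) (m : ℤ) : L.F (x + m) = L.F x + m := iter_add_int L.per 1 x m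
theorem iter_int (n : ℕ) (x : ℝ) (m : ℤ) : L.F^[n] (x + m) = L.F^[n] x + m :=
  iter_add_int L.per n x m
theorem Fm_int (x : ℝ) (m : ℤ) : L.Fm (x + m) = L.Fm x + m := iter_add_int L.Fm_per 1 x m
theorem Fm_iter_int (n : ℕ) (x : ℝ) (m : ℤ) : L.Fm^[n] (x + m) = L.Fm^[n] x + m :=
  iter_add_int L.Fm_per n x m

theorem cont : Continuous L.F := L.hC1.continuous
theorem cont_iter (n : ℕ) : Continuous (L.F^[n]) := L.cont.iterate n
theorem diff : Differentiable ℝ L.F := L.hC1.differentiable (by norm_num)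
theorem diff_iter (n : ℕ) : Differentiable ℝ (L.F^[n]) := L.diff.iterate n
theorem cont_deriv : Continuous (deriv L.F) := L.hC1.continuous_deriv (by norm_num)

theorem strictMono : StrictMonoOn L.F (Icc L.a L.b) := by
  apply strictMonoOn_of_deriv_pos (convex_Icc _ _) L.cont.continuousOn
  rw [interior_Icc]; exact L.dpos

theorem strictMono_int (m : ℤ) : StrictMonoOn L.F (Icc (L.a + m) (L.b + m)) := by
  intro x hx y hy hxy
  have := L.strictMono (a := x - m) ⟨by linarith [hx.1], by linarith [hx.2]⟩ (b := y - m)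
    ⟨by linarith [hy.1], by linarith [hy.2]⟩ (by linarith)
  have e1 := L.per_int (x - m) m
  have e2 := L.per_int (y - m) m
  simp only [sub_add_cancel] at e1 e2
  linarith

theorem strictAnti : StrictAntiOn L.F (Icc (L.b - 1) L.a) := by
  apply strictAntiOn_of_deriv_neg (convex_Icc _ _) L.cont.continuousOn
  rw [interior_Icc]; exact L.dneg

/-- The lift of the open arc on which the map is increasing. -/
def U : Set ℝ := {x | ∃ m : ℤ, L.a + m < x ∧ x < L.b + m}

/-- Points whose orbit stays in `U` up to time `n`. -/
def D (n : ℕ) : Set ℝ := {x | ∀ l ≤ n, L.F^[l] x ∈ L.U}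

/-- The interval `[s,t]` is mapped by each `F^l`, `l < n`, into a closed arc where `F`
is increasing. -/
def Ch (n : ℕ) (s t : ℝ) : Prop :=
  s ≤ t ∧ ∀ l < n, ∃ m : ℤ, L.a + m ≤ L.F^[l] s ∧ L.F^[l] t ≤ L.b + m

variable {L}

theorem notMem_U {x : ℝ} (h : x ∉ L.U) : ∃ m : ℤ, L.b - 1 + m ≤ x ∧ x ≤ L.a + m := by
  have h1 := Int.floor_le (x - L.a)
  have h2 := Int.lt_floor_add_one (x - L.a)
  rcases eq_or_lt_of_le h1 with h3 | h3
  · exact ⟨⌊x - L.a⌋, by linarith [L.hba], by linarith⟩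
  · refine ⟨⌊x - L.a⌋ + 1, ?_, by push_cast; linarith⟩
    by_contra h4
    push_cast at h4
    exact h ⟨⌊x - L.a⌋, by linarith, by linarith⟩

theorem mem_U_iff {x : ℝ} : x ∈ L.U ↔ ¬ ∃ m : ℤ, L.b - 1 + m ≤ x ∧ x ≤ L.a + m := by
  refine ⟨?_, fun h => by_contra fun h' => h (notMem_U h')⟩
  rintro ⟨k, h1, h2⟩ ⟨m, h3, h4⟩
  have e1 : (k : ℝ) < m := by linarith
  have e2 : (m : ℝ) < k + 1 := by linarith
  have e1 : k < m := by exact_mod_cast e1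
  have e2 : m < k + 1 := by exact_mod_cast e2
  omega

theorem U_int {x : ℝ} (m : ℤ) : x + m ∈ L.U ↔ x ∈ L.U := by
  constructor
  · rintro ⟨k, h1, h2⟩; exact ⟨k - m, by push_cast; linarith, by push_cast; linarith⟩
  · rintro ⟨k, h1, h2⟩; exact ⟨k + m, by push_cast; linarith, by push_cast; linarith⟩

theorem isOpen_U : IsOpen L.U := by
  have : L.U = ⋃ m : ℤ, Ioo (L.a + m) (L.b + m) := by ext; simp [U]
  rw [this]; exact isOpen_iUnion fun _ => isOpen_Ioo

theorem D_anti {m n : ℕ} (h : m ≤ n) : L.D n ⊆ L.D m := fun _ hx l hl => hx l (hl.trans h)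

theorem D_int {n : ℕ} {x : ℝ} (m : ℤ) : x + m ∈ L.D n ↔ x ∈ L.D n := by
  simp only [D, mem_ofPred_eq, iter_int, U_int]

theorem D_iter {n k : ℕ} {x : ℝ} (h : x ∈ L.D (n + k)) : L.F^[k] x ∈ L.D n := by
  intro l hl
  rw [← Function.iterate_add_apply]; exact h _ (by omega)

theorem Ch.lt {n : ℕ} {s t : ℝ} (h : L.Ch n s t) {l : ℕ} (hl : l ≤ n) {x y : ℝ} (hx : s ≤ x)
    (hxy : x < y) (hy : y ≤ t) : L.F^[l] x < L.F^[l] y := by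
  have key : ∀ l ≤ n, StrictMonoOn (L.F^[l]) (Icc s t) := by
    intro l
    induction l with
    | zero => intro _; simpa using strictMonoOn_id
    | succ l ih =>
      intro hl x hx y hy hxy
      have ih := ih (by omega)
      obtain ⟨m, h1, h2⟩ := h.2 l (by omega)
      rw [Function.iterate_succ_apply', Function.iterate_succ_apply']
      have e1 := ih.monotoneOn (left_mem_Icc.2 h.1) hx hx.1
      have e2 := ih.monotoneOn hx (right_mem_Icc.2 h.1) hx.2
      have e3 := ih.monotoneOn (left_mem_Icc.2 h.1) hy hy.1
      have e4 := ih.monotoneOn hy (right_mem_Icc.2 h.1) hy.2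
      exact L.strictMono_int m ⟨by linarith, by linarith⟩ ⟨by linarith, by linarith⟩
        (ih hx hy hxy)
  exact key l hl ⟨hx, by linarith⟩ ⟨by linarith, hy⟩ hxy

theorem Ch.le {n : ℕ} {s t : ℝ} (h : L.Ch n s t) {l : ℕ} (hl : l ≤ n) {x y : ℝ} (hx : s ≤ x)
    (hxy : x ≤ y) (hy : y ≤ t) : L.F^[l] x ≤ L.F^[l] y := by
  rcases eq_or_lt_of_le hxy with rfl | h1
  · exact le_rfl
  · exact (h.lt hl hx h1 hy).le

theorem Ch.lt_of_lt {n : ℕ} {s t : ℝ} (h : L.Ch n s t) {l : ℕ} (hl : l ≤ n) {x y : ℝ}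
    (hx : s ≤ x) (hx' : x ≤ t) (hy : s ≤ y) (hy' : y ≤ t) (hxy : L.F^[l] x < L.F^[l] y) :
    x < y := by
  by_contra h1
  exact absurd (h.le hl hy (not_lt.1 h1) hx') (not_le.2 hxy)

theorem Ch.sub {n : ℕ} {s t : ℝ} (h : L.Ch n s t) {x y : ℝ} (hx : s ≤ x)
    (hxy : x ≤ y) (hy : y ≤ t) : L.Ch n x y := by
  refine ⟨hxy, fun l hl => ?_⟩
  obtain ⟨m, h1, h2⟩ := h.2 l hl
  exact ⟨m, h1.trans (h.le hl.le le_rfl hx (hxy.trans hy)),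
    (h.le hl.le (hx.trans hxy) hy le_rfl).trans h2⟩

theorem Ch.anti {n k : ℕ} {s t : ℝ} (h : L.Ch n s t) (hk : k ≤ n) : L.Ch k s t :=
  ⟨h.1, fun l hl => h.2 l (by omega)⟩

theorem Ch.iter {n k : ℕ} {s t : ℝ} (h : L.Ch (n + k) s t) : L.Ch n (L.F^[k] s) (L.F^[k] t) := by
  refine ⟨h.le (by omega) le_rfl h.1 le_rfl, fun l hl => ?_⟩
  rw [← Function.iterate_add_apply, ← Function.iterate_add_apply]
  exact h.2 _ (by omega)

theorem Ch.add {n k : ℕ} {s t : ℝ} (h : L.Ch k s t) (h' : L.Ch n (L.F^[k] s) (L.F^[k] t)) :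
    L.Ch (n + k) s t := by
  refine ⟨h.1, fun l hl => ?_⟩
  rcases lt_or_ge l k with h1 | h1
  · exact h.2 l h1
  · have := h'.2 (l - k) (by omega)
    rwa [← Function.iterate_add_apply, ← Function.iterate_add_apply,
      Nat.sub_add_cancel h1] at this

theorem Ch.join {n : ℕ} {s t u : ℝ} (h : L.Ch n s t) (h' : L.Ch n t u) : L.Ch n s u := by
  refine ⟨h.1.trans h'.1, fun l hl => ?_⟩
  obtain ⟨m, h1, h2⟩ := h.2 l hl
  obtain ⟨k, h3, h4⟩ := h'.2 l hl
  have e1 := h.le hl.le le_rfl h.1 le_rfl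
  have e2 := h'.le hl.le le_rfl h'.1 le_rfl
  have hb := L.hba
  have i1 : (k : ℝ) < m + 1 := by linarith
  have i2 : (m : ℝ) < k + 1 := by linarith
  have i1 : k < m + 1 := by exact_mod_cast i1
  have i2 : m < k + 1 := by exact_mod_cast i2
  obtain rfl : k = m := by omega
  exact ⟨k, h1, h4⟩

theorem Ch.int {n : ℕ} {s t : ℝ} (h : L.Ch n s t) (m : ℤ) : L.Ch n (s + m) (t + m) := by
  refine ⟨by linarith [h.1], fun l hl => ?_⟩
  obtain ⟨k, h1, h2⟩ := h.2 l hl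
  rw [iter_int, iter_int]
  exact ⟨k + m, by push_cast; linarith, by push_cast; linarith⟩

theorem exists_int_of_Ioo_subset_U {s t : ℝ} (hst : s < t) (h : Ioo s t ⊆ L.U) :
    ∃ m : ℤ, L.a + m ≤ s ∧ t ≤ L.b + m := by
  obtain ⟨m, h1, h2⟩ := h (show (s + t) / 2 ∈ Ioo s t from ⟨by linarith, by linarith⟩)
  have hba := L.hba
  refine ⟨m, ?_, ?_⟩
  · by_contra h3
    refine mem_U_iff.1 (h (show L.a + m ∈ Ioo s t from ⟨by linarith, by linarith⟩)) ⟨m, ?_, ?_⟩ <;>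
    linarith
  · by_contra h3
    refine mem_U_iff.1 (h (show L.b + m ∈ Ioo s t from ⟨by linarith, by linarith⟩))
      ⟨m + 1, ?_, ?_⟩ <;> push_cast <;> linarith

theorem Ch_zero {s t : ℝ} (h : s ≤ t) : L.Ch 0 s t := ⟨h, by simp⟩

theorem Ch_one {s t : ℝ} (h : s ≤ t) (m : ℤ) (h1 : L.a + m ≤ s) (h2 : t ≤ L.b + m) :
    L.Ch 1 s t := ⟨h, fun l hl => by obtain rfl : l = 0 := by omega
                                     exact ⟨m, h1, h2⟩⟩

theorem Ch.ivt {n : ℕ} {s t : ℝ} (h : L.Ch n s t) {l : ℕ} {T : ℝ}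
    (h1 : L.F^[l] s ≤ T) (h2 : T ≤ L.F^[l] t) : ∃ z ∈ Icc s t, L.F^[l] z = T :=
  intermediate_value_Icc h.1 (L.cont_iter l).continuousOn ⟨h1, h2⟩

theorem Ch_of_Ioo_subset {n : ℕ} {s t : ℝ} (hst : s < t) (h : Ioo s t ⊆ L.D n) :
    L.Ch (n + 1) s t := by
  have h0 : L.Ch 1 s t := by
    obtain ⟨m, h1, h2⟩ := exists_int_of_Ioo_subset_U hst (fun x hx => h hx 0 (by omega))
    exact Ch_one hst.le m h1 h2
  induction n generalizing s t with
  | zero => exact h0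
  | succ n ih =>
    have h2 : L.F s < L.F t := h0.lt le_rfl le_rfl hst le_rfl
    have h1 : Ioo (L.F s) (L.F t) ⊆ L.D n := by
      intro y hy
      obtain ⟨z, hz, rfl⟩ := h0.ivt (l := 1) hy.1.le hy.2.le
      have hz1 : s < z := lt_of_le_of_ne hz.1 (by rintro rfl; exact lt_irrefl _ hy.1)
      have hz2 : z < t := lt_of_le_of_ne hz.2 (by rintro rfl; exact lt_irrefl _ hy.2)
      exact D_iter (h ⟨hz1, hz2⟩)
    refine Ch.add h0 (ih h2 h1 ?_)
    obtain ⟨m, h3, h4⟩ := exists_int_of_Ioo_subset_U h2 (fun x hx => h1 hx 0 (by omega))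
    exact Ch_one h2.le m h3 h4

theorem Ch.mem_D {n : ℕ} {s t x : ℝ} (h : L.Ch (n + 1) s t) (hx : x ∈ Ioo s t) : x ∈ L.D n := by
  intro l hl
  obtain ⟨m, h1, h2⟩ := h.2 l (by omega)
  exact ⟨m, h1.trans_lt (h.lt (by omega) le_rfl hx.1 hx.2.le),
    (h.lt (by omega) hx.1.le hx.2 le_rfl).trans_le h2⟩

/-- Points of `D n` have admissible orbits up to time `n`. -/
theorem Ch_self_of_mem_D {n : ℕ} {x : ℝ} (h : x ∈ L.D n) : L.Ch (n + 1) x x := by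
  refine ⟨le_rfl, fun l hl => ?_⟩
  obtain ⟨m, h1, h2⟩ := h l (by omega)
  exact ⟨m, h1.le, h2.le⟩

/-- Extension of a monotone branch to the right, up to a target or up to a preimage of `b`. -/
theorem ext_right {i : ℕ} {x T : ℝ} (h : L.Ch i x x) (hT : L.F^[i] x < T) :
    (∃ t, x < t ∧ L.Ch i x t ∧ L.F^[i] t = T) ∨
    ∃ t, L.Ch i x t ∧ L.F^[i] t < T ∧ ∃ l < i, ∃ m : ℤ, L.F^[l] t = L.b + m := by
  induction i generalizing x with
  | zero => exact Or.inl ⟨T, hT, Ch_zero (le_of_lt hT), rfl⟩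
  | succ i ih =>
    have h1 : L.Ch i (L.F x) (L.F x) := Ch.iter (k := 1) h
    obtain ⟨m, hm1, hm2⟩ := h.2 0 (by omega)
    simp only [Function.iterate_zero, id] at hm1 hm2
    have hb : L.Ch 1 x (L.b + m) := Ch_one hm2 m hm1 le_rfl
    have key : ∃ t', L.Ch i (L.F x) t' ∧ L.F^[i] t' ≤ T ∧ (L.F^[i] t' = T ∨
        L.F^[i] t' < T ∧ ∃ l < i, ∃ m : ℤ, L.F^[l] t' = L.b + m) := by
      rcases ih h1 hT with ⟨t, _, h3, h4⟩ | ⟨t, h3, h4, h5⟩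
      · exact ⟨t, h3, h4.le, Or.inl h4⟩
      · exact ⟨t, h3, h4.le, Or.inr ⟨h4, h5⟩⟩
    obtain ⟨t', h3, h4, h5⟩ := key
    rcases le_or_gt t' (L.F (L.b + m)) with h6 | h6
    · obtain ⟨z, hz, rfl⟩ := hb.ivt (l := 1) h3.1 h6
      have hch : L.Ch (i + 1) x z := Ch.add (hb.sub le_rfl hz.1 hz.2) h3
      rcases h5 with h5 | ⟨h5, l, hl, m', h7⟩
      · refine Or.inl ⟨z, lt_of_le_of_ne hz.1 ?_, hch, h5⟩
        rintro rfl; exact hT.ne h5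
      · exact Or.inr ⟨z, hch, h5, l + 1, by omega, m', h7⟩
    · refine Or.inr ⟨L.b + m, Ch.add hb (h3.sub le_rfl (hb.le le_rfl le_rfl hm2 le_rfl) h6.le),
        ?_, 0, by omega, m, rfl⟩
      have := h3.lt (l := i) le_rfl (hb.le (l := 1) le_rfl le_rfl hm2 le_rfl) h6 le_rfl
      exact lt_of_lt_of_le this h4

theorem refl_iter (n : ℕ) (x : ℝ) : L.refl.F^[n] x = -L.F^[n] (-x) := iter_neg _ _ _

theorem refl_Ch {n : ℕ} {s t : ℝ} : L.refl.Ch n s t ↔ L.Ch n (-t) (-s) := by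
  have hr : L.refl.a = -L.b := rfl
  have hr2 : L.refl.b = -L.a := rfl
  simp only [Ch, refl_iter, hr, hr2, neg_le_neg_iff]
  refine and_congr_right fun _ => forall₂_congr fun l _ => ⟨?_, ?_⟩
  · rintro ⟨m, h1, h2⟩; exact ⟨-m, by push_cast; linarith, by push_cast; linarith⟩
  · rintro ⟨m, h1, h2⟩; exact ⟨-m, by push_cast; linarith, by push_cast; linarith⟩

theorem refl_U {x : ℝ} : x ∈ L.refl.U ↔ -x ∈ L.U := by
  have hr : L.refl.a = -L.b := rfl
  have hr2 : L.refl.b = -L.a := rfl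
  simp only [U, mem_ofPred_eq, hr, hr2]
  constructor
  · rintro ⟨m, h1, h2⟩; exact ⟨-m, by push_cast; linarith, by push_cast; linarith⟩
  · rintro ⟨m, h1, h2⟩; exact ⟨-m, by push_cast; linarith, by push_cast; linarith⟩

theorem refl_D {n : ℕ} {x : ℝ} : x ∈ L.refl.D n ↔ -x ∈ L.D n := by
  simp only [D, mem_ofPred_eq, refl_iter, refl_U, neg_neg]

/-- Extension of a monotone branch to the left, up to a target or up to a preimage of `a`. -/
theorem ext_left {i : ℕ} {x T : ℝ} (h : L.Ch i x x) (hT : T < L.F^[i] x) :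
    (∃ t, t < x ∧ L.Ch i t x ∧ L.F^[i] t = T) ∨
    ∃ t, L.Ch i t x ∧ T < L.F^[i] t ∧ ∃ l < i, ∃ m : ℤ, L.F^[l] t = L.a + m := by
  rcases ext_right (L := L.refl) (i := i) (x := -x) (T := -T) (by simpa [refl_Ch] using h)
    (by simpa [refl_iter] using hT) with ⟨t, h1, h2, h3⟩ | ⟨t, h1, h2, l, hl, m, h3⟩
  · exact Or.inl ⟨-t, by linarith, by simpa [refl_Ch] using h2, by rw [refl_iter] at h3; linarith⟩
  · refine Or.inr ⟨-t, by simpa [refl_Ch] using h1, by rw [refl_iter] at h2; linarith, l, hl, -m, ?_⟩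
    have hr2 : L.refl.b = -L.a := rfl
    rw [refl_iter, hr2] at h3; push_cast; linarith

end Lorenz

/-- Intervals of length at most one which are disjoint modulo `ℤ` have total length at most one. -/
theorem sum_length_le_one {ι : Type*} (I : Finset ι) (s t : ι → ℝ) (h0 : ∀ i ∈ I, s i ≤ t i)
    (h1 : ∀ i ∈ I, t i ≤ s i + 1)
    (h2 : ∀ i ∈ I, ∀ j ∈ I, i ≠ j → ∀ (m : ℤ) (x : ℝ), x ∈ Ioo (s i) (t i) →
      x + m ∉ Ioo (s j) (t j)) :
    ∑ i ∈ I, (t i - s i) ≤ 1 := by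
  set A : ι → Set UnitAddCircle := fun i => (fun x : ℝ => (x : UnitAddCircle)) '' Ioo (s i) (t i)
  have hA : ∀ i, IsOpen (A i) := fun i =>
    QuotientAddGroup.isOpenMap_coe _ isOpen_Ioo
  have hv : ∀ i ∈ I, ENNReal.ofReal (t i - s i) ≤ volume (A i) := by
    intro i hi
    have hp := UnitAddCircle.measurePreserving_mk (s i)
    rw [← hp.measure_preimage (hA i).measurableSet.nullMeasurableSet,
      Measure.restrict_apply' measurableSet_Ioc, ← Real.volume_Ioo]
    refine measure_mono fun x hx => ⟨⟨x, hx, rfl⟩, hx.1, hx.2.le.trans (h1 i hi)⟩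
  have hd : (I : Set ι).PairwiseDisjoint A := by
    intro i hi j hj hij
    rw [Function.onFun, Set.disjoint_left]
    rintro _ ⟨x, hx, rfl⟩ ⟨y, hy, hxy⟩
    rw [eq_comm, QuotientAddGroup.eq, AddSubgroup.mem_zmultiples_iff] at hxy
    obtain ⟨m, hm⟩ := hxy
    refine h2 i hi j hj hij m x hx ?_
    rw [show x + (m : ℝ) = y by simp at hm; linarith]; exact hy
  have h3 : ∑ i ∈ I, volume (A i) ≤ 1 := by
    rw [← measure_biUnion_finset hd fun i _ => (hA i).measurableSet]
    exact (measure_mono (subset_univ _)).trans UnitAddCircle.measure_univ.le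
  have h4 : ENNReal.ofReal (∑ i ∈ I, (t i - s i)) ≤ ENNReal.ofReal 1 := by
    rw [ENNReal.ofReal_sum_of_nonneg fun i hi => by linarith [h0 i hi], ENNReal.ofReal_one]
    exact (Finset.sum_le_sum hv).trans h3
  exact (ENNReal.ofReal_le_ofReal_iff zero_le_one).1 h4

theorem crossRatio_add (s x y t c : ℝ) :
    crossRatio (s + c) (x + c) (y + c) (t + c) = crossRatio s x y t := by
  simp [crossRatio]

theorem crossRatio_nonneg {s x y t : ℝ} (h1 : s < x) (h2 : x < y) (h3 : y < t) :
    0 ≤ crossRatio s x y t :=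
  div_nonneg (mul_nonneg (by linarith) (by linarith)) (mul_nonneg (by linarith) (by linarith))

theorem le_mul_crossRatio_left {s x y t : ℝ} (h1 : s < x) (h2 : x < y) (h3 : y < t) :
    y - x ≤ (x - s) * crossRatio s x y t := by
  unfold crossRatio
  have e1 : 0 < x - s := by linarith
  have e2 : 0 < t - y := by linarith
  rw [show (x - s) * ((y - x) * (t - s) / ((x - s) * (t - y))) = (y - x) * ((t - s) / (t - y)) by
    field_simp]
  refine le_mul_of_one_le_right (by linarith) ((one_le_div e2).2 (by linarith))

theorem le_mul_crossRatio_right {s x y t : ℝ} (h1 : s < x) (h2 : x < y) (h3 : y < t) :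
    y - x ≤ (t - y) * crossRatio s x y t := by
  have := le_mul_crossRatio_left (s := -t) (x := -y) (y := -x) (t := -s) (by linarith)
    (by linarith) (by linarith)
  rw [Lorenz.crossRatio_neg] at this
  linarith

namespace Lorenz
variable {L : Lorenz}

theorem Ch.crossRatio_le {n : ℕ} {s t x y : ℝ} (h : L.Ch n s t) (h1 : s < x) (h2 : x < y)
    (h3 : y < t) : crossRatio s x y t ≤
      Real.exp (L.C * ∑ l ∈ Finset.range n, (L.F^[l] y - L.F^[l] s)) *
        crossRatio (L.F^[n] s) (L.F^[n] x) (L.F^[n] y) (L.F^[n] t) := by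
  induction n with
  | zero => simp
  | succ n ih =>
    refine (ih (h.anti (by omega))).trans ?_
    obtain ⟨m, hm1, hm2⟩ := h.2 n (by omega)
    have i1 := h.lt (l := n) (by omega) le_rfl h1 (by linarith)
    have i2 := h.lt (l := n) (by omega) h1.le h2 h3.le
    have i3 := h.lt (l := n) (by omega) (by linarith) h3 le_rfl
    have key := L.crL (L.F^[n] s - m) (L.F^[n] x - m) (L.F^[n] y - m) (L.F^[n] t - m)
      (by linarith) (by linarith) (by linarith) (by linarith) (by linarith)
    have hF : ∀ z, L.F (L.F^[n] z - m) = L.F^[n + 1] z + (-m : ℝ) := by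
      intro z
      have := L.per_int (L.F^[n] z) (-m)
      rw [Function.iterate_succ_apply', sub_eq_add_neg]; push_cast at this; exact this
    simp only [hF, crossRatio_add] at key
    simp only [sub_eq_add_neg _ (m : ℝ), crossRatio_add] at key
    rw [Finset.sum_range_succ, mul_add, Real.exp_add, mul_assoc]
    refine mul_le_mul_of_nonneg_left (key.trans (le_of_eq ?_)) (Real.exp_nonneg _)
    congr 2; ring

/-! ### The orbits of the turning points -/

theorem Fm_ne {n : ℕ} (hn : 1 ≤ n) (x : ℝ) (m : ℤ) : L.Fm^[n] x ≠ x + m := by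
  intro h
  rcases lt_trichotomy ((m : ℝ)) (n * L.rm) with h1 | h1 | h1
  · exact (L.rm_lt n m h1 x).ne' h
  · have : L.rm = m / n := by field_simp; linarith
    exact L.rm_irr ⟨(m : ℚ) / n, by push_cast; exact this.symm⟩
  · exact (L.lt_rm n m h1 x).ne h

theorem Fm_eq_of_notMem {x : ℝ} (h : ∀ m : ℤ, x ∉ Ioo (L.d + m) (L.a + m)) : L.Fm x = L.F x := by
  have h1 := Int.floor_le (x - L.a)
  have h2 := Int.lt_floor_add_one (x - L.a)
  have h3 : x ≤ L.d + ⌊x - L.a⌋ + 1 := by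
    by_contra h4
    exact h (⌊x - L.a⌋ + 1) ⟨by push_cast; linarith, by push_cast; linarith⟩
  have e := L.Fm_eq (x + (-⌊x - L.a⌋ : ℤ)) ⟨by push_cast; linarith, by push_cast; linarith⟩
  rw [Fm_int, per_int] at e
  linarith

theorem Fm_flat_int {x : ℝ} {m : ℤ} (h : x ∈ Icc (L.d + m) (L.a + m)) : L.Fm x = L.F L.a + m := by
  have e := L.Fm_flat (x + (-m : ℤ)) ⟨by push_cast; linarith [h.1], by push_cast; linarith [h.2]⟩
  rw [Fm_int] at e; push_cast at e; linarith

theorem Fm_a : L.Fm L.a = L.F L.a := L.Fm_flat _ ⟨by linarith [L.hd2, L.hba], le_rfl⟩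

theorem Fm_orbit {n : ℕ} (hn : 1 ≤ n) (m : ℤ) : L.Fm^[n] L.a ∉ Icc (L.d + m) (L.a + m) := by
  intro h
  have h1 := Fm_flat_int h
  rw [← Function.iterate_succ_apply' L.Fm, Function.iterate_succ_apply, Fm_a] at h1
  exact Fm_ne hn _ _ h1

theorem iter_a (n : ℕ) : L.F^[n] L.a = L.Fm^[n] L.a := by
  induction n with
  | zero => rfl
  | succ n ih =>
    rw [Function.iterate_succ_apply', Function.iterate_succ_apply', ih]
    refine (Fm_eq_of_notMem fun m hm => ?_).symm
    rcases Nat.eq_zero_or_pos n with rfl | hn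
    · simp only [Function.iterate_zero, id] at hm
      have e1 : (0 : ℝ) < m := by linarith [hm.2]
      have e2 : (m : ℝ) < 1 := by linarith [hm.1, L.hd1]
      have e1 : 0 < m := by exact_mod_cast e1
      have e2 : m < 1 := by exact_mod_cast e2
      omega
    · exact Fm_orbit hn m ⟨hm.1.le, hm.2.le⟩

theorem Fm_order {i j : ℕ} {m m' : ℤ} (h : (i : ℝ) * L.rm + m < j * L.rm + m') (x : ℝ) :
    L.Fm^[i] x + m < L.Fm^[j] x + m' := by
  rcases le_total i j with h1 | h1
  · obtain ⟨k, rfl⟩ := Nat.exists_eq_add_of_le' h1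
    have := L.rm_lt k (m - m') (by push_cast at *; linarith) (L.Fm^[i] x)
    rw [← Function.iterate_add_apply] at this
    push_cast at this; linarith
  · obtain ⟨k, rfl⟩ := Nat.exists_eq_add_of_le' h1
    have := L.lt_rm k (m' - m) (by push_cast at *; linarith) (L.Fm^[j] x)
    rw [← Function.iterate_add_apply] at this
    push_cast at this; linarith

/-- The orbit of `a` is ordered as an orbit of the rotation by `rm`. -/
theorem order_a {i j : ℕ} {m m' : ℤ} (h : (i : ℝ) * L.rm + m < j * L.rm + m') :
    L.F^[i] L.a + m < L.F^[j] L.a + m' := by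
  rw [iter_a, iter_a]; exact Fm_order h _

theorem order_a_iff {i j : ℕ} {m m' : ℤ} :
    L.F^[i] L.a + m < L.F^[j] L.a + m' ↔ (i : ℝ) * L.rm + m < j * L.rm + m' := by
  refine ⟨fun h => ?_, order_a⟩
  by_contra h1
  rcases lt_or_eq_of_le (not_lt.1 h1) with h2 | h2
  · exact lt_asymm h (order_a h2)
  · by_cases hij : i = j
    · subst hij
      have : (m : ℝ) = m' := by linarith
      rw [this] at h; exact lt_irrefl _ h
    · have hne : (i : ℝ) - j ≠ 0 := by
        rw [sub_ne_zero]; exact_mod_cast hij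
      have h3 : L.rm = ((m : ℝ) - m') / (j - i) := by
        rw [eq_div_iff (by intro h; apply hne; linarith)]; linarith
      exact L.rm_irr ⟨((m : ℚ) - m') / (j - i), by push_cast; exact h3.symm⟩

theorem orbit_a {n : ℕ} (hn : 1 ≤ n) :
    L.a + ⌊n * L.rm⌋ < L.F^[n] L.a ∧ L.F^[n] L.a < L.d + 1 + ⌊n * L.rm⌋ := by
  have hirr : ((⌊n * L.rm⌋ : ℤ) : ℝ) ≠ n * L.rm := by
    intro h
    exact (L.rm_irr.natCast_mul (by omega : n ≠ 0)).ne_int _ h.symm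
  have h1 := lt_of_le_of_ne (Int.floor_le (n * L.rm)) hirr
  have h2 := Int.lt_floor_add_one (n * L.rm)
  have h3 := L.rm_lt n _ h1 L.a
  have h4 := L.lt_rm n (⌊n * L.rm⌋ + 1) (by push_cast; linarith) L.a
  have h5 := Fm_orbit (L := L) hn (⌊n * L.rm⌋ + 1)
  rw [iter_a]
  refine ⟨h3, ?_⟩
  by_contra h6
  exact h5 ⟨by push_cast; linarith, h4.le⟩

theorem refl_iter_b (n : ℕ) : L.refl.F^[n] L.refl.a = -L.F^[n] L.b := by
  rw [refl_iter]; simp [refl]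

theorem orbit_b {n : ℕ} (hn : 1 ≤ n) :
    ∃ k : ℤ, L.e + k < L.F^[n] L.b ∧ L.F^[n] L.b < L.b + k := by
  have h := orbit_a (L := L.refl) hn
  have e1 : L.refl.a = -L.b := rfl
  have e2 : L.refl.d = -L.e - 1 := rfl
  rw [refl_iter_b, e1, e2] at h
  exact ⟨-⌊n * L.refl.rm⌋, by push_cast; linarith [h.2], by push_cast; linarith [h.1]⟩

theorem orbit_b_notMem {n : ℕ} (hn : 1 ≤ n) (k : ℤ) : L.F^[n] L.b ∉ Icc (L.b - 1 + k) (L.e + k) := by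
  intro h
  obtain ⟨m, h1, h2⟩ := orbit_b (L := L) hn
  have e1 : (m : ℝ) < k := by linarith [h.2]
  have e2 : (k : ℝ) < m + 1 := by linarith [h.1]
  have e1 : m < k := by exact_mod_cast e1
  have e2 : k < m + 1 := by exact_mod_cast e2
  omega

theorem orbit_a_notMem {n : ℕ} (hn : 1 ≤ n) (k : ℤ) : L.F^[n] L.a ∉ Icc (L.d + k) (L.a + k) := by
  rw [iter_a]; exact Fm_orbit hn k

theorem Ch_a (n : ℕ) : L.Ch n L.a L.a := by
  refine ⟨le_rfl, fun l _ => ?_⟩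
  rcases Nat.eq_zero_or_pos l with rfl | hl
  · exact ⟨0, by simp, by simpa using L.hab.le⟩
  · have := orbit_a (L := L) hl
    exact ⟨_, this.1.le, by linarith [L.hd2]⟩

/-! ### Holes -/

variable (L) in
/-- `[v,w]` is a monotone preimage of age `i` of the arc `[b-1,a]`. -/
def Hole (i : ℕ) (v w : ℝ) : Prop :=
  v < w ∧ L.Ch i v w ∧ ∃ k : ℤ, L.F^[i] v = L.b - 1 + k ∧ L.F^[i] w = L.a + k

theorem Hole.notMem_U {i : ℕ} {v w x : ℝ} (h : L.Hole i v w) (hx : x ∈ Icc v w) :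
    L.F^[i] x ∉ L.U := by
  obtain ⟨_, h1, k, h2, h3⟩ := h
  rw [mem_U_iff, not_not]
  exact ⟨k, h2 ▸ h1.le le_rfl le_rfl hx.1 hx.2, h3 ▸ h1.le le_rfl hx.1 hx.2 le_rfl⟩

theorem Hole.mem_U {i : ℕ} {v w x : ℝ} (h : L.Hole i v w) (hx : x ∈ Ioo v w) {l : ℕ} (hl : l < i) :
    L.F^[l] x ∈ L.U := by
  obtain ⟨_, h1, -⟩ := h
  obtain ⟨m, h2, h3⟩ := h1.2 l hl
  exact ⟨m, h2.trans_lt (h1.lt hl.le le_rfl hx.1 hx.2.le),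
    (h1.lt hl.le hx.1.le hx.2 le_rfl).trans_le h3⟩

theorem Hole.int {i : ℕ} {v w : ℝ} (h : L.Hole i v w) (m : ℤ) : L.Hole i (v + m) (w + m) := by
  obtain ⟨h0, h1, k, h2, h3⟩ := h
  refine ⟨by linarith, h1.int m, k + m, ?_, ?_⟩ <;> rw [iter_int] <;> push_cast <;> linarith

theorem Hole.iter {i k : ℕ} {v w : ℝ} (h : L.Hole (i + k) v w) :
    L.Hole i (L.F^[k] v) (L.F^[k] w) := by
  obtain ⟨h0, h1, m, h2, h3⟩ := h
  refine ⟨h1.lt (by omega) le_rfl h0 le_rfl, h1.iter, m, ?_, ?_⟩ <;>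
  rwa [← Function.iterate_add_apply]

theorem Hole.eq_of_mem {i j : ℕ} {v w v' w' x : ℝ} (h : L.Hole i v w) (h' : L.Hole j v' w')
    (hx : x ∈ Ioo v w) (hx' : x ∈ Ioo v' w') : i = j := by
  rcases lt_trichotomy i j with h1 | h1 | h1
  · exact absurd (h'.mem_U hx' h1) (h.notMem_U ⟨hx.1.le, hx.2.le⟩)
  · exact h1
  · exact absurd (h.mem_U hx h1) (h'.notMem_U ⟨hx'.1.le, hx'.2.le⟩)

theorem Hole.sub_one_lt {i : ℕ} {v w : ℝ} (h : L.Hole i v w) : w - v < 1 := by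
  obtain ⟨_, h1, m, h2, h3⟩ := h
  rcases Nat.eq_zero_or_pos i with rfl | hi
  · simp only [Function.iterate_zero, id] at h2 h3
    linarith [L.hab]
  · obtain ⟨k, h4, h5⟩ := h1.2 0 hi
    simp only [Function.iterate_zero, id] at h4 h5
    linarith [L.hba]

theorem Hole.sum_le_one {i : ℕ} {v w : ℝ} (h : L.Hole i v w) :
    ∑ l ∈ Finset.range (i + 1), (L.F^[l] w - L.F^[l] v) ≤ 1 := by
  have hh : ∀ l ∈ Finset.range (i + 1), L.Hole (i - l) (L.F^[l] v) (L.F^[l] w) := by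
    intro l hl
    refine Hole.iter (k := l) ?_
    rwa [Nat.sub_add_cancel (by simp at hl; omega)]
  refine sum_length_le_one _ _ _ (fun l hl => (hh l hl).1.le)
    (fun l hl => by linarith [(hh l hl).sub_one_lt]) fun l hl j hj hlj m x hx hx' => ?_
  have := Hole.eq_of_mem ((hh l hl).int m) (hh j hj)
    (x := x + m) ⟨by linarith [hx.1], by linarith [hx.2]⟩ hx'
  simp at hl hj; omega

theorem Ch.iter_lt_b {n : ℕ} {s t : ℝ} (h : L.Ch n s t) {l : ℕ} (hl : l < n) :
    L.F^[l] t - L.F^[l] s < 1 := by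
  obtain ⟨m, h1, h2⟩ := h.2 l hl
  linarith [L.hba]

/-- To the right of an admissible point landing in `[a,e)`, the branch extends up to `e`. -/
theorem ext_to_e {i : ℕ} {x : ℝ} {k : ℤ} (h : L.Ch i x x) (h1 : L.a + k ≤ L.F^[i] x)
    (h2 : L.F^[i] x < L.e + k) : ∃ t, x < t ∧ L.Ch i x t ∧ L.F^[i] t = L.e + k := by
  rcases ext_right h h2 with h3 | ⟨t, h3, h4, l, hl, m, h5⟩
  · exact h3
  · exfalso
    have h6 : L.F^[i] t = L.F^[i - l] L.b + m := by
      rw [← iter_int, ← h5, ← Function.iterate_add_apply, Nat.sub_add_cancel hl.le]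
    have h7 := h3.le le_rfl le_rfl h3.1 le_rfl
    refine orbit_b_notMem (L := L) (n := i - l) (by omega) (k - m) ⟨?_, ?_⟩ <;> push_cast <;>
      linarith [L.hba]

theorem Hole.ext {i : ℕ} {v w : ℝ} {k : ℤ} (h : L.Hole i v w) (hk : L.F^[i] w = L.a + k) :
    ∃ t, w < t ∧ L.Ch i v t ∧ L.F^[i] t = L.e + k := by
  obtain ⟨h0, h1, -⟩ := h
  obtain ⟨t, h2, h3, h4⟩ := ext_to_e (k := k) (h1.sub h0.le le_rfl le_rfl) hk.ge
    (by linarith [L.he1])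
  exact ⟨t, h2, h1.join h3, h4⟩

variable (L) in
/-- The Koebe constant next to holes. -/
def Ka : ℝ := 2 * Real.exp (3 * L.C) / ((L.a + 1 - L.b) * (L.e - L.a))

variable (L) in
/-- The depth below which the Koebe estimate next to holes holds. -/
def da : ℝ := min ((L.e - L.a) / 2) (1 / L.Ka)

theorem Ka_pos : 0 < L.Ka := by
  have := L.hba
  have := L.he1
  unfold Ka
  have := Real.exp_pos (3 * L.C)
  exact div_pos (by linarith) (mul_pos (by linarith) (by linarith))

theorem da_pos : 0 < L.da := lt_min (by linarith [L.he1]) (one_div_pos.2 Ka_pos)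

theorem da_mul_Ka {s : ℝ} (hs : s ≤ L.da) : L.Ka * s ≤ 1 := by
  have := hs.trans (min_le_right _ _)
  rwa [le_div_iff₀ Ka_pos, mul_comm] at this

theorem crossRatio_target {s s' : ℝ} (h0 : 0 ≤ s) (h1 : s < s') (h2 : s' ≤ L.da) (k : ℤ) :
    Real.exp (3 * L.C) *
      crossRatio (L.b - 1 + k) (L.a + k + s) (L.a + k + s') (L.e + k) ≤ L.Ka * (s' - s) := by
  have := L.hba
  have := L.he1
  have := L.he2
  have h3 := h2.trans (min_le_left _ _)
  unfold crossRatio Ka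
  rw [show L.a + k + s' - (L.a + k + s) = s' - s by ring,
    show L.e + k - (L.b - 1 + k) = L.e - L.b + 1 by ring,
    show L.a + k + s - (L.b - 1 + k) = L.a + 1 - L.b + s by ring,
    show L.e + k - (L.a + k + s') = L.e - L.a - s' by ring, ← mul_div_assoc, div_mul_eq_mul_div]
  have hE := Real.exp_pos (3 * L.C)
  have e3 : 0 < L.a + 1 - L.b := by linarith
  have e4 : 0 < L.e - L.a - s' := by linarith
  rw [div_le_div_iff₀ (mul_pos (by linarith) e4) (mul_pos (by linarith) (by linarith))]
  have k1 : (L.e - L.b + 1) * (L.e - L.a) ≤ 2 * (L.e - L.a - s') := by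
    nlinarith
  have k2 : L.a + 1 - L.b ≤ L.a + 1 - L.b + s := by linarith
  have k3 := mul_le_mul k1 k2 (by linarith) (by linarith)
  have k4 := mul_le_mul_of_nonneg_left k3 (mul_nonneg hE.le (by linarith : 0 ≤ s' - s))
  linarith

/-- Points at depth `s'` below a hole are at relative distance at most `Ka * s'`, along the
whole orbit. -/
theorem Hole.near {i : ℕ} {v w t : ℝ} {k : ℤ} (h : L.Hole i v w) (hk : L.F^[i] w = L.a + k)
    (ht : L.Ch i w t) (hd : L.F^[i] t ≤ L.a + k + L.da) {l : ℕ} (hl : l ≤ i) :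
    L.F^[l] t - L.F^[l] w ≤ L.Ka * (L.F^[i] t - (L.a + k)) * (L.F^[l] w - L.F^[l] v) := by
  induction i generalizing v w t l with
  | zero =>
    obtain rfl : l = 0 := by omega
    simp only [Function.iterate_zero, id] at *
    obtain ⟨h0, _, k', h1, h2⟩ := h
    simp only [Function.iterate_zero, id] at h1 h2
    have hkk : (k' : ℝ) = k := by linarith
    rw [← hk, h1, h2, show L.a + k' - (L.b - 1 + k') = L.a + 1 - L.b by ring, ← h2]
    rw [mul_right_comm]
    refine le_mul_of_one_le_left (by linarith [ht.1]) ?_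
    unfold Ka
    have := L.hba
    have := L.he1
    have := L.he2
    rw [div_mul_eq_mul_div, one_le_div (mul_pos (by linarith) (by linarith))]
    have hE : 1 ≤ Real.exp (3 * L.C) := Real.one_le_exp (by linarith [L.hC])
    nlinarith [L.hab, mul_nonneg (sub_nonneg.2 hE) (by linarith : 0 ≤ L.a + 1 - L.b)]
  | succ i ih =>
    have ih' : ∀ l ≤ i, L.F^[l + 1] t - L.F^[l + 1] w ≤
        L.Ka * (L.F^[i + 1] t - (L.a + k)) * (L.F^[l + 1] w - L.F^[l + 1] v) := fun l hl =>
      ih (v := L.F v) (w := L.F w) (t := L.F t) (Hole.iter (k := 1) h) hk (Ch.iter (k := 1) ht)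
        hd hl
    rcases Nat.eq_zero_or_pos l with rfl | hl0
    swap
    · obtain ⟨l, rfl⟩ := Nat.exists_eq_add_of_le' hl0
      exact ih' l (by omega)
    rcases eq_or_lt_of_le ht.1 with rfl | hwt
    · simp only [sub_self]
      refine mul_nonneg (mul_nonneg Ka_pos.le (by rw [hk]; simp)) (by simpa using h.1.le)
    have hs0 : L.a + k < L.F^[i + 1] t := hk ▸ ht.lt le_rfl le_rfl hwt le_rfl
    obtain ⟨u, hwu, hch, hu⟩ := h.ext hk
    have hda := min_le_left ((L.e - L.a) / 2) (1 / L.Ka)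
    change L.da ≤ _ at hda
    have htu : t < u := by
      obtain hc := hch.sub h.1.le hwu.le le_rfl
      by_contra hcon
      have := ht.le (l := i + 1) le_rfl hwu.le (not_lt.1 hcon) le_rfl
      linarith [L.he1]
    have hsum : ∑ l ∈ Finset.range (i + 1), (L.F^[l] t - L.F^[l] v) ≤ 3 := by
      have e1 : ∑ l ∈ Finset.range (i + 1), (L.F^[l] t - L.F^[l] v) =
          ∑ l ∈ Finset.range (i + 1), (L.F^[l] w - L.F^[l] v) +
          ∑ l ∈ Finset.range (i + 1), (L.F^[l] t - L.F^[l] w) := by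
        rw [← Finset.sum_add_distrib]; exact Finset.sum_congr rfl fun _ _ => by ring
      have e2 := h.sum_le_one
      rw [Finset.sum_range_succ] at e2
      have e2' : 0 ≤ L.F^[i + 1] w - L.F^[i + 1] v :=
        sub_nonneg.2 (h.2.1.le le_rfl le_rfl h.1.le le_rfl)
      have e3 : ∑ l ∈ Finset.range i, (L.F^[l + 1] t - L.F^[l + 1] w) ≤
          ∑ l ∈ Finset.range i, (L.F^[l + 1] w - L.F^[l + 1] v) := by
        refine Finset.sum_le_sum fun l hl => ?_
        simp only [Finset.mem_range] at hl
        refine (ih' l hl.le).trans (mul_le_of_le_one_left ?_ (da_mul_Ka (by linarith)))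
        exact sub_nonneg.2 (h.2.1.le (by omega) le_rfl h.1.le le_rfl)
      have e4 := Finset.sum_range_succ' (fun l => L.F^[l] t - L.F^[l] w) i
      have e5 := Finset.sum_range_succ' (fun l => L.F^[l] w - L.F^[l] v) i
      have e6 := ht.iter_lt_b (l := 0) (by omega)
      have e7 : 0 < L.F^[0] w - L.F^[0] v := by simpa using h.1
      linarith
    have hcr := hch.crossRatio_le h.1 hwt htu
    obtain ⟨k', hk1, hk2⟩ := h.2.2
    have hkk : (k' : ℝ) = k := by linarith
    rw [hkk] at hk1
    have htar := crossRatio_target (L := L) (s := 0) (s' := L.F^[i + 1] t - (L.a + k)) le_rfl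
      (by linarith) (by linarith) k
    rw [hk1, hk, hu] at hcr
    rw [add_zero, add_sub_cancel, sub_zero] at htar
    have hcr0 := crossRatio_nonneg (s := L.b - 1 + k) (x := L.a + k) (y := L.F^[i + 1] t)
      (t := L.e + k) (by linarith [L.hba]) hs0 (by linarith [L.he1])
    have hexp : Real.exp (L.C * ∑ l ∈ Finset.range (i + 1), (L.F^[l] t - L.F^[l] v)) ≤
        Real.exp (3 * L.C) := Real.exp_le_exp.2 (by nlinarith [L.hC])
    have h1 := le_mul_crossRatio_left h.1 hwt htu
    have h2 := hcr.trans ((mul_le_mul_of_nonneg_right hexp hcr0).trans htar)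
    have h3 := mul_le_mul_of_nonneg_left h2 (sub_nonneg.2 h.1.le)
    simp only [Function.iterate_zero, id]
    linarith

theorem Hole.sum_le {i : ℕ} {v w t : ℝ} {k : ℤ} (h : L.Hole i v w) (hk : L.F^[i] w = L.a + k)
    (ht : L.Ch i w t) (hd : L.F^[i] t ≤ L.a + k + L.da) :
    ∑ l ∈ Finset.range i, (L.F^[l] t - L.F^[l] v) ≤ 3 := by
  have e2 := h.sum_le_one
  rw [Finset.sum_range_succ] at e2
  have e2' : 0 ≤ L.F^[i] w - L.F^[i] v := sub_nonneg.2 (h.2.1.le le_rfl le_rfl h.1.le le_rfl)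
  have e1 : ∑ l ∈ Finset.range i, (L.F^[l] t - L.F^[l] v) ≤
      ∑ l ∈ Finset.range i, (2 * (L.F^[l] w - L.F^[l] v)) := by
    refine Finset.sum_le_sum fun l hl => ?_
    simp only [Finset.mem_range] at hl
    have h1 := h.near hk ht hd hl.le
    have h2 : 0 ≤ L.F^[l] w - L.F^[l] v := sub_nonneg.2 (h.2.1.le hl.le le_rfl h.1.le le_rfl)
    have h3 := mul_le_of_le_one_left h2 (da_mul_Ka (s := L.F^[i] t - (L.a + k)) (by linarith))
    linarith
  rw [← Finset.mul_sum] at e1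
  linarith

/-- Koebe estimate next to a hole: the branch is expanding at the scale of the hole. -/
theorem Hole.koebe {i : ℕ} {v w x t : ℝ} {k : ℤ} (h : L.Hole i v w) (hk : L.F^[i] w = L.a + k)
    (ht : L.Ch i w t) (hd : L.F^[i] t ≤ L.a + k + L.da) (hx : w ≤ x) (hxt : x ≤ t) :
    t - x ≤ 2 * L.Ka * (w - v) * (L.F^[i] t - L.F^[i] x) := by
  rcases eq_or_lt_of_le hxt with rfl | hxt
  · simp
  obtain ⟨u, hwu, hch, hu⟩ := h.ext hk
  have hda := min_le_left ((L.e - L.a) / 2) (1 / L.Ka)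
  change L.da ≤ _ at hda
  have htu : t < u := by
    by_contra hcon
    have := ht.le (l := i) le_rfl hwu.le (not_lt.1 hcon) le_rfl
    linarith [L.he1]
  have hx1 : L.a + k ≤ L.F^[i] x := hk ▸ ht.le le_rfl le_rfl hx hxt.le
  have hx2 : L.F^[i] x < L.F^[i] t := ht.lt le_rfl hx hxt le_rfl
  have hvx : v < x := h.1.trans_le hx
  have hsum := h.sum_le hk ht hd
  have hcr := hch.crossRatio_le hvx hxt htu
  obtain ⟨k', hk1, hk2⟩ := h.2.2
  have hkk : (k' : ℝ) = k := by linarith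
  rw [hkk] at hk1
  have htar := crossRatio_target (L := L) (s := L.F^[i] x - (L.a + k))
    (s' := L.F^[i] t - (L.a + k)) (by linarith) (by linarith) (by linarith) k
  rw [hk1, hu] at hcr
  rw [add_sub_cancel, add_sub_cancel, sub_sub_sub_cancel_right] at htar
  have hcr0 := crossRatio_nonneg (s := L.b - 1 + k) (x := L.F^[i] x) (y := L.F^[i] t)
    (t := L.e + k) (by linarith [L.hba]) hx2 (by linarith [L.he1])
  have hexp : Real.exp (L.C * ∑ l ∈ Finset.range i, (L.F^[l] t - L.F^[l] v)) ≤
      Real.exp (3 * L.C) := Real.exp_le_exp.2 (by nlinarith [L.hC])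
  have h1 := le_mul_crossRatio_left hvx hxt htu
  have h2 := hcr.trans ((mul_le_mul_of_nonneg_right hexp hcr0).trans htar)
  have h3 := mul_le_mul_of_nonneg_left h2 (sub_nonneg.2 hvx.le)
  have h4 := h.near hk (ht.sub le_rfl hx hxt.le) (by linarith) (Nat.zero_le i)
  simp only [Function.iterate_zero, id] at h4
  have h5 := mul_le_of_le_one_left (sub_nonneg.2 h.1.le)
    (da_mul_Ka (L := L) (s := L.F^[i] x - (L.a + k)) (by linarith))
  have h6 : x - v ≤ 2 * (w - v) := by linarith
  have h7 : 0 ≤ L.Ka * (L.F^[i] t - L.F^[i] x) := mul_nonneg Ka_pos.le (by linarith)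
  have h8 := mul_le_mul_of_nonneg_right h6 h7
  linarith

/-! ### Survival of one-sided neighbourhoods of `a` -/

variable (L) in
/-- The length of the maximal one-sided neighbourhood of `a` on which `F^(m+1)` is a monotone
branch. -/
def g (m : ℕ) : ℝ := sSup {t | 0 ≤ t ∧ L.Ch (m + 1) L.a (L.a + t)}

theorem Ch_a_le {m : ℕ} {t : ℝ} (h : L.Ch (m + 1) L.a t) : t ≤ L.b := by
  obtain ⟨k, h1, h2⟩ := h.2 0 (by omega)
  simp only [Function.iterate_zero, id] at h1 h2
  have e : (k : ℝ) ≤ 0 := by linarith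
  linarith

theorem g_bdd (m : ℕ) : BddAbove {t | 0 ≤ t ∧ L.Ch (m + 1) L.a (L.a + t)} :=
  ⟨L.b - L.a, fun _ ht => by linarith [Ch_a_le ht.2]⟩

theorem le_g {m : ℕ} {t : ℝ} (h : L.Ch (m + 1) L.a t) : t - L.a ≤ L.g m :=
  le_csSup (g_bdd m) ⟨by linarith [h.1], by simpa using h⟩

theorem g_nonneg (m : ℕ) : 0 ≤ L.g m := by
  have := le_g (Ch_a (L := L) (m + 1)); linarith

theorem g_spec (m : ℕ) : L.Ch (m + 1) L.a (L.a + L.g m) := by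
  rcases eq_or_lt_of_le (g_nonneg (L := L) m) with h | h
  · rw [← h, add_zero]; exact Ch_a _
  · refine Ch_of_Ioo_subset (by linarith) fun x hx => ?_
    have hne : {t | 0 ≤ t ∧ L.Ch (m + 1) L.a (L.a + t)}.Nonempty :=
      ⟨0, le_rfl, by simpa using Ch_a (L := L) (m + 1)⟩
    obtain ⟨t, ht, hxt⟩ := exists_lt_of_lt_csSup (b := x - L.a) hne
      (by change _ < L.g m; linarith [hx.2])
    exact ht.2.mem_D ⟨hx.1, by linarith⟩

theorem Ch_of_le_g {m : ℕ} {t : ℝ} (h0 : L.a ≤ t) (h : t ≤ L.a + L.g m) : L.Ch (m + 1) L.a t :=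
  (g_spec m).sub le_rfl h0 h

theorem g_anti {m n : ℕ} (h : m ≤ n) : L.g n ≤ L.g m := by
  have := le_g ((g_spec (L := L) n).anti (Nat.succ_le_succ h)); linarith

theorem g_le (m : ℕ) : L.g m ≤ L.b - L.a := by
  have := Ch_a_le (g_spec (L := L) m); linarith

theorem g_pos (m : ℕ) : 0 < L.g m := by
  have h : ∀ l ∈ Finset.range (m + 1), ∀ᶠ x in nhdsWithin L.a (Ioi L.a), L.F^[l] x ∈ L.U := by
    intro l _
    rcases Nat.eq_zero_or_pos l with rfl | hl
    · filter_upwards [Ioo_mem_nhdsGT L.hab] with x hx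
      exact ⟨0, by simpa using hx.1, by simpa using hx.2⟩
    · refine nhdsWithin_le_nhds ((L.cont_iter l).continuousAt.eventually (isOpen_U.mem_nhds ?_))
      have := orbit_a (L := L) hl
      exact ⟨_, this.1, by linarith [L.hd2]⟩
  have h1 := (Finset.eventually_all _).2 h
  obtain ⟨u, hu, hs⟩ := (mem_nhdsGT_iff_exists_Ioo_subset).1 h1
  have : L.Ch (m + 1) L.a u := Ch_of_Ioo_subset hu fun x hx l hl =>
    hs hx l (Finset.mem_range.2 (by omega))
  have := le_g this
  simp only [mem_Ioi] at hu
  linarith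

end Lorenz

/-- The arithmetic of continued fraction convergents which is used in the sequel. -/
structure ConvScheme (ρ : ℝ) where
  q : ℕ → ℕ
  p : ℕ → ℤ
  A : ℕ → ℕ
  q_rec : ∀ k, q (k + 2) = A k * q (k + 1) + q k
  p_rec : ∀ k, p (k + 2) = A k * p (k + 1) + p k
  A_pos : ∀ k, 1 ≤ A k
  q_pos : 1 ≤ q 0
  q_le : q 0 ≤ q 1
  even : ∀ k, (p (2 * k) : ℝ) < q (2 * k) * ρ
  odd : ∀ k, q (2 * k + 1) * ρ < (p (2 * k + 1) : ℝ)
  dec : ∀ k, |q (k + 1) * ρ - p (k + 1)| < |q k * ρ - p k|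
  lt_one : |q 0 * ρ - p 0| < 1
  best : ∀ (k l : ℕ) (m : ℤ), 1 ≤ l → l < q (k + 1) → |q k * ρ - p k| ≤ |l * ρ - m|

namespace ConvScheme
variable {ρ : ℝ} (S : ConvScheme ρ)

/-- Error of the convergents of even index. -/
def ev (k : ℕ) : ℝ := S.q (2 * k) * ρ - S.p (2 * k)
/-- Error of the convergents of odd index. -/
def od (k : ℕ) : ℝ := S.p (2 * k + 1) - S.q (2 * k + 1) * ρ

theorem ev_pos (k : ℕ) : 0 < S.ev k := sub_pos.2 (S.even k)
theorem od_pos (k : ℕ) : 0 < S.od k := sub_pos.2 (S.odd k)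
theorem abs_even (k : ℕ) : |S.q (2 * k) * ρ - S.p (2 * k)| = S.ev k := abs_of_pos (S.ev_pos k)
theorem abs_odd (k : ℕ) : |S.q (2 * k + 1) * ρ - S.p (2 * k + 1)| = S.od k := by
  rw [abs_sub_comm]; exact abs_of_pos (S.od_pos k)

theorem od_lt (k : ℕ) : S.od k < S.ev k := by
  have := S.dec (2 * k); rwa [abs_even, abs_odd] at this
theorem ev_succ_lt (k : ℕ) : S.ev (k + 1) < S.od k := by
  have := S.dec (2 * k + 1)
  rwa [abs_odd, show 2 * k + 1 + 1 = 2 * (k + 1) by ring, abs_even] at this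
theorem ev_lt_one (k : ℕ) : S.ev k < 1 := by
  induction k with
  | zero => have := S.lt_one; rwa [← Nat.mul_zero 2, abs_even] at this
  | succ k ih => linarith [S.ev_succ_lt k, S.od_lt k]
theorem od_lt_one (k : ℕ) : S.od k < 1 := (S.od_lt k).trans (S.ev_lt_one k)
theorem ev_succ (k : ℕ) : S.ev (k + 1) = S.ev k - S.A (2 * k) * S.od k := by
  unfold ev od
  rw [show 2 * (k + 1) = 2 * k + 2 by ring, S.q_rec, S.p_rec]; push_cast; ring

theorem best_even {k l : ℕ} (h : 1 ≤ l) (h' : l < S.q (2 * k + 1)) (m : ℤ) :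
    S.ev k ≤ |l * ρ - m| := by
  have := S.best (2 * k) l m h h'; rwa [abs_even] at this
theorem best_odd {k l : ℕ} (h : 1 ≤ l) (h' : l < S.q (2 * k + 2)) (m : ℤ) :
    S.od k ≤ |l * ρ - m| := by
  have := S.best (2 * k + 1) l m h h'; rwa [abs_odd] at this

theorem q_le_succ (k : ℕ) : S.q k ≤ S.q (k + 1) := by
  cases k with
  | zero => exact S.q_le
  | succ k =>
    rw [S.q_rec]
    have := Nat.mul_le_mul_right (S.q (k + 1)) (S.A_pos k)
    omega
theorem q_mono : Monotone S.q := monotone_nat_of_le_succ S.q_le_succ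
theorem one_le_q (k : ℕ) : 1 ≤ S.q k := S.q_pos.trans (S.q_mono (Nat.zero_le k))
theorem q_add_le (k : ℕ) : S.q (k + 1) + S.q k ≤ S.q (k + 2) := by
  rw [S.q_rec]
  have := Nat.mul_le_mul_right (S.q (k + 1)) (S.A_pos k)
  omega

end ConvScheme

namespace Lorenz
variable {L : Lorenz} (S : ConvScheme L.rm)

/-- The one-sided closest returns of `a`. -/
def R (k : ℕ) : ℝ := L.F^[S.q (2 * k)] L.a - S.p (2 * k) - L.a

theorem irr_ne {n : ℕ} (hn : 1 ≤ n) (m : ℤ) : (n : ℝ) * L.rm ≠ m := fun h =>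
  (L.rm_irr.natCast_mul (by omega : n ≠ 0)).ne_int _ h

theorem lt_d_of_lt_a {n : ℕ} (hn : 1 ≤ n) {m : ℤ} (h : L.F^[n] L.a < L.a + m) :
    L.F^[n] L.a < L.d + m := by
  by_contra h1
  exact orbit_a_notMem hn m ⟨not_lt.1 h1, h.le⟩

theorem order_a_left {n : ℕ} {m m' : ℤ} (h : (m : ℝ) < n * L.rm + m') :
    L.a + m < L.F^[n] L.a + m' := by
  have := order_a (L := L) (i := 0) (j := n) (m := m) (m' := m') (by simpa using h)
  simpa using this

theorem order_a_right {n : ℕ} {m m' : ℤ} (h : n * L.rm + m' < m) :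
    L.F^[n] L.a + m' < L.a + m := by
  have := order_a (L := L) (i := n) (j := 0) (m := m') (m' := m) (by simpa using h)
  simpa using this

theorem R_pos (k : ℕ) : 0 < L.R S k := by
  have := order_a_left (L := L) (n := S.q (2 * k)) (m := S.p (2 * k)) (m' := 0)
    (by simpa using S.even k)
  unfold R; push_cast at this; linarith

theorem a_add_R (k : ℕ) : L.a + L.R S k = L.F^[S.q (2 * k)] L.a - S.p (2 * k) := by
  unfold R; ring

theorem iter_a_add_R (k l : ℕ) :
    L.F^[l] (L.a + L.R S k) = L.F^[l + S.q (2 * k)] L.a - S.p (2 * k) := by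
  have := L.iter_int l (L.F^[S.q (2 * k)] L.a) (-S.p (2 * k))
  rw [a_add_R, Function.iterate_add_apply]; push_cast at this
  rw [sub_eq_add_neg, this]; ring

/-- The arc from `a` to its closest return survives up to the next closest return. -/
theorem Ch_R (k : ℕ) : L.Ch (S.q (2 * k + 1)) L.a (L.a + L.R S k) := by
  refine ⟨by linarith [R_pos S k], fun l hl => ?_⟩
  rw [iter_a_add_R]
  have hq := S.one_le_q (2 * k)
  have key : ((l + S.q (2 * k) : ℕ) : ℝ) * L.rm + (-S.p (2 * k) : ℤ) < (⌊l * L.rm⌋ + 1 : ℤ) := by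
    have h2 := Int.lt_floor_add_one ((l : ℝ) * L.rm)
    rcases Nat.eq_zero_or_pos l with rfl | hl0
    · have := S.ev_lt_one k
      unfold ConvScheme.ev at this
      push_cast; simp; linarith
    · have h1 := S.best_even hl0 hl (⌊l * L.rm⌋ + 1)
      rw [abs_sub_comm, abs_of_pos (by push_cast; linarith)] at h1
      refine lt_of_le_of_ne (by unfold ConvScheme.ev at h1; push_cast at *; linarith) fun h => ?_
      refine irr_ne (L := L) (n := l + S.q (2 * k)) (by omega) (⌊l * L.rm⌋ + 1 + S.p (2 * k)) ?_
      push_cast at *; linarith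
  have h3 := order_a_right key
  have h4 := lt_d_of_lt_a (L := L) (n := l + S.q (2 * k)) (by omega)
    (m := ⌊l * L.rm⌋ + 1 + S.p (2 * k)) (by push_cast at *; linarith)
  push_cast at h4
  refine ⟨⌊l * L.rm⌋, ?_, by linarith [L.hd2]⟩
  rcases Nat.eq_zero_or_pos l with rfl | hl0
  · simp
  · exact (orbit_a hl0).1.le

theorem R_le_g {k m : ℕ} (hm : m < S.q (2 * k + 1)) : L.R S k ≤ L.g m := by
  have := le_g ((Ch_R S k).anti (Nat.succ_le_of_lt hm)); linarith

/-- A monotone branch at `a` does not cross an integer translate of `a`. -/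
theorem Ch.lt_of_iter_lt {N : ℕ} {y : ℝ} {P : ℤ} (h : L.Ch (N + 1) L.a y)
    (hP : L.F^[N] L.a < L.a + P) : L.F^[N] y ≤ L.b - 1 + P := by
  obtain ⟨k, h1, h2⟩ := h.2 N (by omega)
  have e1 : (k : ℝ) < P := by linarith
  have e1 : k + 1 ≤ P := by exact_mod_cast e1
  have e1 : (k : ℝ) + 1 ≤ P := by exact_mod_cast e1
  linarith

theorem g_le_R (k : ℕ) : L.g (S.q (2 * k + 1)) ≤ L.R S k := by
  by_contra hcon
  have hch := g_spec (L := L) (S.q (2 * k + 1))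
  have h1 := order_a_right (L := L) (n := S.q (2 * k + 1)) (m := S.p (2 * k + 1)) (m' := 0)
    (by simpa using S.odd k)
  have h2 := hch.lt_of_iter_lt (P := S.p (2 * k + 1)) (by simpa using h1)
  have h3 := hch.le (l := S.q (2 * k + 1)) (x := L.a + L.R S k) (by omega)
    (by linarith [R_pos S k]) (by linarith) le_rfl
  rw [iter_a_add_R] at h3
  have h4 := order_a_left (L := L) (n := S.q (2 * k + 1) + S.q (2 * k)) (m := S.p (2 * k + 1))
    (m' := -S.p (2 * k)) (by
      have := S.od_lt k
      unfold ConvScheme.od ConvScheme.ev at this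
      push_cast; linarith)
  push_cast at h4
  linarith [L.hba]

theorem F_d_int (l : ℕ) (m : ℤ) : L.F^[l + 1] (L.d + m) = L.F^[l + 1] L.a + m := by
  rw [iter_int, Function.iterate_succ_apply, Function.iterate_succ_apply, L.hdF]

theorem Fm_iter_le (l : ℕ) (x : ℝ) : L.Fm^[l] x ≤ L.F^[l] x := by
  induction l with
  | zero => exact le_rfl
  | succ l ih =>
    rw [Function.iterate_succ_apply', Function.iterate_succ_apply']
    exact (L.Fm_mono ih).trans (L.Fm_le _)

/-- Gap condition expressing that `N` is a good denominator compared to times less than `N'`. -/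
def Gap (ρ : ℝ) (N N' : ℕ) (P : ℤ) : Prop :=
  (N : ℝ) * ρ < P ∧ P - N * ρ < 1 ∧ ∀ (j : ℕ) (m : ℤ), 1 ≤ j → j < N' → P - N * ρ ≤ |j * ρ - m|

theorem Gap.lt {N N' : ℕ} {P : ℤ} (h : Gap L.rm N N' P) (hN : N' ≤ N) {l : ℕ} (hl : l < N') :
    P - N * L.rm < ⌊l * L.rm⌋ + 1 - l * L.rm := by
  obtain ⟨h1, h2, h3⟩ := h
  rcases Nat.eq_zero_or_pos l with rfl | hl0
  · simpa using h2
  · have h4 := h3 l (⌊l * L.rm⌋ + 1) hl0 hl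
    have h5 := Int.lt_floor_add_one ((l : ℝ) * L.rm)
    rw [abs_sub_comm, abs_of_pos (by push_cast; linarith)] at h4
    refine lt_of_le_of_ne (by push_cast at h4; linarith) fun h => ?_
    refine irr_ne (L := L) (n := N - l) (by omega) (P - ⌊l * L.rm⌋ - 1) ?_
    rw [Nat.cast_sub (by omega)]; push_cast; linarith

theorem Gap.iter_a_lt {N N' : ℕ} {P : ℤ} (h : Gap L.rm N N' P) : L.F^[N] L.a < L.a + P := by
  have := order_a_right (L := L) (n := N) (m := P) (m' := 0) (by simpa using h.1)
  simpa using this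

/-- The image of `d` lies to the right of `a + P`. -/
theorem Gap.lt_iter_d {N N' : ℕ} {P : ℤ} (h : Gap L.rm N N' P) (hN : N' ≤ N) {l : ℕ}
    (hl : l < N') : L.a + P < L.F^[N - l] (L.d + 1 + ⌊l * L.rm⌋) := by
  obtain ⟨j, hj⟩ : ∃ j, N = l + j + 1 := ⟨N - l - 1, by omega⟩
  have e1 := F_d_int (L := L) j (⌊l * L.rm⌋ + 1)
  have e2 := order_a_left (L := L) (n := j + 1) (m := P) (m' := ⌊l * L.rm⌋ + 1) (by
    have := h.lt hN hl
    rw [hj] at this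
    push_cast at *; linarith)
  rw [show N - l = j + 1 by omega]
  push_cast at e1 e2
  rw [show L.d + 1 + ⌊l * L.rm⌋ = L.d + (⌊l * L.rm⌋ + 1) by ring, e1]
  linarith

theorem Gap.iter_le {N N' : ℕ} {P : ℤ} (h : Gap L.rm N N' P) (hN : N' ≤ N) {y : ℝ}
    (hy : L.Ch (N + 1) L.a y) {l : ℕ} (hl : l < N') : L.F^[l] y ≤ L.d + 1 + ⌊l * L.rm⌋ := by
  by_contra hcon
  have h0 : L.F^[l] L.a ≤ L.d + 1 + ⌊l * L.rm⌋ := by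
    rcases Nat.eq_zero_or_pos l with rfl | hl0
    · simp; linarith [L.hd1]
    · exact (orbit_a hl0).2.le
  obtain ⟨z, hz, hz'⟩ := hy.ivt (l := l) h0 (not_le.1 hcon).le
  have h1 := h.lt_iter_d hN hl
  rw [← hz', ← Function.iterate_add_apply, Nat.sub_add_cancel (by omega)] at h1
  have h2 := hy.lt_of_iter_lt h.iter_a_lt
  have h3 := hy.le (l := N) (by omega) hz.1 hz.2 le_rfl
  linarith [L.hba]

theorem Gap.iter_eq {N N' : ℕ} {P : ℤ} (h : Gap L.rm N N' P) (hN : N' ≤ N) {y : ℝ}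
    (hy : L.Ch (N + 1) L.a y) {l : ℕ} (hl : l ≤ N') : L.F^[l] y = L.Fm^[l] y := by
  induction l with
  | zero => rfl
  | succ l ih =>
    rw [Function.iterate_succ_apply', Function.iterate_succ_apply', ← ih (by omega)]
    refine (Fm_eq_of_notMem fun m hm => ?_).symm
    have h1 := h.iter_le hN hy (show l < N' by omega)
    have h2 : L.a + ⌊l * L.rm⌋ ≤ L.F^[l] y := by
      refine le_trans ?_ (hy.le (l := l) (by omega) le_rfl hy.1 le_rfl)
      rcases Nat.eq_zero_or_pos l with rfl | hl0
      · simp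
      · exact (orbit_a hl0).1.le
    have e1 : (⌊l * L.rm⌋ : ℝ) < m := by linarith [hm.2]
    have e2 : (m : ℝ) < ⌊l * L.rm⌋ + 1 := by linarith [hm.1]
    have e1 : ⌊l * L.rm⌋ < m := by exact_mod_cast e1
    have e2 : m < ⌊l * L.rm⌋ + 1 := by exact_mod_cast e2
    omega

theorem gap_order {N N' : ℕ} {P : ℤ}
    (h3 : ∀ (j : ℕ) (m : ℤ), 1 ≤ j → j < N' → P - N * L.rm ≤ |j * L.rm - m|)
    {i j : ℕ} (hi : i < N') (hj : j < N') (hij : i ≠ j) {m : ℤ} (h : (j : ℝ) * L.rm < i * L.rm + m) :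
    P - N * L.rm ≤ i * L.rm + m - j * L.rm := by
  rcases lt_or_gt_of_ne hij with h1 | h1
  · have := h3 (j - i) m (by omega) (by omega)
    rw [Nat.cast_sub h1.le, abs_sub_comm, abs_of_pos (by linarith)] at this
    linarith
  · have := h3 (i - j) (-m) (by omega) (by omega)
    rw [Nat.cast_sub h1.le, abs_of_pos (by push_cast; linarith)] at this
    push_cast at this; linarith

theorem Gap.sum_le {N N' : ℕ} {P : ℤ} (h : Gap L.rm N N' P) (hN : N' ≤ N) {y : ℝ}
    (hy : L.Ch (N + 1) L.a y) :
    ∑ l ∈ Finset.range N', (L.F^[l] y - L.F^[l] L.a) ≤ 1 := by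
  have hyP := hy.lt_of_iter_lt h.iter_a_lt
  -- an endpoint of one arc cannot lie inside another arc
  have key : ∀ i < N', ∀ j < N', i ≠ j → ∀ m : ℤ, L.F^[j] L.a ≤ L.F^[i] L.a + m →
      L.F^[j] y ≤ L.F^[i] L.a + m := by
    intro i hi j hj hij m h1
    by_contra h2
    have h3 : (j : ℝ) * L.rm < i * L.rm + m := by
      by_contra h4
      rcases eq_or_lt_of_le (not_lt.1 h4) with h5 | h5
      · have e := order_a_iff (L := L) (i := i) (j := j) (m := m) (m' := 0)
        rcases lt_or_gt_of_ne hij with h6 | h6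
        · refine irr_ne (L := L) (n := j - i) (by omega) m ?_
          rw [Nat.cast_sub h6.le]; linarith
        · refine irr_ne (L := L) (n := i - j) (by omega) (-m) ?_
          rw [Nat.cast_sub h6.le]; push_cast; linarith
      · have := order_a (L := L) (i := i) (j := j) (m := m) (m' := 0) (by simpa using h5)
        push_cast at this; linarith
    have h4 := gap_order h.2.2 hi hj hij h3
    have h5 := iter_mono_nat L.Fm_mono (N - j) (not_le.1 h2).le
    rw [h.iter_eq hN hy hj.le, ← Function.iterate_add_apply, Nat.sub_add_cancel (by omega),
      Fm_iter_int, iter_a, ← Function.iterate_add_apply] at h5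
    have h6 := Fm_iter_le (L := L) N y
    have h7 := order_a_left (L := L) (n := N - j + i) (m := P - 1) (m' := m) (by
      push_cast [Nat.cast_sub (show j ≤ N by omega)]; linarith)
    rw [iter_a] at h7
    have h8 : L.a + P ≤ L.Fm^[N - j + i] L.a + m := by
      rcases eq_or_lt_of_le h4 with h9 | h9
      · by_cases h10 : N - j + i = 0
        · have : j = N := by omega
          omega
        · exfalso
          refine irr_ne (L := L) (n := N - j + i) (by omega) (P - m) ?_
          push_cast [Nat.cast_sub (show j ≤ N by omega)]; linarith
      · have := order_a_left (L := L) (n := N - j + i) (m := P) (m' := m) (by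
          push_cast [Nat.cast_sub (show j ≤ N by omega)]; linarith)
        rw [iter_a] at this
        exact this.le
    linarith [L.hba]
  refine sum_length_le_one _ _ _ (fun l hl => ?_) (fun l hl => ?_)
    fun i hi j hj hij m x hx hx' => ?_
  · exact hy.le (by simp at hl; omega) le_rfl hy.1 le_rfl
  · have := hy.iter_lt_b (l := l) (by simp at hl; omega)
    linarith
  · simp only [Finset.mem_range] at hi hj
    rcases le_total (L.F^[j] L.a) (L.F^[i] L.a + m) with h1 | h1
    · have := key i hi j hj hij m h1
      linarith [hx.1, hx'.2]
    · have := key j hj i hi hij.symm (-m) (by push_cast; linarith)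
      push_cast at this
      linarith [hx.2, hx'.1]

theorem gap_odd (k : ℕ) : Gap L.rm (S.q (2 * k + 1)) (S.q (2 * k + 1)) (S.p (2 * k + 1)) := by
  refine ⟨S.odd k, S.od_lt_one k, fun j m hj hj' => ?_⟩
  exact (S.od_lt k).le.trans (S.best_even hj hj' m)

theorem gap_sum (k : ℕ) : Gap L.rm (S.q (2 * k + 1) + S.q (2 * k + 2)) (S.q (2 * k + 2))
    (S.p (2 * k + 1) + S.p (2 * k + 2)) := by
  have h1 := S.ev_succ_lt k
  have h2 := S.ev_pos (k + 1)
  have h3 := S.od_lt_one k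
  unfold ConvScheme.ev ConvScheme.od at *
  rw [show 2 * (k + 1) = 2 * k + 2 by ring] at *
  refine ⟨?_, ?_, fun j m hj hj' => ?_⟩
  · push_cast; linarith
  · push_cast; linarith
  · have := S.best_odd hj hj' m
    unfold ConvScheme.od at this
    push_cast; linarith

/-- The images of the arc from `a` to its closest return are disjoint. -/
theorem sum_R_le (k : ℕ) :
    ∑ l ∈ Finset.range (S.q (2 * k + 1)), (L.F^[l] (L.a + L.R S k) - L.F^[l] L.a) ≤ 1 := by
  have hch := Ch_R (L := L) S k
  have key : ∀ i < S.q (2 * k + 1), ∀ j < S.q (2 * k + 1), i ≠ j → ∀ m : ℤ,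
      L.F^[j] L.a ≤ L.F^[i] L.a + m → L.F^[j] (L.a + L.R S k) ≤ L.F^[i] L.a + m := by
    intro i hi j hj hij m h1
    by_contra h2
    rw [iter_a_add_R] at h2
    have h3 : (j : ℝ) * L.rm ≤ i * L.rm + m := by
      by_contra h4
      have := order_a (L := L) (i := i) (j := j) (m := m) (m' := 0) (by simpa using h4)
      push_cast at this; linarith
    have h5 := (order_a_iff (L := L) (i := i) (j := j + S.q (2 * k)) (m := m)
      (m' := -S.p (2 * k))).1 (by push_cast; linarith)
    have h6 : |((j : ℝ) - i) * L.rm - m| < S.ev k := by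
      unfold ConvScheme.ev
      push_cast at h5
      rw [abs_lt]; constructor <;> linarith
    rcases lt_or_gt_of_ne hij with h7 | h7
    · have := S.best_even (k := k) (l := j - i) (by omega) (by omega) m
      rw [Nat.cast_sub h7.le] at this; linarith
    · have := S.best_even (k := k) (l := i - j) (by omega) (by omega) (-m)
      rw [Nat.cast_sub h7.le, abs_sub_comm] at this
      push_cast at this
      rw [show -(m : ℝ) - (i - j) * L.rm = (j - i) * L.rm - m by ring] at this
      linarith
  refine sum_length_le_one _ _ _ (fun l hl => ?_) (fun l hl => ?_)
    fun i hi j hj hij m x hx hx' => ?_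
  · exact hch.le (by simp at hl; omega) le_rfl hch.1 le_rfl
  · have := hch.iter_lt_b (l := l) (by simpa using hl)
    linarith
  · simp only [Finset.mem_range] at hi hj
    rcases le_total (L.F^[j] L.a) (L.F^[i] L.a + m) with h1 | h1
    · have := key i hi j hj hij m h1
      linarith [hx.1, hx'.2]
    · have := key j hj i hi hij.symm (-m) (by push_cast; linarith)
      push_cast at this
      linarith [hx.2, hx'.1]

end Lorenz

namespace Lorenz
variable {L : Lorenz}

theorem Ch.shift {n : ℕ} {s t : ℝ} (h : L.Ch n s t) (m : ℤ) : L.Ch n (s - m) (t - m) := by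
  have := h.int (-m); push_cast at this; simpa [sub_eq_add_neg] using this

/-- Cross ratio estimate for the images by `F` of four points of a monotone branch. -/
theorem Ch.crossRatio_F_le {n : ℕ} {s t x y B : ℝ} (h : L.Ch n (L.F s) (L.F t))
    (h1 : L.F s < L.F x) (h2 : L.F x < L.F y) (h3 : L.F y < L.F t)
    (hB : ∑ l ∈ Finset.range n, (L.F^[l + 1] y - L.F^[l + 1] s) ≤ B) :
    crossRatio (L.F s) (L.F x) (L.F y) (L.F t) ≤ Real.exp (L.C * B) *
      crossRatio (L.F^[n + 1] s) (L.F^[n + 1] x) (L.F^[n + 1] y) (L.F^[n + 1] t) := by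
  refine (h.crossRatio_le h1 h2 h3).trans ?_
  have hn := crossRatio_nonneg (h.lt le_rfl le_rfl h1 (h2.trans h3).le)
    (h.lt le_rfl h1.le h2 h3.le) (h.lt le_rfl (h1.trans h2).le h3 le_rfl)
  simp only [Function.iterate_succ_apply] at hB ⊢
  gcongr
  exact L.hC

/-- Expansion near `a`: doubling between scales of two successive closest returns. -/
theorem g_add_le : ∃ lam > 0, ∀ (S : ConvScheme L.rm) (k m : ℕ), S.q (2 * k + 1) ≤ m →
    m < S.q (2 * k + 3) → L.g m ≤ (L.e - L.a) / 2 →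
    L.g (m + S.q (2 * k + 2)) ≤ max (2 * lam * L.R S (k + 1)) (L.g m / 2) := by
  obtain ⟨c₁, hc₁, c₂, hc₂, hpow⟩ := L.powa
  -- choice of the scale
  obtain ⟨lam, hlam, hlam1⟩ : ∃ lam : ℝ, 1 < lam ∧
      8 * lam * Real.exp L.C + 1 ≤ c₁ / c₂ * lam ^ L.la := by
    have h1 : Tendsto (fun x : ℝ => c₁ / c₂ * x ^ (L.la - 1)) atTop atTop :=
      (tendsto_rpow_atTop (by linarith [L.hla])).const_mul_atTop (by positivity)
    obtain ⟨x, hx, hx1⟩ := ((h1.eventually_ge_atTop (8 * Real.exp L.C + 1)).and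
      (eventually_gt_atTop 1)).exists
    refine ⟨x, hx1, ?_⟩
    have h2 : x ^ L.la = x ^ (L.la - 1) * x := by
      rw [← Real.rpow_add_one (by linarith)]; ring_nf
    rw [h2]
    nlinarith [Real.exp_pos L.C]
  refine ⟨lam, by linarith, fun S k m hm hm' hgm => ?_⟩
  set q := S.q (2 * k + 2) with hq
  set P := S.p (2 * k + 2) with hP
  set r := L.R S (k + 1) with hr
  have hr0 : 0 < r := R_pos S (k + 1)
  by_contra hcon
  push Not at hcon
  obtain ⟨hcon1, hcon2⟩ := max_lt_iff.1 hcon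
  set w := L.g (m + q) with hw
  have hw0 : 0 < w := g_pos _
  have hq1 : 1 ≤ q := S.one_le_q _
  obtain ⟨q', hq'⟩ : ∃ q', q = q' + 1 := ⟨q - 1, by omega⟩
  have hch : L.Ch (m + 1 + q) L.a (L.a + w) := by
    have := g_spec (L := L) (m + q); rwa [show m + q + 1 = m + 1 + q by ring] at this
  have hFa : L.F^[q] L.a = L.a + r + P := by rw [hr, R]; simp [hP, hq, mul_add]
  -- the image arc survives
  have hchR : L.Ch (m + 1) L.a (L.a + r) := (Ch_R S (k + 1)).anti (by
    rw [show 2 * (k + 1) + 1 = 2 * k + 3 by ring]; omega)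
  have hy1 : L.F^[q] (L.a + w) - P - L.a ≤ L.g m := by
    refine le_g (hchR.join ?_)
    have := hch.iter.shift P
    rwa [hFa, add_sub_cancel_right] at this
  set x := L.a + w / lam with hx
  have hx0 : L.a < x := by have : 0 < w / lam := by positivity
                           linarith
  have hx1 : x < L.a + w := by
    have : w / lam < w := div_lt_self hw0 hlam
    linarith
  have hφx : x + P < L.F^[q] x := by
    refine lt_of_lt_of_le (L.rm_lt q P ?_ x) (Fm_iter_le q x)
    have := S.even (k + 1)
    rwa [show 2 * (k + 1) = 2 * k + 2 by ring] at this
  have hyx := hch.lt (l := q) (by omega) hx0.le hx1 le_rfl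
  have hax := hch.lt (l := q) (by omega) le_rfl hx0 hx1.le
  -- extension on the right
  obtain ⟨t, ht, htc, htF⟩ := ext_to_e (L := L) (i := q) (x := L.a + w) (k := P)
    ((hch.anti (by omega)).sub (by linarith) le_rfl le_rfl)
    (by linarith) (by linarith [L.he1])
  have hchT : L.Ch q L.a t := (hch.anti (by omega)).join htc
  have hcr := (show L.Ch q' (L.F L.a) (L.F t) from by
      rw [hq'] at hchT; exact hchT.iter (k := 1)).crossRatio_F_le (x := x) (y := L.a + w) (B := 1)
    (hchT.lt (l := 1) hq1 le_rfl hx0 (by linarith))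
    (hchT.lt (l := 1) hq1 (by linarith) hx1 ht.le) (hchT.lt (l := 1) hq1 (by linarith) ht le_rfl)
    (by
      have h1 := (gap_sum (L := L) S k).sum_le (by omega) (y := L.a + w)
        (hch.anti (by omega))
      rw [← hq, hq', Finset.sum_range_succ'] at h1
      simp at h1; simp; linarith)
  rw [← hq', htF, hFa, mul_one] at hcr
  -- lower bound
  have hmono : ∀ u v, L.a ≤ u → u < v → v ≤ t → L.F u < L.F v := fun u v h1 h2 h3 =>
    hchT.lt (l := 1) hq1 h1 h2 h3
  have hwb : w ≤ L.b - L.a := g_le _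
  have hp1 := (hpow w ⟨hw0.le, hwb⟩).1
  have hp2 := (hpow (w / lam) ⟨by positivity, by linarith⟩).2
  have hFx : 0 < L.F x - L.F L.a := by linarith [hmono L.a x le_rfl hx0 (by linarith)]
  have hFxy := hmono x (L.a + w) hx0.le hx1 ht.le
  have hFyt := hmono (L.a + w) t (by linarith) ht le_rfl
  have hlow : 8 * lam * Real.exp L.C ≤ crossRatio (L.F L.a) (L.F x) (L.F (L.a + w)) (L.F t) := by
    have h1 : 8 * lam * Real.exp L.C * (L.F x - L.F L.a) ≤ L.F (L.a + w) - L.F x := by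
      have h2 : (w / lam) ^ L.la = w ^ L.la / lam ^ L.la :=
        Real.div_rpow hw0.le (by linarith) _
      have hl0 : 0 < lam ^ L.la := Real.rpow_pos_of_pos (by linarith) _
      have h3 : (8 * lam * Real.exp L.C + 1) * (L.F x - L.F L.a) ≤ c₁ * w ^ L.la := by
        calc _ ≤ (c₁ / c₂ * lam ^ L.la) * (c₂ * (w / lam) ^ L.la) := by gcongr
          _ = c₁ * w ^ L.la := by rw [h2]; field_simp
      linarith
    unfold crossRatio
    rw [le_div_iff₀ (by apply mul_pos hFx; linarith)]
    calc 8 * lam * Real.exp L.C * ((L.F x - L.F L.a) * (L.F t - L.F (L.a + w)))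
        = (8 * lam * Real.exp L.C * (L.F x - L.F L.a)) * (L.F t - L.F (L.a + w)) := by ring
      _ ≤ _ := by gcongr <;> linarith
  -- upper bound
  set Y := L.F^[q] (L.a + w) with hY
  have hup : crossRatio (L.a + r + P) (L.F^[q] x) Y (L.e + P) < 8 * lam := by
    have h1 : w / (2 * lam) ≤ L.F^[q] x - (L.a + r + P) := by
      have : r ≤ w / (2 * lam) := by rw [le_div_iff₀ (by linarith)]; linarith
      have e : w / lam = w / (2 * lam) + w / (2 * lam) := by field_simp; norm_num
      linarith
    unfold crossRatio
    have h0 : 0 < w / (2 * lam) := by positivity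
    rw [div_lt_iff₀ (by apply mul_pos <;> linarith [L.he1])]
    have h2 : Y - L.F^[q] x < 2 * w := by linarith
    calc (Y - L.F^[q] x) * (L.e + P - (L.a + r + P)) ≤ (Y - L.F^[q] x) * (L.e - L.a) :=
          mul_le_mul_of_nonneg_left (by linarith) (by linarith)
      _ < (2 * w) * (L.e - L.a) := by gcongr; linarith [L.he1]
      _ = 8 * lam * (w / (2 * lam) * ((L.e - L.a) / 2)) := by field_simp; ring
      _ ≤ _ := by
        refine mul_le_mul_of_nonneg_left (mul_le_mul h1 (by linarith) (by linarith [L.he1])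
          (by linarith)) (by linarith)
  nlinarith [Real.exp_pos L.C]

end Lorenz

namespace Lorenz
variable {L : Lorenz} (S : ConvScheme L.rm)

theorem iter_d {n : ℕ} (hn : 1 ≤ n) : L.F^[n] L.d = L.F^[n] L.a := by
  obtain ⟨l, rfl⟩ : ∃ l, n = l + 1 := ⟨n - 1, by omega⟩
  simpa using F_d_int (L := L) l 0

theorem Ch_d (n : ℕ) : L.Ch n L.d L.d := by
  refine ⟨le_rfl, fun l hl => ?_⟩
  rcases Nat.eq_zero_or_pos l with rfl | hl0
  · exact ⟨-1, by push_cast; simp; linarith [L.hd1], by push_cast; simp; linarith [L.hd2]⟩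
  · rw [iter_d hl0]; exact (Ch_a n).2 l hl

theorem iter_a_q (k : ℕ) : L.F^[S.q (2 * k)] L.a = L.a + L.R S k + S.p (2 * k) := by
  unfold R; ring

/-- A hole of age `q (2k)` lies just to the left of `d`. -/
theorem exists_hole_left_d (k : ℕ) (hR : L.R S k ≤ L.da) :
    ∃ v w, L.Hole (S.q (2 * k)) v w ∧ w < L.d ∧ L.Ch (S.q (2 * k)) v L.d ∧
      L.F^[S.q (2 * k)] v = L.b - 1 + S.p (2 * k) ∧ L.F^[S.q (2 * k)] w = L.a + S.p (2 * k) := by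
  have hR0 := R_pos (L := L) S k
  have hde : L.da ≤ (L.e - L.a) / 2 := min_le_left _ _
  have hq := S.one_le_q (2 * k)
  have hFa := iter_a_q (L := L) S k
  set q := S.q (2 * k) with hq'
  set p := S.p (2 * k) with hp'
  have hFd : L.F^[q] L.d = L.a + L.R S k + p := by rw [iter_d hq, hFa]
  rcases ext_left (L := L) (i := q) (x := L.d) (T := L.b - 1 + p) (Ch_d q)
    (by rw [hFd]; linarith [L.hba]) with ⟨t, ht, hch, htF⟩ | ⟨t, hch, htF, l, hl, m, hlm⟩
  · obtain ⟨z, hz, hzF⟩ := hch.ivt (l := q) (T := L.a + p) (by rw [htF]; linarith [L.hba])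
      (by rw [hFd]; linarith)
    have h1 : t < z := lt_of_le_of_ne hz.1 (by rintro rfl; linarith [L.hba])
    have h2 : z < L.d := lt_of_le_of_ne hz.2 (by rintro rfl; linarith)
    exact ⟨t, z, ⟨h1, hch.sub le_rfl hz.1 hz.2, p, htF, hzF⟩, h2, hch, htF, hzF⟩
  · exfalso
    have hF : L.F^[q] t = L.F^[q - l] L.a + m := by
      rw [← iter_int, ← hlm, ← Function.iterate_add_apply, Nat.sub_add_cancel hl.le]
    have hle := hch.le (l := q) le_rfl le_rfl hch.1 le_rfl
    rw [hFd] at hle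
    rcases Nat.eq_zero_or_pos l with rfl | hl0
    · simp only [Function.iterate_zero, id] at hlm
      have h1 : m < 0 := by
        have := hch.1; rw [hlm] at this
        have : (m : ℝ) < 0 := by linarith [L.hd2, L.hba]
        exact_mod_cast this
      have h1 : (m : ℝ) ≤ -1 := by exact_mod_cast (by omega : m ≤ -1)
      rw [Nat.sub_zero, hFa] at hF
      linarith [L.he2]
    · rw [hF] at htF hle
      have h1 : L.a + p < L.F^[q - l] L.a + m := by
        by_contra h2
        refine orbit_a_notMem (L := L) (n := q - l) (by omega) (p - m) ⟨?_, ?_⟩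
        · push_cast; linarith [L.hd2]
        · push_cast; linarith
      have h2 := (order_a_iff (L := L) (i := 0) (j := q - l) (m := p) (m' := m)).1
        (by simpa using h1)
      rw [← hFa] at hle
      have h3 : ¬ ((q : ℝ) * L.rm + (0 : ℤ) < (q - l : ℕ) * L.rm + m) := fun h => by
        have := order_a h; push_cast at this; linarith
      rw [Nat.cast_sub hl.le] at h2 h3
      have h4 := S.best_even (k := k) (l := q - l) (by omega)
        (lt_of_lt_of_le (by omega : q - l < q) (S.q_le_succ (2 * k))) (p - m)
      rw [Nat.cast_sub hl.le] at h4
      push_cast at h2 h3 h4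
      rw [abs_of_pos (by linarith)] at h4
      unfold ConvScheme.ev at h4
      refine irr_ne (L := L) hl0 m ?_
      linarith

/-- Position of the iterates of `a` under the odd closest return, to the right of the hole. -/
theorem hole_left_lt {k : ℕ} {w : ℝ} (hw : L.F^[S.q (2 * k)] w = L.a + S.p (2 * k)) {j : ℕ}
    (hj : j ≤ S.A (2 * k)) :
    w < L.F^[j * S.q (2 * k + 1)] L.a - j * S.p (2 * k + 1) := by
  by_contra hcon
  have h1 := iter_mono_nat L.Fm_mono (S.q (2 * k)) (not_lt.1 hcon)
  have h2 := Fm_iter_le (L := L) (S.q (2 * k)) w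
  have h3 := L.Fm_iter_int (S.q (2 * k)) (L.F^[j * S.q (2 * k + 1)] L.a)
    (-(j * S.p (2 * k + 1)))
  push_cast at h3
  rw [sub_eq_add_neg, h3, iter_a, ← Function.iterate_add_apply, ← iter_a] at h1
  have h4 := order_a_left (L := L) (n := S.q (2 * k) + j * S.q (2 * k + 1)) (m := S.p (2 * k))
    (m' := -(j * S.p (2 * k + 1))) (by
      have e1 := S.ev_succ k
      have e2 := S.ev_pos (k + 1)
      have e3 : (j : ℝ) * S.od k ≤ S.A (2 * k) * S.od k := by
        gcongr
        exact (S.od_pos k).le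
      rw [e1] at e2
      unfold ConvScheme.ev ConvScheme.od at *
      push_cast; nlinarith)
  push_cast at h4
  linarith

theorem iter_n_hole {k : ℕ} {w : ℝ} (hw : L.F^[S.q (2 * k)] w = L.a + S.p (2 * k)) {l : ℕ} :
    L.F^[S.q (2 * k) + l] w = L.F^[l] L.a + S.p (2 * k) := by
  rw [add_comm, Function.iterate_add_apply, hw, iter_int]

theorem iter_n_lt {k : ℕ} {v w : ℝ} (hch : L.Ch (S.q (2 * k)) v L.d)
    (hv : L.F^[S.q (2 * k)] v = L.b - 1 + S.p (2 * k))
    (hw : L.F^[S.q (2 * k)] w = L.a + S.p (2 * k)) :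
    L.F^[S.q (2 * k + 1)] w - S.p (2 * k + 1) < v ∧
      L.a - 2 < L.F^[S.q (2 * k + 1)] w - S.p (2 * k + 1) := by
  obtain ⟨l, hl⟩ : ∃ l, S.q (2 * k + 1) = S.q (2 * k) + l :=
    ⟨_, (Nat.add_sub_of_le (S.q_le_succ (2 * k))).symm⟩
  have e1 := S.ev_pos k
  have e2 := S.od_pos k
  have e3 := S.ev_lt_one k
  have e4 := S.od_lt_one k
  have hodd := S.odd k
  unfold ConvScheme.ev ConvScheme.od at *
  have hF := iter_n_hole S hw (l := l)
  rw [← hl] at hF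
  rw [hF]
  have hl' : (S.q (2 * k + 1) : ℝ) = S.q (2 * k) + l := by exact_mod_cast hl
  have h1 := order_a_right (L := L) (n := l) (m := 0) (m' := S.p (2 * k) - S.p (2 * k + 1))
    (by push_cast; rw [hl'] at e2 e4; linarith)
  have h2 := order_a_left (L := L) (n := l) (m := -2) (m' := S.p (2 * k) - S.p (2 * k + 1))
    (by push_cast; rw [hl'] at e2 e4; linarith)
  push_cast at h1 h2
  refine ⟨?_, by linarith⟩
  have h3 : L.F^[l] L.a + S.p (2 * k) - S.p (2 * k + 1) < L.d := by
    rcases Nat.eq_zero_or_pos l with rfl | hl0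
    · simp only [Function.iterate_zero, id] at h1 ⊢
      have : ((S.p (2 * k) - S.p (2 * k + 1) : ℤ) : ℝ) < 0 := by push_cast; linarith
      have : S.p (2 * k) - S.p (2 * k + 1) ≤ -1 := by
        have : S.p (2 * k) - S.p (2 * k + 1) < 0 := by exact_mod_cast this
        omega
      have : ((S.p (2 * k) - S.p (2 * k + 1) : ℤ) : ℝ) ≤ -1 := by exact_mod_cast this
      push_cast at this
      linarith [L.hd1]
    · have := lt_d_of_lt_a (L := L) hl0 (m := S.p (2 * k + 1) - S.p (2 * k))
        (by push_cast; linarith)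
      push_cast at this; linarith
  by_contra h4
  have h5 := hch.le (l := S.q (2 * k)) le_rfl le_rfl (not_lt.1 h4) h3.le
  have h6 := L.iter_int (S.q (2 * k)) (L.F^[l] L.a) (S.p (2 * k) - S.p (2 * k + 1))
  push_cast at h6
  rw [hv, add_sub_assoc, h6, ← Function.iterate_add_apply, ← hl] at h5
  have h7 := lt_d_of_lt_a (L := L) (S.one_le_q (2 * k + 1)) (m := S.p (2 * k + 1)) (by
    have := order_a_right (L := L) (n := S.q (2 * k + 1)) (m := S.p (2 * k + 1)) (m' := 0)
      (by simpa using hodd)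
    simpa using this)
  linarith [L.hd2]

theorem Ch_hole_d {k : ℕ} {v w : ℝ} (hvw : v ≤ w) (hwd : w ≤ L.d)
    (hch : L.Ch (S.q (2 * k)) v L.d)
    (hw : L.F^[S.q (2 * k)] w = L.a + S.p (2 * k)) :
    L.Ch (S.q (2 * k + 1) + S.q (2 * k)) w L.d := by
  refine (hch.sub hvw hwd le_rfl).add ?_
  rw [hw, iter_d (S.one_le_q _), iter_a_q]
  exact (Ch_R S k).int _

theorem sum_hole_d_le {k : ℕ} {v w : ℝ} (hR : L.R S k ≤ L.da) (hole : L.Hole (S.q (2 * k)) v w)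
    (hwd : w ≤ L.d) (hch : L.Ch (S.q (2 * k)) v L.d)
    (hw : L.F^[S.q (2 * k)] w = L.a + S.p (2 * k)) :
    ∑ l ∈ Finset.range (S.q (2 * k + 1)), (L.F^[l] L.d - L.F^[l] w) ≤ 2 := by
  obtain ⟨j, hj⟩ : ∃ j, S.q (2 * k + 1) = S.q (2 * k) + j :=
    ⟨_, (Nat.add_sub_of_le (S.q_le_succ (2 * k))).symm⟩
  have hFd : L.F^[S.q (2 * k)] L.d = L.a + L.R S k + S.p (2 * k) := by
    rw [iter_d (S.one_le_q _), iter_a_q]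
  rw [hj, Finset.sum_range_add]
  have h1 : ∑ l ∈ Finset.range (S.q (2 * k)), (L.F^[l] L.d - L.F^[l] w) ≤ 1 := by
    have h2 := hole.sum_le_one
    rw [Finset.sum_range_succ] at h2
    have h3 := hole.2.1.le (l := S.q (2 * k)) le_rfl le_rfl hole.1.le le_rfl
    refine le_trans (Finset.sum_le_sum fun l hl => ?_)
      (show ∑ l ∈ Finset.range (S.q (2 * k)), (L.F^[l] w - L.F^[l] v) ≤ 1 by linarith)
    have hl' : l ≤ S.q (2 * k) := (Finset.mem_range.1 hl).le
    have h4 := hole.near hw (t := L.d) (hch.sub hole.1.le hwd le_rfl) (by rw [hFd]; linarith) hl'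
    have h5 := hole.2.1.le hl' le_rfl hole.1.le le_rfl
    rw [hFd] at h4
    have h6 := da_mul_Ka hR
    rw [show L.a + L.R S k + S.p (2 * k) - (L.a + S.p (2 * k)) = L.R S k by ring] at h4
    nlinarith
  have h2 : ∑ l ∈ Finset.range j, (L.F^[S.q (2 * k) + l] L.d - L.F^[S.q (2 * k) + l] w) ≤ 1 := by
    refine le_trans ?_ (sum_R_le (L := L) S k)
    rw [hj, add_comm (S.q (2 * k)) j, Finset.sum_range_add]
    refine le_add_of_le_of_nonneg (Finset.sum_le_sum fun l _ => ?_)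
      (Finset.sum_nonneg fun l hl => ?_)
    · rw [iter_n_hole S hw, add_comm _ l, Function.iterate_add_apply, hFd, iter_int]
      linarith
    · have := (Ch_R (L := L) S k).le (l := j + l) (by
        have := Finset.mem_range.1 hl; omega) le_rfl (by linarith [R_pos (L := L) S k]) le_rfl
      linarith
  linarith

theorem iter_a_odd_lt (k : ℕ) : L.F^[S.q (2 * k + 1)] L.a < L.d + S.p (2 * k + 1) :=
  lt_d_of_lt_a (S.one_le_q _) (gap_odd S k).iter_a_lt

/-- A branch at `a` extends until its image covers the next copy of `[a, e]`. -/
theorem ext_odd {k : ℕ} {y : ℝ} (hy : L.Ch (S.q (2 * k + 1)) L.a y)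
    (h : L.F^[S.q (2 * k + 1)] y < L.e + S.p (2 * k + 1)) :
    ∃ t, y < t ∧ L.Ch (S.q (2 * k + 1)) L.a t ∧
      L.F^[S.q (2 * k + 1)] t = L.e + S.p (2 * k + 1) := by
  set n := S.q (2 * k + 1)
  rcases ext_right (hy.sub hy.1 le_rfl le_rfl) h with ⟨t, ht, hch, htF⟩ | ⟨t, hch, htF, l, hl, m, hlm⟩
  · exact ⟨t, ht, hy.join hch, htF⟩
  · exfalso
    have hc := hy.join hch
    have hF : L.F^[n] t = L.F^[n - l] L.b + m := by
      rw [← iter_int, ← hlm, ← Function.iterate_add_apply, Nat.sub_add_cancel hl.le]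
    have h1 : L.F^[n] t < L.b - 1 + S.p (2 * k + 1) := by
      by_contra h2
      refine orbit_b_notMem (L := L) (n := n - l) (by omega) (S.p (2 * k + 1) - m) ⟨?_, ?_⟩ <;>
        push_cast <;> linarith
    have h3 : L.F^[l] L.a ≤ L.d + 1 + ⌊l * L.rm⌋ ∧ L.a + ⌊l * L.rm⌋ ≤ L.F^[l] L.a := by
      rcases Nat.eq_zero_or_pos l with rfl | hl0
      · simp; linarith [L.hd1]
      · exact ⟨(orbit_a hl0).2.le, (orbit_a hl0).1.le⟩
    have h4 : L.d + 1 + ⌊l * L.rm⌋ ≤ L.F^[l] t := by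
      have h5 := hc.le hl.le le_rfl hc.1 le_rfl
      rw [hlm] at h5 ⊢
      have h6 : (⌊l * L.rm⌋ : ℝ) < m + 1 := by linarith [L.hba]
      have h6 : ⌊l * L.rm⌋ < m + 1 := by exact_mod_cast h6
      have h6 : (⌊l * L.rm⌋ : ℝ) ≤ m := by exact_mod_cast (by omega : ⌊l * L.rm⌋ ≤ m)
      linarith [L.hd2]
    obtain ⟨z, hz, hzF⟩ := hc.ivt h3.1 h4
    have h7 := (gap_odd (L := L) S k).lt_iter_d le_rfl hl
    rw [← hzF, ← Function.iterate_add_apply, Nat.sub_add_cancel hl.le] at h7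
    have h8 := hc.le (l := n) le_rfl hz.1 hz.2 le_rfl
    linarith [L.hba]

theorem exists_lipschitz : ∃ M > 0, ∀ x y, L.F y - L.F x ≤ M * |y - x| := by
  have hper : ∀ x, deriv L.F (x + 1) = deriv L.F x := fun x => by
    have : (fun y => L.F (y + 1)) = fun y => L.F y + 1 := funext L.per
    have h2 := congrFun (congrArg deriv this) x
    rwa [deriv_comp_add_const, deriv_add_const] at h2
  obtain ⟨M, hM⟩ := (isCompact_Icc (a := (0 : ℝ)) (b := 1)).exists_bound_of_continuousOn
    L.cont_deriv.continuousOn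
  have hall : ∀ x, ‖deriv L.F x‖ ≤ |M| + 1 := fun x => by
    have h1 : deriv L.F x = deriv L.F (Int.fract x) := by
      have := (show Function.Periodic (deriv L.F) 1 from hper).sub_int_mul_eq (x := x) ⌊x⌋
      rw [mul_one] at this; rw [← this]; rfl
    rw [h1]
    have := hM (Int.fract x) ⟨Int.fract_nonneg x, (Int.fract_lt_one x).le⟩
    linarith [le_abs_self M]
  refine ⟨|M| + 1, by positivity, fun x y => ?_⟩
  have := Convex.norm_image_sub_le_of_norm_deriv_le (f := L.F) (s := univ) (C := |M| + 1)
    (fun x _ => L.diff x) (fun x _ => hall x) convex_univ (mem_univ x) (mem_univ y)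
  exact (le_abs_self _).trans this

/-- Main distortion estimate around `d`. -/
theorem core_odd : ∃ B > 0, ∀ (S : ConvScheme L.rm) (k : ℕ) (v w x y : ℝ), L.R S k ≤ L.da →
    L.Hole (S.q (2 * k)) v w → w < L.d → L.Ch (S.q (2 * k)) v L.d →
    L.F^[S.q (2 * k)] v = L.b - 1 + S.p (2 * k) → L.F^[S.q (2 * k)] w = L.a + S.p (2 * k) →
    w < x → x ≤ L.d → L.Ch (S.q (2 * k + 1) + 1) L.a y → L.F x < L.F y →
    w + S.p (2 * k + 1) ≤ L.F^[S.q (2 * k + 1)] x →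
    L.F y - L.F x ≤ B * L.R S k *
      (L.F^[S.q (2 * k + 1)] y - L.F^[S.q (2 * k + 1)] x) := by
  obtain ⟨M, hM, hLip⟩ := exists_lipschitz (L := L)
  have hKa := Ka_pos (L := L)
  have hd2 := L.hd2
  have he : 0 < L.e - L.b + 1 := by linarith [L.he1, L.hba]
  refine ⟨M * L.Ka * (Real.exp (L.C * 3) * 3 / (L.e - L.b + 1)), by positivity, ?_⟩
  intro S k v w x y hR hole hwd hvd hv hw hwx hxd hy hxy hxn
  obtain ⟨hH, hH2⟩ := iter_n_lt S hvd hv hw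
  have hR0 := R_pos (L := L) S k
  have hyn : L.F^[S.q (2 * k + 1)] y ≤ L.b - 1 + S.p (2 * k + 1) :=
    hy.lt_of_iter_lt (gap_odd S k).iter_a_lt
  obtain ⟨t, ht, htc, htF⟩ := ext_odd S (k := k) (hy.anti (by omega)) (by linarith)
  have hwdc : L.Ch (S.q (2 * k + 1)) w L.d := (Ch_hole_d S hole.1.le hwd.le hvd hw).anti (by omega)
  have hsum1 := sum_hole_d_le S hR hole hwd.le hvd hw
  have hsum2 := (gap_odd (L := L) S k).sum_le le_rfl hy
  have hn := S.one_le_q (2 * k + 1)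
  set n := S.q (2 * k + 1) with hn'
  set p := S.p (2 * k + 1)
  have hFxn : L.F^[n] w < L.F^[n] x := hwdc.lt le_rfl le_rfl hwx hxd
  have hFyx : L.F w < L.F x := hwdc.lt (l := 1) hn le_rfl hwx hxd
  have hFd := hwdc.le (l := 1) hn le_rfl hwd.le le_rfl
  have hFt : L.F y < L.F t := htc.lt (l := 1) hn hy.1 ht le_rfl
  have hFxd : L.F x ≤ L.F L.d := hwdc.le (l := 1) hn hwx.le hxd le_rfl
  have hdn : L.F^[n] L.d = L.F^[n] L.a := iter_d hn
  obtain ⟨j, hj⟩ : ∃ j, n = j + 1 := ⟨n - 1, by omega⟩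
  have hchF : L.Ch j (L.F w) (L.F t) := by
    rw [hj] at hwdc htc
    have h1 := hwdc.iter (k := 1)
    have h2 := htc.iter (k := 1)
    simp only [Function.iterate_one] at h1 h2
    rw [L.hdF] at h1
    exact h1.join h2
  have hynx : L.F^[n] x < L.F^[n] y := by
    have := hchF.lt (l := j) le_rfl hFyx.le hxy hFt.le
    rwa [← Function.iterate_succ_apply, ← Function.iterate_succ_apply, Nat.succ_eq_add_one,
      ← hj] at this
  have hsum : ∑ l ∈ Finset.range j, (L.F^[l + 1] y - L.F^[l + 1] w) ≤ 3 := by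
    rw [hj, Finset.sum_range_succ'] at hsum1 hsum2
    have : ∑ l ∈ Finset.range j, (L.F^[l + 1] y - L.F^[l + 1] w) =
        ∑ l ∈ Finset.range j, (L.F^[l + 1] y - L.F^[l + 1] L.a) +
        ∑ l ∈ Finset.range j, (L.F^[l + 1] L.d - L.F^[l + 1] w) := by
      rw [← Finset.sum_add_distrib]
      refine Finset.sum_congr rfl fun l _ => ?_
      rw [iter_d (L := L) (n := l + 1) (by omega)]; ring
    have h1 := hy.1
    simp only [Function.iterate_zero, id] at hsum1 hsum2
    linarith
  have hcr := hchF.crossRatio_F_le hFyx hxy hFt hsum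
  rw [← hj, htF] at hcr
  -- the two sides of the cross ratio inequality
  have hV : 0 < w - v := by linarith [hole.1]
  have hVx : w - v ≤ L.F^[n] x - L.F^[n] w := by linarith
  have hright : crossRatio (L.F^[n] w) (L.F^[n] x) (L.F^[n] y) (L.e + p) ≤
      (L.F^[n] y - L.F^[n] x) * 3 / ((w - v) * (L.e - L.b + 1)) := by
    unfold crossRatio
    gcongr
    · linarith [L.he2, L.hba]
    · linarith
  have hleft := le_mul_crossRatio_left hFyx hxy hFt
  have hxw : L.F x - L.F w ≤ M * (L.Ka * L.R S k * (w - v)) := by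
    have h1 := hole.near hw (t := L.d) (hvd.sub hole.1.le hwd.le le_rfl) (by
      rw [iter_d (S.one_le_q _), iter_a_q]; linarith) (Nat.zero_le _)
    rw [iter_d (S.one_le_q _), iter_a_q,
      show L.a + L.R S k + S.p (2 * k) - (L.a + S.p (2 * k)) = L.R S k by ring] at h1
    simp only [Function.iterate_zero, id] at h1
    have h2 := hLip w L.d
    rw [abs_of_pos (by linarith)] at h2
    nlinarith
  calc L.F y - L.F x ≤ (L.F x - L.F w) * crossRatio (L.F w) (L.F x) (L.F y) (L.F t) := hleft
    _ ≤ (M * (L.Ka * L.R S k * (w - v))) * (Real.exp (L.C * 3) *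
        ((L.F^[n] y - L.F^[n] x) * 3 / ((w - v) * (L.e - L.b + 1)))) := by
      refine mul_le_mul hxw (hcr.trans ?_) (crossRatio_nonneg hFyx hxy hFt) (by positivity)
      gcongr
    _ = _ := by field_simp

theorem deriv_int (x : ℝ) (m : ℤ) : deriv L.F (x + m) = deriv L.F x := by
  have : (fun y => L.F (y + m)) = fun y => L.F y + m := funext fun y => L.per_int y m
  have h2 := congrFun (congrArg deriv this) x
  rwa [deriv_comp_add_const, deriv_add_const] at h2

/-- Linear lower bounds on the increasing branch away from its endpoints. -/
theorem exists_lower {s t : ℝ} (hs : L.a < s) (ht : t < L.b) : ∃ c > 0, ∀ x y, s ≤ x → x ≤ y →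
    y ≤ t → c * (y - x) ≤ L.F y - L.F x := by
  rcases lt_or_ge t s with hst | hst
  · exact ⟨1, one_pos, fun x y h1 h2 h3 => by linarith⟩
  obtain ⟨z, hz, hmin⟩ := isCompact_Icc.exists_isMinOn (nonempty_Icc.2 hst)
    (L.cont_deriv.continuousOn (s := Icc s t))
  refine ⟨deriv L.F z, L.dpos z ⟨by linarith [hz.1], by linarith [hz.2]⟩, fun x y h1 h2 h3 => ?_⟩
  refine (convex_Icc s t).mul_sub_le_image_sub_of_le_deriv L.cont.continuousOn
    L.diff.differentiableOn (fun u hu => ?_) x ⟨h1, h2.trans h3⟩ y ⟨h1.trans h2, h3⟩ h2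
  rw [interior_Icc] at hu
  exact hmin ⟨hu.1.le, hu.2.le⟩

theorem exists_lower_d : ∃ c > 0, (∀ x, (L.a - 1 + L.d) / 2 ≤ x → x ≤ L.d →
    c * (L.d - x) ≤ L.F L.d - L.F x) ∧
    ∀ x, L.d ≤ x → x ≤ L.b - 1 → c * (x - L.d) ≤ L.F x - L.F L.d := by
  have h1 := L.hd1
  have h2 := L.hd2
  obtain ⟨c, hc, h⟩ := exists_lower (L := L) (s := (L.a - 1 + L.d) / 2 + 1)
    (t := (L.d + (L.b - 1)) / 2 + 1) (by linarith) (by linarith)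
  have h' : ∀ x y, (L.a - 1 + L.d) / 2 ≤ x → x ≤ y → y ≤ (L.d + (L.b - 1)) / 2 →
      c * (y - x) ≤ L.F y - L.F x := fun x y h3 h4 h5 => by
    have := h (x + 1) (y + 1) (by linarith) (by linarith) (by linarith)
    rw [L.per, L.per] at this; linarith
  refine ⟨c / 2, by positivity, fun x h3 h4 => ?_, fun x h3 h4 => ?_⟩
  · have := h' x L.d h3 h4 (by linarith)
    nlinarith
  · rcases le_total x ((L.d + (L.b - 1)) / 2) with h5 | h5
    · have := h' L.d x (by linarith) h3 h5
      nlinarith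
    · have h6 := h' L.d ((L.d + (L.b - 1)) / 2) (by linarith) (by linarith) le_rfl
      have h7 := (L.strictMono_int (-1)).monotoneOn
        (show (L.d + (L.b - 1)) / 2 ∈ _ from ⟨by push_cast; linarith, by push_cast; linarith⟩)
        (show x ∈ _ from ⟨by push_cast; linarith, by push_cast; linarith⟩) h5
      nlinarith

/-- Recursive estimate at odd closest returns. -/
theorem g_pow_le : ∃ B > 0, ∃ η > 0, ∀ (S : ConvScheme L.rm) (k : ℕ), L.R S k ≤ η →
    ∃ ε ≥ 0, ε ≤ (B * L.R S k) ^ (S.A (2 * k) - 1) ∧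
      ∀ m, L.g (m + S.q (2 * k + 1)) ^ L.la ≤ B * L.R S k * (ε + L.g m ^ L.la) := by
  obtain ⟨B, hB, hcore⟩ := core_odd (L := L)
  obtain ⟨c, hc, hlow1, hlow2⟩ := exists_lower_d (L := L)
  obtain ⟨c₁, hc₁, c₂, hc₂, hpow⟩ := L.powa
  have hd1 := L.hd1
  have hd2 := L.hd2
  have hKa := Ka_pos (L := L)
  refine ⟨max (B / c) (max (B / c₁) (B / c₁ * (c₂ / c))),
    lt_max_of_lt_left (by positivity), min L.da ((L.d - (L.a - 1)) / 2 / L.Ka),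
    lt_min da_pos (by apply div_pos _ hKa; linarith), fun S k hR => ?_⟩
  set B' := max (B / c) (max (B / c₁) (B / c₁ * (c₂ / c))) with hB'
  have hR0 := R_pos (L := L) S k
  have hRd : L.R S k ≤ L.da := hR.trans (min_le_left _ _)
  have hRK : L.Ka * L.R S k ≤ (L.d - (L.a - 1)) / 2 := by
    have := hR.trans (min_le_right _ _)
    rw [le_div_iff₀ hKa] at this; linarith
  obtain ⟨v, w, hole, hwd, hvd, hv, hw⟩ := exists_hole_left_d S k hRd
  have hcore' := fun x y => hcore S k v w x y hRd hole hwd hvd hv hw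
  have hn := S.one_le_q (2 * k + 1)
  have hwj := fun j hj => hole_left_lt (L := L) S hw (j := j) hj
  have hwd1 : (L.a - 1 + L.d) / 2 ≤ w := by
    have h1 := hole.near hw (t := L.d) (hvd.sub hole.1.le hwd.le le_rfl) (by
      rw [iter_d (S.one_le_q _), iter_a_q]; linarith) (Nat.zero_le _)
    rw [iter_d (S.one_le_q _), iter_a_q,
      show L.a + L.R S k + S.p (2 * k) - (L.a + S.p (2 * k)) = L.R S k by ring] at h1
    simp only [Function.iterate_zero, id] at h1
    have h2 := hole.sub_one_lt
    have h3 := hole.1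
    nlinarith [mul_pos hKa hR0]
  have hodd := S.odd k
  have han := iter_a_odd_lt (L := L) S k
  have hA := S.A_pos (2 * k)
  set n := S.q (2 * k + 1) with hn'
  set p := S.p (2 * k + 1) with hp
  set A := S.A (2 * k)
  set r := L.R S k
  -- the orbit of `a` under the odd closest return
  set u : ℕ → ℝ := fun j => L.F^[j * n] L.a - j * p with hu
  have hud : ∀ j, 1 ≤ j → u j < L.d := fun j hj => by
    have hj' : (0 : ℝ) < j := by exact_mod_cast hj
    have h1 := order_a_right (L := L) (n := j * n) (m := j * p) (m' := 0) (by
      push_cast; nlinarith)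
    have h2 := lt_d_of_lt_a (L := L) (n := j * n) (m := j * p) (Nat.mul_pos hj hn)
      (by simpa using h1)
    push_cast at h2; simp only [hu]; linarith
  have hun : ∀ j, L.F^[n] (u j) = u (j + 1) + p := fun j => by
    have := L.iter_int n (L.F^[j * n] L.a) (-(j * p))
    push_cast at this
    simp only [hu]
    rw [sub_eq_add_neg, this, ← Function.iterate_add_apply]
    rw [show n + j * n = (j + 1) * n by ring]; push_cast; ring
  have hstep : ∀ j, 1 ≤ j → j + 1 ≤ A → L.d - u j ≤ B' * r * (L.d - u (j + 1)) := by
    intro j hj hjA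
    have h1 := hwj j (by omega)
    have h2 := hwj (j + 1) hjA
    have h0 := hud j hj
    have h3 := hlow1 (u j) (by linarith) h0.le
    have hF : L.F (u j) < L.F L.a := by rw [← L.hdF]; nlinarith
    have h4 := hcore' (u j) L.a h1 h0.le (Ch_a _) hF (by rw [hun]; simp only [hu] at *; linarith)
    rw [hun, ← L.hdF] at h4
    have h5 := hud (j + 1) (by omega)
    have h6 : c * (L.d - u j) ≤ B * r * (L.d - u (j + 1)) :=
      h3.trans (h4.trans (mul_le_mul_of_nonneg_left (by linarith) (by positivity)))
    calc L.d - u j ≤ (B * r * (L.d - u (j + 1))) / c := by rw [le_div_iff₀ hc]; linarith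
      _ = B / c * (r * (L.d - u (j + 1))) := by ring
      _ ≤ B' * (r * (L.d - u (j + 1))) :=
        mul_le_mul_of_nonneg_right (le_max_left _ _) (mul_nonneg hR0.le (by linarith))
      _ = _ := by ring
  have hB'0 : 0 < B' := lt_max_of_lt_left (by positivity)
  have hind : ∀ i, 1 + i ≤ A → L.d - u 1 ≤ (B' * r) ^ i * (L.d - u (1 + i)) := by
    intro i
    induction i with
    | zero => intro _; simp
    | succ i ih =>
      intro hi
      have h1 := ih (by omega)
      have h2 := hstep (1 + i) (by omega) (by omega)
      calc _ ≤ (B' * r) ^ i * (B' * r * (L.d - u (1 + i + 1))) := h1.trans (by gcongr)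
        _ = _ := by rw [pow_succ, add_assoc]; ring
  have hu1 : u 1 = L.F^[n] L.a - p := by simp [hu]
  refine ⟨L.d - u 1, by linarith [hud 1 le_rfl], ?_, fun m => ?_⟩
  · have h1 := hind (A - 1) (by omega)
    refine h1.trans (mul_le_of_le_one_right (by positivity) ?_)
    have h2 := hwj A le_rfl
    rw [show 1 + (A - 1) = A by omega]
    have : w < u A := h2
    linarith [L.hba]
  · have hg0 := g_pos (L := L) (m + n)
    have hgs := g_spec (L := L) (m + n)
    set y := L.a + L.g (m + n) with hy
    have hFy : L.F L.a < L.F y := hgs.lt (l := 1) (by omega) le_rfl (by linarith) le_rfl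
    have h1 := hcore' L.d y hwd le_rfl (hgs.anti (by omega)) (by rw [L.hdF]; exact hFy) (by
      rw [iter_d hn]; have : w < u 1 := hwj 1 hA
      linarith)
    have h2 := (hpow (L.g (m + n)) ⟨hg0.le, g_le _⟩).1
    rw [L.hdF, iter_d hn] at h1
    have hξb : L.F^[n] y ≤ L.b - 1 + p :=
      (hgs.anti (by omega) : L.Ch (n + 1) L.a y).lt_of_iter_lt (gap_odd S k).iter_a_lt
    set ξ := L.F^[n] y - p with hξ
    have hξ2 : c * (ξ - L.d) ≤ c₂ * L.g m ^ L.la := by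
      have hgm : 0 ≤ L.g m ^ L.la := Real.rpow_nonneg (g_nonneg m) _
      rcases le_total ξ L.d with h3 | h3
      · nlinarith
      · obtain ⟨z, hz, hzF⟩ := intermediate_value_Icc L.he1.le (L.cont.continuousOn (s := Icc L.a L.e))
          (show L.F ξ ∈ _ by
            have hm := (L.strictMono_int (-1)).monotoneOn
            have e1 := hm (a := L.d) (b := ξ) ⟨by push_cast; linarith, by push_cast; linarith⟩
              ⟨by push_cast; linarith, by push_cast; linarith⟩ h3
            have e2 := hm (a := ξ) (b := L.b - 1) ⟨by push_cast; linarith, by push_cast; linarith⟩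
              ⟨by push_cast; linarith [L.hab], by push_cast; linarith⟩ (by linarith)
            have e3 := L.per (L.b - 1)
            rw [sub_add_cancel] at e3
            rw [L.hdF] at e1
            exact ⟨e1, by rw [L.heF]; linarith⟩)
        have hchξ : L.Ch (m + 1) L.d ξ := by
          have e1 := (show L.Ch (m + 1 + n) L.a y by
            rwa [show m + n + 1 = m + 1 + n by ring] at hgs).iter.shift p
          exact e1.sub (by linarith [hud 1 le_rfl]) h3 le_rfl
        have hchz : L.Ch (m + 1) L.a z := by
          refine ⟨hz.1, fun l hl => ?_⟩
          rcases Nat.eq_zero_or_pos l with rfl | hl0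
          · exact ⟨0, by simp, by simpa using hz.2.trans L.he2.le⟩
          · obtain ⟨l', rfl⟩ : ∃ l', l = l' + 1 := ⟨l - 1, by omega⟩
            have := hchξ.2 _ hl
            rwa [iter_d hl0, Function.iterate_succ_apply _ _ ξ, ← hzF,
              ← Function.iterate_succ_apply] at this
        have e1 := le_g hchz
        have e2 := (hpow (z - L.a) ⟨by linarith [hz.1], by linarith [hz.2, L.he2]⟩).2
        have e3 := hlow2 ξ h3 (by linarith)
        rw [add_sub_cancel, hzF, ← L.hdF] at e2
        have e4 : (z - L.a) ^ L.la ≤ L.g m ^ L.la :=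
          Real.rpow_le_rpow (by linarith [hz.1]) e1 (by linarith [L.hla])
        calc _ ≤ L.F ξ - L.F L.d := e3
          _ ≤ _ := e2
          _ ≤ _ := by gcongr
    have hε : 0 ≤ L.d - u 1 := by linarith [hud 1 le_rfl]
    have hgm : 0 ≤ L.g m ^ L.la := Real.rpow_nonneg (g_nonneg m) _
    have h5 : ξ - L.d ≤ c₂ / c * L.g m ^ L.la := by
      rw [div_mul_eq_mul_div, le_div_iff₀ hc]; linarith
    calc L.g (m + n) ^ L.la ≤ (B * r * (L.F^[n] y - L.F^[n] L.a)) / c₁ := by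
          rw [le_div_iff₀ hc₁]; linarith
      _ = B / c₁ * r * ((L.d - u 1) + (ξ - L.d)) := by rw [hu1, hξ]; ring
      _ ≤ B / c₁ * r * ((L.d - u 1) + c₂ / c * L.g m ^ L.la) := by gcongr
      _ = B / c₁ * (r * (L.d - u 1)) + B / c₁ * (c₂ / c) * (r * L.g m ^ L.la) := by ring
      _ ≤ B' * (r * (L.d - u 1)) + B' * (r * L.g m ^ L.la) := by
        gcongr
        · exact (le_max_left _ _).trans (le_max_right _ _)
        · exact (le_max_right _ _).trans (le_max_right _ _)
      _ = _ := by ring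

theorem sum_blocks_le {u : ℕ → ℝ} (hu : Antitone u) (n A : ℕ) :
    ∑ m ∈ Finset.Ico n ((A + 1) * n), u m ≤ n * ∑ j ∈ Finset.range A, u ((j + 1) * n) := by
  induction A with
  | zero => simp
  | succ A ih =>
    rw [← Finset.sum_Ico_consecutive u (n := (A + 1) * n) (by nlinarith) (by nlinarith),
      Finset.sum_range_succ, mul_add]
    refine add_le_add ih ?_
    refine (Finset.sum_le_card_nsmul _ _ (u ((A + 1) * n)) fun m hm => hu
      (Finset.mem_Ico.1 hm).1).trans ?_
    rw [Nat.card_Ico, show (A + 1 + 1) * n - (A + 1) * n = n by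
      rw [show (A + 1 + 1) * n = (A + 1) * n + n by ring]; omega, nsmul_eq_mul]

theorem pow_recursion {h : ℕ → ℝ} {β ε : ℝ} {A : ℕ} (hβ0 : 0 ≤ β) (hβ : β ≤ 1 / 2)
    (hA : 1 ≤ A) (hε : ε ≤ β ^ (A - 1)) (h1 : h 0 ≤ 1) (hrec : ∀ j, h (j + 1) ≤ β * (ε + h j))
    {j : ℕ} (hj : j ≤ A) : h j ≤ 3 * β ^ j := by
  have key : ∀ j ≤ A, h j ≤ (1 + 2 ^ (j + 1) / 2 ^ A) * β ^ j := by
    intro j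
    induction j with
    | zero => intro _; simp; exact h1.trans (by linarith [show (0 : ℝ) ≤ 2 / 2 ^ A by positivity])
    | succ j ih =>
      intro hj
      have h2 := ih (by omega)
      obtain ⟨i, rfl⟩ : ∃ i, A = j + 1 + i := ⟨A - (j + 1), by omega⟩
      have h3 : β * ε ≤ β ^ (j + 1) * (1 / 2) ^ i := by
        calc β * ε ≤ β * β ^ (j + 1 + i - 1) := by gcongr
          _ = β ^ (j + 1) * β ^ i := by
            rw [← pow_succ', ← pow_add]; congr 1; omega
          _ ≤ _ := by gcongr
      have h4 : (2 : ℝ) ^ (j + 1) / 2 ^ (j + 1 + i) = (1 / 2) ^ i := by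
        rw [pow_add (2 : ℝ) (j + 1), one_div, inv_pow]; field_simp
      have h5 : (2 : ℝ) ^ (j + 1 + 1) / 2 ^ (j + 1 + i) = 2 * (1 / 2) ^ i := by
        rw [pow_succ, mul_comm _ (2 : ℝ), mul_div_assoc, h4]
      rw [h4] at h2
      rw [h5]
      calc h (j + 1) ≤ β * ε + β * h j := by rw [← mul_add]; exact hrec j
        _ ≤ β ^ (j + 1) * (1 / 2) ^ i + β * ((1 + (1 / 2) ^ i) * β ^ j) := by gcongr
        _ = _ := by ring
  refine (key j hj).trans ?_
  gcongr
  have : (2 : ℝ) ^ (j + 1) / 2 ^ A ≤ 2 := by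
    rw [div_le_iff₀ (by positivity), pow_succ, mul_comm]
    gcongr; norm_num
  linarith

/-- The contribution of times comparable with an odd closest return. -/
theorem sum_first_le : ∃ K > 0, ∃ η > 0, ∀ (S : ConvScheme L.rm) (k : ℕ), L.R S k ≤ η →
    ∑ m ∈ Finset.Ico (S.q (2 * k + 1)) (S.q (2 * k + 1) + S.q (2 * k + 2)), L.g m ≤
      K * (S.q (2 * k + 1) * L.R S k) := by
  obtain ⟨B, hB, η, hη, hg⟩ := g_pow_le (L := L)
  have hla := L.hla
  have hla0 : 0 < L.la := by linarith
  set θ : ℝ := (1 / 2 : ℝ) ^ (1 / L.la) with hθ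
  have hθ0 : 0 < θ := by positivity
  have hθ1 : θ < 1 := Real.rpow_lt_one (by norm_num) (by norm_num) (by positivity)
  refine ⟨(2 + 6 * B) / (1 - θ), div_pos (by positivity) (by linarith),
    min η (min 1 (1 / (2 * B))), by positivity, fun S k hR => ?_⟩
  have hR0 := R_pos (L := L) S k
  obtain ⟨ε, hε0, hε, hrec⟩ := hg S k (hR.trans (min_le_left _ _))
  have hR1 : L.R S k ≤ 1 := hR.trans ((min_le_right _ _).trans (min_le_left _ _))
  have hβ : B * L.R S k ≤ 1 / 2 := by
    have := hR.trans ((min_le_right _ _).trans (min_le_right _ _))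
    rw [le_div_iff₀ (by positivity)] at this; linarith
  have hgR := g_le_R (L := L) S k
  have hqr : S.q (2 * k + 1) + S.q (2 * k + 2) ≤ (S.A (2 * k) + 1 + 1) * S.q (2 * k + 1) := by
    have h1 := S.q_rec (2 * k)
    have h2 := S.q_le_succ (2 * k)
    rw [h1]; nlinarith
  have hA := S.A_pos (2 * k)
  set n := S.q (2 * k + 1)
  set A := S.A (2 * k)
  set r := L.R S k
  have hh : ∀ j ≤ A, L.g ((j + 1) * n) ^ L.la ≤ 3 * (B * r) ^ j := fun j hj =>
    pow_recursion (h := fun j => L.g ((j + 1) * n) ^ L.la) (by positivity) hβ hA hε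
      (by
        simp only [zero_add, one_mul]
        exact Real.rpow_le_one (g_nonneg _) (hgR.trans hR1) hla0.le)
      (fun j => by
        have := hrec ((j + 1) * n)
        rwa [show (j + 1) * n + n = (j + 1 + 1) * n by ring] at this) hj
  have hgj : ∀ j ≤ A, L.g ((j + 1) * n) ≤ (2 + 6 * B) * r * θ ^ j := by
    intro j hj
    have hθj : θ ^ j = (1 / 2 : ℝ) ^ ((j : ℝ) / L.la) := by
      rw [hθ, ← Real.rpow_natCast, ← Real.rpow_mul (by norm_num)]; congr 1; ring
    rcases le_total ((j : ℝ) / L.la) 1 with hx | hx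
    · have h1 : (1 / 2 : ℝ) ≤ θ ^ j := by
        rw [hθj]
        calc (1 / 2 : ℝ) = (1 / 2 : ℝ) ^ (1 : ℝ) := by simp
          _ ≤ _ := Real.rpow_le_rpow_of_exponent_ge (by norm_num) (by norm_num) hx
      have h2 : L.g ((j + 1) * n) ≤ r := (g_anti (by nlinarith)).trans hgR
      have h3 : 0 ≤ B * r * θ ^ j := by positivity
      nlinarith
    · have h1 := hh j hj
      have h2 : L.g ((j + 1) * n) ≤ (3 * (B * r) ^ j) ^ (1 / L.la) := by
        calc L.g ((j + 1) * n) = (L.g ((j + 1) * n) ^ L.la) ^ (1 / L.la) := by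
              rw [← Real.rpow_mul (g_nonneg _), mul_one_div_cancel hla0.ne', Real.rpow_one]
          _ ≤ _ := Real.rpow_le_rpow (Real.rpow_nonneg (g_nonneg _) _) h1 (by positivity)
      have h3 : (3 * (B * r) ^ j) ^ (1 / L.la) = 3 ^ (1 / L.la) * (B * r) ^ ((j : ℝ) / L.la) := by
        rw [Real.mul_rpow (by norm_num) (by positivity), ← Real.rpow_natCast, ← Real.rpow_mul
          (by positivity)]; congr 2; ring
      have h4 : (3 : ℝ) ^ (1 / L.la) ≤ 3 := by
        calc (3 : ℝ) ^ (1 / L.la) ≤ 3 ^ (1 : ℝ) := Real.rpow_le_rpow_of_exponent_le (by norm_num)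
              (by rw [div_le_one hla0]; exact hla.le)
          _ = 3 := by simp
      have h5 : (B * r) ^ ((j : ℝ) / L.la) ≤ B * r * (2 * θ ^ j) := by
        have h6 : (2 : ℝ) * θ ^ j = (1 / 2 : ℝ) ^ ((j : ℝ) / L.la - 1) := by
          rw [hθj, Real.rpow_sub_one (by norm_num)]; ring
        rw [h6, show (j : ℝ) / L.la = 1 + ((j : ℝ) / L.la - 1) by ring,
          Real.rpow_add (by positivity), Real.rpow_one, add_sub_cancel_left]
        gcongr
      calc _ ≤ 3 * (B * r * (2 * θ ^ j)) := by
            rw [h3] at h2; exact h2.trans (by gcongr)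
        _ ≤ _ := by nlinarith [show 0 ≤ r * θ ^ j by positivity]
  calc ∑ m ∈ Finset.Ico n (n + S.q (2 * k + 2)), L.g m
      ≤ ∑ m ∈ Finset.Ico n ((A + 1 + 1) * n), L.g m :=
        Finset.sum_le_sum_of_subset_of_nonneg (Finset.Ico_subset_Ico le_rfl hqr)
          fun i _ _ => g_nonneg i
    _ ≤ n * ∑ j ∈ Finset.range (A + 1), L.g ((j + 1) * n) :=
        sum_blocks_le (fun _ _ h => g_anti h) n (A + 1)
    _ ≤ n * ∑ j ∈ Finset.range (A + 1), (2 + 6 * B) * r * θ ^ j := by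
        gcongr with j hj
        exact hgj j (by have := Finset.mem_range.1 hj; omega)
    _ ≤ n * ((2 + 6 * B) * r * (1 - θ)⁻¹) := by
        rw [← Finset.mul_sum]
        gcongr
        rw [← tsum_geometric_of_lt_one hθ0.le hθ1]
        exact (summable_geometric_of_lt_one hθ0.le hθ1).sum_le_tsum _ fun _ _ => by positivity
    _ = _ := by ring

/-- Summability of the survival lengths under the arithmetic condition. -/
theorem summable_g (hs : Summable fun k => (S.q (2 * k + 1) : ℝ) * L.R S k) : Summable L.g := by
  obtain ⟨K, hK, η, hη, hfirst⟩ := sum_first_le (L := L)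
  obtain ⟨lam, hlam, hdouble⟩ := g_add_le (L := L)
  have hR0 := R_pos (L := L) S
  have hlim := hs.tendsto_atTop_zero
  have he := L.he1
  obtain ⟨k₀, hk₀⟩ := eventually_atTop.1
    (hlim.eventually (gt_mem_nhds (show 0 < min η ((L.e - L.a) / 2) by
      apply lt_min hη; linarith)))
  have hRs : ∀ k ≥ k₀, L.R S k ≤ min η ((L.e - L.a) / 2) := fun k hk => by
    have h1 := hk₀ k hk
    have h2 : (1 : ℝ) ≤ S.q (2 * k + 1) := by exact_mod_cast S.one_le_q _
    nlinarith [hR0 k]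
  have hblock : ∀ k ≥ k₀, ∑ m ∈ Finset.Ico (S.q (2 * k + 1)) (S.q (2 * (k + 1) + 1)), L.g m ≤
      2 * K * (S.q (2 * k + 1) * L.R S k) +
        4 * lam * (S.q (2 * (k + 1) + 1) * L.R S (k + 1)) := by
    intro k hk
    have h1 := hfirst S k ((hRs k hk).trans (min_le_left _ _))
    have hgR := (g_le_R (L := L) S k).trans ((hRs k hk).trans (min_le_right _ _))
    rw [show 2 * (k + 1) + 1 = 2 * k + 3 by ring]
    have h2 := S.q_add_le (2 * k + 1)
    rw [show 2 * k + 1 + 1 = 2 * k + 2 by ring, show 2 * k + 1 + 2 = 2 * k + 3 by ring] at h2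
    have h3 := hdouble S k
    set n := S.q (2 * k + 1)
    set q := S.q (2 * k + 2)
    set N := S.q (2 * k + 3)
    set r := L.R S (k + 1) with hr
    have hr0 : 0 < r := hR0 _
    have h4 : ∑ m ∈ Finset.Ico (n + q) N, L.g m ≤
        ∑ m ∈ Finset.Ico n N, (2 * lam * r + L.g m / 2) := by
      obtain ⟨N', hN'⟩ : ∃ N', N = N' + q := ⟨N - q, by omega⟩
      have h5 : ∑ m ∈ Finset.Ico (n + q) N, L.g m = ∑ m ∈ Finset.Ico n N', L.g (m + q) := by
        rw [hN', Finset.sum_Ico_add']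
      rw [h5]
      calc ∑ m ∈ Finset.Ico n N', L.g (m + q)
          ≤ ∑ m ∈ Finset.Ico n N', (2 * lam * r + L.g m / 2) := by
            refine Finset.sum_le_sum fun m hm => ?_
            rw [Finset.mem_Ico] at hm
            refine (h3 m hm.1 (by omega) ((g_anti hm.1).trans hgR)).trans (max_le ?_ ?_)
            · linarith [g_nonneg (L := L) m]
            · have : 0 ≤ lam * r := by positivity
              linarith
        _ ≤ _ := Finset.sum_le_sum_of_subset_of_nonneg
            (Finset.Ico_subset_Ico le_rfl (by omega)) fun m _ _ => by
              have := g_nonneg (L := L) m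
              positivity
    rw [Finset.sum_add_distrib, ← Finset.sum_div, Finset.sum_const, Nat.card_Ico, nsmul_eq_mul] at h4
    have h6 := Finset.sum_Ico_consecutive L.g (show n ≤ n + q by omega) (show n + q ≤ N by omega)
    have h7 : ((N - n : ℕ) : ℝ) * (2 * lam * r) ≤ 2 * lam * (N * r) := by
      have : ((N - n : ℕ) : ℝ) ≤ N := by exact_mod_cast Nat.sub_le _ _
      have : 0 ≤ lam * r := by positivity
      nlinarith
    linarith
  -- summation over blocks
  have hn : StrictMono fun k => S.q (2 * k + 1) := strictMono_nat_of_lt_succ fun k => by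
    have h2 := S.q_add_le (2 * k + 1)
    have := S.one_le_q (2 * k + 1 + 1)
    rw [show 2 * (k + 1) + 1 = 2 * k + 1 + 2 by ring]; omega
  set T := ∑' k, (S.q (2 * k + 1) : ℝ) * L.R S k with hT
  have hpos : ∀ k, 0 ≤ (S.q (2 * k + 1) : ℝ) * L.R S k := fun k =>
    mul_nonneg (Nat.cast_nonneg _) (hR0 k).le
  have hind : ∀ j, ∑ m ∈ Finset.range (S.q (2 * (k₀ + j) + 1)), L.g m ≤
      ∑ m ∈ Finset.range (S.q (2 * k₀ + 1)), L.g m +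
      ∑ i ∈ Finset.range j, (2 * K * (S.q (2 * (k₀ + i) + 1) * L.R S (k₀ + i)) +
        4 * lam * (S.q (2 * (k₀ + i + 1) + 1) * L.R S (k₀ + i + 1))) := by
    intro j
    induction j with
    | zero => simp
    | succ j ih =>
      rw [Finset.sum_range_succ _ j, ← add_assoc]
      have h1 := hblock (k₀ + j) (by omega)
      have h2 : S.q (2 * (k₀ + j) + 1) ≤ S.q (2 * (k₀ + j + 1) + 1) :=
        hn.monotone (show k₀ + j ≤ k₀ + j + 1 by omega)
      rw [← Finset.sum_range_add_sum_Ico L.g h2]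
      linarith
  have hsh : ∀ c j, ∑ i ∈ Finset.range j, (S.q (2 * (c + i) + 1) : ℝ) * L.R S (c + i) ≤ T := by
    intro c j
    have h1 : (fun i => (S.q (2 * (c + i) + 1) : ℝ) * L.R S (c + i)) =
        (fun k => (S.q (2 * k + 1) : ℝ) * L.R S k) ∘ (c + ·) := rfl
    have h2 : Summable fun i => (S.q (2 * (c + i) + 1) : ℝ) * L.R S (c + i) :=
      hs.comp_injective (add_right_injective c)
    refine (h2.sum_le_tsum _ fun i _ => hpos _).trans ?_
    exact h2.tsum_le_tsum_of_inj (c + ·) (add_right_injective c) (fun k _ => hpos k)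
      (fun i => le_rfl) hs
  refine summable_of_sum_range_le (c := ∑ m ∈ Finset.range (S.q (2 * k₀ + 1)), L.g m +
    (2 * K * T + 4 * lam * T)) (fun m => g_nonneg m) fun M => ?_
  calc ∑ m ∈ Finset.range M, L.g m ≤ ∑ m ∈ Finset.range (S.q (2 * (k₀ + M) + 1)), L.g m :=
        Finset.sum_le_sum_of_subset_of_nonneg (Finset.range_subset_range.2
          ((Nat.le_add_left M k₀).trans (hn.id_le (k₀ + M)))) fun m _ _ => g_nonneg m
    _ ≤ _ := (hind M).trans (by
        rw [Finset.sum_add_distrib, ← Finset.mul_sum, ← Finset.mul_sum]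
        have h1 := hsh k₀ M
        have h2 := hsh (k₀ + 1) M
        simp only [show ∀ i, k₀ + 1 + i = k₀ + i + 1 from fun i => by ring] at h2
        gcongr)

end Lorenz

namespace Lorenz
variable {L : Lorenz}

/-- No monotone branch of an iterate maps a nondegenerate interval into itself. -/
theorem Ch.no_selfmap {p : ℕ} {s t : ℝ} (h : L.Ch p s t) (hp : 1 ≤ p) (hst : s < t) (k : ℤ)
    (h1 : s + k ≤ L.F^[p] s) (h2 : L.F^[p] t ≤ t + k) : False := by
  set φ : ℝ → ℝ := fun x => L.F^[p] x - x - k with hφ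
  have hφc : Continuous φ := ((L.cont_iter p).sub continuous_id).sub continuous_const
  have hφd : ∀ x, HasDerivAt φ (deriv (L.F^[p]) x - 1) x := fun x =>
    (((L.diff_iter p) x).hasDerivAt.sub (hasDerivAt_id x)).sub_const _
  have hd0 : ∀ x ∈ Icc s t, 0 ≤ deriv (L.F^[p]) x := by
    intro x hx
    have h3 : MonotoneOn (L.F^[p]) (Icc s t) := fun u hu v hv huv => h.le le_rfl hu.1 huv hv.2
    have h4 : derivWithin (L.F^[p]) (Icc s t) x = deriv (L.F^[p]) x :=
      ((L.diff_iter p) x).derivWithin ((uniqueDiffOn_Icc hst) x hx)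
    rw [← h4]
    exact h3.derivWithin_nonneg
  have hfix : ∀ x ∈ Icc s t, φ x = 0 → 1 < deriv (L.F^[p]) x := by
    intro x hx hx0
    have h3 := L.repel x p k hp (by simp only [hφ] at hx0; linarith)
    rwa [abs_of_nonneg (hd0 x hx)] at h3
  obtain ⟨s', hs', hs'p⟩ : ∃ s' ∈ Ico s t, 0 < φ s' := by
    have h3 : 0 ≤ φ s := by simp only [hφ]; linarith
    rcases eq_or_lt_of_le h3 with h4 | h4
    · have h5 := hfix s ⟨le_rfl, hst.le⟩ h4.symm
      have h6 := hasDerivWithinAt_iff_tendsto_slope.1 ((hφd s).hasDerivWithinAt (s := Ioi s))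
      have h7 := (h6.eventually (lt_mem_nhds (show (0 : ℝ) < _ by linarith)))
      rw [sdiff_singleton_eq_self (by simp)] at h7
      obtain ⟨u, hu, hu2⟩ := (h7.and (Ioo_mem_nhdsGT hst)).exists
      refine ⟨u, ⟨hu2.1.le, hu2.2⟩, ?_⟩
      rw [slope_def_field, ← h4, sub_zero] at hu
      exact (div_pos_iff_of_pos_right (by linarith [hu2.1])).1 hu
    · exact ⟨s, ⟨le_rfl, hst⟩, h4⟩
  set B := {x | x ∈ Icc s' t ∧ φ x ≤ 0} with hB
  have hBne : B.Nonempty := ⟨t, ⟨hs'.2.le, le_rfl⟩, by simp only [hφ]; linarith⟩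
  have hBc : IsClosed B := isClosed_Icc.inter (isClosed_le hφc continuous_const)
  have hBb : BddBelow B := ⟨s', fun x hx => hx.1.1⟩
  have hz := hBc.csInf_mem hBne hBb
  set z := sInf B with hzdef
  have hlt : ∀ x, s' ≤ x → x < z → 0 < φ x := by
    intro x hx hxz
    by_contra hc
    exact absurd (csInf_le hBb ⟨⟨hx, hxz.le.trans hz.1.2⟩, not_lt.1 hc⟩) (not_le.2 hxz)
  have hsz : s' < z := lt_of_le_of_ne hz.1.1 fun he => by
    have := hz.2; rw [← he] at this; linarith
  have hz0 : φ z = 0 := by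
    refine le_antisymm hz.2 ?_
    refine ge_of_tendsto ((hφc.tendsto z).mono_left (nhdsWithin_le_nhds (s := Iio z))) ?_
    filter_upwards [Ioo_mem_nhdsLT hsz] with x hx
    exact (hlt x hx.1.le hx.2).le
  have h5 := hfix z ⟨hs'.1.trans hsz.le, hz.1.2⟩ hz0
  have h6 := hasDerivWithinAt_iff_tendsto_slope.1 ((hφd z).hasDerivWithinAt (s := Iio z))
  rw [sdiff_singleton_eq_self (by simp)] at h6
  have h7 : deriv (L.F^[p]) z - 1 ≤ 0 := by
    refine le_of_tendsto h6 ?_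
    filter_upwards [Ioo_mem_nhdsLT hsz] with x hx
    rw [slope_def_field, hz0, sub_zero]
    exact div_nonpos_of_nonneg_of_nonpos (hlt x hx.1.le hx.2).le (by linarith [hx.2])
  linarith

/-- The lift of the arc `[α, β]`. -/
def arc (α β : ℝ) : Set ℝ := {u | ∃ m : ℤ, α + m ≤ u ∧ u ≤ β + m}

theorem arc_eq (α β : ℝ) : arc α β =
    (fun u : ℝ => (u : UnitAddCircle)) ⁻¹' ((fun u : ℝ => (u : UnitAddCircle)) '' Icc α β) := by
  ext u
  have key : ∀ v : ℝ, (v : UnitAddCircle) = (u : UnitAddCircle) ↔ ∃ m : ℤ, u = v + m := by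
    intro v
    rw [eq_comm, ← sub_eq_zero, ← AddCircle.coe_sub, AddCircle.coe_eq_zero_iff]
    simp only [zsmul_eq_mul, mul_one]
    exact exists_congr fun m => ⟨fun h => by linarith, fun h => by linarith⟩
  constructor
  · rintro ⟨m, h1, h2⟩
    exact ⟨u - m, ⟨by linarith, by linarith⟩, (key _).2 ⟨m, by ring⟩⟩
  · rintro ⟨v, hv, h⟩
    obtain ⟨m, hm⟩ := (key v).1 h
    exact ⟨m, by linarith [hv.1], by linarith [hv.2]⟩

theorem isClosed_arc (α β : ℝ) : IsClosed (arc α β) := by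
  rw [arc_eq]
  have hc : Continuous (fun u : ℝ => (u : UnitAddCircle)) := AddCircle.continuous_mk' 1
  exact (isCompact_Icc.image hc).isClosed.preimage hc

theorem arc_int {α β u : ℝ} (m : ℤ) : u + m ∈ arc α β ↔ u ∈ arc α β := by
  constructor
  · rintro ⟨k, h1, h2⟩; exact ⟨k - m, by push_cast; linarith, by push_cast; linarith⟩
  · rintro ⟨k, h1, h2⟩; exact ⟨k + m, by push_cast; linarith, by push_cast; linarith⟩

theorem arc_mono {α β α' β' : ℝ} (h1 : α' ≤ α) (h2 : β ≤ β') : arc α β ⊆ arc α' β' := by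
  rintro u ⟨m, h3, h4⟩; exact ⟨m, by linarith, by linarith⟩

theorem exists_int_of_Icc_subset_arc {α β s t : ℝ} (hβ : β < α + 1) (hst : s ≤ t)
    (h : Icc s t ⊆ arc α β) : ∃ m : ℤ, α + m ≤ s ∧ t ≤ β + m := by
  obtain ⟨m, h1, h2⟩ := h ⟨le_rfl, hst⟩
  refine ⟨m, h1, ?_⟩
  by_contra hc
  push Not at hc
  set u := min t ((β + m + (α + m + 1)) / 2) with hu
  have hu1 : β + m < u := lt_min hc (by linarith)
  have hu2 : u < α + m + 1 := (min_le_right _ _).trans_lt (by linarith)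
  obtain ⟨k, h3, h4⟩ := h ⟨h2.trans hu1.le, min_le_left t _⟩
  have e1 : (m : ℝ) < k := by linarith
  have e2 : (k : ℝ) < m + 1 := by linarith
  have e1 : m < k := by exact_mod_cast e1
  have e2 : k < m + 1 := by exact_mod_cast e2
  omega

variable (L) in
/-- Points whose orbit stays in the lift of `[α, β]` before time `n`. -/
def Kset (α β : ℝ) (n : ℕ) : Set ℝ := {x | ∀ l < n, L.F^[l] x ∈ arc α β}

theorem isClosed_Kset (α β : ℝ) (n : ℕ) : IsClosed (L.Kset α β n) := by
  have : L.Kset α β n = ⋂ l ∈ Finset.range n, (L.F^[l]) ⁻¹' arc α β := by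
    ext; simp [Kset]
  rw [this]
  exact isClosed_biInter fun l _ => (isClosed_arc α β).preimage (L.cont_iter l)

theorem Kset_anti (α β : ℝ) {m n : ℕ} (h : m ≤ n) : L.Kset α β n ⊆ L.Kset α β m :=
  fun _ hx l hl => hx l (by omega)

theorem Kset_mono {α β α' β' : ℝ} (h1 : α' ≤ α) (h2 : β ≤ β') (n : ℕ) :
    L.Kset α β n ⊆ L.Kset α' β' n := fun _ hx l hl => arc_mono h1 h2 (hx l hl)

theorem Kset_int {α β x : ℝ} {n : ℕ} (m : ℤ) : x + m ∈ L.Kset α β n ↔ x ∈ L.Kset α β n := by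
  simp only [Kset, mem_ofPred_eq, iter_int, arc_int]

theorem Kset_iter {α β x : ℝ} {n k : ℕ} (h : x ∈ L.Kset α β (n + k)) :
    L.F^[k] x ∈ L.Kset α β n := by
  intro l hl
  rw [← Function.iterate_add_apply]; exact h _ (by omega)

theorem Kset_add {α β x : ℝ} {n k : ℕ} (h : x ∈ L.Kset α β k) (h' : L.F^[k] x ∈ L.Kset α β n) :
    x ∈ L.Kset α β (n + k) := by
  intro l hl
  rcases lt_or_ge l k with h1 | h1
  · exact h l h1
  · have := h' (l - k) (by omega)
    rwa [← Function.iterate_add_apply, Nat.sub_add_cancel h1] at this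

theorem Ch_of_Icc_subset_Kset {α β s t : ℝ} {n : ℕ} (hα : L.a ≤ α) (hβ : β ≤ L.b) (hst : s ≤ t)
    (h : Icc s t ⊆ L.Kset α β n) : L.Ch n s t := by
  induction n with
  | zero => exact Ch_zero hst
  | succ n ih =>
    have h1 := ih fun x hx => Kset_anti _ _ (by omega) (h hx)
    refine ⟨hst, fun l hl => ?_⟩
    have h2 : Icc (L.F^[l] s) (L.F^[l] t) ⊆ arc α β := by
      intro u hu
      obtain ⟨z, hz, rfl⟩ := h1.ivt hu.1 hu.2
      exact h hz l hl
    obtain ⟨m, h3, h4⟩ := exists_int_of_Icc_subset_arc (by linarith [L.hba])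
      (h1.le (by omega) le_rfl hst le_rfl) h2
    exact ⟨m, by linarith, by linarith⟩

theorem Ch.Icc_subset_Kset {α β s t : ℝ} {n : ℕ} (h : L.Ch n s t)
    (h' : ∀ l < n, ∃ m : ℤ, α + m ≤ L.F^[l] s ∧ L.F^[l] t ≤ β + m) :
    Icc s t ⊆ L.Kset α β n := by
  intro x hx l hl
  obtain ⟨m, h1, h2⟩ := h' l hl
  exact ⟨m, h1.trans (h.le hl.le le_rfl hx.1 hx.2), (h.le hl.le hx.1 hx.2 le_rfl).trans h2⟩

theorem deriv_iter_add (n k : ℕ) (x : ℝ) :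
    deriv (L.F^[n + k]) x = deriv (L.F^[n]) (L.F^[k] x) * deriv (L.F^[k]) x := by
  rw [Function.iterate_add]
  exact deriv_comp x ((L.diff_iter n) _) ((L.diff_iter k) x)

theorem cont_deriv_iter (n : ℕ) : Continuous (deriv (L.F^[n])) := by
  have : ContDiff ℝ 1 (L.F^[n]) := by
    induction n with
    | zero => exact contDiff_id
    | succ n ih => rw [Function.iterate_succ]; exact ih.comp L.hC1
  exact this.continuous_deriv (by norm_num)

theorem deriv_iter_int (n : ℕ) (x : ℝ) (m : ℤ) :
    deriv (L.F^[n]) (x + m) = deriv (L.F^[n]) x := by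
  have h1 : (fun y => L.F^[n] (y + m)) = fun y => L.F^[n] y + m := funext fun y => iter_int _ _ _ _
  rw [← deriv_comp_add_const, h1, deriv_add_const]

theorem deriv_pos_of_mem_arc {α β x : ℝ} (hα : L.a < α) (hβ : β < L.b) (h : x ∈ arc α β) :
    0 < deriv L.F x := by
  obtain ⟨m, h1, h2⟩ := h
  have h3 := L.dpos (x - m) ⟨by linarith, by linarith⟩
  have h4 := deriv_int (L := L) (x - m) m
  rw [sub_add_cancel] at h4
  rwa [h4]

theorem deriv_iter_pos {α β x : ℝ} {n : ℕ} (hα : L.a < α) (hβ : β < L.b)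
    (h : x ∈ L.Kset α β n) : 0 < deriv (L.F^[n]) x := by
  induction n with
  | zero => simp
  | succ n ih =>
    rw [Nat.add_comm, deriv_iter_add, Function.iterate_one]
    exact mul_pos (deriv_pos_of_mem_arc hα hβ (h n (by omega)))
      (ih (Kset_anti _ _ (by omega) h))

/-- Distortion along orbits staying away from the critical points. -/
theorem exists_distortion {α β : ℝ} (hα : L.a < α) (hβ : β < L.b) : ∃ Λ > 0, ∀ n s t,
    Icc s t ⊆ L.Kset α β n → ∀ u ∈ Icc s t, ∀ v ∈ Icc s t, deriv (L.F^[n]) u ≤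
      Real.exp (Λ * ∑ l ∈ Finset.range n, (L.F^[l] t - L.F^[l] s)) * deriv (L.F^[n]) v := by
  obtain ⟨Λ, hΛ0, hΛ⟩ := L.distort (min (α - L.a) (L.b - β)) (lt_min (by linarith) (by linarith))
  refine ⟨Λ + 1, by linarith, fun n s t h u hu v hv => ?_⟩
  have hst : s ≤ t := hu.1.trans hu.2
  induction n with
  | zero => simp
  | succ n ih =>
    have hch := Ch_of_Icc_subset_Kset hα.le hβ.le hst h
    have h' : Icc s t ⊆ L.Kset α β n := fun x hx => Kset_anti _ _ (by omega) (h hx)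
    have h1 := ih h'
    obtain ⟨m, h2, h3⟩ := exists_int_of_Icc_subset_arc (α := α) (β := β) (by linarith [L.hba])
      (hch.le (l := n) (by omega) le_rfl hst le_rfl) (by
        intro w hw
        obtain ⟨z, hz, rfl⟩ := hch.ivt hw.1 hw.2
        exact h hz n (by omega))
    have hloc : ∀ w ∈ Icc s t, L.F^[n] s ≤ L.F^[n] w ∧ L.F^[n] w ≤ L.F^[n] t := fun w hw =>
      ⟨hch.le (by omega) le_rfl hw.1 hw.2, hch.le (by omega) hw.1 hw.2 le_rfl⟩
    have hmem : ∀ w ∈ Icc s t, L.F^[n] w - m ∈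
        Icc (L.a + min (α - L.a) (L.b - β)) (L.b - min (α - L.a) (L.b - β)) := fun w hw => by
      have := hloc w hw
      exact ⟨by linarith [min_le_left (α - L.a) (L.b - β)],
        by linarith [min_le_right (α - L.a) (L.b - β)]⟩
    have h4 := hΛ _ (hmem u hu) _ (hmem v hv)
    have hdi : ∀ w, deriv L.F (w - m) = deriv L.F w := fun w => by
      have := deriv_int (L := L) (w - m) m
      rw [sub_add_cancel] at this; exact this.symm
    rw [hdi, hdi] at h4
    have h5 : |L.F^[n] u - m - (L.F^[n] v - m)| ≤ L.F^[n] t - L.F^[n] s := by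
      have := hloc u hu
      have := hloc v hv
      rw [abs_le]; constructor <;> linarith
    have hpv := deriv_pos_of_mem_arc hα hβ (h hv n (by omega))
    have hpv' := deriv_iter_pos hα hβ (h' hv)
    have hpu' := deriv_iter_pos hα hβ (h' hu)
    have h6 : deriv L.F (L.F^[n] u) ≤
        Real.exp ((Λ + 1) * (L.F^[n] t - L.F^[n] s)) * deriv L.F (L.F^[n] v) := by
      refine h4.trans ?_
      gcongr
      linarith
    rw [Nat.add_comm n, deriv_iter_add, deriv_iter_add, Function.iterate_one, Nat.add_comm 1 n,
      Finset.sum_range_succ, mul_add, Real.exp_add]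
    calc _ ≤ (Real.exp ((Λ + 1) * (L.F^[n] t - L.F^[n] s)) * deriv L.F (L.F^[n] v)) *
          (Real.exp ((Λ + 1) * ∑ l ∈ Finset.range n, (L.F^[l] t - L.F^[l] s)) *
            deriv (L.F^[n]) v) := by
            apply mul_le_mul h6 h1 hpu'.le
            positivity
      _ = _ := by ring

theorem length_distortion {Λ : ℝ} {n : ℕ} {s t : ℝ}
    (hΛ : ∀ u ∈ Icc s t, ∀ v ∈ Icc s t, deriv (L.F^[n]) u ≤ Λ * deriv (L.F^[n]) v)
    {p q : ℝ} (hsp : s ≤ p) (hpq : p < q) (hqt : q ≤ t) :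
    (L.F^[n] t - L.F^[n] s) * (q - p) ≤ Λ * (L.F^[n] q - L.F^[n] p) * (t - s) := by
  obtain ⟨u, hu, hu'⟩ := exists_deriv_eq_slope (L.F^[n]) (show s < t by linarith)
    (L.cont_iter n).continuousOn (L.diff_iter n).differentiableOn
  obtain ⟨v, hv, hv'⟩ := exists_deriv_eq_slope (L.F^[n]) hpq
    (L.cont_iter n).continuousOn (L.diff_iter n).differentiableOn
  rw [eq_div_iff (by linarith)] at hu' hv'
  rw [← hu', ← hv']
  have h1 := hΛ u ⟨hu.1.le, hu.2.le⟩ v ⟨by linarith [hv.1], by linarith [hv.2]⟩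
  have h2 : 0 ≤ (t - s) * (q - p) := mul_nonneg (by linarith) (by linarith)
  nlinarith

variable (L) in
/-- Points whose whole orbit stays in the closed increasing arc. -/
def Kinf : Set ℝ := ⋂ n, L.Kset L.a L.b n

theorem Kinf_int {x : ℝ} (m : ℤ) : x + m ∈ L.Kinf ↔ x ∈ L.Kinf := by
  simp only [Kinf, mem_iInter, Kset_int]

theorem Ch_of_Icc_subset_Kinf {s t : ℝ} (hst : s ≤ t) (h : Icc s t ⊆ L.Kinf) (n : ℕ) :
    L.Ch n s t :=
  Ch_of_Icc_subset_Kset le_rfl le_rfl hst fun _ hx => mem_iInter.1 (h hx) n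

theorem Icc_iter_subset_Kinf {s t : ℝ} (hst : s ≤ t) (h : Icc s t ⊆ L.Kinf) (n : ℕ) :
    Icc (L.F^[n] s) (L.F^[n] t) ⊆ L.Kinf := by
  intro u hu
  obtain ⟨z, hz, rfl⟩ := (Ch_of_Icc_subset_Kinf hst h n).ivt hu.1 hu.2
  exact mem_iInter.2 fun k => Kset_iter (mem_iInter.1 (h hz) (k + n))

theorem sub_lt_one_of_Icc_subset_Kinf {s t : ℝ} (hst : s ≤ t) (h : Icc s t ⊆ L.Kinf) :
    t < s + 1 := by
  obtain ⟨m, h1, h2⟩ := (Ch_of_Icc_subset_Kinf hst h 1).2 0 one_pos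
  simp only [Function.iterate_zero, id] at h1 h2
  linarith [L.hba]

/-- Maximal intervals in `Kinf`. -/
theorem exists_maximal {x : ℝ} (hx : x ∈ L.Kinf) : ∃ c d, c ≤ x ∧ x ≤ d ∧ Icc c d ⊆ L.Kinf ∧
    ∀ u v, Icc u v ⊆ L.Kinf → ∀ z ∈ Icc u v, z ∈ Icc c d → c ≤ u ∧ v ≤ d := by
  have hcl : IsClosed L.Kinf := isClosed_iInter fun n => isClosed_Kset _ _ n
  set A := {u | u ≤ x ∧ Icc u x ⊆ L.Kinf}
  set B := {v | x ≤ v ∧ Icc x v ⊆ L.Kinf}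
  have hself : Icc x x ⊆ L.Kinf := by simpa using hx
  have hA : BddBelow A := ⟨x - 1, fun u hu => by
    linarith [sub_lt_one_of_Icc_subset_Kinf hu.1 hu.2]⟩
  have hB : BddAbove B := ⟨x + 1, fun u hu => by
    linarith [sub_lt_one_of_Icc_subset_Kinf hu.1 hu.2]⟩
  have hAx : x ∈ A := ⟨le_rfl, hself⟩
  have hBx : x ∈ B := ⟨le_rfl, hself⟩
  have hcx : sInf A ≤ x := csInf_le hA hAx
  have hxd : x ≤ sSup B := le_csSup hB hBx
  have hAe : Icc (sInf A) x ⊆ L.Kinf := by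
    rcases eq_or_lt_of_le hcx with h | h
    · rw [h]; exact hself
    · rw [← closure_Ioc h.ne]
      refine hcl.closure_subset_iff.2 fun z hz => ?_
      obtain ⟨u, hu, hu'⟩ := exists_lt_of_csInf_lt ⟨x, hAx⟩ hz.1
      exact hu.2 ⟨hu'.le, hz.2⟩
  have hBe : Icc x (sSup B) ⊆ L.Kinf := by
    rcases eq_or_lt_of_le hxd with h | h
    · rw [← h]; exact hself
    · rw [← closure_Ico h.ne]
      refine hcl.closure_subset_iff.2 fun z hz => ?_
      obtain ⟨u, hu, hu'⟩ := exists_lt_of_lt_csSup ⟨x, hBx⟩ hz.2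
      exact hu.2 ⟨hz.1, hu'.le⟩
  have hI : Icc (sInf A) (sSup B) ⊆ L.Kinf := fun z hz => by
    rcases le_total z x with h | h
    · exact hAe ⟨hz.1, h⟩
    · exact hBe ⟨h, hz.2⟩
  refine ⟨sInf A, sSup B, hcx, hxd, hI, fun u v huv z hz hz' => ?_⟩
  have hun : ∀ w, min u x ≤ w → w ≤ max v x → w ∈ L.Kinf := by
    intro w h1 h2
    by_cases h3 : w ∈ Icc u v
    · exact huv h3
    · by_cases h4 : w ∈ Icc (sInf A) (sSup B)
      · exact hI h4
      · exfalso
        simp only [mem_Icc, not_and_or, not_le] at h3 h4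
        rcases min_le_iff.1 h1 with h1 | h1 <;> rcases le_max_iff.1 h2 with h2 | h2 <;>
        rcases h3 with h3 | h3 <;> rcases h4 with h4 | h4 <;>
        linarith [hz.1, hz.2, hz'.1, hz'.2]
  constructor
  · rcases le_total x u with h | h
    · exact hcx.trans h
    · exact csInf_le hA ⟨h, fun w hw => hun w (by simp [h, hw.1]) (by simp [hw.2])⟩
  · rcases le_total v x with h | h
    · exact h.trans hxd
    · exact le_csSup hB ⟨h, fun w hw => hun w (by simp [hw.1]) (by simp [h, hw.2])⟩

/-- No interval keeps all its iterates away from the critical points. -/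
theorem no_interval {α β s t : ℝ} (hα : L.a < α) (hβ : β < L.b) (hst : s < t)
    (h : ∀ n, Icc s t ⊆ L.Kset α β n) : False := by
  have hK : Icc s t ⊆ L.Kinf := fun x hx => mem_iInter.2 fun n => Kset_mono hα.le hβ.le n (h n hx)
  have hz : ∀ l, L.F^[l] s ∈ L.Kinf := fun l => Icc_iter_subset_Kinf hst.le hK l
    ⟨le_rfl, (Ch_of_Icc_subset_Kinf hst.le hK l).le le_rfl le_rfl hst.le le_rfl⟩
  choose c d hc hd hcd hmax using fun l => exists_maximal (hz l)
  have hle : ∀ l, c l ≤ d l := fun l => (hc l).trans (hd l)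
  have hmap : ∀ l p, c (p + l) ≤ L.F^[p] (c l) ∧ L.F^[p] (d l) ≤ d (p + l) := by
    intro l p
    have hch := Ch_of_Icc_subset_Kinf (hle l) (hcd l) p
    refine hmax _ _ _ (Icc_iter_subset_Kinf (hle l) (hcd l) p) (L.F^[p + l] s) ?_ ⟨hc _, hd _⟩
    rw [Function.iterate_add_apply]
    exact ⟨hch.le le_rfl le_rfl (hc l) (hd l), hch.le le_rfl (hc l) (hd l) le_rfl⟩
  have hpos : ∀ l, c l < d l := fun l => by
    have h1 := hmax l _ _ (Icc_iter_subset_Kinf hst.le hK l) (L.F^[l] s)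
      ⟨le_rfl, (Ch_of_Icc_subset_Kinf hst.le hK l).le le_rfl le_rfl hst.le le_rfl⟩ ⟨hc l, hd l⟩
    have h2 := (Ch_of_Icc_subset_Kinf hst.le hK l).lt le_rfl le_rfl hst le_rfl
    linarith
  have hdisj : ∀ l l', l < l' → ∀ (m : ℤ) (x : ℝ), x ∈ Icc (c l) (d l) →
      x + m ∉ Icc (c l') (d l') := by
    intro l l' hll m x hx hx'
    have h1 : Icc (c l + m) (d l + m) ⊆ L.Kinf := fun y hy => by
      rw [← sub_add_cancel y (m : ℝ), Kinf_int]
      exact hcd l ⟨by linarith [hy.1], by linarith [hy.2]⟩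
    have h2 : Icc (c l' - m) (d l' - m) ⊆ L.Kinf := fun y hy => by
      rw [← Kinf_int m]
      exact hcd l' ⟨by linarith [hy.1], by linarith [hy.2]⟩
    have h3 := hmax l' _ _ h1 (x + m) ⟨by linarith [hx.1], by linarith [hx.2]⟩ hx'
    have h4 := hmax l _ _ h2 x ⟨by linarith [hx'.1], by linarith [hx'.2]⟩ hx
    have h5 := hmap l (l' - l)
    rw [Nat.sub_add_cancel hll.le] at h5
    exact (Ch_of_Icc_subset_Kinf (hle l) (hcd l) (l' - l)).no_selfmap (by omega) (hpos l) m
      (by linarith) (by linarith)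
  have hsum : Summable fun l => d l - c l := by
    refine summable_of_sum_range_le (c := 1) (fun l => by linarith [hle l]) fun n => ?_
    refine sum_length_le_one _ _ _ (fun i _ => hle i) (fun i _ =>
      (sub_lt_one_of_Icc_subset_Kinf (hle i) (hcd i)).le) ?_
    intro i _ j _ hij m x hx hx'
    rcases lt_or_gt_of_ne hij with h1 | h1
    · exact hdisj i j h1 m x ⟨hx.1.le, hx.2.le⟩ ⟨hx'.1.le, hx'.2.le⟩
    · refine hdisj j i h1 (-m) (x + m) ⟨hx'.1.le, hx'.2.le⟩ ?_
      rw [Int.cast_neg, add_neg_cancel_right]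
      exact ⟨hx.1.le, hx.2.le⟩
  set η := min (α - L.a) (L.b - β) / 2 with hη
  have hη0 : 0 < η := half_pos (lt_min (by linarith) (by linarith))
  have hα' : L.a < α - η := by
    have := min_le_left (α - L.a) (L.b - β)
    linarith
  have hβ' : β + η < L.b := by
    have := min_le_right (α - L.a) (L.b - β)
    linarith
  obtain ⟨Λ, hΛ0, hΛ⟩ := exists_distortion (L := L) hα' hβ'
  have htail := hsum.tendsto_sum_tsum_nat
  set ε := min (η / 9) (1 / (9 * Λ)) with hε
  have hε0 : 0 < ε := lt_min (by linarith) (by positivity)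
  obtain ⟨N, hN⟩ := (htail.eventually (lt_mem_nhds (sub_lt_self _ hε0))).exists
  have hNs : ∀ n, ∑ l ∈ Finset.range n, (d (N + l) - c (N + l)) ≤ ε := by
    intro n
    have h1 := hsum.sum_le_tsum (Finset.range (N + n)) (fun l _ => by linarith [hle l])
    rw [Finset.sum_range_add] at h1
    linarith
  have hNl : ∀ l, d (N + l) - c (N + l) ≤ ε := fun l => by
    refine le_trans ?_ (hNs (l + 1))
    exact Finset.single_le_sum (f := fun l => d (N + l) - c (N + l))
      (fun i _ => by linarith [hle (N + i)]) (Finset.self_mem_range_succ l)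
  set k := d N - c N with hk
  have hk0 : 0 < k := by linarith [hpos N]
  have key : ∀ n, Icc (c N - k) (d N + k) ⊆ L.Kset (α - η) (β + η) n ∧
      ∀ l < n, L.F^[l] (d N + k) - L.F^[l] (c N - k) ≤ 9 * (d (N + l) - c (N + l)) := by
    intro n
    induction n with
    | zero => exact ⟨fun x _ l hl => absurd hl (Nat.not_lt_zero _), by simp⟩
    | succ n ih =>
      obtain ⟨h1, h2⟩ := ih
      have hch := Ch_of_Icc_subset_Kset hα'.le hβ'.le (by linarith) h1
      have h3 := length_distortion (hΛ n _ _ h1) (p := c N) (q := d N)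
        (by linarith) (hpos N) (by linarith)
      have h4 : Λ * ∑ l ∈ Finset.range n, (L.F^[l] (d N + k) - L.F^[l] (c N - k)) ≤ 1 := by
        have h5 : ∑ l ∈ Finset.range n, (L.F^[l] (d N + k) - L.F^[l] (c N - k)) ≤ 9 * ε := by
          refine (Finset.sum_le_sum fun l hl => h2 l (Finset.mem_range.1 hl)).trans ?_
          rw [← Finset.mul_sum]
          linarith [hNs n]
        calc _ ≤ Λ * (9 * (1 / (9 * Λ))) := by
              gcongr
              exact h5.trans (by linarith [min_le_right (η / 9) (1 / (9 * Λ))])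
          _ = 1 := by field_simp
      have h5 : Real.exp (Λ * ∑ l ∈ Finset.range n,
          (L.F^[l] (d N + k) - L.F^[l] (c N - k))) ≤ 3 := by
        refine (Real.exp_le_exp.2 h4).trans ?_
        linarith [Real.exp_one_lt_d9]
      have h6 := hmap N n
      rw [Nat.add_comm n N] at h6
      have h7 : 0 ≤ L.F^[n] (d N) - L.F^[n] (c N) :=
        sub_nonneg.2 (hch.le le_rfl (by linarith) (hle N) (by linarith))
      have h8 : L.F^[n] (d N + k) - L.F^[n] (c N - k) ≤ 9 * (d (N + n) - c (N + n)) := by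
        have h9 : (L.F^[n] (d N + k) - L.F^[n] (c N - k)) * k ≤
            9 * (d (N + n) - c (N + n)) * k := by
          refine h3.trans ?_
          rw [show d N + k - (c N - k) = 3 * k by rw [hk]; ring]
          calc _ ≤ 3 * (d (N + n) - c (N + n)) * (3 * k) := by
                gcongr <;> linarith
            _ = _ := by ring
        exact le_of_mul_le_mul_right h9 hk0
      refine ⟨fun x hx l hl => ?_, fun l hl => ?_⟩
      · rcases Nat.lt_succ_iff_lt_or_eq.1 hl with h9 | rfl
        · exact h1 hx l h9
        · obtain ⟨m, h10, h11⟩ := h (N + l + 1) ⟨le_rfl, hst.le⟩ (N + l) (by omega)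
          have h12 : L.F^[N + l] s = L.F^[l] (L.F^[N] s) := by
            rw [← Function.iterate_add_apply, Nat.add_comm]
          have h13 := hch.le (l := l) le_rfl (x := c N - k) (y := L.F^[N] s) le_rfl
            (by linarith [hc N]) (by linarith [hd N])
          have h14 := hch.le (l := l) le_rfl (x := L.F^[N] s) (y := d N + k)
            (by linarith [hc N]) (by linarith [hd N]) le_rfl
          have h15 := hch.le (l := l) le_rfl (x := c N - k) (y := x) le_rfl hx.1 hx.2
          have h16 := hch.le (l := l) le_rfl (x := x) (y := d N + k) hx.1 hx.2 le_rfl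
          rw [h12] at h10 h11
          have h17 := hNl l
          have h18 := min_le_left (η / 9) (1 / (9 * Λ))
          exact ⟨m, by linarith, by linarith⟩
      · rcases Nat.lt_succ_iff_lt_or_eq.1 hl with h9 | rfl
        · exact h2 l h9
        · exact h8
  have hfin := hmax N (c N - k) (d N + k) (fun x hx => mem_iInter.2 fun n =>
    Kset_mono hα'.le hβ'.le n ((key n).1 hx)) (c N) ⟨by linarith, by linarith⟩ ⟨le_rfl, hle N⟩
  linarith [hfin.1]

/-- Uniform version of `no_interval`. -/
theorem exists_no_interval {α β ε : ℝ} (hα : L.a < α) (hβ : β < L.b) (hε : 0 < ε) :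
    ∃ N, ∀ s, ¬ Icc s (s + ε) ⊆ L.Kset α β N := by
  by_contra hcon
  push Not at hcon
  set A : ℕ → Set ℝ := fun n => Icc 0 1 ∩ {s | ∀ θ ∈ Icc 0 ε, s + θ ∈ L.Kset α β n} with hA
  have hcl : ∀ n, IsClosed (A n) := fun n => by
    refine isClosed_Icc.inter ?_
    have : {s | ∀ θ ∈ Icc 0 ε, s + θ ∈ L.Kset α β n} =
        ⋂ θ ∈ Icc 0 ε, (fun s => s + θ) ⁻¹' L.Kset α β n := by ext; simp
    rw [this]
    exact isClosed_biInter fun θ _ => (isClosed_Kset α β n).preimage (continuous_add_const θ)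
  have hne : ∀ n, (A n).Nonempty := fun n => by
    obtain ⟨s, hs⟩ := hcon n
    refine ⟨Int.fract s, ⟨Int.fract_nonneg s, (Int.fract_lt_one s).le⟩, fun θ hθ => ?_⟩
    rw [← Kset_int ⌊s⌋, show Int.fract s + θ + ⌊s⌋ = s + θ by rw [Int.fract]; ring]
    exact hs ⟨by linarith [hθ.1], by linarith [hθ.2]⟩
  obtain ⟨s, hs⟩ := IsCompact.nonempty_iInter_of_sequence_nonempty_isCompact_isClosed A
    (fun n x hx => ⟨hx.1, fun θ hθ => Kset_anti _ _ (by omega) (hx.2 θ hθ)⟩) hne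
    (isCompact_Icc.of_isClosed_subset (hcl 0) inter_subset_left) hcl
  rw [mem_iInter] at hs
  refine no_interval hα hβ (show s < s + ε by linarith) fun n x hx => ?_
  have := (hs n).2 (x - s) ⟨by linarith [hx.1], by linarith [hx.2]⟩
  rwa [add_sub_cancel] at this

/-- A small cross ratio keeps the middle interval shorter than the left one along the orbit. -/
theorem Ch.middle_le {n : ℕ} {s x y t : ℝ} (h : L.Ch n s t) (h1 : s < x) (h2 : x < y) (h3 : y < t)
    (hX : ∑ l ∈ Finset.range n, (L.F^[l] x - L.F^[l] s) ≤ 1)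
    (hcr : Real.exp (3 * L.C) * crossRatio (L.F^[n] s) (L.F^[n] x) (L.F^[n] y) (L.F^[n] t) ≤ 1) :
    ∀ l ≤ n, L.F^[l] y - L.F^[l] x ≤ L.F^[l] x - L.F^[l] s := by
  have hC := L.hC
  have h3C : (1 : ℝ) ≤ Real.exp (3 * L.C) := Real.one_le_exp (by linarith)
  induction n generalizing s x y t with
  | zero =>
    intro l hl
    obtain rfl : l = 0 := by omega
    simp only [Function.iterate_zero, id] at *
    have h4 := le_mul_crossRatio_left h1 h2 h3
    have h5 := crossRatio_nonneg h1 h2 h3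
    nlinarith
  | succ n ih =>
    have hm : ∀ {u v : ℝ}, s ≤ u → u < v → v ≤ t → L.F u < L.F v := fun hu huv hv =>
      h.lt (l := 1) (by omega) hu huv hv
    have hpos : ∀ l < n + 1, 0 ≤ L.F^[l] x - L.F^[l] s := fun l hl =>
      sub_nonneg.2 (h.le hl.le le_rfl h1.le (by linarith))
    have hX' := hX
    rw [Finset.sum_range_succ'] at hX'
    simp only [Function.iterate_succ_apply, Function.iterate_zero, id] at hX'
    have h4 := ih (s := L.F s) (x := L.F x) (y := L.F y) (t := L.F t) h.iter
      (hm le_rfl h1 (by linarith)) (hm h1.le h2 h3.le) (hm (by linarith) h3 le_rfl)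
      (by linarith) (by simpa only [Function.iterate_succ_apply] using hcr)
    have h5 := h.crossRatio_le h1 h2 h3
    have h6 : ∑ l ∈ Finset.range (n + 1), (L.F^[l] y - L.F^[l] s) ≤ 3 := by
      rw [Finset.sum_range_succ']
      simp only [Function.iterate_succ_apply, Function.iterate_zero, id]
      have h7 : ∑ l ∈ Finset.range n, (L.F^[l] (L.F y) - L.F^[l] (L.F s)) ≤
          ∑ l ∈ Finset.range n, 2 * (L.F^[l] (L.F x) - L.F^[l] (L.F s)) :=
        Finset.sum_le_sum fun l hl => by
          linarith [h4 l (Finset.mem_range.1 hl).le]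
      rw [← Finset.mul_sum] at h7
      obtain ⟨m, h8, h9⟩ := h.2 0 (by omega)
      simp only [Function.iterate_zero, id] at h8 h9
      linarith [L.hba]
    intro l hl
    rcases Nat.eq_zero_or_pos l with rfl | hl0
    · simp only [Function.iterate_zero, id]
      have h7 := le_mul_crossRatio_left h1 h2 h3
      have h8 : crossRatio s x y t ≤ 1 := by
        refine h5.trans (le_trans ?_ hcr)
        refine mul_le_mul_of_nonneg_right (Real.exp_le_exp.2 (by nlinarith)) ?_
        exact crossRatio_nonneg (h.lt le_rfl le_rfl h1 (by linarith)) (h.lt le_rfl h1.le h2 h3.le)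
          (h.lt le_rfl (by linarith) h3 le_rfl)
      nlinarith
    · obtain ⟨l', rfl⟩ : ∃ l', l = l' + 1 := ⟨l - 1, by omega⟩
      simpa only [Function.iterate_succ_apply] using h4 l' (by omega)

/-- Infinitesimal form of the cross-ratio inequality. -/
theorem Ch.deriv_ge {n : ℕ} {s x t B : ℝ} (h : L.Ch n s t) (h1 : s < x) (h2 : x < t)
    (hB : ∑ l ∈ Finset.range n, (L.F^[l] x - L.F^[l] s) ≤ B) :
    1 ≤ Real.exp (L.C * B) * (x - s) * ((L.F^[n] t - L.F^[n] s) /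
      ((L.F^[n] x - L.F^[n] s) * (L.F^[n] t - L.F^[n] x))) * deriv (L.F^[n]) x := by
  have hX : L.F^[n] s < L.F^[n] x := h.lt le_rfl le_rfl h1 h2.le
  have hT : L.F^[n] x < L.F^[n] t := h.lt le_rfl h1.le h2 le_rfl
  have hslope := hasDerivWithinAt_iff_tendsto_slope.1
    (((L.diff_iter n) x).hasDerivAt.hasDerivWithinAt (s := Ioi x))
  rw [sdiff_singleton_eq_self (by simp)] at hslope
  have hcont : Continuous fun y => Real.exp (L.C * ∑ l ∈ Finset.range n, (L.F^[l] y - L.F^[l] s)) :=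
    Real.continuous_exp.comp (continuous_const.mul (continuous_finsetSum _ fun l _ =>
      (L.cont_iter l).sub continuous_const))
  have hc2 : ContinuousAt (fun y => (L.F^[n] t - L.F^[n] s) /
      ((L.F^[n] x - L.F^[n] s) * (L.F^[n] t - L.F^[n] y))) x := by
    refine ContinuousAt.div continuousAt_const (continuousAt_const.mul (continuousAt_const.sub
      (L.cont_iter n).continuousAt)) ?_
    exact mul_ne_zero (by linarith) (by linarith)
  have hlim := ((((hcont.tendsto x).mono_left (nhdsWithin_le_nhds (s := Ioi x))).mul_const
    (x - s)).mul (hc2.tendsto.mono_left (nhdsWithin_le_nhds (s := Ioi x)))).mul hslope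
  have hle : (1 : ℝ) ≤ Real.exp (L.C * ∑ l ∈ Finset.range n, (L.F^[l] x - L.F^[l] s)) * (x - s) *
      ((L.F^[n] t - L.F^[n] s) / ((L.F^[n] x - L.F^[n] s) * (L.F^[n] t - L.F^[n] x))) *
      deriv (L.F^[n]) x := by
    refine ge_of_tendsto hlim ?_
    filter_upwards [Ioo_mem_nhdsGT h2] with y hy
    have h3 := h.crossRatio_le h1 hy.1 hy.2
    have h4 := le_mul_crossRatio_left h1 hy.1 hy.2
    have h5 := mul_le_mul_of_nonneg_left h3 (sub_nonneg.2 h1.le)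
    have h6 : 0 < y - x := by linarith [hy.1]
    rw [slope_def_field, ← mul_le_mul_iff_of_pos_right h6, one_mul]
    refine h4.trans (h5.trans (le_of_eq ?_))
    unfold crossRatio
    field_simp
  refine hle.trans ?_
  have hd : 0 ≤ deriv (L.F^[n]) x := by
    by_contra hneg
    push Not at hneg
    have : Real.exp (L.C * ∑ l ∈ Finset.range n, (L.F^[l] x - L.F^[l] s)) * (x - s) *
      ((L.F^[n] t - L.F^[n] s) / ((L.F^[n] x - L.F^[n] s) * (L.F^[n] t - L.F^[n] x))) *
      deriv (L.F^[n]) x ≤ 0 := by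
      refine mul_nonpos_of_nonneg_of_nonpos ?_ hneg.le
      have : 0 < x - s := by linarith
      have : 0 < L.F^[n] t - L.F^[n] s := by linarith
      have : 0 < L.F^[n] x - L.F^[n] s := by linarith
      have : 0 < L.F^[n] t - L.F^[n] x := by linarith
      positivity
    linarith
  have : 0 < x - s := by linarith
  have : 0 < L.F^[n] t - L.F^[n] s := by linarith
  have : 0 < L.F^[n] x - L.F^[n] s := by linarith
  have : 0 < L.F^[n] t - L.F^[n] x := by linarith
  have hC := L.hC
  gcongr

/-- Orbits staying in the arc `[α, β]` have an expanding time. -/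
def Expands (L : Lorenz) (α β : ℝ) : Prop :=
  ∀ x, (∀ n, x ∈ L.Kset α β n) → ∃ n, 1 ≤ n ∧ 2 ≤ deriv (L.F^[n]) x

theorem Expands.exists_time {α β : ℝ} (hα : L.a < α) (hβ : β < L.b) (h : L.Expands α β) :
    ∃ α' N, L.a < α' ∧ α' < α ∧
      ∀ x ∈ L.Kset α' β N, ∃ n, 1 ≤ n ∧ n ≤ N ∧ 3 / 2 ≤ deriv (L.F^[n]) x := by
  set η := (α - L.a) / 2 with hη
  have hη0 : 0 < η := by linarith
  set u : ℕ → ℝ := fun N => α - η / (N + 1) with hu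
  have hu0 : ∀ N, L.a < u N := fun N => by
    have : η / (N + 1) ≤ η := div_le_self hη0.le (by linarith [(Nat.cast_nonneg N : (0 : ℝ) ≤ N)])
    simp only [hu]; linarith
  have hu1 : ∀ N, u N < α := fun N => by
    have : 0 < η / ((N : ℝ) + 1) := by positivity
    simp only [hu]; linarith
  have humono : Monotone u := fun m n hmn => by
    simp only [hu]
    have : (m : ℝ) ≤ n := by exact_mod_cast hmn
    gcongr
  by_contra hcon
  push Not at hcon
  set A : ℕ → Set ℝ := fun N => Icc 0 1 ∩ (L.Kset (u N) β N ∩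
    {x | ∀ n, 1 ≤ n → n ≤ N → deriv (L.F^[n]) x ≤ 3 / 2}) with hA
  have hcl : ∀ N, IsClosed (A N) := fun N => by
    refine isClosed_Icc.inter ((isClosed_Kset _ _ _).inter ?_)
    simp only [ofPred_forall]
    exact isClosed_iInter fun n => isClosed_iInter fun _ => isClosed_iInter fun _ =>
      isClosed_le (cont_deriv_iter n) continuous_const
  have hne : ∀ N, (A N).Nonempty := fun N => by
    obtain ⟨x, hx, hx'⟩ := hcon (u N) N (hu0 N) (hu1 N)
    have he : Int.fract x + ⌊x⌋ = x := Int.fract_add_floor x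
    refine ⟨Int.fract x, ⟨Int.fract_nonneg x, (Int.fract_lt_one x).le⟩, ?_, fun n hn hnN => ?_⟩
    · rw [← Kset_int ⌊x⌋, he]; exact hx
    · rw [← deriv_iter_int n _ ⌊x⌋, he]; exact (hx' n hn hnN).le
  obtain ⟨x, hx⟩ := IsCompact.nonempty_iInter_of_sequence_nonempty_isCompact_isClosed A
    (fun N y hy => ⟨hy.1, Kset_mono (humono (by omega)) le_rfl _ (Kset_anti _ _ (by omega) hy.2.1),
      fun n hn hnN => hy.2.2 n hn (by omega)⟩) hne
    (isCompact_Icc.of_isClosed_subset (hcl 0) inter_subset_left) hcl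
  rw [mem_iInter] at hx
  obtain ⟨n, hn, hn2⟩ := h x (by
    intro n l hl
    have h1 : ∀ N, L.F^[l] x ∈ arc (u N) β := fun N => by
      have := (hx (N + l + 1)).2.1 l (by omega)
      exact arc_mono (humono (by omega)) le_rfl this
    obtain ⟨m, h2, h3⟩ := h1 0
    refine ⟨m, ?_, h3⟩
    have h4 : ∀ N, u N + m ≤ L.F^[l] x := by
      intro N
      obtain ⟨k, h5, h6⟩ := h1 N
      have h7 := humono (Nat.zero_le N)
      have e1 : (m : ℝ) < k + 1 := by linarith [hu0 0, L.hba]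
      have e1 : m < k + 1 := by exact_mod_cast e1
      have e2 : (m : ℝ) ≤ k := by exact_mod_cast (by omega : m ≤ k)
      linarith
    have hlim : Tendsto u atTop (nhds (α - 0)) := by
      refine tendsto_const_nhds.sub ?_
      have := (tendsto_const_div_atTop_nhds_zero_nat η).comp (tendsto_add_atTop_nat 1)
      refine this.congr fun N => ?_
      simp
    rw [sub_zero] at hlim
    exact le_of_tendsto' (hlim.add_const _) h4)
  have := (hx n).2.2 n hn le_rfl
  linarith

/-- Uniform exponential growth of derivatives. -/
def Hyp (L : Lorenz) (α β : ℝ) : Prop :=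
  ∃ C > 0, ∃ κ > 1, ∀ n, ∀ x ∈ L.Kset α β n, C * κ ^ n ≤ deriv (L.F^[n]) x

theorem exists_deriv_lower {α β : ℝ} (hα : L.a < α) (hβ : β < L.b) :
    ∃ c > 0, c ≤ 1 ∧ ∀ x ∈ arc α β, c ≤ deriv L.F x := by
  rcases lt_or_ge β α with h | h
  · refine ⟨1, one_pos, le_rfl, ?_⟩
    rintro x ⟨m, h1, h2⟩
    linarith
  · obtain ⟨z, hz, hz'⟩ := isCompact_Icc.exists_isMinOn ⟨α, left_mem_Icc.2 h⟩
      L.cont_deriv.continuousOn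
    refine ⟨min 1 (deriv L.F z), lt_min one_pos (L.dpos z ⟨by linarith [hz.1], by linarith [hz.2]⟩),
      min_le_left _ _, ?_⟩
    rintro x ⟨m, h1, h2⟩
    have h3 := deriv_int (L := L) (x - m) m
    rw [sub_add_cancel] at h3
    rw [h3]
    exact (min_le_right _ _).trans (hz' ⟨by linarith, by linarith⟩)

theorem hyp_of_time {α β : ℝ} {N : ℕ} (hα : L.a < α) (hβ : β < L.b)
    (h : ∀ x ∈ L.Kset α β N, ∃ n, 1 ≤ n ∧ n ≤ N ∧ 3 / 2 ≤ deriv (L.F^[n]) x) :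
    L.Hyp α β := by
  obtain ⟨c, hc0, hc1, hc⟩ := exists_deriv_lower (L := L) hα hβ
  set κ : ℝ := (3 / 2 : ℝ) ^ (1 / ((N + 1 : ℕ) : ℝ)) with hκ
  have hκ1 : 1 < κ := Real.one_lt_rpow (by norm_num) (by positivity)
  have hκN : κ ^ (N + 1) = 3 / 2 := by
    rw [hκ, ← Real.rpow_natCast, ← Real.rpow_mul (by norm_num), one_div_mul_cancel (by positivity),
      Real.rpow_one]
  have hlow : ∀ n, ∀ x ∈ L.Kset α β n, c ^ n ≤ deriv (L.F^[n]) x := by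
    intro n
    induction n with
    | zero => intro x _; simp
    | succ n ih =>
      intro x hx
      rw [Nat.add_comm, deriv_iter_add, Function.iterate_one, pow_add, pow_one]
      have := ih x (Kset_anti _ _ (by omega) hx)
      have := hc _ (hx n (by omega))
      gcongr
      exact (deriv_pos_of_mem_arc hα hβ (hx n (by omega))).le
  refine ⟨c ^ N / κ ^ (N + 1), by positivity, κ, hκ1, fun n => ?_⟩
  induction n using Nat.strong_induction_on with
  | _ n ih =>
    intro x hx
    rcases lt_or_ge n N with hnN | hnN
    · refine le_trans ?_ (hlow n x hx)
      have h1 : κ ^ n ≤ κ ^ (N + 1) := pow_le_pow_right₀ hκ1.le (by omega)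
      have h2 : c ^ N ≤ c ^ n := pow_le_pow_of_le_one hc0.le hc1 hnN.le
      rw [div_mul_eq_mul_div, div_le_iff₀ (by positivity)]
      gcongr
    · obtain ⟨j, hj1, hjN, hj⟩ := h x (Kset_anti _ _ hnN hx)
      obtain ⟨i, rfl⟩ : ∃ i, n = i + j := ⟨n - j, by omega⟩
      have h1 := ih i (by omega) _ (Kset_iter hx)
      rw [deriv_iter_add]
      have h2 : κ ^ j ≤ deriv (L.F^[j]) x := by
        refine le_trans ?_ hj
        rw [← hκN]
        exact pow_le_pow_right₀ hκ1.le (by omega)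
      calc _ = (c ^ N / κ ^ (N + 1) * κ ^ i) * κ ^ j := by rw [pow_add]; ring
        _ ≤ _ := by
          gcongr
          exact (deriv_iter_pos hα hβ (Kset_iter hx)).le

theorem Expands.hyp {α β : ℝ} (hα : L.a < α) (hβ : β < L.b) (h : L.Expands α β) : L.Hyp α β := by
  obtain ⟨α', N, h1, h2, h3⟩ := h.exists_time hα hβ
  exact hyp_of_time (N := N) hα hβ fun x hx => h3 x (Kset_mono h2.le le_rfl _ hx)

theorem Hyp.exists_ge {α β : ℝ} (h : L.Hyp α β) {x : ℝ} (hx : ∀ n, x ∈ L.Kset α β n) (M : ℝ) :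
    ∃ n, 1 ≤ n ∧ M ≤ deriv (L.F^[n]) x := by
  obtain ⟨C, hC, κ, hκ, h1⟩ := h
  have h2 := ((tendsto_pow_atTop_atTop_of_one_lt hκ).const_mul_atTop hC).eventually_ge_atTop M
  obtain ⟨n, hn, hn1⟩ := (h2.and (eventually_ge_atTop 1)).exists
  exact ⟨n, hn1, hn.trans (h1 n x (hx n))⟩

theorem long_return {y β ε τ : ℝ} {N n : ℕ} {k : ℤ} {x : ℝ} (hy : L.a < y) (hβ : β < L.b)
    (hyK : ∀ n, y ∈ L.Kset y β n) (hN : ∀ n ≥ N, L.refl.g n < L.b - β) (hτ0 : 0 < τ) (hτ1 : τ ≤ 1)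
    (hτ : ∀ r ≤ N, ∀ m : ℤ, L.F^[r] L.b + m ∉ Ioo y (y + τ)) (hε0 : 0 < ε) (hε : ε ≤ τ / 2)
    (hεK : Real.exp (3 * L.C) * (ε * (4 / ((L.a + 1 - L.b) * τ))) ≤ 1)
    (hx : ∀ l < n, L.F^[l] x ∈ arc (y + ε) β) (hx1 : y + k ≤ L.F^[n] x)
    (hx2 : L.F^[n] x < y + ε + k) :
    ∃ s t, s < t ∧ Icc s t ⊆ L.Kset y β n ∧ 1 ≤ Real.exp (2 * L.C) * (2 * (t - s)) *
      (4 / ((L.a + 1 - L.b) * τ)) * deriv (L.F^[n]) x := by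
  have hab := L.hab
  have hba := L.hba
  have hyβ : y ≤ β := by
    obtain ⟨m, h1, h2⟩ := hyK 1 0 (by omega)
    linarith
  have hxK : x ∈ L.Kset y β n := fun l hl => by
    obtain ⟨m, h1, h2⟩ := hx l hl
    exact ⟨m, by linarith, h2⟩
  have hChx : L.Ch n x x := Ch_of_Icc_subset_Kset hy.le hβ.le le_rfl (by simpa using hxK)
  -- left extension
  obtain ⟨s, hsx, hCs, hFs⟩ : ∃ s, s < x ∧ L.Ch n s x ∧ L.F^[n] s = L.b - 1 + k := by
    rcases L.ext_left hChx (T := L.b - 1 + k) (by linarith) with h | ⟨t, hCt, hFt, l, hl, m, hm⟩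
    · exact h
    exfalso
    obtain ⟨r, rfl⟩ : ∃ r, n = r + l := ⟨n - l, by omega⟩
    have h1 := hCt.iter
    rw [hm] at h1
    have h2 : L.F^[r] (L.a + m) = L.F^[r + l] t := by rw [Function.iterate_add_apply, hm]
    have h3 : L.F^[r] (L.F^[l] x) = L.F^[r + l] x := by rw [Function.iterate_add_apply]
    have h4 := orbit_a_notMem (L := L) (n := r) (by omega) (k - m)
    rw [iter_int] at h2
    push_cast at h4
    have h5 : L.a + k < L.F^[r] L.a + m := by
      by_contra hc
      exact h4 ⟨by linarith [L.hd2], by linarith⟩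
    obtain ⟨m', h6, h7⟩ := hx l hl
    obtain ⟨m2, h8, h9⟩ := h1.2 0 (by omega)
    have h10 := h1.1
    simp only [Function.iterate_zero, id] at h8 h9
    have e1 : m < m' + 1 := by
      have : (m : ℝ) < m' + 1 := by linarith
      exact_mod_cast this
    have e2 : m' < m2 + 1 := by
      have : (m' : ℝ) < m2 + 1 := by linarith
      exact_mod_cast this
    have e3 : m2 ≤ m := by
      have : (m2 : ℝ) ≤ m := by linarith
      exact_mod_cast this
    obtain rfl : m' = m := by omega
    refine h1.no_selfmap (by omega) (by linarith) (k - m') ?_ ?_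
    · rw [iter_int]; push_cast; linarith
    · rw [h3]; push_cast; linarith
  -- right extension
  obtain ⟨t, hxt, hCt, hFt⟩ : ∃ t, x < t ∧ L.Ch n x t ∧ L.F^[n] t = y + τ + k := by
    rcases L.ext_right hChx (T := y + τ + k) (by linarith) with h | ⟨t, hCt, hFt, l, hl, m, hm⟩
    · exact h
    exfalso
    obtain ⟨r, rfl⟩ : ∃ r, n = r + l := ⟨n - l, by omega⟩
    have h1 := hCt.iter
    rw [hm] at h1
    have h2 : L.F^[r] (L.b + m) = L.F^[r + l] t := by rw [Function.iterate_add_apply, hm]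
    obtain ⟨m', h6, h7⟩ := hx l hl
    obtain ⟨m2, h8, h9⟩ := h1.2 0 (by omega)
    have h10 := h1.1
    simp only [Function.iterate_zero, id] at h8 h9
    have e1 : m ≤ m2 := by
      have : (m : ℝ) ≤ m2 := by linarith
      exact_mod_cast this
    have e2 : m' < m + 1 := by
      have : (m' : ℝ) < m + 1 := by linarith
      exact_mod_cast this
    have e3 : m2 < m' + 1 := by
      have : (m2 : ℝ) < m' + 1 := by linarith
      exact_mod_cast this
    obtain rfl : m' = m := by omega
    have h11 := (h1.sub h7 (by linarith) le_rfl).int (-m')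
    push_cast at h11
    rw [add_neg_cancel_right, add_neg_cancel_right] at h11
    have h12 : L.refl.Ch (r - 1 + 1) L.refl.a (-β) := by
      rw [Nat.sub_add_cancel (by omega), refl_Ch]
      simpa [refl] using h11
    have h13 := le_g h12
    have h14 : r - 1 < N := by
      by_contra hc
      have := hN (r - 1) (by omega)
      simp only [refl] at h13
      simp only [refl] at this
      linarith
    have h15 : L.F^[r + l] x < L.F^[r + l] t := by
      refine hCt.lt le_rfl le_rfl ?_ le_rfl
      rcases hCt.1.lt_or_eq with h | h
      · exact h
      · rw [← h] at hm; linarith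
    refine hτ r (by omega) (m' - k) ?_
    rw [iter_int] at h2
    push_cast
    exact ⟨by linarith, by linarith⟩
  have hst := hCs.join hCt
  obtain ⟨s2, ⟨hs2, hs2x⟩, hFs2⟩ := hCs.ivt (l := n) (T := y + k) (by linarith) hx1
  have hss2 : s < s2 := hCs.lt_of_lt le_rfl le_rfl hsx.le hs2 hs2x (by linarith)
  have hstar : ∀ l < n, ∃ m : ℤ, y + m ≤ L.F^[l] s ∧ L.F^[l] x ≤ β + m := by
    intro l hl
    obtain ⟨r, rfl⟩ : ∃ r, n = r + l := ⟨n - l, by omega⟩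
    obtain ⟨m', h6, h7⟩ := hx l hl
    refine ⟨m', ?_, h7⟩
    by_contra! hc
    have h1 := hCs.iter.sub hc.le (by linarith) le_rfl
    have h2 : L.F^[r] (L.F^[l] s) = L.F^[r + l] s := by rw [Function.iterate_add_apply]
    have h3 : L.F^[r] (L.F^[l] x) = L.F^[r + l] x := by rw [Function.iterate_add_apply]
    have h4 := hCs.iter.le le_rfl le_rfl hc.le (by linarith)
    obtain ⟨j, h8, h9⟩ := hyK (r + 1) r (by omega)
    rw [h2, hFs, iter_int] at h4
    have e1 : k ≤ j + m' := by
      have : (k : ℝ) < j + m' + 1 := by linarith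
      have : k < j + m' + 1 := by exact_mod_cast this
      omega
    have e1' : (k : ℝ) ≤ j + m' := by exact_mod_cast e1
    refine h1.no_selfmap (by omega) (by linarith) (k - m') ?_ ?_
    · rw [iter_int]; push_cast; linarith
    · rw [h3]; push_cast; linarith
  have hCs2 : L.Ch n s s2 := hCs.sub le_rfl hs2 hs2x
  have hdisj : ∀ l l', l < l' → l' < n → ∀ (m : ℤ), ∀ z ∈ Ioo (L.F^[l] s) (L.F^[l] s2),
      z + m ∉ Ioo (L.F^[l'] s) (L.F^[l'] s2) := by
    intro l l' hl hl' m z hz hzm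
    obtain ⟨r, rfl⟩ : ∃ r, n = r + l' := ⟨n - l', by omega⟩
    have h1 := hCs2.iter.lt le_rfl le_rfl hzm.1 hzm.2.le
    have h2 := hCs2.iter.lt le_rfl hzm.1.le hzm.2 le_rfl
    rw [← Function.iterate_add_apply, hFs, iter_int] at h1
    rw [← Function.iterate_add_apply, hFs2, iter_int] at h2
    have h0 := (hCs2.anti (k := r + l) (by omega)).iter
    have h3 := h0.le le_rfl le_rfl hz.1.le hz.2.le
    have h4 := h0.le le_rfl hz.1.le hz.2.le le_rfl
    rw [← Function.iterate_add_apply] at h3 h4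
    obtain ⟨j, h5, h6⟩ := hstar (r + l) (by omega)
    have h7 := hCs.le (l := r + l) (by omega) hs2 hs2x le_rfl
    have e1 : j + m < k := by
      have : (j : ℝ) + m < k := by linarith
      exact_mod_cast this
    have e2 : k < j + m + 1 := by
      have : (k : ℝ) < j + m + 1 := by linarith
      exact_mod_cast this
    omega
  have hsum : ∑ l ∈ Finset.range n, (L.F^[l] s2 - L.F^[l] s) ≤ 1 := by
    refine sum_length_le_one _ _ _ (fun l hl => ?_) (fun l hl => ?_) ?_
    · exact hCs2.le (Finset.mem_range.1 hl).le le_rfl hs2 le_rfl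
    · linarith [hCs2.iter_lt_b (Finset.mem_range.1 hl)]
    · intro i hi j hj hij m z hz hzm
      rcases lt_or_gt_of_ne hij with h | h
      · exact hdisj i j h (Finset.mem_range.1 hj) m z hz hzm
      · refine hdisj j i h (Finset.mem_range.1 hi) (-m) _ hzm ?_
        push_cast
        rwa [add_neg_cancel_right]
  have hA : 0 < L.a + 1 - L.b := by linarith
  have hmid : ∀ l ≤ n, L.F^[l] x - L.F^[l] s2 ≤ L.F^[l] s2 - L.F^[l] s := by
    rcases hs2x.lt_or_eq with h | h
    · refine hst.middle_le hss2 h hxt hsum (le_trans ?_ hεK)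
      refine mul_le_mul_of_nonneg_left ?_ (Real.exp_pos _).le
      rw [crossRatio, hFs, hFs2, hFt, div_le_iff₀ (by
        refine mul_pos (by linarith) (by linarith))]
      have h1 : (L.a + 1 - L.b) * (τ / 2) ≤
          (y + k - (L.b - 1 + k)) * (y + τ + k - L.F^[n] x) := by
        refine mul_le_mul (by linarith) (by linarith) (by linarith) (by linarith)
      have h2 : (L.F^[n] x - (y + k)) * (y + τ + k - (L.b - 1 + k)) ≤ ε * 2 := by
        refine mul_le_mul (by linarith) (by linarith) (by linarith) (by linarith)
      refine h2.trans ?_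
      calc ε * 2 = ε * (4 / ((L.a + 1 - L.b) * τ)) * ((L.a + 1 - L.b) * (τ / 2)) := by
            field_simp; ring
        _ ≤ _ := mul_le_mul_of_nonneg_left h1 (by positivity)
    · intro l hl
      rw [h, sub_self]
      exact sub_nonneg.2 (hCs.le hl le_rfl hsx.le le_rfl)
  refine ⟨s, s2, hss2, hCs2.Icc_subset_Kset fun l hl => ?_, ?_⟩
  · obtain ⟨m, h1, h2⟩ := hstar l hl
    exact ⟨m, h1, (hCs.le hl.le hs2 hs2x le_rfl).trans h2⟩
  · have h1 := hst.deriv_ge hsx hxt (B := 2) (by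
      have : ∑ l ∈ Finset.range n, (L.F^[l] x - L.F^[l] s) ≤
          ∑ l ∈ Finset.range n, 2 * (L.F^[l] s2 - L.F^[l] s) :=
        Finset.sum_le_sum fun l hl => by linarith [hmid l (Finset.mem_range.1 hl).le]
      rw [← Finset.mul_sum] at this
      linarith)
    have hD := deriv_iter_pos hy hβ hxK
    refine h1.trans (mul_le_mul_of_nonneg_right ?_ hD.le)
    rw [hFs, hFt, mul_comm L.C 2]
    have h3 := hmid 0 (by omega)
    simp only [Function.iterate_zero, id] at h3
    refine mul_le_mul (mul_le_mul_of_nonneg_left (by linarith) (Real.exp_pos _).le) ?_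
      (div_nonneg (by linarith) (mul_nonneg (by linarith) (by linarith)))
      (mul_nonneg (Real.exp_pos _).le (by linarith))
    rw [div_le_iff₀ (mul_pos (by linarith) (by linarith))]
    have h4 : (L.a + 1 - L.b) * (τ / 2) ≤
        (L.F^[n] x - (L.b - 1 + k)) * (y + τ + k - L.F^[n] x) := by
      refine mul_le_mul (by linarith) (by linarith) (by linarith) (by linarith)
    calc y + τ + k - (L.b - 1 + k) ≤ 2 := by linarith
      _ = (4 / ((L.a + 1 - L.b) * τ)) * ((L.a + 1 - L.b) * (τ / 2)) := by field_simp; ring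
      _ ≤ _ := mul_le_mul_of_nonneg_left h4 (by positivity)

theorem short_return {y β : ℝ} (hy : L.a < y) (hβ : β < L.b) (hyK : ∀ n, y ∈ L.Kset y β n)
    {i : ℕ} (hi : 1 ≤ i) : ∃ ε > 0, ∃ σ > 1, ∀ x, ∀ k : ℤ, y ≤ x → x < y + ε →
      y + k ≤ L.F^[i] x → L.F^[i] x < y + ε + k → σ ≤ deriv (L.F^[i]) x := by
  obtain ⟨m, h1, h2⟩ := hyK (i + 1) i (by omega)
  rcases h1.eq_or_lt with h | h
  · have h3 := L.repel y i m hi h.symm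
    rw [abs_of_pos (deriv_iter_pos hy hβ (hyK i))] at h3
    have h4 := (L.cont_deriv_iter i).continuousAt.eventually_mem
      (Ioi_mem_nhds (show (1 + deriv (L.F^[i]) y) / 2 < deriv (L.F^[i]) y by linarith))
    obtain ⟨ε, hε, h5⟩ := Metric.eventually_nhds_iff.1 h4
    refine ⟨ε, hε, (1 + deriv (L.F^[i]) y) / 2, by linarith, fun x k hx1 hx2 _ _ => ?_⟩
    exact (h5 (by rw [Real.dist_eq, abs_lt]; constructor <;> linarith)).le
  · have h4 := (L.cont_iter i).continuousAt.eventually_mem (Ioo_mem_nhds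
      (show y + m + (L.F^[i] y - y - m) / 2 < L.F^[i] y by linarith)
      (show L.F^[i] y < L.b + m by linarith))
    obtain ⟨ε, hε, h5⟩ := Metric.eventually_nhds_iff.1 h4
    refine ⟨min ε ((L.F^[i] y - y - m) / 2), lt_min hε (by linarith), 2, by norm_num,
      fun x k hx1 hx2 hk1 hk2 => ?_⟩
    exfalso
    have h6 := min_le_left ε ((L.F^[i] y - y - m) / 2)
    have h7 := min_le_right ε ((L.F^[i] y - y - m) / 2)
    obtain ⟨h8, h9⟩ := h5 (y := x) (by rw [Real.dist_eq, abs_lt]; constructor <;> linarith)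
    have e1 : k < m + 1 := by
      have : (k : ℝ) < m + 1 := by linarith [L.hba]
      exact_mod_cast this
    have e2 : m < k := by
      have : (m : ℝ) < k := by linarith
      exact_mod_cast this
    omega

theorem short_returns {y β : ℝ} (hy : L.a < y) (hβ : β < L.b) (hyK : ∀ n, y ∈ L.Kset y β n)
    (N : ℕ) : ∃ ε > 0, ∃ σ > 1, ∀ i, 1 ≤ i → i ≤ N → ∀ x, ∀ k : ℤ, y ≤ x → x < y + ε →
      y + k ≤ L.F^[i] x → L.F^[i] x < y + ε + k → σ ≤ deriv (L.F^[i]) x := by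
  induction N with
  | zero => exact ⟨1, one_pos, 2, by norm_num, fun i h1 h2 => by omega⟩
  | succ N ih =>
    obtain ⟨ε, hε, σ, hσ, h⟩ := ih
    obtain ⟨ε', hε', σ', hσ', h'⟩ := short_return hy hβ hyK (i := N + 1) (by omega)
    refine ⟨min ε ε', lt_min hε hε', min σ σ', lt_min hσ hσ', fun i hi hiN x k h1 h2 h3 h4 => ?_⟩
    have := min_le_left ε ε'
    have := min_le_right ε ε'
    rcases Nat.lt_or_ge N i with hc | hc
    · obtain rfl : i = N + 1 := by omega
      exact (min_le_right _ _).trans (h' x k h1 (by linarith) h3 (by linarith))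
    · exact (min_le_left _ _).trans (h i hi hc x k h1 (by linarith) h3 (by linarith))

theorem exists_gap (c y : ℝ) (N : ℕ) :
    ∃ τ > 0, τ ≤ 1 ∧ ∀ r ≤ N, ∀ m : ℤ, L.F^[r] c + m ∉ Ioo y (y + τ) := by
  have h1 : ∀ r, ∃ τ > 0, ∀ m : ℤ, L.F^[r] c + m ∉ Ioo y (y + τ) := fun r => by
    refine ⟨L.F^[r] c + (⌊y - L.F^[r] c⌋ + 1) - y, by
      linarith [Int.lt_floor_add_one (y - L.F^[r] c)], fun m hm => ?_⟩
    have h2 : ⌊y - L.F^[r] c⌋ < m := Int.floor_lt.2 (by linarith [hm.1])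
    have h3 : (⌊y - L.F^[r] c⌋ : ℝ) + 1 ≤ m := by exact_mod_cast h2
    linarith [hm.2]
  induction N with
  | zero =>
    obtain ⟨τ, hτ, h⟩ := h1 0
    refine ⟨min τ 1, lt_min hτ one_pos, min_le_right _ _, fun r hr m hm => ?_⟩
    obtain rfl : r = 0 := by omega
    exact h m ⟨hm.1, hm.2.trans_le (by linarith [min_le_left τ 1])⟩
  | succ N ih =>
    obtain ⟨τ, hτ, hτ1, h⟩ := ih
    obtain ⟨τ', hτ', h'⟩ := h1 (N + 1)
    refine ⟨min τ τ', lt_min hτ hτ', (min_le_left _ _).trans hτ1, fun r hr m hm => ?_⟩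
    rcases Nat.lt_or_ge N r with hc | hc
    · obtain rfl : r = N + 1 := by omega
      exact h' m ⟨hm.1, hm.2.trans_le (by linarith [min_le_right τ τ'])⟩
    · exact h r hc m ⟨hm.1, hm.2.trans_le (by linarith [min_le_left τ τ'])⟩

theorem return_expand {y β : ℝ} (hy : L.a < y) (hβ : β < L.b) (hyK : ∀ n, y ∈ L.Kset y β n)
    (hg : Tendsto L.refl.g atTop (nhds 0)) :
    ∃ ε > 0, ∃ σ > 1, ∀ x i, ∀ k : ℤ, 1 ≤ i → y ≤ x → x < y + ε → x ∈ L.Kset y β i →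
      (∀ l, 0 < l → l < i → L.F^[l] x ∈ arc (y + ε) β) →
      y + k ≤ L.F^[i] x → L.F^[i] x < y + ε + k → σ ≤ deriv (L.F^[i]) x := by
  obtain ⟨N, hN⟩ := eventually_atTop.1 (hg.eventually_lt_const (show 0 < L.b - β by linarith))
  obtain ⟨τ, hτ0, hτ1, hτ⟩ := L.exists_gap L.b y N
  obtain ⟨c, hc0, hc1, hc⟩ := exists_deriv_lower (L := L) hy hβ
  have hA : 0 < L.a + 1 - L.b := by linarith [L.hba]
  set K : ℝ := 4 / ((L.a + 1 - L.b) * τ) with hK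
  have hK0 : 0 < K := by positivity
  set η : ℝ := c / (4 * Real.exp (2 * L.C) * K) with hη
  obtain ⟨N2, hN2⟩ := exists_no_interval (L := L) hy hβ (ε := η) (by positivity)
  obtain ⟨ε, hε, σ, hσ, hs⟩ := short_returns hy hβ hyK N2
  set ε' := min ε (min (τ / 2) (1 / (Real.exp (3 * L.C) * K))) with hε'
  have h1 : ε' ≤ ε := min_le_left _ _
  have h2 : ε' ≤ τ / 2 := (min_le_right _ _).trans (min_le_left _ _)
  have h3 : ε' ≤ 1 / (Real.exp (3 * L.C) * K) := (min_le_right _ _).trans (min_le_right _ _)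
  have h0 : 0 < ε' := by positivity
  refine ⟨ε', h0, min σ 2, lt_min hσ (by norm_num), fun x i k hi hx1 hx2 hxK hl hk1 hk2 => ?_⟩
  rcases Nat.lt_or_ge N2 i with hiN | hiN
  swap
  · exact (min_le_left _ _).trans (hs i hi hiN x k hx1 (by linarith) hk1 (by linarith))
  refine (min_le_right _ _).trans ?_
  obtain ⟨n, rfl⟩ : ∃ n, i = n + 1 := ⟨i - 1, by omega⟩
  have hDn := deriv_iter_pos hy hβ (Kset_iter hxK)
  simp only [Function.iterate_one] at hDn
  obtain ⟨s, t, hst, hI, hD⟩ := long_return (x := L.F x) (n := n) (k := k) hy hβ hyK hN hτ0 hτ1 hτ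
    h0 h2 (by
      rw [← mul_assoc, mul_comm _ ε', mul_assoc]
      rwa [le_div_iff₀ (by positivity)] at h3) (fun l hl' => by
      rw [← Function.iterate_succ_apply]; exact hl (l + 1) (by omega) (by omega))
      (by rwa [← Function.iterate_succ_apply]) (by rwa [← Function.iterate_succ_apply])
  have hts : t - s < η := by
    by_contra! hcon
    refine hN2 s (fun z hz => Kset_anti _ _ (by omega) (hI ⟨hz.1, ?_⟩))
    linarith [hz.2]
  rw [deriv_iter_add, Function.iterate_one]
  have h4 := hc x (hxK 0 (by omega))
  have h5 : Real.exp (2 * L.C) * (2 * (t - s)) * K ≤ c / 2 := by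
    calc _ ≤ Real.exp (2 * L.C) * (2 * η) * K := by gcongr
      _ = c / 2 := by rw [hη]; field_simp; ring
  have h6 : 1 ≤ c / 2 * deriv (L.F^[n]) (L.F x) :=
    hD.trans (mul_le_mul_of_nonneg_right h5 hDn.le)
  nlinarith

theorem Kset_of_forall {α β x : ℝ} (h : ∀ l, L.F^[l] x ∈ arc α β) (n : ℕ) : x ∈ L.Kset α β n :=
  fun l _ => h l

theorem Expands.of_gt {y β : ℝ} (hy : L.a < y) (hβ : β < L.b)
    (hg : Tendsto L.refl.g atTop (nhds 0)) (h : ∀ y' > y, L.Expands y' β) : L.Expands y β := by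
  intro x hx
  have hx' : ∀ l, L.F^[l] x ∈ arc y β := fun l => hx (l + 1) l (by omega)
  by_cases hyK : ∀ n, y ∈ L.Kset y β n
  · obtain ⟨ε, hε, σ, hσ, hr⟩ := return_expand hy hβ hyK hg
    have hmem : ∀ j, (¬ ∃ m : ℤ, y + m ≤ L.F^[j] x ∧ L.F^[j] x < y + ε + m) →
        L.F^[j] x ∈ arc (y + ε) β := fun j hj => by
      obtain ⟨m, h1, h2⟩ := hx' j
      refine ⟨m, ?_, h2⟩
      by_contra! hc
      exact hj ⟨m, h1, hc⟩
    have hDpos : ∀ j, 0 < deriv (L.F^[j]) x := fun j => deriv_iter_pos hy hβ (hx j)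
    by_cases hinf : ∀ J, ∃ j ≥ J, ∃ m : ℤ, y + m ≤ L.F^[j] x ∧ L.F^[j] x < y + ε + m
    · obtain ⟨j0, _, hj0⟩ := hinf 0
      have hclaim : ∀ N : ℕ, ∃ j ≥ N, (∃ m : ℤ, y + m ≤ L.F^[j] x ∧ L.F^[j] x < y + ε + m) ∧
          σ ^ N * deriv (L.F^[j0]) x ≤ deriv (L.F^[j]) x := by
        intro N
        induction N with
        | zero => exact ⟨j0, by omega, hj0, by simp⟩
        | succ N ih =>
          obtain ⟨j, hjN, ⟨m, hm1, hm2⟩, hjD⟩ := ih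
          have hex : ∃ i, 1 ≤ i ∧ ∃ m : ℤ, y + m ≤ L.F^[i + j] x ∧ L.F^[i + j] x < y + ε + m := by
            obtain ⟨j', hj', h1⟩ := hinf (j + 1)
            exact ⟨j' - j, by omega, by rwa [Nat.sub_add_cancel (by omega)]⟩
          classical
          obtain ⟨hi1, k, hk1, hk2⟩ := Nat.find_spec hex
          have hmin := fun l => Nat.find_min hex (m := l)
          generalize Nat.find hex = i at *
          refine ⟨i + j, by omega, ⟨k, hk1, hk2⟩, ?_⟩
          have h1 : ∀ l, L.F^[l] (L.F^[j] x + ((-m : ℤ) : ℝ)) = L.F^[l + j] x + ((-m : ℤ) : ℝ) := by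
            intro l; rw [iter_int, Function.iterate_add_apply]
          have h2 := hr (L.F^[j] x + ((-m : ℤ) : ℝ)) i (k - m) hi1 (by push_cast; linarith)
            (by push_cast; linarith) (by rw [Kset_int]; exact Kset_iter (hx (i + j))) (by
              intro l hl0 hli
              rw [h1, arc_int]
              refine hmem _ fun hc => hmin l hli ⟨hl0, hc⟩) (by rw [h1]; push_cast; linarith)
            (by rw [h1]; push_cast; linarith)
          rw [deriv_iter_int] at h2
          rw [deriv_iter_add]
          calc σ ^ (N + 1) * deriv (L.F^[j0]) x = σ * (σ ^ N * deriv (L.F^[j0]) x) := by ring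
            _ ≤ _ := mul_le_mul h2 hjD (mul_nonneg (by positivity) (hDpos _).le) (by linarith)
      obtain ⟨N, hN⟩ := pow_unbounded_of_one_lt (2 / deriv (L.F^[j0]) x) hσ
      obtain ⟨j, hj, -, hjD⟩ := hclaim (N + 1)
      refine ⟨j, by omega, le_trans ?_ hjD⟩
      rw [div_lt_iff₀ (hDpos _)] at hN
      refine hN.le.trans (mul_le_mul_of_nonneg_right ?_ (hDpos _).le)
      exact pow_le_pow_right₀ hσ.le (by omega)
    · push Not at hinf
      obtain ⟨J, hJ⟩ := hinf
      have h1 : ∀ n, L.F^[J] x ∈ L.Kset (y + ε) β n := Kset_of_forall fun l => by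
        rw [← Function.iterate_add_apply]
        exact hmem _ fun ⟨m, h2, h3⟩ => absurd h3 (not_lt.2 (hJ _ (by omega) m h2))
      obtain ⟨n, hn, h2⟩ := ((h _ (by linarith)).hyp (by linarith) hβ).exists_ge h1
        (2 / deriv (L.F^[J]) x)
      refine ⟨n + J, by omega, ?_⟩
      rw [deriv_iter_add]
      rwa [div_le_iff₀ (hDpos _)] at h2
  · push Not at hyK
    obtain ⟨n, hn⟩ := hyK
    obtain ⟨l, hl⟩ : ∃ l, L.F^[l] y ∉ arc y β := by
      by_contra! hc
      exact hn (Kset_of_forall hc n)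
    have h1 := (L.cont_iter l).continuousAt.eventually_mem
      ((isClosed_arc y β).isOpen_compl.mem_nhds hl)
    obtain ⟨ε, hε, h2⟩ := Metric.eventually_nhds_iff.1 h1
    refine h (y + ε) (by linarith) x (Kset_of_forall fun j => ?_)
    obtain ⟨m, h3, h4⟩ := hx' j
    refine ⟨m, ?_, h4⟩
    by_contra! hc
    have h5 := h2 (y := L.F^[j] x + ((-m : ℤ) : ℝ)) (by
      rw [Real.dist_eq, abs_lt]; push_cast; constructor <;> linarith)
    rw [iter_int, mem_compl_iff, arc_int, ← Function.iterate_add_apply] at h5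
    exact h5 (hx' _)

theorem Hyp.expands {α β : ℝ} (h : L.Hyp α β) : L.Expands α β := fun _ hx => h.exists_ge hx 2

/-- Hyperbolicity of the set of orbits avoiding a neighbourhood of the turning points. -/
theorem hyp {α β : ℝ} (hα : L.a < α) (hβ : β < L.b)
    (hg : Tendsto L.refl.g atTop (nhds 0)) : L.Hyp α β := by
  refine Expands.hyp hα hβ ?_
  have hmono : ∀ {y y'}, y ≤ y' → L.Expands y β → L.Expands y' β := fun hyy h x hx =>
    h x fun n => Kset_mono hyy le_rfl n (hx n)
  set S := {y | α ≤ y ∧ L.Expands y β} with hS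
  have hne : S.Nonempty := by
    refine ⟨max α (β + 1), le_max_left _ _, fun x hx => ?_⟩
    obtain ⟨m, h1, h2⟩ := hx 1 0 (by omega)
    linarith [le_max_right α (β + 1)]
  have hbd : BddBelow S := ⟨α, fun y hy => hy.1⟩
  have h1 : α ≤ sInf S := le_csInf hne fun y hy => hy.1
  have h2 : L.Expands (sInf S) β := Expands.of_gt (by linarith) hβ hg fun y' hy' => by
    obtain ⟨y, hy, hyy⟩ := exists_lt_of_csInf_lt hne hy'
    exact hmono hyy.le hy.2
  rcases h1.eq_or_lt with h | h
  · rwa [h]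
  · exfalso
    obtain ⟨α', N, h3, h4, h5⟩ := h2.exists_time (by linarith) hβ
    have h6 : max α α' ∈ S := ⟨le_max_left _ _, Hyp.expands <| hyp_of_time (N := N)
      (lt_of_lt_of_le hα (le_max_left _ _)) hβ
      fun x hx => h5 x (Kset_mono (le_max_right _ _) le_rfl _ hx)⟩
    have h7 := csInf_le hbd h6
    exact absurd h7 (not_le.2 (max_lt h h4))

theorem Kset_expand {α β C κ : ℝ} (hH : ∀ n, ∀ x ∈ L.Kset α β n, C * κ ^ n ≤ deriv (L.F^[n]) x)
    {n : ℕ} {s t : ℝ} (hst : s ≤ t) (h : Icc s t ⊆ L.Kset α β n) :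
    C * κ ^ n * (t - s) ≤ L.F^[n] t - L.F^[n] s :=
  (convex_Icc s t).mul_sub_le_image_sub_of_le_deriv (L.cont_iter n).continuousOn
    (L.diff_iter n).differentiableOn (fun x hx => hH n x (h (interior_subset hx)))
    s (left_mem_Icc.2 hst) t (right_mem_Icc.2 hst) hst

theorem exists_pullback {α β α' β' C κ : ℝ} (h1 : L.a < α') (h2 : α' < α) (h3 : β < β')
    (h4 : β' < L.b) (hC : 0 < C) (hκ : 1 < κ)
    (hH : ∀ n, ∀ x ∈ L.Kset α' β' n, C * κ ^ n ≤ deriv (L.F^[n]) x) :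
    ∃ ρ > 0, ∀ n, ∀ x ∈ L.Kset α β n, ∃ s t, s < x ∧ x < t ∧ Icc s t ⊆ L.Kset α' β' n ∧
      L.F^[n] s = L.F^[n] x - ρ ∧ L.F^[n] t = L.F^[n] x + ρ := by
  obtain ⟨c, hc, hcF⟩ := L.exists_lower h1 h4
  set ρ := C * c * min (α - α') (β' - β) with hρ
  have hρ0 : 0 < ρ := by
    have : 0 < min (α - α') (β' - β) := lt_min (by linarith) (by linarith)
    positivity
  have key : ∀ n, ∀ x ∈ L.Kset α β n, ∀ y ∈ Icc (L.F^[n] x - ρ) (L.F^[n] x + ρ),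
      ∃ t, uIcc x t ⊆ L.Kset α' β' n ∧ L.F^[n] t = y := by
    intro n
    induction n with
    | zero => intro x hx y hy; exact ⟨y, fun z _ l hl => by omega, rfl⟩
    | succ n ih =>
      intro x hx y hy
      rw [Function.iterate_succ_apply] at hy
      obtain ⟨t', ht', hy'⟩ := ih (L.F x) (Kset_iter (k := 1) hx) y hy
      have hκn : 1 ≤ κ ^ n := one_le_pow₀ hκ.le
      have hd : |t' - L.F x| ≤ c * min (α - α') (β' - β) := by
        have h5 : C * |t' - L.F x| ≤ ρ := by
          rcases le_total (L.F x) t' with h | h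
          · rw [uIcc_of_le h] at ht'
            have := Kset_expand hH h ht'
            rw [abs_of_nonneg (by linarith)]
            rw [hy'] at this
            nlinarith [hy.2, mul_nonneg hC.le (sub_nonneg.2 h)]
          · rw [uIcc_of_ge h] at ht'
            have := Kset_expand hH h ht'
            rw [abs_of_nonpos (by linarith)]
            rw [hy'] at this
            nlinarith [hy.1, mul_nonneg hC.le (sub_nonneg.2 h)]
        rw [hρ, mul_assoc] at h5
        exact le_of_mul_le_mul_left h5 hC
      obtain ⟨hd1, hd2⟩ := abs_le.1 hd
      have m1 := mul_le_mul_of_nonneg_left (min_le_left (α - α') (β' - β)) hc.le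
      have m2 := mul_le_mul_of_nonneg_left (min_le_right (α - α') (β' - β)) hc.le
      obtain ⟨m, hm1, hm2⟩ := hx 0 (by omega)
      simp only [Function.iterate_zero, id] at hm1 hm2
      have e1 : ∀ u v : ℝ, α' + m ≤ u → u ≤ v → v ≤ β' + m → c * (v - u) ≤ L.F v - L.F u := by
        intro u v hu huv hv
        have := hcF (u + ((-m : ℤ) : ℝ)) (v + ((-m : ℤ) : ℝ)) (by push_cast; linarith) (by linarith)
          (by push_cast; linarith)
        rw [per_int, per_int] at this
        linarith
      have e2 := e1 (α' + m) x le_rfl (by linarith) (by linarith)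
      have e3 := e1 x (β' + m) (by linarith) (by linarith) le_rfl
      have e4 : c * (α - α') ≤ c * (x - (α' + m)) :=
        mul_le_mul_of_nonneg_left (by linarith) hc.le
      have e5 : c * (β' - β) ≤ c * (β' + m - x) :=
        mul_le_mul_of_nonneg_left (by linarith) hc.le
      obtain ⟨t, ht, htF⟩ := intermediate_value_Icc (show α' + m ≤ β' + m by linarith)
        L.cont.continuousOn (show t' ∈ Icc (L.F (α' + m)) (L.F (β' + m)) from
          ⟨by linarith, by linarith⟩)
      have hsub : uIcc x t ⊆ Icc (α' + m) (β' + m) :=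
        uIcc_subset_Icc ⟨by linarith, by linarith⟩ ht
      have hmono : MonotoneOn L.F (uIcc x t) := fun u hu v hv huv => by
        have := e1 u v (hsub hu).1 huv (hsub hv).2
        nlinarith
      refine ⟨t, fun z hz => ?_, by rw [Function.iterate_succ_apply, htF, hy']⟩
      refine Kset_add (n := n) (k := 1) (fun l hl => ?_) ?_
      · obtain rfl : l = 0 := by omega
        exact ⟨m, (hsub hz).1, (hsub hz).2⟩
      · refine ht' ?_
        rw [← htF]
        exact hmono.image_uIcc_subset ⟨z, hz, rfl⟩
  refine ⟨ρ, hρ0, fun n x hx => ?_⟩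
  obtain ⟨s, hs, hsF⟩ := key n x hx (L.F^[n] x - ρ) ⟨le_rfl, by linarith⟩
  obtain ⟨t, ht, htF⟩ := key n x hx (L.F^[n] x + ρ) ⟨by linarith, le_rfl⟩
  have hsx : s < x := by
    by_contra! hc
    rw [uIcc_of_le hc] at hs
    have := (Ch_of_Icc_subset_Kset h1.le h4.le hc hs).le (l := n) le_rfl le_rfl hc le_rfl
    linarith
  have hxt : x < t := by
    by_contra! hc
    rw [uIcc_of_ge hc] at ht
    have := (Ch_of_Icc_subset_Kset h1.le h4.le hc ht).le (l := n) le_rfl le_rfl hc le_rfl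
    linarith
  refine ⟨s, t, hsx, hxt, fun z hz => ?_, hsF, htF⟩
  rcases le_total z x with h | h
  · exact hs (by rw [uIcc_of_ge hsx.le]; exact ⟨hz.1, h⟩)
  · exact ht (by rw [uIcc_of_le hxt.le]; exact ⟨h, hz.2⟩)

theorem exists_bounded_distortion {α β C κ ρ : ℝ} (h1 : L.a < α) (h2 : β < L.b) (hC : 0 < C)
    (hκ : 1 < κ) (hρ : 0 < ρ) (hH : ∀ n, ∀ x ∈ L.Kset α β n, C * κ ^ n ≤ deriv (L.F^[n]) x) :
    ∃ M > 0, ∀ n s t, s ≤ t → Icc s t ⊆ L.Kset α β n → L.F^[n] t - L.F^[n] s ≤ ρ →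
      ∀ u ∈ Icc s t, ∀ v ∈ Icc s t, deriv (L.F^[n]) u ≤ M * deriv (L.F^[n]) v := by
  obtain ⟨Λ, hΛ, hd⟩ := exists_distortion (L := L) h1 h2
  have hr0 : 0 ≤ κ⁻¹ := by positivity
  have hr1 : κ⁻¹ < 1 := inv_lt_one_of_one_lt₀ hκ
  refine ⟨Real.exp (Λ * (ρ / C * (1 - κ⁻¹)⁻¹)), Real.exp_pos _,
    fun n s t hst hI hlen u hu v hv => ?_⟩
  refine (hd n s t hI u hu v hv).trans
    (mul_le_mul_of_nonneg_right (Real.exp_le_exp.2 ?_) (deriv_iter_pos h1 h2 (hI hv)).le)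
  refine mul_le_mul_of_nonneg_left ?_ hΛ.le
  have hCh := Ch_of_Icc_subset_Kset h1.le h2.le hst hI
  have hb : ∀ l ∈ Finset.range n, L.F^[l] t - L.F^[l] s ≤ ρ / C * κ⁻¹ ^ (n - 1 - l) := by
    intro l hl
    have hl := Finset.mem_range.1 hl
    have h3 : Icc (L.F^[l] s) (L.F^[l] t) ⊆ L.Kset α β (n - l) := by
      intro z hz
      obtain ⟨w, hw, rfl⟩ := hCh.ivt (l := l) hz.1 hz.2
      refine Kset_iter (k := l) ?_
      rw [Nat.sub_add_cancel hl.le]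
      exact hI hw
    have h4 := Kset_expand hH (hCh.le hl.le le_rfl hst le_rfl) h3
    rw [← Function.iterate_add_apply, ← Function.iterate_add_apply, Nat.sub_add_cancel hl.le] at h4
    have h5 : 0 ≤ L.F^[l] t - L.F^[l] s := sub_nonneg.2 (hCh.le hl.le le_rfl hst le_rfl)
    have h6 : κ ^ (n - 1 - l) ≤ κ ^ (n - l) := pow_le_pow_right₀ hκ.le (by omega)
    rw [inv_pow, div_mul_eq_mul_div, ← div_eq_mul_inv, div_div, le_div_iff₀ (by positivity)]
    have h7 := mul_le_mul_of_nonneg_left h6 (mul_nonneg h5 hC.le)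
    nlinarith
  refine (Finset.sum_le_sum hb).trans ?_
  rw [← Finset.mul_sum, Finset.sum_range_reflect (fun j => κ⁻¹ ^ j) n]
  refine mul_le_mul_of_nonneg_left ?_ (by positivity)
  rw [← tsum_geometric_of_lt_one hr0 hr1]
  exact (summable_geometric_of_lt_one hr0 hr1).sum_le_tsum _ fun _ _ => by positivity

theorem exists_escape_measure {α β ρ : ℝ} (h1 : L.a < α) (h2 : β < L.b) (hρ : 0 < ρ) :
    ∃ m : ℕ, ∃ γ : ℝ≥0∞, 0 < γ ∧ ∀ m' ≥ m, ∀ c : ℝ,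
      γ ≤ volume (Icc (c - ρ) (c + ρ) \ L.Kset α β m') := by
  obtain ⟨m, hm⟩ := exists_no_interval (L := L) h1 h2 (show 0 < ρ / 4 by linarith)
  have hcomp : ∃ γ : ℝ≥0∞, 0 < γ ∧ ∀ c ∈ Icc (0 : ℝ) 1,
      γ ≤ volume (Icc (c - ρ) (c + ρ) \ L.Kset α β m) := by
    refine isCompact_Icc.induction_on (p := fun s => ∃ γ : ℝ≥0∞, 0 < γ ∧ ∀ c ∈ s,
      γ ≤ volume (Icc (c - ρ) (c + ρ) \ L.Kset α β m)) ⟨1, one_pos, by simp⟩ ?_ ?_ ?_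
    · rintro s t hst ⟨γ, hγ, h⟩
      exact ⟨γ, hγ, fun c hc => h c (hst hc)⟩
    · rintro s t ⟨γ, hγ, h⟩ ⟨γ', hγ', h'⟩
      refine ⟨min γ γ', lt_min hγ hγ', fun c hc => ?_⟩
      rcases hc with hc | hc
      · exact (min_le_left _ _).trans (h c hc)
      · exact (min_le_right _ _).trans (h' c hc)
    · intro c _
      refine ⟨Ioo (c - ρ / 2) (c + ρ / 2),
        mem_nhdsWithin_of_mem_nhds (Ioo_mem_nhds (by linarith) (by linarith)),
        volume (Ioo (c - ρ / 2) (c + ρ / 2) \ L.Kset α β m), ?_, ?_⟩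
      · refine (isOpen_Ioo.sdiff (isClosed_Kset _ _ _)).measure_pos _ ?_
        obtain ⟨z, hz, hzK⟩ := not_subset.1 (hm c)
        exact ⟨z, ⟨by linarith [hz.1], by linarith [hz.2]⟩, hzK⟩
      · intro c' hc'
        refine measure_mono (sdiff_subset_sdiff_left fun z hz => ?_)
        exact ⟨by linarith [hz.1, hc'.2], by linarith [hz.2, hc'.1]⟩
  obtain ⟨γ, hγ, h⟩ := hcomp
  refine ⟨m, γ, hγ, fun m' hm' c => ?_⟩
  refine (h (Int.fract c) ⟨Int.fract_nonneg c, (Int.fract_lt_one c).le⟩).trans ?_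
  rw [← measure_preimage_add_right volume ((-⌊c⌋ : ℤ) : ℝ)
    (Icc (Int.fract c - ρ) (Int.fract c + ρ) \ L.Kset α β m)]
  refine measure_mono fun z hz => ?_
  have hc := Int.floor_add_fract c
  obtain ⟨⟨h3, h4⟩, h5⟩ := hz
  rw [Kset_int] at h5
  push_cast at h3 h4
  exact ⟨⟨by linarith, by linarith⟩, fun hz => h5 (Kset_anti _ _ hm' hz)⟩

theorem escape_ratio {α β M ρ c s t : ℝ} {n m : ℕ} {γ : ℝ≥0∞} {N : Set ℝ} (hst : s < t)
    (hI : Icc s t ⊆ L.Kset α β n) (hα : L.a < α) (hβ : β < L.b)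
    (hs : L.F^[n] s = c - ρ) (ht : L.F^[n] t = c + ρ)
    (hM : ∀ u ∈ Icc s t, ∀ v ∈ Icc s t, deriv (L.F^[n]) u ≤ M * deriv (L.F^[n]) v)
    (hγ : γ ≤ volume (Icc (c - ρ) (c + ρ) \ L.Kset α β m))
    (hN : ∀ z ∈ N, L.F^[n] z ∈ L.Kset α β m) :
    ENNReal.ofReal (t - s) * γ ≤ ENNReal.ofReal (2 * ρ * M) * volume (Icc s t \ N) := by
  obtain ⟨v, hv, hvD⟩ := exists_deriv_eq_slope (L.F^[n]) hst (L.cont_iter n).continuousOn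
    (L.diff_iter n).differentiableOn
  have hts : 0 < t - s := by linarith
  have hslope : deriv (L.F^[n]) v = 2 * ρ / (t - s) := by rw [hvD, hs, ht]; ring
  have hLip : LipschitzOnWith (M * (2 * ρ / (t - s))).toNNReal (L.F^[n]) (Icc s t) := by
    refine Convex.lipschitzOnWith_of_nnnorm_deriv_le (fun x _ => L.diff_iter n x) (fun x hx => ?_)
      (convex_Icc s t)
    have h1 := hM x hx v (Ioo_subset_Icc_self hv)
    rw [hslope] at h1
    have h2 := (deriv_iter_pos hα hβ (hI hx)).le
    rw [← Real.toNNReal_coe (r := ‖deriv (L.F^[n]) x‖₊)]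
    refine Real.toNNReal_le_toNNReal ?_
    rwa [coe_nnnorm, Real.norm_of_nonneg h2]
  have himg : Icc (c - ρ) (c + ρ) \ L.Kset α β m ⊆ L.F^[n] '' (Icc s t \ N) := by
    rintro y ⟨hy, hyK⟩
    obtain ⟨z, hz, rfl⟩ := intermediate_value_Icc hst.le (L.cont_iter n).continuousOn
      (show y ∈ Icc (L.F^[n] s) (L.F^[n] t) by rwa [hs, ht])
    exact ⟨z, ⟨hz, fun h => hyK (hN z h)⟩, rfl⟩
  have h1 := (hLip.mono (sdiff_subset (t := N))).hausdorffMeasure_image_le (d := 1) zero_le_one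
  rw [hausdorffMeasure_real, ENNReal.rpow_one] at h1
  have h2 := (hγ.trans (measure_mono himg)).trans h1
  calc ENNReal.ofReal (t - s) * γ
      ≤ ENNReal.ofReal (t - s) * (ENNReal.ofReal (M * (2 * ρ / (t - s))) * volume (Icc s t \ N)) := by
        gcongr
        exact h2
    _ = _ := by
        rw [← mul_assoc, ← ENNReal.ofReal_mul hts.le]
        congr 2
        field_simp

/-- Pull-back intervals of radius `ρ` around the points of `Kset α β n` in `[a, b]`. -/
def pullbacks (L : Lorenz) (α β α' β' ρ : ℝ) (n : ℕ) : Set (ℝ × ℝ) :=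
  {p | Icc p.1 p.2 ⊆ L.Kset α' β' n ∧ ∃ x ∈ L.Kset α β n ∩ Icc L.a L.b, p.1 < x ∧ x < p.2 ∧
    L.F^[n] p.1 = L.F^[n] x - ρ ∧ L.F^[n] p.2 = L.F^[n] x + ρ}

/-- The union of the pull-back intervals. -/
def pullbackSet (L : Lorenz) (α β α' β' ρ : ℝ) (n : ℕ) : Set ℝ :=
  ⋃ p ∈ L.pullbacks α β α' β' ρ n, Ioo p.1 p.2

theorem pullbackSet_le {α β α' β' ρ M R : ℝ} {n m : ℕ} {γ : ℝ≥0∞} (hα : L.a < α') (hβ : β' < L.b)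
    (hR : ∀ p ∈ L.pullbacks α β α' β' ρ n, p.2 - p.1 ≤ R)
    (hM : ∀ s t, s ≤ t → Icc s t ⊆ L.Kset α' β' n → L.F^[n] t - L.F^[n] s ≤ 2 * ρ →
      ∀ u ∈ Icc s t, ∀ v ∈ Icc s t, deriv (L.F^[n]) u ≤ M * deriv (L.F^[n]) v)
    (hγ : ∀ c : ℝ, γ ≤ volume (Icc (c - ρ) (c + ρ) \ L.Kset α' β' m)) :
    γ * volume (L.pullbackSet α β α' β' ρ n) ≤ 5 * ENNReal.ofReal (2 * ρ * M) *
      volume (L.pullbackSet α β α' β' ρ n \ L.pullbackSet α β α' β' ρ (n + m)) := by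
  set T := L.pullbacks α β α' β' ρ n
  set N := L.pullbackSet α β α' β' ρ (n + m) with hN
  have hlt : ∀ p ∈ T, p.1 < p.2 := fun p hp => by
    obtain ⟨-, x, -, h1, h2, -⟩ := hp; exact h1.trans h2
  obtain ⟨u, huT, hdisj, hcov⟩ :=
    Vitali.exists_disjoint_subfamily_covering_enlargement_closedBall T
      (fun p => (p.1 + p.2) / 2) (fun p => (p.2 - p.1) / 2) (R / 2)
      (fun p hp => by linarith [hR p hp]) 5 (by norm_num)
  have hball : ∀ p : ℝ × ℝ, Metric.closedBall ((p.1 + p.2) / 2) ((p.2 - p.1) / 2) = Icc p.1 p.2 :=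
    fun p => (Real.Icc_eq_closedBall _ _).symm
  simp only [hball] at hdisj
  have hcount : u.Countable := hdisj.countable_of_nonempty_interior fun p hp => by
    rw [interior_Icc]; exact nonempty_Ioo.2 (hlt p (huT hp))
  have hNopen : IsOpen N := isOpen_biUnion fun p _ => isOpen_Ioo
  have hNK : ∀ z ∈ N, L.F^[n] z ∈ L.Kset α' β' m := by
    intro z hz
    obtain ⟨p, hp, hzp⟩ := mem_iUnion₂.1 hz
    refine Kset_iter ?_
    rw [add_comm]
    exact hp.1 (Ioo_subset_Icc_self hzp)
  have hone : ∀ p ∈ u, ENNReal.ofReal (p.2 - p.1) * γ ≤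
      ENNReal.ofReal (2 * ρ * M) * volume (Ioo p.1 p.2 \ N) := by
    intro p hp
    obtain ⟨hI, x, -, hx1, hx2, hF1, hF2⟩ := huT hp
    have h1 := escape_ratio (hlt p (huT hp)) hI hα hβ hF1 hF2
      (hM _ _ (hlt p (huT hp)).le hI (by linarith)) (hγ _) hNK
    refine h1.trans (le_of_eq ?_)
    congr 1
    exact measure_congr ((Ioo_ae_eq_Icc (μ := volume)).symm.diff (ae_eq_refl _))
  have hsum : ∑' p : u, volume (Ioo p.1.1 p.1.2 \ N) ≤
      volume (L.pullbackSet α β α' β' ρ n \ N) := by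
    rw [← measure_biUnion hcount (fun p hp q hq hpq => ?_) fun p _ =>
      measurableSet_Ioo.diff hNopen.measurableSet]
    · refine measure_mono (iUnion₂_subset fun p hp => sdiff_subset_sdiff_left ?_)
      exact subset_biUnion_of_mem (u := fun p : ℝ × ℝ => Ioo p.1 p.2) (huT hp)
    · exact (hdisj hp hq hpq).mono (sdiff_subset.trans Ioo_subset_Icc_self)
        (sdiff_subset.trans Ioo_subset_Icc_self)
  have hcover : volume (L.pullbackSet α β α' β' ρ n) ≤ ∑' p : u, 5 * ENNReal.ofReal (p.1.2 - p.1.1) := by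
    calc volume (L.pullbackSet α β α' β' ρ n)
        ≤ volume (⋃ p ∈ u, Metric.closedBall ((p.1 + p.2) / 2) (5 * ((p.2 - p.1) / 2))) := by
          refine measure_mono (iUnion₂_subset fun p hp => ?_)
          obtain ⟨q, hq, hpq⟩ := hcov p hp
          rw [hball] at hpq
          exact (Ioo_subset_Icc_self.trans hpq).trans (subset_biUnion_of_mem
            (u := fun p : ℝ × ℝ => Metric.closedBall ((p.1 + p.2) / 2) (5 * ((p.2 - p.1) / 2))) hq)
      _ ≤ ∑' p : u, volume (Metric.closedBall ((p.1.1 + p.1.2) / 2) (5 * ((p.1.2 - p.1.1) / 2))) :=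
          measure_biUnion_le volume hcount _
      _ = _ := by
          refine tsum_congr fun p => ?_
          rw [Real.volume_closedBall, show 2 * (5 * ((p.1.2 - p.1.1) / 2)) = 5 * (p.1.2 - p.1.1) by
            ring, ENNReal.ofReal_mul (by norm_num)]
          norm_num
  calc γ * volume (L.pullbackSet α β α' β' ρ n)
      ≤ γ * ∑' p : u, 5 * ENNReal.ofReal (p.1.2 - p.1.1) := by gcongr
    _ = 5 * ∑' p : u, ENNReal.ofReal (p.1.2 - p.1.1) * γ := by
        rw [ENNReal.tsum_mul_left, ENNReal.tsum_mul_right]; ring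
    _ ≤ 5 * ∑' p : u, ENNReal.ofReal (2 * ρ * M) * volume (Ioo p.1.1 p.1.2 \ N) := by
        have := ENNReal.tsum_le_tsum fun p : u => hone p.1 p.2
        gcongr 5 * ?_
    _ = 5 * ENNReal.ofReal (2 * ρ * M) * ∑' p : u, volume (Ioo p.1.1 p.1.2 \ N) := by
        rw [ENNReal.tsum_mul_left]; ring
    _ ≤ _ := by gcongr

theorem exists_measure_Kset_le {α β : ℝ} (hα : L.a < α) (hβ : β < L.b)
    (hg : Tendsto L.refl.g atTop (nhds 0)) :
    ∃ C > 0, ∃ θ > 0, θ < 1 ∧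
      ∀ n, volume (L.Kset α β n ∩ Icc L.a L.b) ≤ ENNReal.ofReal (C * θ ^ n) := by
  have hα' : L.a < (L.a + α) / 2 := by linarith
  have hβ' : (β + L.b) / 2 < L.b := by linarith
  obtain ⟨C, hC, κ, hκ, hH⟩ := hyp hα' hβ' hg
  set α' := (L.a + α) / 2
  set β' := (β + L.b) / 2
  obtain ⟨ρ, hρ, hpull⟩ := exists_pullback (α := α) (β := β) hα' (by simp only [α']; linarith)
    (by simp only [β']; linarith) hβ' hC hκ hH
  obtain ⟨M, hM0, hM⟩ := exists_bounded_distortion hα' hβ' hC hκ (show 0 < 2 * ρ by linarith) hH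
  obtain ⟨m0, γ, hγ0, hγ⟩ := exists_escape_measure (L := L) hα' hβ' hρ
  obtain ⟨m1, hm1⟩ := pow_unbounded_of_one_lt (2 / C) hκ
  set m := m0 + m1 + 1 with hm
  set V := fun n => volume (L.pullbackSet α β α' β' ρ n) with hV
  have hκm : 2 < C * κ ^ m := by
    have : κ ^ m1 ≤ κ ^ m := pow_le_pow_right₀ hκ.le (by omega)
    rw [div_lt_iff₀ hC] at hm1
    nlinarith
  have hlen : ∀ n, ∀ p ∈ L.pullbacks α β α' β' ρ n, p.2 - p.1 ≤ 2 * ρ / C := by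
    rintro n p ⟨hI, x, -, h1, h2, h3, h4⟩
    have h5 := Kset_expand hH (h1.trans h2).le hI
    have h6 : 1 ≤ κ ^ n := one_le_pow₀ hκ.le
    rw [le_div_iff₀ hC]
    have : 0 ≤ C * (p.2 - p.1) := mul_nonneg hC.le (by linarith)
    nlinarith
  have hVfin : ∀ n, V n ≤ ENNReal.ofReal (L.b - L.a + 2 * (2 * ρ / C)) := by
    intro n
    rw [show L.b - L.a + 2 * (2 * ρ / C) = (L.b + 2 * ρ / C) - (L.a - 2 * ρ / C) by ring,
      ← Real.volume_Icc]
    refine measure_mono (iUnion₂_subset fun p hp z hz => ?_)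
    have h0 := hlen n p hp
    obtain ⟨-, x, ⟨-, hx⟩, h1, h2, -⟩ := hp
    exact ⟨by linarith [hx.1, hz.1], by linarith [hx.2, hz.2]⟩
  have hsub : ∀ n, L.pullbackSet α β α' β' ρ (n + m) ⊆ L.pullbackSet α β α' β' ρ n := by
    intro n z hz
    obtain ⟨p, ⟨hI, x, ⟨hxK, hx⟩, h1, h2, h3, h4⟩, hzp⟩ := mem_iUnion₂.1 hz
    have hxK' := Kset_anti (L := L) α β (show n ≤ n + m by omega) hxK
    obtain ⟨s, t, hsx, hxt, hJ, hsF, htF⟩ := hpull n x hxK'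
    refine mem_iUnion₂.2 ⟨(s, t), ⟨hJ, x, ⟨hxK', hx⟩, hsx, hxt, hsF, htF⟩, ?_⟩
    have hI' : Icc p.1 p.2 ⊆ L.Kset α' β' n := fun w hw => Kset_anti _ _ (by omega) (hI hw)
    have hCh := Ch_of_Icc_subset_Kset hα'.le hβ'.le (h1.trans h2).le hI'
    have hCh2 := Ch_of_Icc_subset_Kset hα'.le hβ'.le (h1.trans h2).le hI
    have himg : Icc (L.F^[n] p.1) (L.F^[n] p.2) ⊆ L.Kset α' β' m := by
      intro w hw
      obtain ⟨w', hw', rfl⟩ := hCh.ivt (l := n) hw.1 hw.2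
      refine Kset_iter (k := n) ?_
      rw [add_comm]
      exact hI hw'
    have hle := Kset_expand hH (hCh.le le_rfl le_rfl (h1.trans h2).le le_rfl) himg
    rw [← Function.iterate_add_apply, ← Function.iterate_add_apply, add_comm m, h3, h4] at hle
    have hpos : 0 ≤ L.F^[n] p.2 - L.F^[n] p.1 :=
      sub_nonneg.2 (hCh.le le_rfl le_rfl (h1.trans h2).le le_rfl)
    have hdist : L.F^[n] p.2 - L.F^[n] p.1 < ρ ∨ L.F^[n] p.2 - L.F^[n] p.1 ≤ 0 := by
      rcases hpos.eq_or_lt with h | h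
      · right; exact h.symm.le
      · left; nlinarith
    have hdist' : L.F^[n] p.2 - L.F^[n] p.1 < ρ := by
      rcases hdist with h | h <;> linarith
    constructor
    · by_contra! hc
      simp only at hc
      have e1 := hCh.le (l := n) le_rfl hzp.1.le hc (by linarith)
      have e2 := hCh.le (l := n) le_rfl le_rfl hzp.1.le hzp.2.le
      have e3 := hCh.le (l := n) le_rfl h1.le h2.le le_rfl
      linarith
    · by_contra! hc
      simp only at hc
      have e1 := hCh.le (l := n) le_rfl (by linarith) hc hzp.2.le
      have e2 := hCh.le (l := n) le_rfl hzp.1.le hzp.2.le le_rfl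
      have e3 := hCh.le (l := n) le_rfl le_rfl h1.le h2.le
      linarith
  have hγtop : γ ≠ ⊤ := by
    refine ne_top_of_le_ne_top ?_ ((hγ m0 le_rfl 0).trans (measure_mono sdiff_subset))
    simp
  set g := γ.toReal with hgdef
  have hg0 : 0 < g := ENNReal.toReal_pos hγ0.ne' hγtop
  have hVtop : ∀ n, V n ≠ ⊤ := fun n => ne_top_of_le_ne_top ENNReal.ofReal_ne_top (hVfin n)
  have hrec : ∀ n, g * (V n).toReal ≤ 10 * ρ * M * ((V n).toReal - (V (n + m)).toReal) := by
    intro n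
    have h1 := pullbackSet_le (γ := γ) (m := m) (α := α) (β := β) hα' hβ' (hlen n)
      (hM n) (fun c => hγ m (by omega) c)
    rw [measure_sdiff (hsub n) (isOpen_biUnion fun p _ => isOpen_Ioo).measurableSet.nullMeasurableSet
      (hVtop _)] at h1
    have h2 := ENNReal.toReal_mono (ENNReal.mul_ne_top (ENNReal.mul_ne_top (by norm_num)
      ENNReal.ofReal_ne_top) (ne_top_of_le_ne_top (hVtop n) tsub_le_self)) h1
    rw [ENNReal.toReal_mul, ENNReal.toReal_mul, ENNReal.toReal_mul, ENNReal.toReal_sub_of_le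
      (measure_mono (hsub n)) (hVtop n), ENNReal.toReal_ofReal (by positivity)] at h2
    norm_num at h2
    linarith
  set B := L.b - L.a + 2 * (2 * ρ / C) with hB
  have hB0 : 0 < B := by have := L.hab; have : 0 < 2 * ρ / C := by positivity
                         linarith
  set η := max (1 / 2) (1 - g / (10 * ρ * M)) with hη
  have hη0 : 0 < η := lt_of_lt_of_le (by norm_num) (le_max_left _ _)
  have hη1 : η < 1 := max_lt (by norm_num) (by
    have : 0 < g / (10 * ρ * M) := by positivity
    linarith)
  have hstep : ∀ n, (V (n + m)).toReal ≤ η * (V n).toReal := by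
    intro n
    have h1 := hrec n
    have h2 : (V (n + m)).toReal ≤ (1 - g / (10 * ρ * M)) * (V n).toReal := by
      have h3 : g / (10 * ρ * M) * (V n).toReal ≤ (V n).toReal - (V (n + m)).toReal := by
        rw [div_mul_eq_mul_div, div_le_iff₀ (by positivity)]
        linarith
      linarith
    exact h2.trans (mul_le_mul_of_nonneg_right (le_max_right _ _) ENNReal.toReal_nonneg)
  have hiter : ∀ j r, (V (r + j * m)).toReal ≤ B * η ^ j := by
    intro j r
    induction j with
    | zero =>
      have := ENNReal.toReal_mono ENNReal.ofReal_ne_top (hVfin r)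
      rw [ENNReal.toReal_ofReal hB0.le] at this
      simpa using this
    | succ j ih =>
      rw [show r + (j + 1) * m = r + j * m + m by ring]
      refine (hstep _).trans ?_
      rw [pow_succ]
      nlinarith
  have hK : ∀ n, volume (L.Kset α β n ∩ Icc L.a L.b) ≤ V n := by
    intro n
    refine measure_mono fun x hx => ?_
    obtain ⟨s, t, hsx, hxt, hJ, hsF, htF⟩ := hpull n x hx.1
    exact mem_iUnion₂.2 ⟨(s, t), ⟨hJ, x, hx, hsx, hxt, hsF, htF⟩, hsx, hxt⟩
  set θ : ℝ := η ^ (1 / (m : ℝ)) with hθ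
  have hm0 : (0 : ℝ) < m := by positivity
  have hθm : θ ^ m = η := by
    rw [hθ, ← Real.rpow_natCast, ← Real.rpow_mul hη0.le, one_div_mul_cancel hm0.ne', Real.rpow_one]
  have hθ0 : 0 < θ := Real.rpow_pos_of_pos hη0 _
  have hθ1 : θ < 1 := Real.rpow_lt_one hη0.le hη1 (by positivity)
  refine ⟨B / η, by positivity, θ, hθ0, hθ1, fun n => (hK n).trans ?_⟩
  rw [← ENNReal.ofReal_toReal (hVtop n)]
  refine ENNReal.ofReal_le_ofReal ?_
  have h1 := hiter (n / m) (n % m)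
  rw [Nat.mod_add_div' n m] at h1
  refine h1.trans ?_
  rw [div_mul_eq_mul_div, le_div_iff₀ hη0, mul_assoc, ← pow_succ]
  refine mul_le_mul_of_nonneg_left ?_ hB0.le
  rw [← hθm, ← pow_mul]
  refine pow_le_pow_of_le_one hθ0.le hθ1.le ?_
  have := Nat.div_add_mod n m
  have h3 := Nat.mod_lt n (show m > 0 by omega)
  rw [Nat.mul_add]
  omega

/-- `l` is a deep time of `x` on the left: `x` is accumulated through a monotone branch of `F^[l]`
by a point whose image is a translate of `a`, at image distance at most `δ`. -/
def Ldeep (L : Lorenz) (δ : ℝ) (l : ℕ) (x : ℝ) : Prop :=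
  ∃ (u : ℝ) (k : ℤ), u < x ∧ L.Ch l u x ∧ L.F^[l] u = L.a + k ∧ L.F^[l] x ≤ L.a + k + δ

/-- The mirror notion of `Ldeep` at translates of `b`. -/
def Rdeep (L : Lorenz) (δ : ℝ) (l : ℕ) (x : ℝ) : Prop :=
  ∃ (u : ℝ) (k : ℤ), x < u ∧ L.Ch l x u ∧ L.F^[l] u = L.b + k ∧ L.b + k - δ ≤ L.F^[l] x

theorem refl_Ldeep {δ x : ℝ} {l : ℕ} : L.refl.Ldeep δ l x ↔ L.Rdeep δ l (-x) := by
  constructor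
  · rintro ⟨u, k, h1, h2, h3, h4⟩
    have ha : L.refl.a = -L.b := rfl
    rw [refl_iter, ha] at h3 h4
    refine ⟨-u, -k, by linarith, refl_Ch.1 h2, ?_, ?_⟩ <;> push_cast <;> linarith
  · rintro ⟨u, k, h1, h2, h3, h4⟩
    have ha : L.refl.a = -L.b := rfl
    refine ⟨-u, -k, by linarith, refl_Ch.2 (by simpa using h2), ?_, ?_⟩ <;>
      rw [refl_iter, ha] <;> push_cast
    · rw [neg_neg]; linarith
    · linarith

theorem refl_Rdeep {δ x : ℝ} {l : ℕ} : L.refl.Rdeep δ l x ↔ L.Ldeep δ l (-x) := by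
  constructor
  · rintro ⟨u, k, h1, h2, h3, h4⟩
    have ha : L.refl.b = -L.a := rfl
    rw [refl_iter, ha] at h3 h4
    refine ⟨-u, -k, by linarith, refl_Ch.1 h2, ?_, ?_⟩ <;> push_cast <;> linarith
  · rintro ⟨u, k, h1, h2, h3, h4⟩
    have ha : L.refl.b = -L.a := rfl
    refine ⟨-u, -k, by linarith, refl_Ch.2 (by simpa using h2), ?_, ?_⟩ <;>
      rw [refl_iter, ha] <;> push_cast
    · rw [neg_neg]; linarith
    · linarith

/-- A point passing close to `a` at time `l` is deep at time `l`, or the branch of `F^[l]` on its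
left ends at a point which visited `a` at an earlier time, when the point itself was close. -/
theorem exists_near (hg : Tendsto L.g atTop (nhds 0)) {δ : ℝ} (hδ : 0 < δ) :
    ∃ δ' > 0, δ' ≤ δ ∧ ∀ (l : ℕ) (x : ℝ) (k : ℤ), x ∈ L.D l → L.a + k < L.F^[l] x →
      L.F^[l] x ≤ L.a + k + δ' → L.Ldeep δ l x ∨ ∃ j < l, ∃ (t : ℝ) (m : ℤ), t < x ∧ L.Ch l t x ∧
        L.F^[j] t = L.a + m ∧ L.F^[j] x ≤ L.a + m + δ ∧ L.a + k < L.F^[l] t := by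
  obtain ⟨r0, hr0⟩ := eventually_atTop.1 (hg.eventually (ge_mem_nhds hδ))
  obtain ⟨τ, hτ, -, hgap⟩ := L.exists_gap L.a L.a r0
  refine ⟨min δ (τ / 2), by positivity, min_le_left _ _, fun l x k hx h1 h2 => ?_⟩
  have h3 := min_le_left δ (τ / 2)
  have h4 := min_le_right δ (τ / 2)
  rcases ext_left ((Ch_self_of_mem_D hx).anti (Nat.le_succ l)) h1 with
    ⟨t, htx, hch, hF⟩ | ⟨t, hch, hF, j, hj, m, hm⟩
  · exact Or.inl ⟨t, k, htx, hch, hF, by linarith⟩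
  · right
    have htx : t < x := by
      refine lt_of_le_of_ne hch.1 ?_
      rintro rfl
      refine mem_U_iff.1 (hx j hj.le) ⟨m, ?_, hm.le⟩
      linarith [L.hba]
    refine ⟨j, hj, t, m, htx, hch, hm, ?_, hF⟩
    obtain ⟨r, rfl⟩ := Nat.exists_eq_add_of_lt hj
    have h5 : L.F^[j + r + 1] t = L.F^[r + 1] L.a + m := by
      rw [show j + r + 1 = (r + 1) + j by ring, Function.iterate_add_apply, hm, iter_int]
    have hr : r0 < r + 1 := by
      by_contra hcon
      refine hgap (r + 1) (by omega) (m - k) ⟨?_, ?_⟩ <;> push_cast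
      · linarith
      · linarith [hch.le le_rfl le_rfl htx.le le_rfl]
    have h6 : L.Ch (r + 1) (L.F^[j] t) (L.F^[j] x) :=
      Ch.iter (by rwa [show r + 1 + j = j + r + 1 by ring])
    have h7 := h6.int (-m)
    rw [hm, Int.cast_neg, add_neg_cancel_right] at h7
    linarith [le_g h7, hr0 r (by omega)]

theorem exists_pos_of_le (N : ℕ) {s t : ℝ} (hst : s < t) :
    ∃ μ > 0, ∀ l ≤ N, L.Ch l s t → μ ≤ L.F^[l] t - L.F^[l] s := by
  induction N with
  | zero => exact ⟨t - s, by linarith, fun l hl _ => by simp [Nat.le_zero.1 hl]⟩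
  | succ N ih =>
    obtain ⟨μ, hμ, h⟩ := ih
    by_cases hc : L.Ch (N + 1) s t
    · refine ⟨min μ (L.F^[N + 1] t - L.F^[N + 1] s), lt_min hμ ?_, fun l hl hch => ?_⟩
      · linarith [hc.lt le_rfl le_rfl hst le_rfl]
      · rcases Nat.le_succ_iff.1 hl with h1 | rfl
        · exact (min_le_left _ _).trans (h l h1 hch)
        · exact min_le_right _ _
    · refine ⟨μ, hμ, fun l hl hch => ?_⟩
      rcases Nat.le_succ_iff.1 hl with h1 | rfl
      · exact h l h1 hch
      · exact absurd hch hc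

theorem exists_margin (hg : Tendsto L.refl.g atTop (nhds 0)) :
    ∃ δ > 0, ∀ l, L.Ch l ((L.a + L.e) / 2) L.e →
      δ ≤ L.F^[l] L.e - L.F^[l] ((L.a + L.e) / 2) := by
  set a₁ := (L.a + L.e) / 2 with ha₁
  have he1 := L.he1
  have he2 := L.he2
  have hab := L.hab
  have hmem1 : a₁ ∈ Icc L.a L.b := ⟨by linarith, by linarith⟩
  have hmem2 : L.e ∈ Icc L.a L.b := ⟨by linarith, by linarith⟩
  have h1 : L.F a₁ < L.F L.e := L.strictMono hmem1 hmem2 (by linarith)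
  have h2 : L.F L.a < L.F a₁ := L.strictMono ⟨le_rfl, hab.le⟩ hmem1 (by linarith)
  have hFb : L.F L.e + 1 = L.F L.b := by rw [L.heF]; ring
  have hFd : L.F (L.b - 1) + 1 = L.F L.b := by
    rw [← L.per]; ring_nf
  have hFdd : L.F (L.b - 1) > L.F L.a := L.strictAnti ⟨le_rfl, by linarith [L.hba]⟩
    ⟨by linarith [L.hba], le_rfl⟩ (by linarith [L.hba])
  -- the point `y` in `(a, b)` over `F a₁ + 1`
  obtain ⟨y, hy, hyF⟩ : ∃ y ∈ Icc L.a L.b, L.F y = max (L.F L.a) (L.F a₁ + 1) := by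
    have := intermediate_value_Icc hab.le L.cont.continuousOn
    exact this ⟨le_max_left _ _, max_le (by linarith) (by linarith)⟩
  have hyb : y < L.b := by
    refine lt_of_le_of_ne hy.2 ?_
    rintro rfl
    rcases max_choice (L.F L.a) (L.F a₁ + 1) with h | h <;> rw [h] at hyF <;> linarith
  obtain ⟨r0, hr0⟩ := eventually_atTop.1 (hg.eventually (gt_mem_nhds (sub_pos.2 hyb)))
  obtain ⟨μ, hμ, h⟩ := L.exists_pos_of_le r0 (show a₁ < L.e by linarith)
  refine ⟨μ, hμ, fun l hl => h l ?_ hl⟩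
  by_contra hcon
  obtain ⟨r, rfl⟩ : ∃ r, l = r + 1 := ⟨l - 1, by omega⟩
  have h3 : L.Ch (r + 1) y L.b := by
    refine Ch.add (k := 1) (Ch_one hyb.le 0 (by simpa using hy.1) (by simp)) ?_
    have h4 : L.Ch r (L.F^[1] a₁) (L.F^[1] L.e) := hl.iter
    have h5 := h4.int 1
    simp only [Function.iterate_one, Int.cast_one] at h5 ⊢
    rw [hFb] at h5
    refine h5.sub ?_ ?_ le_rfl
    · rw [hyF]; exact le_max_right _ _
    · rw [hyF]; exact max_le (by linarith) (by linarith)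
  have h6 : L.refl.Ch (r + 1) L.refl.a (-y) := refl_Ch.2 (by simpa [refl] using h3)
  have h7 := le_g h6
  have : L.refl.a = -L.b := rfl
  have := hr0 r (by omega)
  linarith

end Lorenz

theorem volume_le_of_expand {P : Set ℝ} {f : ℝ → ℝ} {K : ℝ}
    (h : ∀ x ∈ P, ∀ y ∈ P, x < y → y - x ≤ K * |f y - f x|) :
    volume P ≤ ENNReal.ofReal K * volume (f '' P) := by
  have h' : ∀ x ∈ P, ∀ y ∈ P, |x - y| ≤ K * |f x - f y| := by
    intro x hx y hy
    rcases lt_trichotomy x y with hxy | rfl | hxy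
    · rw [abs_of_neg (by linarith), abs_sub_comm]; linarith [h x hx y hy hxy]
    · simp
    · rw [abs_of_pos (by linarith)]; exact h y hy x hx hxy
  have hinj : InjOn f P := by
    intro x hx y hy hxy
    have := h' x hx y hy
    rw [hxy, sub_self, abs_zero, mul_zero] at this
    linarith [abs_nonpos_iff.1 this]
  have hLip : LipschitzOnWith K.toNNReal (Function.invFunOn f P) (f '' P) := by
    refine LipschitzOnWith.of_dist_le_mul ?_
    rintro _ ⟨x, hx, rfl⟩ _ ⟨y, hy, rfl⟩
    rw [hinj.leftInvOn_invFunOn hx, hinj.leftInvOn_invFunOn hy, Real.dist_eq, Real.dist_eq]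
    exact (h' x hx y hy).trans (mul_le_mul_of_nonneg_right (Real.le_coe_toNNReal K) (abs_nonneg _))
  have h1 := hLip.hausdorffMeasure_image_le (d := 1) zero_le_one
  rw [hausdorffMeasure_real, ENNReal.rpow_one, hinj.leftInvOn_invFunOn.image_image] at h1
  exact h1

namespace Lorenz
variable {L : Lorenz}

/-- Compatible scales `δ' ≤ δ` at the critical point `a`. -/
structure Scales (L : Lorenz) (δ δ' : ℝ) : Prop where
  pos : 0 < δ
  le_da : δ ≤ L.da
  two : 2 * δ < L.b - L.a
  margin : ∀ l, L.Ch l ((L.a + L.e) / 2) L.e → δ < L.F^[l] L.e - L.F^[l] ((L.a + L.e) / 2)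
  pos' : 0 < δ'
  near : ∀ (l : ℕ) (x : ℝ) (k : ℤ), x ∈ L.D l → L.a + k < L.F^[l] x →
      L.F^[l] x ≤ L.a + k + δ' → L.Ldeep δ l x ∨ ∃ j < l, ∃ (t : ℝ) (m : ℤ), t < x ∧ L.Ch l t x ∧
        L.F^[j] t = L.a + m ∧ L.F^[j] x ≤ L.a + m + δ ∧ L.a + k < L.F^[l] t

theorem refl_refl : L.refl.refl = L := by
  cases L
  simp [refl]

theorem exists_scales (hg : Tendsto L.g atTop (nhds 0)) (hg' : Tendsto L.refl.g atTop (nhds 0)) :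
    ∃ δ δ', L.Scales δ δ' ∧ L.refl.Scales δ δ' := by
  obtain ⟨δ₁, h1, hm1⟩ := exists_margin hg'
  obtain ⟨δ₂, h2, hm2⟩ := exists_margin (L := L.refl) (by rwa [refl_refl])
  have hab := L.hab
  have hab' : L.refl.b - L.refl.a = L.b - L.a := by simp [refl]; ring
  have p1 := L.da_pos
  have p2 := L.refl.da_pos
  obtain ⟨δ, hδ, q1, q2, q3, q4, q5⟩ : ∃ δ > 0, δ < δ₁ ∧ δ < δ₂ ∧ δ ≤ L.da ∧ δ ≤ L.refl.da ∧
      2 * δ < L.b - L.a := by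
    set x := min (min δ₁ δ₂) (min (min L.da L.refl.da) (L.b - L.a)) with hx
    have : 0 < x := lt_min (lt_min h1 h2) (lt_min (lt_min p1 p2) (by linarith))
    have e1 : x ≤ δ₁ := (min_le_left _ _).trans (min_le_left _ _)
    have e2 : x ≤ δ₂ := (min_le_left _ _).trans (min_le_right _ _)
    have e3 : x ≤ L.da := (min_le_right _ _).trans ((min_le_left _ _).trans (min_le_left _ _))
    have e4 : x ≤ L.refl.da :=
      (min_le_right _ _).trans ((min_le_left _ _).trans (min_le_right _ _))
    have e5 : x ≤ L.b - L.a := (min_le_right _ _).trans (min_le_right _ _)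
    exact ⟨x / 3, by positivity, by linarith, by linarith, by linarith, by linarith, by linarith⟩
  obtain ⟨δa, a1, a2, a3⟩ := exists_near hg hδ
  obtain ⟨δb, b1, b2, b3⟩ := exists_near hg' hδ
  refine ⟨δ, min δa δb, ⟨hδ, q3, q5, fun l hl => q1.trans_le (hm1 l hl), lt_min a1 b1,
    fun l x k hx h1 h2 => a3 l x k hx h1 ?_⟩, ⟨hδ, q4, by rw [hab']; exact q5,
    fun l hl => q2.trans_le (hm2 l hl), lt_min a1 b1, fun l x k hx h1 h2 => b3 l x k hx h1 ?_⟩⟩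
  · linarith [min_le_left δa δb]
  · linarith [min_le_right δa δb]

theorem Scales.near_b {δ δ' : ℝ} (hs : L.refl.Scales δ δ') {l : ℕ} {x : ℝ} {k : ℤ} (hx : x ∈ L.D l)
    (h1 : L.F^[l] x < L.b + k) (h2 : L.b + k - δ' ≤ L.F^[l] x) :
    L.Rdeep δ l x ∨ ∃ j < l, ∃ (t : ℝ) (m : ℤ), x < t ∧ L.Ch l x t ∧
        L.F^[j] t = L.b + m ∧ L.b + m - δ ≤ L.F^[j] x := by
  have ha : L.refl.a = -L.b := rfl
  rcases hs.near l (-x) (-k) (refl_D.2 (by simpa using hx))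
    (by rw [ha, refl_iter, neg_neg]; push_cast; linarith)
    (by rw [ha, refl_iter, neg_neg]; push_cast; linarith) with h | ⟨j, hj, t, m, c1, c2, c3, c4, -⟩
  · left
    simpa using refl_Ldeep.1 h
  · right
    rw [ha, refl_iter] at c3 c4
    rw [neg_neg] at c4
    refine ⟨j, hj, -t, -m, by linarith, by simpa using refl_Ch.1 c2, ?_, ?_⟩ <;>
      push_cast <;> linarith

theorem Scales.mem_arc {δ δ' : ℝ} (hs : L.Scales δ δ') (hs' : L.refl.Scales δ δ') {l : ℕ} {x : ℝ}
    (hx : x ∈ L.D l) (h0 : ¬ L.Ldeep δ l x ∧ ¬ L.Rdeep δ l x)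
    (h : ∀ j, 1 ≤ j → j < l → ¬ L.Ldeep δ j x ∧ ¬ L.Rdeep δ j x) :
    L.F^[l] x ∈ arc (L.a + δ') (L.b - δ') ∨
    (∃ m q : ℤ, L.a + m < x ∧ L.Ch l (L.a + m) x ∧ x ≤ L.a + m + δ ∧ L.a + q < L.F^[l] (L.a + m) ∧
      L.F^[l] x < L.b + q) ∨
    (∃ m : ℤ, x < L.b + m ∧ L.b + m - δ ≤ x) := by
  obtain ⟨q, hq1, hq2⟩ := hx l le_rfl
  rcases le_total (L.F^[l] x) (L.a + q + δ') with h1 | h1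
  · rcases hs.near l x q hx hq1 h1 with h2 | ⟨j, hj, t, m, c1, c2, c3, c4, c5⟩
    · exact absurd h2 h0.1
    · rcases Nat.eq_zero_or_pos j with rfl | hj0
      · simp only [Function.iterate_zero, id] at c3 c4
        subst c3
        exact Or.inr (Or.inl ⟨m, q, c1, c2, c4, c5, hq2⟩)
      · exact absurd ⟨t, m, c1, c2.anti hj.le, c3, c4⟩ (h j hj0 hj).1
  · rcases le_total (L.b + q - δ') (L.F^[l] x) with h2 | h2
    · rcases hs'.near_b hx hq2 h2 with h3 | ⟨j, hj, t, m, c1, c2, c3, c4⟩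
      · exact absurd h3 h0.2
      · rcases Nat.eq_zero_or_pos j with rfl | hj0
        · simp only [Function.iterate_zero, id] at c3 c4
          subst c3
          exact Or.inr (Or.inr ⟨m, c1, c4⟩)
        · exact absurd ⟨t, m, c1, c2.anti hj.le, c3, c4⟩ (h j hj0 hj).2
    · exact Or.inl ⟨q, by linarith, by linarith⟩

/-- Points close to `a` whose orbit stays in the gaps up to time `m` without deep times. -/
def E (L : Lorenz) (δ : ℝ) (m : ℕ) : Set ℝ := {y | L.a < y ∧ y ≤ L.a + δ ∧ y ∈ L.D m ∧
  ∀ l, 1 ≤ l → l ≤ m → ¬ L.Ldeep δ l y ∧ ¬ L.Rdeep δ l y}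

theorem Scales.mem_arc_of_E {δ δ' : ℝ} (hs : L.Scales δ δ') (hs' : L.refl.Scales δ δ') {k l m : ℕ}
    {y : ℝ} (hy : y ∈ L.E δ m) (hk : ¬ L.Ch (k + 1) L.a y) (hk1 : 1 ≤ k) (hkl : k ≤ l)
    (hlm : l ≤ m) : L.F^[l] y ∈ arc (L.a + δ') (L.b - δ') := by
  obtain ⟨h1, h2, h3, h4⟩ := hy
  have htwo := hs.two
  have hba := L.hba
  have hpos := hs.pos
  rcases hs.mem_arc hs' (D_anti hlm h3) (h4 l (by omega) hlm)
    (fun j hj hjl => h4 j hj (by omega)) with h | ⟨i, q, c1, c2, c3, c4, c5⟩ | ⟨i, c1, c2⟩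
  · exact h
  · exfalso
    have e1 : (i : ℝ) < 1 := by linarith
    have e2 : (-1 : ℝ) < i := by linarith
    have e1 : i < 1 := by exact_mod_cast e1
    have e2 : -1 < i := by exact_mod_cast e2
    obtain rfl : i = 0 := by omega
    simp only [Int.cast_zero, add_zero] at c2 c4
    refine hk (Ch.anti (n := l + 1) ⟨c2.1, fun l' hl' => ?_⟩ (by omega))
    rcases Nat.lt_succ_iff_lt_or_eq.1 hl' with h | rfl
    · exact c2.2 l' h
    · exact ⟨q, c4.le, c5.le⟩
  · exfalso
    rcases lt_or_ge i 0 with hi | hi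
    · have : (i : ℝ) ≤ -1 := by exact_mod_cast Int.le_sub_one_of_lt hi
      linarith
    · have : (0 : ℝ) ≤ i := by exact_mod_cast hi
      linarith

theorem Scales.exists_room {δ δ' : ℝ} (hs : L.Scales δ δ')
    (hg' : Tendsto L.refl.g atTop (nhds 0)) :
    ∃ μ > 0, ∀ (k m : ℕ) (y : ℝ), y ∈ L.E δ m → k ≤ m →
      L.F^[k] y ∈ arc (L.a + δ') (L.b - δ') →
      ∃ t, y < t ∧ L.Ch k y t ∧ μ ≤ L.F^[k] t - L.F^[k] y := by
  have hpos := hs.pos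
  have hpos' := hs.pos'
  have hba := L.hba
  have htwo := hs.two
  obtain ⟨r0, hr0⟩ := eventually_atTop.1 (hg'.eventually (gt_mem_nhds hpos))
  obtain ⟨μ, hμ, h⟩ := L.exists_pos_of_le r0 (show L.b - δ < L.b by linarith)
  refine ⟨min μ δ', lt_min hμ hpos', fun k m y ⟨y1, y2, y3, y4⟩ hkm ⟨q, hq1, hq2⟩ => ?_⟩
  rcases ext_right ((Ch_self_of_mem_D (D_anti hkm y3)).anti (Nat.le_succ k))
    (show L.F^[k] y < L.b + q by linarith) with ⟨t, h1, h2, h3⟩ | ⟨t, h1, h2, l, hl, i, hi⟩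
  · exact ⟨t, h1, h2, by linarith [min_le_right μ δ']⟩
  · have hyt : y < t := by
      refine lt_of_le_of_ne h1.1 ?_
      rintro rfl
      refine mem_U_iff.1 (y3 l (by omega)) ⟨i + 1, ?_, ?_⟩ <;> push_cast <;> linarith
    refine ⟨t, hyt, h1, (min_le_left _ _).trans ?_⟩
    have hl1 : L.F^[l] y < L.b + i - δ := by
      by_contra hcon
      rcases Nat.eq_zero_or_pos l with rfl | hl0
      · simp only [Function.iterate_zero, id] at hi hcon
        have : (-1 : ℝ) < i := by linarith
        have : -1 < i := by exact_mod_cast this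
        have : (0 : ℝ) ≤ i := by exact_mod_cast (by omega : 0 ≤ i)
        linarith
      · exact (y4 l hl0 (by omega)).2 ⟨t, i, hyt, h1.anti hl.le, hi, by linarith⟩
    obtain ⟨r, rfl⟩ := Nat.exists_eq_add_of_lt hl
    have h6 : L.Ch (r + 1) (L.F^[l] y) (L.F^[l] t) :=
      Ch.iter (by rwa [show r + 1 + l = l + r + 1 by ring])
    have h7 := h6.int (-i)
    rw [hi, Int.cast_neg, add_neg_cancel_right] at h7
    have h8 : L.Ch (r + 1) (L.b - δ) L.b := h7.sub (by linarith) (by linarith) le_rfl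
    have h9 : L.refl.Ch (r + 1) L.refl.a (-(L.b - δ)) := refl_Ch.2 (by simpa [refl] using h8)
    have h10 := le_g h9
    have ha : L.refl.a = -L.b := rfl
    have hr : r + 1 ≤ r0 := by
      by_contra hcon
      have := hr0 r (by omega)
      linarith
    refine (h _ hr h8).trans ?_
    have e1 : ∀ z, L.F^[l + r + 1] z = L.F^[r + 1] (L.F^[l] z + -i) + i := by
      intro z
      have := L.iter_int (r + 1) (L.F^[l] z) (-i)
      push_cast at this
      rw [this, neg_add_cancel_right, show l + r + 1 = (r + 1) + l by ring,
        Function.iterate_add_apply]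
    rw [e1 t, e1 y, hi, add_neg_cancel_right]
    have := h7.le le_rfl le_rfl (show L.F^[l] y + -i ≤ L.b - δ by linarith) (by linarith)
    linarith

/-- Points of `E` that separate from `a` exactly at time `k` and then stay away from the critical
points during `j` further steps, with room on the right at time `k`. -/
def P (L : Lorenz) (δ δ' μ : ℝ) (k j : ℕ) : Set ℝ := {y | L.a < y ∧ y ≤ L.a + δ ∧ L.Ch k L.a y ∧
  ¬ L.Ch (k + 1) L.a y ∧ L.F^[k] y ∈ L.Kset (L.a + δ') (L.b - δ') (j + 1) ∧
  ∃ t, y < t ∧ L.Ch k y t ∧ μ ≤ L.F^[k] t - L.F^[k] y}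

theorem Scales.E_subset {δ δ' μ : ℝ} (hs : L.Scales δ δ') (hs' : L.refl.Scales δ δ')
    (hμ : ∀ (k m : ℕ) (y : ℝ), y ∈ L.E δ m → k ≤ m →
      L.F^[k] y ∈ arc (L.a + δ') (L.b - δ') →
      ∃ t, y < t ∧ L.Ch k y t ∧ μ ≤ L.F^[k] t - L.F^[k] y) (m : ℕ) :
    L.E δ m ⊆ Ioc L.a (L.a + L.g m) ∪
      ⋃ p ∈ Finset.HasAntidiagonal.antidiagonal m, L.P δ δ' μ p.1 p.2 := by
  intro y hy
  obtain ⟨h1, h2, h3, h4⟩ := id hy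
  by_cases hm : L.Ch (m + 1) L.a y
  · exact Or.inl ⟨h1, by linarith [le_g hm]⟩
  · right
    classical
    have hex : ∃ k, ¬ L.Ch (k + 1) L.a y := ⟨m, hm⟩
    obtain ⟨k, hk, hmin⟩ : ∃ k, ¬ L.Ch (k + 1) L.a y ∧ ∀ j < k, L.Ch (j + 1) L.a y :=
      ⟨Nat.find hex, Nat.find_spec hex, fun j hj => not_not.1 (Nat.find_min hex hj)⟩
    have htwo := hs.two
    have hpos := hs.pos
    have hk1 : 1 ≤ k := by
      by_contra hcon
      obtain rfl : k = 0 := by omega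
      exact hk (Ch_one h1.le 0 (by simp) (by push_cast; linarith))
    have hkm : k ≤ m := by
      by_contra hcon
      exact hm (hmin m (by omega))
    have hch : L.Ch k L.a y := by
      have := hmin (k - 1) (by omega)
      rwa [Nat.sub_add_cancel hk1] at this
    have harc : ∀ l, k ≤ l → l ≤ m → L.F^[l] y ∈ arc (L.a + δ') (L.b - δ') :=
      fun l hl hlm => hs.mem_arc_of_E hs' hy hk hk1 hl hlm
    refine mem_iUnion₂.2 ⟨(k, m - k), by simp [Finset.HasAntidiagonal.mem_antidiagonal]; omega, h1, h2, hch, hk, ?_,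
      hμ k m y hy hkm (harc k le_rfl hkm)⟩
    intro l hl
    rw [← Function.iterate_add_apply]
    exact harc _ (by omega) (by simp at hl; omega)

theorem P_subset_Ioc {δ δ' μ : ℝ} {k j : ℕ} :
    L.P δ δ' μ (k + 1) j ⊆ Ioc (L.a + L.g (k + 1)) (L.a + L.g k) := by
  rintro y ⟨h1, h2, h3, h4, -⟩
  refine ⟨?_, by linarith [le_g h3]⟩
  by_contra hcon
  exact h4 (Ch_of_le_g h1.le (by linarith))

theorem P_zero {δ δ' μ : ℝ} (hs : L.Scales δ δ') {j : ℕ} : L.P δ δ' μ 0 j = ∅ := by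
  ext y
  simp only [mem_empty_iff_false, iff_false]
  rintro ⟨h1, h2, h3, h4, -⟩
  have htwo := hs.two
  have hpos := hs.pos
  exact h4 (Ch_one h1.le 0 (by simp) (by push_cast; linarith))

theorem Ch.image_le {k : ℕ} {s t : ℝ} (h : L.Ch (k + 1) s t) :
    L.F^[k + 1] t - L.F^[k + 1] s ≤ L.F L.b - L.F L.a := by
  obtain ⟨m, h1, h2⟩ := h.2 k (by omega)
  have hst := h.le (l := k) (by omega) le_rfl h.1 le_rfl
  have hab := L.hab
  have e1 := (L.strictMono_int m).monotoneOn ⟨le_rfl, by linarith⟩ ⟨h1, hst.trans h2⟩ h1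
  have e2 := (L.strictMono_int m).monotoneOn ⟨h1.trans hst, h2⟩ ⟨by linarith, le_rfl⟩ h2
  rw [L.per_int] at e1 e2
  rw [Function.iterate_succ_apply', Function.iterate_succ_apply']
  linarith

theorem P_expand {δ δ' μ : ℝ} (hμ : 0 < μ) (hδ' : 0 < δ') {k j : ℕ} {x y : ℝ}
    (hx : x ∈ L.P δ δ' μ (k + 1) j) (hy : y ∈ L.P δ δ' μ (k + 1) j) (hxy : x < y) :
    y - x ≤ (Real.exp (L.C * (k + 1)) * ((L.F L.b - L.F L.a) / ((L.a + 1 - L.b) * μ))) *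
      |L.F^[k + 1] y - L.F^[k + 1] x| := by
  obtain ⟨x1, -, x3, x4, x5, -⟩ := hx
  obtain ⟨-, -, y3, -, -, t, t1, t2, t3⟩ := hy
  have hch : L.Ch (k + 1) L.a t := y3.join t2
  have hX := x5 0 (by omega)
  simp only [Function.iterate_zero, id] at hX
  obtain ⟨q, q1, q2⟩ := hX
  have hax := hch.lt le_rfl le_rfl x1 (by linarith)
  have hxy' := hch.lt le_rfl x1.le hxy t1.le
  have hyt := hch.lt le_rfl (by linarith) t1 le_rfl
  have hab := L.hab
  have hba := L.hba
  have hd2 := L.hd2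
  have hroom : L.a + 1 - L.b ≤ L.F^[k + 1] x - L.F^[k + 1] L.a := by
    obtain ⟨p1, p2⟩ := orbit_a (L := L) (n := k + 1) (by omega)
    set p := ⌊((k + 1 : ℕ) : ℝ) * L.rm⌋
    have hpq : p < q := by
      rcases lt_trichotomy p q with h | rfl | h
      · exact h
      · exfalso
        refine x4 ⟨x1.le, fun l hl => ?_⟩
        rcases Nat.lt_succ_iff_lt_or_eq.1 hl with h | rfl
        · exact x3.2 l h
        · exact ⟨p, p1.le, by linarith⟩
      · have : (q : ℝ) + 1 ≤ p := by exact_mod_cast h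
        linarith
    have : (p : ℝ) + 1 ≤ q := by exact_mod_cast hpq
    linarith
  have h1 := hch.crossRatio_le x1 hxy t1
  have h2 := le_mul_crossRatio_right x1 hxy t1
  have hcr0 := crossRatio_nonneg x1 hxy t1
  have htle : t - y ≤ 1 := by
    have := Ch_a_le hch
    linarith
  have hsum : ∑ l ∈ Finset.range (k + 1), (L.F^[l] y - L.F^[l] L.a) ≤ k + 1 := by
    calc _ ≤ ∑ l ∈ Finset.range (k + 1), (1 : ℝ) := Finset.sum_le_sum fun l hl => by
          obtain ⟨m, m1, m2⟩ := y3.2 l (Finset.mem_range.1 hl)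
          linarith
      _ = _ := by simp
  have hexp : Real.exp (L.C * ∑ l ∈ Finset.range (k + 1), (L.F^[l] y - L.F^[l] L.a)) ≤
      Real.exp (L.C * (k + 1)) :=
    Real.exp_le_exp.2 (mul_le_mul_of_nonneg_left hsum L.hC)
  have hTS := hch.image_le
  have hcr : crossRatio (L.F^[k + 1] L.a) (L.F^[k + 1] x) (L.F^[k + 1] y) (L.F^[k + 1] t) ≤
      (L.F L.b - L.F L.a) / ((L.a + 1 - L.b) * μ) * (L.F^[k + 1] y - L.F^[k + 1] x) := by
    unfold crossRatio
    rw [div_mul_eq_mul_div]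
    refine div_le_div₀ ?_ ?_ (by have : 0 < L.a + 1 - L.b := by linarith
                                 positivity) ?_
    · refine mul_nonneg ?_ (by linarith)
      linarith
    · rw [mul_comm]
      exact mul_le_mul_of_nonneg_right hTS (by linarith)
    · exact mul_le_mul hroom t3 hμ.le (by linarith)
  rw [abs_of_pos (by linarith)]
  calc y - x ≤ (t - y) * crossRatio L.a x y t := h2
    _ ≤ 1 * crossRatio L.a x y t := mul_le_mul_of_nonneg_right htle hcr0
    _ ≤ Real.exp (L.C * (k + 1)) * crossRatio (L.F^[k + 1] L.a) (L.F^[k + 1] x) (L.F^[k + 1] y)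
        (L.F^[k + 1] t) := by
      rw [one_mul]
      exact h1.trans (mul_le_mul_of_nonneg_right hexp (crossRatio_nonneg hax hxy' hyt))
    _ ≤ _ := by
      rw [mul_assoc]
      exact mul_le_mul_of_nonneg_left hcr (Real.exp_nonneg _)

theorem volume_window {S : Set ℝ} (hS : ∀ (x : ℝ) (m : ℤ), x ∈ S → x + m ∈ S)
    (hS' : S ⊆ arc L.a L.b) (s G : ℝ) :
    volume (S ∩ Icc s (s + G)) ≤ (⌈G⌉₊ + 2 : ℕ) * volume (S ∩ Icc L.a L.b) := by
  set m0 := ⌊s - L.a⌋ with hm0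
  have hsub : S ∩ Icc s (s + G) ⊆ ⋃ i ∈ Finset.range (⌈G⌉₊ + 2),
      (fun x : ℝ => x + -((m0 + i : ℤ) : ℝ)) ⁻¹' (S ∩ Icc L.a L.b) := by
    rintro x ⟨hx, hx1, hx2⟩
    obtain ⟨m, m1, m2⟩ := hS' hx
    have e1 := Int.floor_le (s - L.a)
    have e2 := Int.lt_floor_add_one (s - L.a)
    rw [← hm0] at e1 e2
    have hba := L.hba
    have e3 : (m0 : ℝ) < m + 1 := by linarith
    have e3 : m0 < m + 1 := by exact_mod_cast e3
    obtain ⟨i, hi⟩ := Int.eq_ofNat_of_zero_le (show 0 ≤ m - m0 by omega)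
    have hmi : m = m0 + i := by omega
    have e4 : (i : ℝ) < ⌈G⌉₊ + 2 := by
      have := Nat.le_ceil G
      have : (m : ℝ) = m0 + i := by exact_mod_cast hmi
      linarith
    refine mem_iUnion₂.2 ⟨i, Finset.mem_range.2 (by exact_mod_cast e4), ?_, ?_⟩
    · have := hS x (-(m0 + i)) hx
      push_cast at this ⊢
      exact this
    · have : (m : ℝ) = m0 + i := by exact_mod_cast hmi
      constructor <;> push_cast <;> linarith
  refine (measure_mono hsub).trans ((measure_biUnion_finset_le _ _).trans ?_)
  simp only [measure_preimage_add_right, Finset.sum_const, Finset.card_range, nsmul_eq_mul]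
  exact le_rfl

theorem exists_volume_P_le {δ δ' μ : ℝ} (hs : L.Scales δ δ') (hμ : 0 < μ)
    (hg' : Tendsto L.refl.g atTop (nhds 0)) : ∃ K > 0, ∃ θ > 0, θ < 1 ∧ ∀ k j,
      volume (L.P δ δ' μ (k + 1) j) ≤ ENNReal.ofReal (K * Real.exp (L.C * (k + 1)) * θ ^ j) := by
  have hpos' := hs.pos'
  obtain ⟨C, hC, θ, h0, h1, h⟩ := L.exists_measure_Kset_le (show L.a < L.a + δ' by linarith)
    (show L.b - δ' < L.b by linarith) hg'
  set G := L.F L.b - L.F L.a with hG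
  have hG0 : 0 < G := sub_pos.2 (L.strictMono ⟨le_rfl, L.hab.le⟩ ⟨L.hab.le, le_rfl⟩ L.hab)
  have hgap : 0 < L.a + 1 - L.b := by linarith [L.hba]
  refine ⟨G / ((L.a + 1 - L.b) * μ) * ((⌈G⌉₊ + 2) * C), by positivity, θ, h0, h1, fun k j => ?_⟩
  have e1 := volume_le_of_expand (P := L.P δ δ' μ (k + 1) j) (f := L.F^[k + 1])
    (fun x hx y hy hxy => P_expand hμ hs.pos' hx hy hxy)
  have e2 : L.F^[k + 1] '' L.P δ δ' μ (k + 1) j ⊆ L.Kset (L.a + δ') (L.b - δ') (j + 1) ∩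
      Icc (L.F^[k + 1] L.a) (L.F^[k + 1] L.a + G) := by
    rintro _ ⟨y, ⟨y1, y2, y3, y4, y5, -⟩, rfl⟩
    exact ⟨y5, y3.le le_rfl le_rfl y1.le le_rfl, by linarith [y3.image_le]⟩
  refine e1.trans ((mul_le_mul_right ((measure_mono e2).trans
    ((volume_window (fun x m hx => (Kset_int m).2 hx) (fun x hx => arc_mono (by linarith)
      (by linarith) (hx 0 (by omega))) _ _).trans
      (mul_le_mul_right (h (j + 1)) _))) _).trans ?_)
  rw [← ENNReal.ofReal_natCast, ← ENNReal.ofReal_mul (by positivity),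
    ← ENNReal.ofReal_mul (by positivity)]
  refine ENNReal.ofReal_le_ofReal ?_
  push_cast
  have : θ ^ (j + 1) ≤ θ ^ j := pow_le_pow_of_le_one h0.le h1.le (by omega)
  calc _ = G / ((L.a + 1 - L.b) * μ) * ((⌈G⌉₊ + 2) * C) * Real.exp (L.C * (k + 1)) * θ ^ (j + 1) := by
        ring
    _ ≤ _ := mul_le_mul_of_nonneg_left this (by positivity)

end Lorenz

theorem tsum_antidiagonal (f : ℕ → ℕ → ℝ≥0∞) :
    ∑' m, ∑ p ∈ Finset.HasAntidiagonal.antidiagonal m, f p.1 p.2 = ∑' k, ∑' j, f k j := by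
  rw [← ENNReal.tsum_prod (f := f), ← Finset.HasAntidiagonal.sigmaAntidiagonalEquivProd.tsum_eq,
    ENNReal.tsum_sigma']
  refine tsum_congr fun m => ?_
  rw [← Finset.tsum_subtype]
  rfl

namespace Lorenz
variable {L : Lorenz}

theorem summable_mul_sub {g : ℕ → ℝ} (hs : Summable g) (h0 : ∀ n, 0 ≤ g n)
    (hanti : ∀ n, g (n + 1) ≤ g n) : Summable fun k : ℕ => (k + 1 : ℝ) * (g k - g (k + 1)) := by
  refine summable_of_sum_range_le (c := ∑' k, g k)
    (fun k => mul_nonneg (by positivity) (sub_nonneg.2 (hanti k))) fun n => ?_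
  have key : ∑ k ∈ Finset.range n, (k + 1 : ℝ) * (g k - g (k + 1)) =
      ∑ k ∈ Finset.range n, g k - n * g n := by
    induction n with
    | zero => simp
    | succ n ih => rw [Finset.sum_range_succ, Finset.sum_range_succ, ih]; push_cast; ring
  rw [key]
  have := hs.sum_le_tsum (Finset.range n) fun i _ => h0 i
  have : 0 ≤ (n : ℝ) * g n := mul_nonneg (by positivity) (h0 n)
  linarith

theorem tsum_volume_P {δ δ' μ : ℝ} (hs : L.Scales δ δ') (hμ : 0 < μ) (hg : Summable L.g)
    (hg' : Tendsto L.refl.g atTop (nhds 0)) :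
    ∑' k, ∑' j, volume (L.P δ δ' μ k j) ≠ ∞ := by
  obtain ⟨K, hK, θ, h0, h1, h⟩ := exists_volume_P_le hs hμ hg'
  obtain ⟨B, hB⟩ := exists_pow_lt_of_lt_one (show 0 < 1 / 2 * Real.exp (-L.C) by positivity) h1
  have hBC : Real.exp L.C * θ ^ B ≤ 1 / 2 := by
    have := mul_le_mul_of_nonneg_left hB.le (Real.exp_pos L.C).le
    rwa [mul_left_comm, ← Real.exp_add, add_neg_cancel, Real.exp_zero, mul_one] at this
  have h1' : 0 < 1 - θ := by linarith
  set H : ℕ → ℝ := fun k => B * ((k + 1 : ℝ) * (L.g k - L.g (k + 1))) +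
    K / (1 - θ) * (1 / 2) ^ k with hH
  have hHs : Summable H :=
    ((summable_mul_sub hg g_nonneg fun n => g_anti (Nat.le_succ n)).mul_left _).add
      ((summable_geometric_of_lt_one (by norm_num) (by norm_num)).mul_left _)
  have hle : ∀ k, ∑' j, volume (L.P δ δ' μ (k + 1) j) ≤ ENNReal.ofReal (H k) := by
    intro k
    have hd : 0 ≤ L.g k - L.g (k + 1) := sub_nonneg.2 (g_anti (Nat.le_succ k))
    rw [← ENNReal.summable.sum_add_tsum_nat_add' (k := B * (k + 1)), hH,
      ENNReal.ofReal_add (by positivity) (by positivity)]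
    refine add_le_add ?_ ?_
    · calc _ ≤ ∑ j ∈ Finset.range (B * (k + 1)), ENNReal.ofReal (L.g k - L.g (k + 1)) := by
            refine Finset.sum_le_sum fun j _ => (measure_mono P_subset_Ioc).trans ?_
            rw [Real.volume_Ioc]
            exact ENNReal.ofReal_le_ofReal (by linarith)
        _ = _ := by
            rw [Finset.sum_const, Finset.card_range, nsmul_eq_mul, ← ENNReal.ofReal_natCast,
              ← ENNReal.ofReal_mul (by positivity)]
            congr 1; push_cast; ring
    · have hterm : ∀ j, volume (L.P δ δ' μ (k + 1) (j + B * (k + 1))) ≤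
          ENNReal.ofReal (K * (1 / 2) ^ k * θ ^ j) := by
        intro j
        refine (h k _).trans (ENNReal.ofReal_le_ofReal ?_)
        have e1 : Real.exp (L.C * (k + 1)) * θ ^ (B * (k + 1)) ≤ (1 / 2) ^ k := by
          have : Real.exp (L.C * (k + 1)) * θ ^ (B * (k + 1)) = (Real.exp L.C * θ ^ B) ^ (k + 1) := by
            rw [mul_pow, ← Real.exp_nat_mul, ← pow_mul]
            push_cast
            congr 2; ring
          rw [this]
          exact (pow_le_pow_left₀ (by positivity) hBC _).trans
            (pow_le_pow_of_le_one (by norm_num) (by norm_num) (by omega))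
        calc _ = K * (Real.exp (L.C * (k + 1)) * θ ^ (B * (k + 1))) * θ ^ j := by
              rw [pow_add]; ring
          _ ≤ _ := mul_le_mul_of_nonneg_right (mul_le_mul_of_nonneg_left e1 hK.le) (by positivity)
      refine (ENNReal.tsum_le_tsum hterm).trans ?_
      rw [← ENNReal.ofReal_tsum_of_nonneg (fun j => by positivity)
        ((summable_geometric_of_lt_one h0.le h1).mul_left _), tsum_mul_left,
        tsum_geometric_of_lt_one h0.le h1]
      refine ENNReal.ofReal_le_ofReal (le_of_eq ?_)
      field_simp
  rw [tsum_eq_zero_add' ENNReal.summable]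
  simp only [P_zero hs, measure_empty, tsum_zero, zero_add]
  exact ne_top_of_le_ne_top hHs.tsum_ofReal_ne_top (ENNReal.tsum_le_tsum hle)

theorem Scales.tsum_volume_E {δ δ' : ℝ} (hs : L.Scales δ δ') (hs' : L.refl.Scales δ δ')
    (hg : Summable L.g) (hg' : Tendsto L.refl.g atTop (nhds 0)) :
    ∑' m, volume (L.E δ m) ≠ ∞ := by
  obtain ⟨μ, hμ, hroom⟩ := hs.exists_room hg'
  have hle : ∀ m, volume (L.E δ m) ≤ ENNReal.ofReal (L.g m) +
      ∑ p ∈ Finset.HasAntidiagonal.antidiagonal m, volume (L.P δ δ' μ p.1 p.2) := by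
    intro m
    refine (measure_mono (hs.E_subset hs' hroom m)).trans ((measure_union_le _ _).trans ?_)
    refine add_le_add ?_ (measure_biUnion_finset_le _ _)
    rw [Real.volume_Ioc]
    exact ENNReal.ofReal_le_ofReal (by linarith)
  refine ne_top_of_le_ne_top ?_ (ENNReal.tsum_le_tsum hle)
  rw [ENNReal.tsum_add, tsum_antidiagonal fun k j => volume (L.P δ δ' μ k j)]
  exact ENNReal.add_ne_top.2 ⟨hg.tsum_ofReal_ne_top, tsum_volume_P hs hμ hg hg'⟩

theorem Hole.left_le {i : ℕ} {v w v' w' x : ℝ} (h : L.Hole i v w) (h' : L.Hole i v' w')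
    (hx : x ∈ Ioo v w) (hx' : x ∈ Ioo v' w') (hv : v ≤ v') : v = v' ∧ w = w' := by
  obtain ⟨h1, h2, k, h3, h4⟩ := h
  obtain ⟨h1', h2', k', h3', h4'⟩ := h'
  have hv'w : v' < w := hx'.1.trans hx.2
  have hjoin : L.Ch i v w' := (h2.sub le_rfl hv hv'w.le).join h2'
  have e1 := hjoin.le le_rfl le_rfl hv h1'.le
  have e2 := h2.lt le_rfl hv hv'w le_rfl
  rw [h3, h3'] at e1
  rw [h3', h4] at e2
  have hkk : k = k' := by
    have e3 : (k : ℝ) ≤ k' := by linarith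
    have e4 : (k' : ℝ) < k + 1 := by linarith [L.hab]
    have e3 : k ≤ k' := by exact_mod_cast e3
    have e4 : k' < k + 1 := by exact_mod_cast e4
    omega
  subst hkk
  obtain rfl : v = v' := by
    by_contra hne
    have := hjoin.lt le_rfl le_rfl (lt_of_le_of_ne hv hne) h1'.le
    linarith
  refine ⟨rfl, ?_⟩
  rcases lt_trichotomy w w' with h | h | h
  · have := h2'.lt le_rfl h1.le h le_rfl
    linarith
  · exact h
  · have := h2.lt le_rfl h1'.le h le_rfl
    linarith

theorem Hole.eq {i : ℕ} {v w v' w' x : ℝ} (h : L.Hole i v w) (h' : L.Hole i v' w')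
    (hx : x ∈ Ioo v w) (hx' : x ∈ Ioo v' w') : v = v' ∧ w = w' := by
  rcases le_total v v' with hv | hv
  · exact h.left_le h' hx hx' hv
  · exact (h'.left_le h hx' hx hv).imp Eq.symm Eq.symm

/-- The holes of age `i` in the basic gap. -/
def holes (L : Lorenz) (i : ℕ) : Set (ℝ × ℝ) := {p | L.Hole i p.1 p.2 ∧ L.a ≤ p.1 ∧ p.2 ≤ L.b}

theorem holes_disjoint (i : ℕ) :
    (L.holes i).PairwiseDisjoint fun p => Ioo p.1 p.2 := by
  intro p hp q hq hpq
  refine Set.disjoint_left.2 fun x hx hx' => hpq ?_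
  have := hp.1.eq hq.1 hx hx'
  exact Prod.ext this.1 this.2

theorem holes_countable (i : ℕ) : (L.holes i).Countable :=
  (holes_disjoint i).countable_of_isOpen (fun _ _ => isOpen_Ioo) fun _ hp => nonempty_Ioo.2 hp.1.1

theorem tsum_holes : ∑' i, ∑' p : L.holes i, ENNReal.ofReal (p.1.2 - p.1.1) ≤ 1 := by
  have h1 : ∀ i, ∑' p : L.holes i, ENNReal.ofReal (p.1.2 - p.1.1) =
      volume (⋃ p ∈ L.holes i, Ioo p.1 p.2) := by
    intro i
    rw [measure_biUnion (holes_countable i) (holes_disjoint i) fun _ _ => measurableSet_Ioo]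
    simp [Real.volume_Ioo]
  simp only [h1]
  rw [← measure_iUnion]
  · calc _ ≤ volume (Icc L.a L.b) := by
          refine measure_mono (iUnion_subset fun i => iUnion₂_subset fun p hp => ?_)
          exact fun x hx => ⟨by linarith [hp.2.1, hx.1], by linarith [hp.2.2, hx.2]⟩
      _ ≤ 1 := by
          rw [Real.volume_Icc, ← ENNReal.ofReal_one]
          exact ENNReal.ofReal_le_ofReal (by linarith [L.hba])
  · intro i j hij
    refine Set.disjoint_left.2 fun x hx hx' => hij ?_
    obtain ⟨p, hp, hxp⟩ := mem_iUnion₂.1 hx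
    obtain ⟨q, hq, hxq⟩ := mem_iUnion₂.1 hx'
    exact hp.1.eq_of_mem hq.1 hxp hxq
  · exact fun i => MeasurableSet.biUnion (holes_countable i) fun _ _ => measurableSet_Ioo

/-- Points of `D (i + j)` in the basic gap whose last deep time is `i`, on the left. -/
def W (L : Lorenz) (δ : ℝ) (i j : ℕ) : Set ℝ := {x | x ∈ Ioo L.a L.b ∧ x ∈ L.D (i + j) ∧
  L.Ldeep δ i x ∧ ∀ l, i < l → l ≤ i + j → ¬ L.Ldeep δ l x ∧ ¬ L.Rdeep δ l x}

theorem Scales.W_zero {δ δ' : ℝ} (hs : L.Scales δ δ') (j : ℕ) : L.W δ 0 j ⊆ L.E δ j := by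
  rintro x ⟨⟨h1, h2⟩, h3, ⟨u, k, h4, -, h5, h6⟩, h7⟩
  simp only [Function.iterate_zero, id] at h5 h6
  have htwo := hs.two
  have hpos := hs.pos
  have hba := L.hba
  have e1 : (k : ℝ) < 1 := by linarith
  have e2 : (-1 : ℝ) < k := by linarith
  have e1 : k < 1 := by exact_mod_cast e1
  have e2 : -1 < k := by exact_mod_cast e2
  obtain rfl : k = 0 := by omega
  rw [zero_add] at h3 h7
  exact ⟨h1, by simpa using h6, h3, fun l hl hlj => h7 l (by omega) hlj⟩

theorem Ldeep.exists_hole {δ x : ℝ} {i : ℕ} (hx : x ∈ Ioo L.a L.b) (h : L.Ldeep δ (i + 1) x) :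
    ∃ (v w : ℝ) (k : ℤ), (v, w) ∈ L.holes (i + 1) ∧ L.F^[i + 1] w = L.a + k ∧ w < x ∧
      L.Ch (i + 1) w x ∧ L.F^[i + 1] x ≤ L.a + k + δ := by
  obtain ⟨w, k, h1, h2, h3, h4⟩ := h
  have hab := L.hab
  have hba := L.hba
  obtain ⟨v, hvw, hch, hv⟩ : ∃ v < w, L.Ch (i + 1) v w ∧ L.F^[i + 1] v = L.b - 1 + k := by
    rcases ext_left (h2.sub le_rfl le_rfl h1.le) (show L.b - 1 + k < L.F^[i + 1] w by
      rw [h3]; linarith) with h5 | ⟨t, h5, h6, l, hl, m, h7⟩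
    · exact h5
    · exfalso
      have h8 : L.F^[i + 1] t = L.F^[i + 1 - l] L.a + m := by
        rw [← iter_int, ← h7, ← Function.iterate_add_apply, Nat.sub_add_cancel hl.le]
      have h9 := h5.le le_rfl le_rfl h5.1 le_rfl
      refine orbit_a_notMem (L := L) (n := i + 1 - l) (by omega) (k - m) ⟨?_, ?_⟩ <;> push_cast <;>
        linarith [L.hd2]
  obtain ⟨m, m1, m2⟩ := (hch.join h2).2 0 (by omega)
  simp only [Function.iterate_zero, id] at m1 m2
  have e1 : (-1 : ℝ) < m := by linarith [hx.1]
  have e1 : -1 < m := by exact_mod_cast e1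
  have e1 : (0 : ℝ) ≤ m := by exact_mod_cast (by omega : 0 ≤ m)
  exact ⟨v, w, k, ⟨⟨hvw, hch, k, hv, h3⟩, by simp only; linarith, by simp only; linarith [hx.2]⟩,
    h3, h1, h2, h4⟩

theorem Scales.mem_E_of_W {δ δ' : ℝ} (hs : L.Scales δ δ') {i j : ℕ} {x v w : ℝ} {k : ℤ}
    (hx : x ∈ L.W δ i j) (hh : L.Hole i v w) (hk : L.F^[i] w = L.a + k) (hwx : w < x)
    (hch : L.Ch i w x) (hd : L.F^[i] x ≤ L.a + k + δ) : L.F^[i] x + (-k : ℤ) ∈ L.E δ j := by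
  obtain ⟨hab, hD, -, hno⟩ := hx
  have h1 := hch.lt le_rfl le_rfl hwx le_rfl
  have hda : δ ≤ (L.e - L.a) / 2 := hs.le_da.trans (min_le_left _ _)
  have he1 := L.he1
  have he2 := L.he2
  have hba := L.hba
  have key : ∀ z l, L.F^[l] (z + ((-k : ℤ) : ℝ)) = L.F^[l] z - k := by
    intro z l
    rw [iter_int]; push_cast; ring
  refine ⟨by push_cast; linarith, by push_cast; linarith,
    (D_int _).2 (D_iter (by rwa [add_comm])), fun l hl hlj => ⟨?_, ?_⟩⟩
  · rintro ⟨u, q, u1, u2, u3, u4⟩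
    refine (hno (l + i) (by omega) (by omega)).1 ?_
    push_cast at u1
    obtain ⟨m, m1, m2⟩ := u2.2 0 (by omega)
    simp only [Function.iterate_zero, id] at m1 m2
    push_cast at m2
    have e1 : (-1 : ℝ) < m := by linarith
    have e1 : -1 < m := by exact_mod_cast e1
    have e1 : (0 : ℝ) ≤ m := by exact_mod_cast (by omega : 0 ≤ m)
    obtain ⟨u', ⟨hu1, hu2⟩, hu⟩ := hch.ivt (l := i) (T := u + k) (by linarith) (by linarith)
    have hch' := u2.int k
    rw [← hu, Int.cast_neg, neg_add_cancel_right] at hch'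
    rw [key, ← Function.iterate_add_apply] at u4
    refine ⟨u', q + k, ?_, (hch.sub hu1 hu2 le_rfl).add hch', ?_, ?_⟩
    · exact lt_of_le_of_ne hu2 (by rintro rfl; linarith)
    · rw [Function.iterate_add_apply, hu, iter_int, u3]; push_cast; ring
    · push_cast; linarith
  · rintro ⟨u, q, u1, u2, u3, u4⟩
    refine (hno (l + i) (by omega) (by omega)).2 ?_
    push_cast at u1
    have hue : u ≤ L.e := by
      by_contra hcon
      have hya : L.F^[i] x + ((-k : ℤ) : ℝ) ≤ (L.a + L.e) / 2 := by push_cast; linarith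
      have e1 := hs.margin l (u2.sub hya (by linarith) (not_le.1 hcon).le)
      have e2 := u2.le le_rfl le_rfl hya (by linarith)
      have e3 := u2.le le_rfl (x := L.e) (by linarith) (not_le.1 hcon).le le_rfl
      linarith
    obtain ⟨t, t1, t2, t3⟩ := hh.ext hk
    have hxt : x ≤ t := by
      by_contra hcon
      have := hch.lt le_rfl t1.le (not_le.1 hcon) le_rfl
      linarith
    have hxt' : L.Ch i x t := t2.sub (by linarith [hh.1]) hxt le_rfl
    obtain ⟨u', ⟨hu1, hu2⟩, hu⟩ := hxt'.ivt (l := i) (T := u + k) (by linarith) (by linarith)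
    have hch' := u2.int k
    rw [← hu, Int.cast_neg, neg_add_cancel_right] at hch'
    rw [key, ← Function.iterate_add_apply] at u4
    refine ⟨u', q + k, ?_, (hxt'.sub le_rfl hu1 hu2).add hch', ?_, ?_⟩
    · exact lt_of_le_of_ne hu1 (by rintro rfl; linarith)
    · rw [Function.iterate_add_apply, hu, iter_int, u3]; push_cast; ring
    · push_cast; linarith

theorem Scales.volume_W_le {δ δ' : ℝ} (hs : L.Scales δ δ') (i j : ℕ) :
    volume (L.W δ (i + 1) j) ≤ ENNReal.ofReal (2 * L.Ka) *
      (∑' p : L.holes (i + 1), ENNReal.ofReal (p.1.2 - p.1.1)) * volume (L.E δ j) := by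
  set Q : ℝ × ℝ → Set ℝ := fun p => {x | p.2 < x ∧ L.Ch (i + 1) p.2 x ∧ ∃ k : ℤ,
    L.F^[i + 1] p.2 = L.a + k ∧ L.F^[i + 1] x ≤ L.a + k + δ ∧
    L.F^[i + 1] x + (-k : ℤ) ∈ L.E δ j} with hQ
  have hsub : L.W δ (i + 1) j ⊆ ⋃ p ∈ L.holes (i + 1), Q p := by
    intro x hx
    obtain ⟨v, w, k, h1, h2, h3, h4, h5⟩ := Ldeep.exists_hole hx.1 hx.2.2.1
    exact mem_iUnion₂.2 ⟨(v, w), h1, h3, h4, k, h2, h5, hs.mem_E_of_W hx h1.1 h2 h3 h4 h5⟩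
  have hvol : ∀ p ∈ L.holes (i + 1), volume (Q p) ≤
      ENNReal.ofReal (2 * L.Ka) * ENNReal.ofReal (p.2 - p.1) * volume (L.E δ j) := by
    rintro ⟨v, w⟩ ⟨hh, -⟩
    have hKa := L.Ka_pos
    obtain ⟨k, hkv, hkw⟩ := hh.2.2
    simp only at hkv hkw hh
    rw [← ENNReal.ofReal_mul (by positivity)]
    refine (volume_le_of_expand (f := L.F^[i + 1]) (K := 2 * L.Ka * (w - v)) ?_).trans ?_
    · rintro x ⟨hx1, -⟩ y ⟨hy1, hy2, k', hy3, hy4, -⟩ hxy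
      simp only at hx1 hy1 hy2 hy3
      refine (hh.koebe hy3 hy2 (hy4.trans (by linarith [hs.le_da])) hx1.le hxy.le).trans ?_
      exact mul_le_mul_of_nonneg_left (le_abs_self _)
        (mul_nonneg (by positivity) (by linarith [hh.1]))
    · refine mul_le_mul_right ?_ _
      calc _ ≤ volume ((fun y : ℝ => y + (-k : ℤ)) ⁻¹' L.E δ j) := by
            refine measure_mono ?_
            rintro _ ⟨x, ⟨-, -, k', hk', -, hx⟩, rfl⟩
            simp only at hk'
            have : (k : ℝ) = k' := by linarith
            obtain rfl : k = k' := by exact_mod_cast this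
            exact hx
        _ = _ := measure_preimage_add_right _ _ _
  refine (measure_mono hsub).trans ((measure_biUnion_le _ (holes_countable _) _).trans ?_)
  rw [← ENNReal.tsum_mul_left, ← ENNReal.tsum_mul_right]
  exact ENNReal.tsum_le_tsum fun p => hvol p.1 p.2

theorem Scales.tsum_volume_W {δ δ' : ℝ} (hs : L.Scales δ δ')
    (hE : ∑' m, volume (L.E δ m) ≠ ∞) :
    ∑' n, volume (⋃ p ∈ Finset.HasAntidiagonal.antidiagonal n, L.W δ p.1 p.2) ≠ ∞ := by
  set c : ℕ → ℝ≥0∞ := fun i => ∑' p : L.holes i, ENNReal.ofReal (p.1.2 - p.1.1) with hc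
  have hle : ∀ n, volume (⋃ p ∈ Finset.HasAntidiagonal.antidiagonal n, L.W δ p.1 p.2) ≤
      ∑ p ∈ Finset.HasAntidiagonal.antidiagonal n, volume (L.W δ p.1 p.2) :=
    fun n => measure_biUnion_finset_le _ _
  refine ne_top_of_le_ne_top ?_ (ENNReal.tsum_le_tsum hle)
  rw [tsum_antidiagonal fun i j => volume (L.W δ i j), tsum_eq_zero_add' ENNReal.summable]
  refine ENNReal.add_ne_top.2 ⟨ne_top_of_le_ne_top hE
    (ENNReal.tsum_le_tsum fun j => measure_mono (hs.W_zero j)), ?_⟩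
  refine ne_top_of_le_ne_top ?_ (ENNReal.tsum_le_tsum fun i => ENNReal.tsum_le_tsum fun j =>
    hs.volume_W_le i j)
  simp only [ENNReal.tsum_mul_left, ENNReal.tsum_mul_right]
  refine ENNReal.mul_ne_top (ENNReal.mul_ne_top ENNReal.ofReal_ne_top ?_) hE
  refine ne_top_of_le_ne_top ENNReal.one_ne_top (le_trans ?_ (tsum_holes (L := L)))
  rw [tsum_eq_zero_add' (f := c) ENNReal.summable]
  exact le_add_self

theorem Scales.D_subset {δ δ' : ℝ} (hs : L.Scales δ δ') (hs' : L.refl.Scales δ δ') (n : ℕ) :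
    L.D n ∩ Ioo L.a L.b ⊆ (L.Kset (L.a + δ') (L.b - δ') (n + 1) ∩ Icc L.a L.b) ∪
      ((⋃ p ∈ Finset.HasAntidiagonal.antidiagonal n, L.W δ p.1 p.2) ∪
      Neg.neg ⁻¹' (⋃ p ∈ Finset.HasAntidiagonal.antidiagonal n, L.refl.W δ p.1 p.2)) := by
  classical
  rintro x ⟨hD, hab⟩
  by_cases hex : ∃ l ≤ n, L.Ldeep δ l x ∨ L.Rdeep δ l x
  · right
    obtain ⟨i, hi, hdeep, hmax⟩ : ∃ i ≤ n, (L.Ldeep δ i x ∨ L.Rdeep δ i x) ∧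
        ∀ l, i < l → l ≤ n → ¬ L.Ldeep δ l x ∧ ¬ L.Rdeep δ l x := by
      set Q : ℕ → Prop := fun l => L.Ldeep δ l x ∨ L.Rdeep δ l x with hQ
      obtain ⟨l, hl, hlQ⟩ := hex
      refine ⟨Nat.findGreatest Q n, Nat.findGreatest_le n, Nat.findGreatest_spec (P := Q) hl hlQ,
        fun j hj hjn => ?_⟩
      exact not_or.1 (Nat.findGreatest_is_greatest (P := Q) hj hjn)
    have hin : i + (n - i) = n := by omega
    rcases hdeep with h | h
    · left
      refine mem_iUnion₂.2 ⟨(i, n - i), by simp [Finset.HasAntidiagonal.mem_antidiagonal, hin],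
        hab, ?_, h, ?_⟩
      · simpa only [hin] using hD
      · simpa only [hin] using hmax
    · right
      refine mem_iUnion₂.2 ⟨(i, n - i), by simp [Finset.HasAntidiagonal.mem_antidiagonal, hin],
        ?_, ?_, ?_, ?_⟩
      · simpa [refl, and_comm] using hab
      · simp only [hin]
        exact refl_D.2 (by simpa using hD)
      · exact refl_Ldeep.2 (by simpa using h)
      · intro l hl hln
        simp only [hin] at hln
        rw [refl_Ldeep, refl_Rdeep, neg_neg]
        exact (hmax l hl hln).symm
  · left
    push Not at hex
    refine ⟨fun l hl => ?_, hab.1.le, hab.2.le⟩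
    rcases hs.mem_arc hs' (D_anti (show l ≤ n by omega) hD) (hex l (by omega))
      (fun j _ hjl => hex j (by omega)) with h | ⟨m, q, c1, -, c3, -⟩ | ⟨m, c1, c2⟩
    · exact h
    · exact absurd ⟨L.a + m, m, c1, Ch_zero c1.le, rfl, c3⟩ (hex 0 (by omega)).1
    · exact absurd ⟨L.b + m, m, c1, Ch_zero c1.le, rfl, c2⟩ (hex 0 (by omega)).2

theorem tsum_volume_D (hg : Summable L.g) (hg' : Summable L.refl.g) :
    ∑' n, volume (L.D n ∩ Ioo L.a L.b) ≠ ∞ := by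
  obtain ⟨δ, δ', hs, hs'⟩ := exists_scales hg.tendsto_atTop_zero hg'.tendsto_atTop_zero
  have hs'' : L.refl.refl.Scales δ δ' := by rwa [refl_refl]
  have hE := hs.tsum_volume_E hs' hg hg'.tendsto_atTop_zero
  have hE' := hs'.tsum_volume_E hs'' hg' (by rw [refl_refl]; exact hg.tendsto_atTop_zero)
  have hpos := hs.pos'
  obtain ⟨C, hC, θ, h0, h1, h⟩ := L.exists_measure_Kset_le (show L.a < L.a + δ' by linarith)
    (show L.b - δ' < L.b by linarith) hg'.tendsto_atTop_zero
  have hle : ∀ n, volume (L.D n ∩ Ioo L.a L.b) ≤ ENNReal.ofReal (C * θ ^ (n + 1)) +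
      (volume (⋃ p ∈ Finset.HasAntidiagonal.antidiagonal n, L.W δ p.1 p.2) +
        volume (⋃ p ∈ Finset.HasAntidiagonal.antidiagonal n, L.refl.W δ p.1 p.2)) := by
    intro n
    refine (measure_mono (hs.D_subset hs' n)).trans ((measure_union_le _ _).trans
      (add_le_add (h (n + 1)) ((measure_union_le _ _).trans (add_le_add_right ?_ _))))
    rw [Measure.measure_preimage_neg]
  refine ne_top_of_le_ne_top ?_ (ENNReal.tsum_le_tsum hle)
  rw [ENNReal.tsum_add, ENNReal.tsum_add]
  refine ENNReal.add_ne_top.2 ⟨?_, ENNReal.add_ne_top.2 ⟨hs.tsum_volume_W hE,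
    hs'.tsum_volume_W hE'⟩⟩
  refine Summable.tsum_ofReal_ne_top (Summable.mul_left _ ?_)
  exact (summable_nat_add_iff 1).2 (summable_geometric_of_lt_one h0.le h1)

/-- Points of the critical interval which do not return to it before time `m + 1`. -/
def Rset (L : Lorenz) (m : ℕ) : Set ℝ :=
  {x | x ∈ Icc (L.b - 1) L.a ∧ ∀ l, 1 ≤ l → l ≤ m → L.F^[l] x ∈ L.U}

theorem refl_Rset {m : ℕ} {x : ℝ} : x ∈ L.refl.Rset m ↔ -x + ((-1 : ℤ) : ℝ) ∈ L.Rset m := by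
  have e1 : L.refl.a = -L.b := rfl
  have e2 : L.refl.b = -L.a := rfl
  simp only [Rset, mem_ofPred_eq, refl_U, refl_iter, neg_neg, iter_int, U_int, e1, e2, mem_Icc]
  push_cast
  refine and_congr_left fun _ => ⟨fun h => ⟨?_, ?_⟩, fun h => ⟨?_, ?_⟩⟩ <;> linarith [h.1, h.2]

theorem iter_congr {x y : ℝ} (h : L.F x = L.F y) {l : ℕ} (hl : 1 ≤ l) :
    L.F^[l] x = L.F^[l] y := by
  obtain ⟨k, rfl⟩ : ∃ k, l = k + 1 := ⟨l - 1, by omega⟩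
  rw [Function.iterate_succ_apply, Function.iterate_succ_apply, h]

theorem exists_tsum_Rset_near (h : ∑' n, volume (L.D n ∩ Ioo L.a L.b) ≠ ∞) :
    ∃ s > 0, ∑' m, volume (L.Rset m ∩ Icc (L.a - s) L.a) ≠ ∞ := by
  obtain ⟨s, hs, K, hK, τ, h1, h2, h3, h4⟩ := L.twina
  refine ⟨s, hs, ?_⟩
  have hle : ∀ m, volume (L.Rset m ∩ Icc (L.a - s) L.a) ≤
      ENNReal.ofReal K * volume (L.D m ∩ Ioo L.a L.b) := by
    intro m
    refine (volume_le_of_expand (f := τ) (K := K) ?_).trans (mul_le_mul_right ?_ _)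
    · rintro x ⟨-, hx⟩ y ⟨-, hy⟩ hxy
      refine (h4 x hx y hy hxy.le).2.trans (mul_le_mul_of_nonneg_left ?_ hK.le)
      rw [abs_sub_comm]; exact le_abs_self _
    · calc _ ≤ volume (L.D m ∩ Ioo L.a L.b ∪ {L.a, L.b}) := by
            refine measure_mono ?_
            rintro _ ⟨x, ⟨hx, hx'⟩, rfl⟩
            obtain ⟨e1, e2⟩ := h3 x hx'
            rcases eq_or_lt_of_le e1.1 with h | ha
            · right; left; exact h.symm
            rcases eq_or_lt_of_le e1.2 with h | hb
            · right; right; exact h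
            left
            refine ⟨fun l hl => ?_, ha, hb⟩
            rcases Nat.eq_zero_or_pos l with rfl | hl0
            · exact ⟨0, by simpa using ha, by simpa using hb⟩
            · rw [iter_congr e2 hl0]
              exact hx.2 l hl0 hl
        _ ≤ _ := by
            refine (measure_union_le _ _).trans ?_
            rw [(Set.toFinite {L.a, L.b}).measure_zero, add_zero]
  refine ne_top_of_le_ne_top ?_ (ENNReal.tsum_le_tsum hle)
  rw [ENNReal.tsum_mul_left]
  exact ENNReal.mul_ne_top ENNReal.ofReal_ne_top h

theorem tsum_Rset_middle (h : ∑' n, volume (L.D n ∩ Ioo L.a L.b) ≠ ∞) {s t : ℝ}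
    (hs : L.b - 1 < s) (ht : t < L.a) : ∑' m, volume (L.Rset m ∩ Icc s t) ≠ ∞ := by
  rcases lt_or_ge t s with hst | hst
  · simp [Icc_eq_empty (not_le.2 hst)]
  obtain ⟨z, hz, hmax⟩ := isCompact_Icc.exists_isMaxOn (nonempty_Icc.2 hst)
    (L.cont_deriv.continuousOn (s := Icc s t))
  set c := -deriv L.F z with hc
  have hc0 : 0 < c := neg_pos.2 (L.dneg z ⟨by linarith [hz.1], by linarith [hz.2]⟩)
  have hexp : ∀ x ∈ Icc s t, ∀ y ∈ Icc s t, x ≤ y → L.F y - L.F x ≤ -c * (y - x) := by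
    intro x hx y hy hxy
    rw [hc, neg_neg]
    refine (convex_Icc s t).image_sub_le_mul_sub_of_deriv_le L.cont.continuousOn
      L.diff.differentiableOn (fun u hu => ?_) x hx y hy hxy
    rw [interior_Icc] at hu
    exact hmax ⟨hu.1.le, hu.2.le⟩
  set G := L.F s - L.F t with hG
  have hle : ∀ m, volume (L.Rset (m + 1) ∩ Icc s t) ≤ ENNReal.ofReal (1 / c) *
      ((⌈G⌉₊ + 2 : ℕ) * volume (L.D m ∩ Ioo L.a L.b)) := by
    intro m
    refine (volume_le_of_expand (f := L.F) (K := 1 / c) ?_).trans (mul_le_mul_right ?_ _)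
    · rintro x ⟨-, hx⟩ y ⟨-, hy⟩ hxy
      rw [one_div, inv_mul_eq_div, le_div_iff₀ hc0, abs_sub_comm]
      exact le_trans (by linarith [hexp x hx y hy hxy.le]) (le_abs_self _)
    · have e1 : L.F '' (L.Rset (m + 1) ∩ Icc s t) ⊆ L.D m ∩ Icc (L.F t) (L.F t + G) := by
        rintro _ ⟨x, ⟨hx, hx'⟩, rfl⟩
        refine ⟨fun l hl => ?_, ?_, ?_⟩
        · rw [← Function.iterate_succ_apply]
          exact hx.2 _ (by omega) (by omega)
        · have := hexp x hx' t ⟨hst, le_rfl⟩ hx'.2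
          have : 0 ≤ c * (t - x) := mul_nonneg hc0.le (by linarith [hx'.2])
          linarith
        · have := hexp s ⟨le_rfl, hst⟩ x hx' hx'.1
          have : 0 ≤ c * (x - s) := mul_nonneg hc0.le (by linarith [hx'.1])
          linarith
      refine (measure_mono e1).trans ((volume_window (L := L) (fun x m hx => (D_int m).2 hx)
        (fun x hx => ?_) _ _).trans (mul_le_mul_right (measure_mono ?_) _))
      · obtain ⟨m, m1, m2⟩ := hx 0 (by omega)
        exact ⟨m, m1.le, m2.le⟩
      · rintro x ⟨hx, h1, h2⟩
        refine ⟨hx, ?_, ?_⟩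
        · refine lt_of_le_of_ne h1 ?_
          rintro rfl
          refine mem_U_iff.1 (hx 0 (by omega)) ⟨0, ?_, ?_⟩ <;>
            simp only [Function.iterate_zero, id] <;> push_cast <;> linarith [L.hba]
        · refine lt_of_le_of_ne h2 ?_
          rintro rfl
          refine mem_U_iff.1 (hx 0 (by omega)) ⟨1, ?_, ?_⟩ <;>
            simp only [Function.iterate_zero, id] <;> push_cast <;> linarith [L.hba]
  rw [tsum_eq_zero_add' ENNReal.summable]
  refine ENNReal.add_ne_top.2 ⟨?_, ne_top_of_le_ne_top ?_ (ENNReal.tsum_le_tsum hle)⟩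
  · exact ne_top_of_le_ne_top (by rw [Real.volume_Icc]; exact ENNReal.ofReal_ne_top)
      (measure_mono inter_subset_right)
  · rw [ENNReal.tsum_mul_left, ENNReal.tsum_mul_left]
    exact ENNReal.mul_ne_top ENNReal.ofReal_ne_top
      (ENNReal.mul_ne_top (ENNReal.natCast_ne_top _) h)

theorem tsum_Rset (hg : Summable L.g) (hg' : Summable L.refl.g) : ∑' m, volume (L.Rset m) ≠ ∞ := by
  have hD := tsum_volume_D hg hg'
  have hD' := tsum_volume_D (L := L.refl) hg' (by rwa [refl_refl])
  obtain ⟨s, hs, h1⟩ := exists_tsum_Rset_near hD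
  obtain ⟨s', hs', h2⟩ := exists_tsum_Rset_near hD'
  have h3 := tsum_Rset_middle hD (s := L.b - 1 + s') (t := L.a - s) (by linarith) (by linarith)
  refine ne_top_of_le_ne_top (ENNReal.add_ne_top.2 ⟨ENNReal.add_ne_top.2 ⟨h1, h2⟩, h3⟩) ?_
  rw [← ENNReal.tsum_add, ← ENNReal.tsum_add]
  refine ENNReal.tsum_le_tsum fun m => ?_
  have e1 : L.refl.a = -L.b := rfl
  calc volume (L.Rset m) ≤ volume ((L.Rset m ∩ Icc (L.a - s) L.a ∪
        Neg.neg ⁻¹' ((fun x : ℝ => x + (-1 : ℤ)) ⁻¹' (L.refl.Rset m ∩ Icc (L.refl.a - s') L.refl.a))) ∪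
        L.Rset m ∩ Icc (L.b - 1 + s') (L.a - s)) := by
        refine measure_mono fun x hx => ?_
        rcases le_total (L.a - s) x with h | h
        · exact Or.inl (Or.inl ⟨hx, h, hx.1.2⟩)
        · rcases le_total x (L.b - 1 + s') with h' | h'
          · refine Or.inl (Or.inr ⟨refl_Rset.2 ?_, ?_⟩)
            · convert hx using 1; push_cast; ring
            · rw [e1, mem_Icc]; push_cast
              exact ⟨by linarith, by linarith [hx.1.1]⟩
          · exact Or.inr ⟨hx, h', h⟩
    _ ≤ _ := by
        refine (measure_union_le _ _).trans (add_le_add_left ((measure_union_le _ _).trans ?_) _)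
        rw [Measure.measure_preimage_neg, measure_preimage_add_right]

theorem summable_g_of_tsum_Rset (h : ∑' m, volume (L.Rset m) ≠ ∞) : Summable L.g := by
  obtain ⟨s, hs, K, hK, τ, h1, h2, h3, h4⟩ := L.twina
  set c := min s (1 / K) with hc
  have hc0 : 0 < c := by positivity
  have hle : ∀ m, ENNReal.ofReal (c * L.g m) ≤ volume (L.Rset m) := by
    intro m
    have hg0 := L.g_nonneg m
    have hg1 : L.g m ≤ 1 := by linarith [L.g_le m, L.hba]
    calc ENNReal.ofReal (c * L.g m) = volume (Ioo (L.a - c * L.g m) L.a) := by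
          rw [Real.volume_Ioo]; congr 1; ring
      _ ≤ _ := by
          refine measure_mono fun x hx => ?_
          have k1 : c * L.g m ≤ s := by
            calc c * L.g m ≤ c * 1 := mul_le_mul_of_nonneg_left hg1 hc0.le
              _ ≤ s := by rw [mul_one]; exact min_le_left _ _
          have hx' : x ∈ Icc (L.a - s) L.a := ⟨by linarith [hx.1], hx.2.le⟩
          obtain ⟨e1, e2⟩ := h4 x hx' L.a ⟨by linarith, le_rfl⟩ hx.2.le
          rw [h2] at e1 e2
          have k2 : K * (L.a - x) < L.g m := by
            have : K * c ≤ 1 := by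
              calc K * c ≤ K * (1 / K) := mul_le_mul_of_nonneg_left (min_le_right _ _) hK.le
                _ = 1 := by field_simp
            have h5 : K * (L.a - x) < K * (c * L.g m) :=
              mul_lt_mul_of_pos_left (by linarith [hx.1]) hK
            nlinarith
          have k3 : L.a < τ x := by
            have : 0 < K * (τ x - L.a) := by linarith [hx.2]
            linarith [pos_of_mul_pos_right this hK.le]
          have hD := (L.g_spec m).mem_D (x := τ x) ⟨k3, by linarith⟩
          refine ⟨⟨by linarith [hx'.1], hx.2.le⟩, fun l hl hlm => ?_⟩
          rw [← iter_congr (h3 x hx').2 hl]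
          exact hD l hlm
  have hfin : ∑' m, ENNReal.ofReal (c * L.g m) ≠ ∞ :=
    ne_top_of_le_ne_top h (ENNReal.tsum_le_tsum hle)
  have hsum := ENNReal.summable_toReal hfin
  simp only [ENNReal.toReal_ofReal (mul_nonneg hc0.le (L.g_nonneg _))] at hsum
  exact (summable_mul_left_iff hc0.ne').1 hsum

theorem tsum_refl_Rset : ∑' m, volume (L.refl.Rset m) = ∑' m, volume (L.Rset m) := by
  refine tsum_congr fun m => ?_
  have : L.refl.Rset m = Neg.neg ⁻¹' ((fun x : ℝ => x + (-1 : ℤ)) ⁻¹' L.Rset m) := by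
    ext x; exact refl_Rset
  rw [this, Measure.measure_preimage_neg, measure_preimage_add_right]

/-- The return time is integrable exactly when the survival lengths are summable on both sides. -/
theorem tsum_Rset_iff :
    ∑' m, volume (L.Rset m) ≠ ∞ ↔ Summable L.g ∧ Summable L.refl.g :=
  ⟨fun h => ⟨summable_g_of_tsum_Rset h, summable_g_of_tsum_Rset (by rwa [tsum_refl_Rset])⟩,
    fun h => tsum_Rset h.1 h.2⟩

theorem summable_q_mul_R (S : ConvScheme L.rm) (hg : Summable L.g) :
    Summable fun k => (S.q (2 * k + 1) : ℝ) * L.R S k := by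
  have hR0 := R_pos (L := L) S
  have key : ∀ n, ∑ k ∈ Finset.range (n + 1), (S.q (2 * k + 1) : ℝ) * L.R S k ≤
      2 * ∑ m ∈ Finset.range (S.q (2 * n + 1)), L.g m := by
    intro n
    induction n with
    | zero =>
      have h : (S.q (2 * 0 + 1) : ℝ) * L.R S 0 ≤ ∑ m ∈ Finset.range (S.q (2 * 0 + 1)), L.g m := by
        have := Finset.card_nsmul_le_sum (Finset.range (S.q (2 * 0 + 1))) L.g (L.R S 0)
          fun m hm => R_le_g S (Finset.mem_range.1 hm)
        simpa using this
      have h0 : 0 ≤ (S.q (2 * 0 + 1) : ℝ) * L.R S 0 := mul_nonneg (Nat.cast_nonneg _) (hR0 0).le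
      simp only [zero_add, Finset.sum_range_one]
      linarith
    | succ n ih =>
      have h1 := S.q_rec (2 * n + 1)
      have h2 := S.q_rec (2 * n)
      have hA := S.A_pos (2 * n + 1)
      have hA' := S.A_pos (2 * n)
      have h3 : S.q (2 * n + 1) ≤ S.q (2 * n + 2) := by nlinarith
      have h4 : 2 * S.q (2 * n + 1) ≤ S.q (2 * (n + 1) + 1) := by
        rw [show 2 * (n + 1) + 1 = 2 * n + 1 + 2 by ring, h1]
        rw [show 2 * n + 1 + 1 = 2 * n + 2 by ring]; nlinarith
      have h5 : (2 : ℝ) * S.q (2 * n + 1) ≤ S.q (2 * (n + 1) + 1) := by exact_mod_cast h4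
      have h6 : S.q (2 * n + 1) ≤ S.q (2 * (n + 1) + 1) := by omega
      have h : ((S.q (2 * (n + 1) + 1) : ℝ) - S.q (2 * n + 1)) * L.R S (n + 1) ≤
          ∑ m ∈ Finset.Ico (S.q (2 * n + 1)) (S.q (2 * (n + 1) + 1)), L.g m := by
        have := Finset.card_nsmul_le_sum (Finset.Ico (S.q (2 * n + 1)) (S.q (2 * (n + 1) + 1)))
          L.g (L.R S (n + 1)) fun m hm => R_le_g S (Finset.mem_Ico.1 hm).2
        rw [Nat.card_Ico, nsmul_eq_mul, Nat.cast_sub h6] at this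
        exact this
      rw [Finset.sum_range_succ, ← Finset.sum_range_add_sum_Ico _ h6]
      nlinarith [hR0 (n + 1)]
  refine summable_of_sum_range_le (c := 2 * ∑' m, L.g m)
    (fun k => mul_nonneg (Nat.cast_nonneg _) (hR0 k).le) fun n => ?_
  have h1 := (Finset.sum_le_sum_of_subset_of_nonneg (Finset.range_mono (Nat.le_succ n))
    fun k _ _ => mul_nonneg (Nat.cast_nonneg (S.q (2 * k + 1))) (hR0 k).le).trans (key n)
  have h2 := hg.sum_le_tsum (Finset.range (S.q (2 * n + 1))) fun m _ => g_nonneg m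
  linarith

/-- Summability of the widths `g`, in terms of the distances on the circle at the times of
closest return. -/
theorem summable_g_iff (S : ConvScheme L.rm) : Summable L.g ↔
    Summable fun k => (S.q (2 * k + 1) : ℝ) * ‖((L.R S k : ℝ) : UnitAddCircle)‖ := by
  have hR0 := R_pos (L := L) S
  have hab := L.hab
  have hc : 0 < 1 - (L.b - L.a) := by linarith [L.hba]
  have hR1 : ∀ k, L.R S k ≤ L.b - L.a := fun k =>
    (R_le_g S (Nat.lt_of_lt_of_le one_pos (S.one_le_q _))).trans (g_le 0)
  have hup : ∀ k, ‖((L.R S k : ℝ) : UnitAddCircle)‖ ≤ L.R S k := fun k => by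
    have := round_le (L.R S k) 0
    rw [UnitAddCircle.norm_eq]
    simpa [abs_of_pos (hR0 k)] using this
  have hlow : ∀ k, (1 - (L.b - L.a)) * L.R S k ≤ ‖((L.R S k : ℝ) : UnitAddCircle)‖ := fun k => by
    have h0 := hR0 k
    have h1 := hR1 k
    rw [UnitAddCircle.norm_eq]
    rcases le_or_gt (round (L.R S k)) 0 with h | h
    · have : (round (L.R S k) : ℝ) ≤ 0 := by exact_mod_cast h
      refine le_trans ?_ (le_abs_self _)
      nlinarith
    · have : (1 : ℝ) ≤ round (L.R S k) := by exact_mod_cast h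
      refine le_trans ?_ (neg_le_abs _)
      nlinarith
  refine ⟨fun h => (summable_q_mul_R S h).of_nonneg_of_le (fun k => by positivity)
    fun k => mul_le_mul_of_nonneg_left (hup k) (Nat.cast_nonneg _), fun h => summable_g S ?_⟩
  refine (h.mul_left (1 - (L.b - L.a))⁻¹).of_nonneg_of_le
    (fun k => mul_nonneg (Nat.cast_nonneg _) (hR0 k).le) fun k => ?_
  rw [le_inv_mul_iff₀ hc, mul_left_comm]
  exact mul_le_mul_of_nonneg_left (hlow k) (Nat.cast_nonneg _)

end Lorenz

/-- Passing from `ρ` to `-ρ` shifts the convergents by one. -/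
def ConvScheme.shift {ρ : ℝ} (S : ConvScheme ρ) : ConvScheme (-ρ) where
  q k := S.q (k + 1)
  p k := -S.p (k + 1)
  A k := S.A (k + 1)
  q_rec k := S.q_rec (k + 1)
  p_rec k := by rw [S.p_rec (k + 1)]; ring
  A_pos k := S.A_pos (k + 1)
  q_pos := S.one_le_q 1
  q_le := S.q_le_succ 1
  even k := by have := S.odd k; push_cast; linarith
  odd k := by
    have := S.even (k + 1)
    rw [show 2 * (k + 1) = 2 * k + 1 + 1 by ring] at this
    push_cast; linarith
  dec k := by
    have := S.dec (k + 1)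
    rw [← abs_neg, ← abs_neg (_ - _)] at this
    convert this using 2 <;> push_cast <;> ring
  lt_one := by
    have h1 := S.dec 0
    have h2 := S.lt_one
    rw [← abs_neg] at h1
    refine lt_of_eq_of_lt ?_ (h1.trans h2)
    congr 1; push_cast; ring
  best k l m h h' := by
    have := S.best (k + 1) l (-m) h h'
    rw [← abs_neg, ← abs_neg (_ - ((-m : ℤ) : ℝ))] at this
    convert this using 2 <;> push_cast <;> ring

theorem cfFrac_irrational {ρ : ℝ} (h : Irrational ρ) (k : ℕ) : Irrational (cfFrac ρ k) := by
  induction k with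
  | zero => rw [cfFrac, Int.fract]; exact h.sub_intCast _
  | succ k ih =>
    rw [cfFrac, Int.fract, one_div]; exact ih.inv.sub_intCast _

theorem cfFrac_mem {ρ : ℝ} (h : Irrational ρ) (k : ℕ) : 0 < cfFrac ρ k ∧ cfFrac ρ k < 1 := by
  have h0 : 0 ≤ cfFrac ρ k ∧ cfFrac ρ k < 1 := by
    cases k <;> exact ⟨Int.fract_nonneg _, Int.fract_lt_one _⟩
  exact ⟨lt_of_le_of_ne h0.1 (cfFrac_irrational h k).ne_zero.symm, h0.2⟩

theorem cfA_succ_pos {ρ : ℝ} (h : Irrational ρ) (k : ℕ) : 1 ≤ cfA ρ (k + 1) := by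
  obtain ⟨h1, h2⟩ := cfFrac_mem h k
  rw [cfA, Int.le_floor]
  push_cast
  exact (one_le_div h1).2 h2.le

theorem cfA_toNat {ρ : ℝ} (h : Irrational ρ) (k : ℕ) :
    (((cfA ρ (k + 1)).toNat : ℕ) : ℤ) = cfA ρ (k + 1) :=
  Int.toNat_of_nonneg (zero_le_one.trans (cfA_succ_pos h k))

theorem cfFrac_succ_mul {ρ : ℝ} (h : Irrational ρ) (k : ℕ) :
    cfFrac ρ (k + 1) * cfFrac ρ k = 1 - (cfA ρ (k + 1)).toNat * cfFrac ρ k := by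
  have h1 := (cfFrac_mem h k).1.ne'
  have h2 : (((cfA ρ (k + 1)).toNat : ℕ) : ℝ) = cfA ρ (k + 1) := by exact_mod_cast cfA_toNat h k
  rw [h2, cfFrac, cfA, Int.fract]
  field_simp

/-- Numerators of the convergents of `ρ`. -/
def cfP (ρ : ℝ) : ℕ → ℤ
  | 0 => ⌊ρ⌋
  | 1 => (cfA ρ 1).toNat * ⌊ρ⌋ + 1
  | n + 2 => (cfA ρ (n + 2)).toNat * cfP ρ (n + 1) + cfP ρ n

/-- The signed error of the convergents. -/
def cfErr (ρ : ℝ) (k : ℕ) : ℝ := cfQ ρ k * ρ - cfP ρ k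

theorem cfErr_zero (ρ : ℝ) : cfErr ρ 0 = cfFrac ρ 0 := by
  rw [cfErr, cfQ, cfP, cfFrac, Int.fract]; simp

theorem cfErr_succ {ρ : ℝ} (h : Irrational ρ) (k : ℕ) :
    cfErr ρ (k + 1) = -(cfFrac ρ (k + 1) * cfErr ρ k) := by
  have h0 := cfErr_zero ρ
  induction k with
  | zero =>
    have h1 := cfFrac_succ_mul h 0
    rw [h0, h1, ← h0]
    simp only [cfErr, cfQ, cfP]; push_cast; ring
  | succ k ih =>
    have h1 := cfFrac_succ_mul h (k + 1)
    have h2 : cfErr ρ (k + 2) = (cfA ρ (k + 2)).toNat * cfErr ρ (k + 1) + cfErr ρ k := by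
      simp only [cfErr, cfQ, cfP]; push_cast; ring
    rw [h2, ih]
    linear_combination (-cfErr ρ k) * h1

theorem cfErr_sign {ρ : ℝ} (h : Irrational ρ) (k : ℕ) : 0 < (-1) ^ k * cfErr ρ k := by
  induction k with
  | zero =>
    simpa [cfErr_zero] using (cfFrac_mem h 0).1
  | succ k ih =>
    rw [cfErr_succ h, pow_succ]
    have := mul_pos (cfFrac_mem h (k + 1)).1 ih
    linarith

theorem cfP_mul_cfQ (ρ : ℝ) (k : ℕ) :
    cfP ρ (k + 1) * cfQ ρ k - cfP ρ k * cfQ ρ (k + 1) = (-1) ^ k := by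
  induction k with
  | zero => simp only [cfP, cfQ]; push_cast; ring
  | succ k ih =>
    rw [show cfP ρ (k + 1 + 1) = (cfA ρ (k + 2)).toNat * cfP ρ (k + 1) + cfP ρ k from rfl,
      show cfQ ρ (k + 1 + 1) = (cfA ρ (k + 2)).toNat * cfQ ρ (k + 1) + cfQ ρ k from rfl]
    push_cast
    rw [pow_succ, ← ih]; ring

theorem cfErr_best {ρ : ℝ} (h : Irrational ρ) (k l : ℕ) (m : ℤ) (hl : 1 ≤ l)
    (hl' : l < cfQ ρ (k + 1)) : |cfErr ρ k| ≤ |l * ρ - m| := by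
  set s : ℤ := (-1) ^ k with hs
  have hss : s * s = 1 := by rw [hs, ← mul_pow]; simp
  have hdet : cfP ρ (k + 1) * cfQ ρ k - cfP ρ k * cfQ ρ (k + 1) = s := cfP_mul_cfQ ρ k
  set u : ℤ := s * (l * cfP ρ (k + 1) - m * cfQ ρ (k + 1)) with hu
  set v : ℤ := s * (m * cfQ ρ k - l * cfP ρ k) with hv
  have e1 : (l : ℤ) = u * cfQ ρ k + v * cfQ ρ (k + 1) := by
    linear_combination (-(l : ℤ)) * hss - s * (l : ℤ) * hdet
  have e2 : m = u * cfP ρ k + v * cfP ρ (k + 1) := by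
    linear_combination (-m) * hss - s * m * hdet
  have e3 : l * ρ - m = u * cfErr ρ k + v * cfErr ρ (k + 1) := by
    have f1 : (l : ℝ) = u * cfQ ρ k + v * cfQ ρ (k + 1) := by exact_mod_cast e1
    have f2 : (m : ℝ) = u * cfP ρ k + v * cfP ρ (k + 1) := by exact_mod_cast e2
    rw [f1, f2]; simp only [cfErr]; ring
  rw [e3, cfErr_succ h]
  have hθ := cfFrac_mem h (k + 1)
  rw [show u * cfErr ρ k + v * -(cfFrac ρ (k + 1) * cfErr ρ k) =
    (u - v * cfFrac ρ (k + 1)) * cfErr ρ k by ring, abs_mul]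
  refine le_mul_of_one_le_left (abs_nonneg _) ?_
  have hl0 : (1 : ℤ) ≤ l := by exact_mod_cast hl
  have hl1 : (l : ℤ) < cfQ ρ (k + 1) := by exact_mod_cast hl'
  have hq : (0 : ℤ) ≤ cfQ ρ k := by positivity
  have hq' : (0 : ℤ) ≤ cfQ ρ (k + 1) := by positivity
  rcases lt_trichotomy v 0 with hv0 | hv0 | hv0
  · have hu1 : 1 ≤ u := by
      by_contra hc
      nlinarith
    have f1 : (1 : ℝ) ≤ u := by exact_mod_cast hu1
    have f2 : (v : ℝ) < 0 := by exact_mod_cast hv0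
    exact le_trans (by nlinarith) (le_abs_self _)
  · have hu1 : 1 ≤ u := by
      by_contra hc
      rw [hv0] at e1
      nlinarith
    have f1 : (1 : ℝ) ≤ u := by exact_mod_cast hu1
    rw [hv0]; simpa using f1.trans (le_abs_self _)
  · have hu1 : u ≤ -1 := by
      by_contra hc
      nlinarith
    have f1 : (u : ℝ) ≤ -1 := by exact_mod_cast hu1
    have f2 : (0 : ℝ) < v := by exact_mod_cast hv0
    exact le_trans (by nlinarith) (neg_le_abs _)

/-- The convergents of an irrational number. -/
def cfScheme {ρ : ℝ} (h : Irrational ρ) : ConvScheme ρ where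
  q := cfQ ρ
  p := cfP ρ
  A k := (cfA ρ (k + 2)).toNat
  q_rec _ := rfl
  p_rec _ := rfl
  A_pos k := by have := cfA_succ_pos h (k + 1); rw [show k + 1 + 1 = k + 2 by ring] at this; omega
  q_pos := le_rfl
  q_le := by
    have := cfA_succ_pos h 0
    rw [zero_add] at this; simp only [cfQ]; omega
  even k := by
    have := cfErr_sign h (2 * k)
    rw [pow_mul] at this; simpa [cfErr] using this
  odd k := by
    have := cfErr_sign h (2 * k + 1)
    rw [pow_succ, pow_mul] at this; simp [cfErr] at this; exact this
  dec k := by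
    change |cfErr ρ (k + 1)| < |cfErr ρ k|
    have h0 : cfErr ρ k ≠ 0 := fun h0 => by have := cfErr_sign h k; simp [h0] at this
    obtain ⟨h1, h2⟩ := cfFrac_mem h (k + 1)
    rw [cfErr_succ h, abs_neg, abs_mul, abs_of_pos h1]
    exact mul_lt_of_lt_one_left (abs_pos.2 h0) h2
  lt_one := by
    have h1 := cfFrac_mem h 0
    change |cfErr ρ 0| < 1
    rw [cfErr_zero, abs_of_pos h1.1]; exact h1.2
  best := cfErr_best h

theorem UnitAddCircle.coe_add_int (x : ℝ) (m : ℤ) :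
    ((x + m : ℝ) : UnitAddCircle) = (x : UnitAddCircle) := by
  rw [AddCircle.coe_add, add_eq_left, AddCircle.coe_eq_zero_iff]
  exact ⟨m, by simp⟩

theorem UnitAddCircle.coe_eq_coe {x y : ℝ} (h : (x : UnitAddCircle) = y) :
    ∃ m : ℤ, x = y + m := by
  rw [← sub_eq_zero, ← AddCircle.coe_sub, AddCircle.coe_eq_zero_iff] at h
  obtain ⟨m, hm⟩ := h
  exact ⟨m, by rw [zsmul_eq_mul, mul_one] at hm; linarith⟩

namespace BimodData
variable (B : BimodData)

theorem continuous_f : Continuous B.f := by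
  have h : Continuous fun x : ℝ => B.f ((x : ℝ) : UnitAddCircle) := by
    simp only [B.hf]
    exact (AddCircle.continuous_mk' 1).comp B.hC2.continuous
  exact (QuotientAddGroup.isQuotientMap_mk (N := AddSubgroup.zmultiples (1 : ℝ))).continuous_iff.2 h

theorem iterate_f (n : ℕ) (x : ℝ) : B.f^[n] (x : UnitAddCircle) = ((B.F^[n] x : ℝ) : UnitAddCircle) := by
  induction n generalizing x with
  | zero => rfl
  | succ n ih => rw [Function.iterate_succ_apply, Function.iterate_succ_apply, B.hf, ih]

theorem isClosed_II : IsClosed B.II :=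
  (isCompact_Icc.image (AddCircle.continuous_mk' 1)).isClosed

/-- Points without entry to `𝕀` at the times `1, …, m`. -/
def late (m : ℕ) : Set UnitAddCircle := {x | ∀ l, 1 ≤ l → l ≤ m → B.f^[l] x ∉ B.II}

theorem measurableSet_late (m : ℕ) : MeasurableSet (B.late m) := by
  have : B.late m = ⋂ l, ⋂ (_ : 1 ≤ l), ⋂ (_ : l ≤ m), B.f^[l] ⁻¹' (B.II)ᶜ := by
    ext x; simp [late]
  rw [this]
  exact .iInter fun l => .iInter fun _ => .iInter fun _ =>
    (B.isClosed_II.isOpen_compl.preimage (B.continuous_f.iterate l)).measurableSet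

theorem N0e_eq (x : UnitAddCircle) :
    B.N0e x = ∑' m, (B.late m).indicator (fun _ => (1 : ℝ≥0∞)) x := by
  classical
  unfold N0e
  split_ifs with h
  · have hmem := Nat.sInf_mem h
    set n := sInf (B.returnSet x) with hn
    have hiff : ∀ m, x ∈ B.late m ↔ m < n := by
      intro m
      refine ⟨fun hx => ?_, fun hm l hl hlm hII => ?_⟩
      · by_contra hc
        exact hx n hmem.1 (not_lt.1 hc) hmem.2
      · have : n ≤ l := Nat.sInf_le ⟨hl, hII⟩
        omega
    rw [tsum_eq_sum (s := Finset.range n)]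
    · rw [Finset.sum_congr rfl fun m hm =>
        Set.indicator_of_mem ((hiff m).2 (Finset.mem_range.1 hm)) _]
      simp
    · intro m hm
      exact Set.indicator_of_notMem (fun hx => hm (Finset.mem_range.2 ((hiff m).1 hx))) _
  · have hall : ∀ m, x ∈ B.late m := fun m l hl _ hII => h ⟨l, hl, hII⟩
    rw [tsum_congr fun m => Set.indicator_of_mem (hall m) _]
    exact (ENNReal.tsum_const_eq_top_of_ne_zero one_ne_zero).symm

theorem lintegral_N0e : ∫⁻ x in B.II, B.N0e x = ∑' m, volume (B.late m ∩ B.II) := by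
  simp only [N0e_eq]
  rw [lintegral_tsum fun m => (measurable_const.indicator (B.measurableSet_late m)).aemeasurable]
  refine tsum_congr fun m => ?_
  rw [lintegral_indicator_const (B.measurableSet_late m), one_mul,
    Measure.restrict_apply (B.measurableSet_late m)]

variable {B} {L : Lorenz}

theorem mem_II_iff (ha : L.a = B.ctm) (hb : L.b = B.ctp + 1) (y : ℝ) :
    ((y : ℝ) : UnitAddCircle) ∈ B.II ↔ y ∉ L.U := by
  constructor
  · rintro ⟨z, hz, hzy⟩ ⟨k, h1, h2⟩
    obtain ⟨m, hm⟩ := UnitAddCircle.coe_eq_coe hzy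
    have e1 : (k : ℝ) < -m := by linarith [hz.2]
    have e2 : -(m : ℝ) < k + 1 := by linarith [hz.1]
    have e1' : k < -m := by exact_mod_cast e1
    have e2' : -m < k + 1 := by exact_mod_cast e2
    omega
  · intro h
    obtain ⟨m, h1, h2⟩ := Lorenz.notMem_U h
    refine ⟨y - m, ⟨by linarith, by linarith⟩, ?_⟩
    simp

theorem volume_late (hF : L.F = B.F) (ha : L.a = B.ctm) (hb : L.b = B.ctp + 1) (m : ℕ) :
    volume (B.late m ∩ B.II) = volume (L.Rset m) := by
  have hmeas := (B.measurableSet_late m).inter B.isClosed_II.measurableSet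
  rw [← (UnitAddCircle.measurePreserving_mk B.ctp).measure_preimage hmeas.nullMeasurableSet,
    Measure.restrict_apply (AddCircle.measurable_mk' hmeas)]
  have hiff : ∀ x : ℝ, (x : UnitAddCircle) ∈ B.late m ↔
      ∀ l, 1 ≤ l → l ≤ m → L.F^[l] x ∈ L.U := fun x => by
    simp only [late, mem_ofPred_eq, B.iterate_f, mem_II_iff ha hb, not_not, hF]
  have h12 : B.ctm < B.ctp + 1 := by linarith [B.h0, B.h2]
  apply le_antisymm
  · refine (measure_mono (t := L.Rset m ∪ {B.ctp + 1}) ?_).trans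
      ((measure_union_le _ _).trans (by simp))
    rintro x ⟨⟨hx1, hx2⟩, hx3⟩
    rcases eq_or_lt_of_le hx3.2 with h | h
    · exact Or.inr h
    · refine Or.inl ⟨?_, (hiff x).1 hx1⟩
      obtain ⟨k, h1, h2⟩ := Lorenz.notMem_U ((mem_II_iff ha hb x).1 hx2)
      have e1 : (k : ℝ) < 1 := by linarith
      have e2 : (-1 : ℝ) < k := by linarith [hx3.1]
      have e1' : k < 1 := by exact_mod_cast e1
      have e2' : -1 < k := by exact_mod_cast e2
      obtain rfl : k = 0 := by omega
      simp only [Int.cast_zero, add_zero] at h1 h2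
      exact ⟨h1, h2⟩
  · refine (measure_mono (t := _ ∪ {B.ctp}) ?_).trans
      ((measure_union_le _ _).trans (by simp; rfl))
    rintro x ⟨hx1, hx2⟩
    rcases eq_or_lt_of_le hx1.1 with h | h
    · exact Or.inr (by simp only [mem_singleton_iff]; linarith)
    · refine Or.inl ⟨⟨(hiff x).2 hx2, ⟨x, ⟨by linarith, by linarith [hx1.2]⟩, rfl⟩⟩,
        by linarith, by linarith [hx1.2]⟩

theorem condCm_iff (hF : L.F = B.F) (ha : L.a = B.ctm) (hr : L.rm = B.rhom) :
    B.CondCm ↔ Summable L.g := by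
  have hirr : Irrational L.rm := L.rm_irr
  rw [Lorenz.summable_g_iff (cfScheme hirr), CondCm]
  refine iff_of_eq (congrArg Summable (funext fun k => ?_))
  have : (cfScheme hirr).q = cfQ B.rhom := by rw [← hr]; rfl
  rw [Lorenz.R, this, hF, ha, cm, B.iterate_f, dist_eq_norm, ← AddCircle.coe_sub]
  congr 2
  have := UnitAddCircle.coe_add_int (B.F^[cfQ B.rhom (2 * k)] B.ctm - B.ctm)
    (-(cfScheme hirr).p (2 * k))
  rw [← this]; congr 1; push_cast; ring

theorem condCp_iff (hF : L.F = B.F) (hb : L.b = B.ctp + 1) (hr : L.rp = B.rhop) :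
    B.CondCp ↔ Summable L.refl.g := by
  have hirr : Irrational L.rp := L.rp_irr
  rw [Lorenz.summable_g_iff (L := L.refl) (cfScheme hirr).shift, CondCp]
  refine iff_of_eq (congrArg Summable (funext fun k => ?_))
  have hq : ∀ j, (cfScheme hirr).shift.q j = cfQ B.rhop (j + 1) := by rw [← hr]; exact fun _ => rfl
  have hcp : B.cp = ((L.b : ℝ) : UnitAddCircle) := by
    have := UnitAddCircle.coe_add_int B.ctp 1
    rw [cp, ← this, hb]; simp
  unfold Lorenz.R
  rw [hq, hq, hcp, B.iterate_f, dist_eq_norm, ← AddCircle.coe_sub]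
  congr 1
  rw [← norm_neg, ← AddCircle.coe_neg]
  have := UnitAddCircle.coe_add_int (-(B.F^[cfQ B.rhop (2 * k + 1)] L.b - L.b))
    (-(cfScheme hirr).shift.p (2 * k))
  rw [← this]; congr 2
  change _ = (fun x => -L.F (-x))^[_] (-L.b) - _ - -L.b
  rw [Lorenz.iter_neg, hF]; push_cast; rw [neg_neg]; ring

theorem lintegral_N0e_lt_top_iff (hF : L.F = B.F) (ha : L.a = B.ctm) (hb : L.b = B.ctp + 1)
    (hm : L.rm = B.rhom) (hp : L.rp = B.rhop) :
    (∫⁻ x in B.II, B.N0e x ∂volume) < ⊤ ↔ (B.CondCm ∧ B.CondCp) := by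
  rw [condCm_iff hF ha hm, condCp_iff hF hb hp, ← Lorenz.tsum_Rset_iff, lintegral_N0e,
    lt_top_iff_ne_top]
  simp only [volume_late hF ha hb]

end BimodData

theorem sub_le_of_deriv_le {F G : ℝ → ℝ} {x y : ℝ} (hxy : x ≤ y) (hFc : ContinuousOn F (Icc x y))
    (hGc : ContinuousOn G (Icc x y)) (hF : ∀ z ∈ Ioo x y, DifferentiableAt ℝ F z)
    (hG : ∀ z ∈ Ioo x y, DifferentiableAt ℝ G z)
    (h : ∀ z ∈ Ioo x y, deriv F z ≤ deriv G z) : F y - F x ≤ G y - G x := by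
  have : MonotoneOn (fun z => G z - F z) (Icc x y) := by
    refine monotoneOn_of_deriv_nonneg (convex_Icc x y) (hGc.sub hFc) ?_ ?_ <;>
      rw [interior_Icc]
    · exact fun z hz => ((hG z hz).sub (hF z hz)).differentiableWithinAt
    · intro z hz
      rw [deriv_fun_sub (hG z hz) (hF z hz)]
      linarith [h z hz]
  have := this (left_mem_Icc.2 hxy) (right_mem_Icc.2 hxy) hxy
  simp only at this
  linarith

theorem sub_le_mul_of_deriv_le {F G : ℝ → ℝ} {x y : ℝ} (hxy : x ≤ y) (hF : Differentiable ℝ F)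
    (hG : Differentiable ℝ G) (c : ℝ)
    (h : ∀ z ∈ Ioo x y, deriv F z ≤ c * deriv G z) : F y - F x ≤ c * (G y - G x) := by
  have := sub_le_of_deriv_le (G := fun z => c * G z) hxy hF.continuous.continuousOn
    (hG.const_mul c).continuous.continuousOn (fun z _ => hF z) (fun z _ => (hG.const_mul c) z)
    (fun z hz => by rw [deriv_const_mul_field]; exact h z hz)
  linarith

theorem mul_le_sub_of_le_deriv {F G : ℝ → ℝ} {x y : ℝ} (hxy : x ≤ y) (hF : Differentiable ℝ F)
    (hG : Differentiable ℝ G) (c : ℝ)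
    (h : ∀ z ∈ Ioo x y, c * deriv G z ≤ deriv F z) : c * (G y - G x) ≤ F y - F x := by
  have := sub_le_mul_of_deriv_le (F := fun z => -F z) hxy hF.neg hG (-c)
    (fun z hz => by rw [deriv.fun_neg]; linarith [h z hz])
  linarith

/-- The model density with zeros of orders `α` and `β` at `a` and `b`. -/
def modelDens (a b α β z : ℝ) : ℝ := (z - a) ^ α * (b - z) ^ β

/-- A primitive of the model density. -/
def model (a b α β x : ℝ) : ℝ := ∫ z in a..x, modelDens a b α β z

section model
variable {a b α β : ℝ}

theorem hasDerivAt_model (hα : 0 ≤ α) (hβ : 0 ≤ β) (x : ℝ) :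
    HasDerivAt (model a b α β) (modelDens a b α β x) x := by
  have hc : Continuous (modelDens a b α β) :=
    ((continuous_id.sub continuous_const).rpow_const fun _ => Or.inr hα).mul
      ((continuous_const.sub continuous_id).rpow_const fun _ => Or.inr hβ)
  exact (hc.integral_hasStrictDerivAt a x).hasDerivAt

theorem modelDens_pos {z : ℝ} (hz : z ∈ Ioo a b) : 0 < modelDens a b α β z :=
  mul_pos (Real.rpow_pos_of_pos (by linarith [hz.1]) _) (Real.rpow_pos_of_pos (by linarith [hz.2]) _)

/-- `modelWeight` is the inverse square root of the model density. -/
def modelWeight (a b α β z : ℝ) : ℝ :=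
  Real.exp (α / 2 * -Real.log (z - a) + β / 2 * -Real.log (b - z))

theorem modelDens_eq {z : ℝ} (hz : z ∈ Ioo a b) :
    modelDens a b α β z = (modelWeight a b α β z ^ 2)⁻¹ := by
  rw [modelDens, modelWeight, Real.rpow_def_of_pos (by linarith [hz.1]),
    Real.rpow_def_of_pos (by linarith [hz.2]), ← Real.exp_nat_mul, ← Real.exp_neg, ← Real.exp_add]
  congr 1; push_cast; ring

theorem convexOn_modelWeight (hα : 0 ≤ α) (hβ : 0 ≤ β) :
    ConvexOn ℝ (Ioo a b) (modelWeight a b α β) := by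
  have h1 : ConvexOn ℝ (Ioo a b) fun z => -Real.log (z - a) := by
    refine ⟨convex_Ioo a b, fun x hx y hy s t hs ht hst => ?_⟩
    have := strictConcaveOn_log_Ioi.concaveOn.2 (show x - a ∈ Ioi 0 by simpa using hx.1)
      (show y - a ∈ Ioi 0 by simpa using hy.1) hs ht hst
    simp only [smul_eq_mul] at this ⊢
    rw [show s * (x - a) + t * (y - a) = s * x + t * y - (s + t) * a by ring, hst, one_mul] at this
    linarith
  have h2 : ConvexOn ℝ (Ioo a b) fun z => -Real.log (b - z) := by
    refine ⟨convex_Ioo a b, fun x hx y hy s t hs ht hst => ?_⟩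
    have := strictConcaveOn_log_Ioi.concaveOn.2 (show b - x ∈ Ioi 0 by simpa using hx.2)
      (show b - y ∈ Ioi 0 by simpa using hy.2) hs ht hst
    simp only [smul_eq_mul] at this ⊢
    rw [show s * (b - x) + t * (b - y) = (s + t) * b - (s * x + t * y) by ring, hst,
      one_mul] at this
    linarith
  have h3 := (h1.smul (show 0 ≤ α / 2 by positivity)).add (h2.smul (show 0 ≤ β / 2 by positivity))
  refine ⟨convex_Ioo a b, fun x hx y hy s t hs ht hst => ?_⟩
  exact (Real.exp_monotone (h3.2 hx hy hs ht hst)).trans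
    (convexOn_exp.2 (mem_univ _) (mem_univ _) hs ht hst)

theorem differentiable_model (hα : 0 ≤ α) (hβ : 0 ≤ β) : Differentiable ℝ (model a b α β) :=
  fun x => (hasDerivAt_model hα hβ x).differentiableAt

theorem deriv_model (hα : 0 ≤ α) (hβ : 0 ≤ β) : deriv (model a b α β) = modelDens a b α β :=
  funext fun x => (hasDerivAt_model hα hβ x).deriv

theorem model_lt (hα : 0 ≤ α) (hβ : 0 ≤ β) {x y : ℝ} (hx : a ≤ x) (hxy : x < y) (hy : y ≤ b) :
    model a b α β x < model a b α β y := by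
  refine strictMonoOn_of_deriv_pos (convex_Icc x y)
    (differentiable_model hα hβ).continuous.continuousOn (fun z hz => ?_)
    (left_mem_Icc.2 hxy.le) (right_mem_Icc.2 hxy.le) hxy
  rw [interior_Icc] at hz
  rw [deriv_model hα hβ]
  exact modelDens_pos ⟨by linarith [hz.1], by linarith [hz.2]⟩

/-- Comparison of `∫ w⁻²` with `∫ l⁻²`, for an affine function `l`. -/
theorem hasDerivAt_moebius {p c k z : ℝ} (hp : c ≠ 0) (hz : c + k * (z - p) ≠ 0) :
    HasDerivAt (fun z => (z - p) / (c * (c + k * (z - p)))) (((c + k * (z - p)) ^ 2)⁻¹) z := by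
  have h1 : HasDerivAt (fun z => z - p) 1 z := (hasDerivAt_id z).sub_const p
  have h2 : HasDerivAt (fun z => c * (c + k * (z - p))) (c * (k * 1)) z :=
    ((h1.const_mul k).const_add c).const_mul c
  refine (h1.div h2 (mul_ne_zero hp hz)).congr_deriv ?_
  field_simp
  ring

theorem crossRatio_le_model (hα : 0 ≤ α) (hβ : 0 ≤ β) {s x y t : ℝ} (hs : a ≤ s) (hsx : s < x)
    (hxy : x < y) (hyt : y < t) (ht : t ≤ b) :
    crossRatio s x y t ≤ crossRatio (model a b α β s) (model a b α β x) (model a b α β y)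
      (model a b α β t) := by
  set E := model a b α β with hE
  set w := modelWeight a b α β with hw
  have hconv := convexOn_modelWeight (a := a) (b := b) hα hβ
  have hx : x ∈ Ioo a b := ⟨by linarith, by linarith⟩
  have hy : y ∈ Ioo a b := ⟨by linarith, by linarith⟩
  have hwpos : ∀ z, 0 < w z := fun z => Real.exp_pos _
  have hEd := differentiable_model (a := a) (b := b) hα hβ
  have hE' : ∀ z ∈ Ioo a b, deriv E z = (w z ^ 2)⁻¹ := fun z hz => by
    rw [hE, deriv_model hα hβ, modelDens_eq hz]
  set k := (w y - w x) / (y - x) with hk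
  have hky : w y = w x + k * (y - x) := by rw [hk]; field_simp [(sub_pos.2 hxy).ne']; ring
  have hwx := hwpos x
  have hwy := hwpos y
  have hA : 0 < E x - E s := sub_pos.2 (model_lt hα hβ hs hsx (by linarith))
  have hB : 0 < E y - E x := sub_pos.2 (model_lt hα hβ (by linarith) hxy (by linarith))
  have hC : 0 < E t - E y := sub_pos.2 (model_lt hα hβ (by linarith) hyt ht)
  -- comparison on the three intervals with the Möbius map given by the chord of `w`
  have compare : ∀ p u v, (∀ z ∈ Icc u v, 0 < w p + k * (z - p)) → ∀ z ∈ Icc u v,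
      HasDerivAt (fun z => (z - p) / (w p * (w p + k * (z - p)))) (((w p + k * (z - p)) ^ 2)⁻¹) z :=
    fun p u v h z hz => hasDerivAt_moebius (hwpos p).ne' (h z hz).ne'
  have hBin : y - x ≤ (E y - E x) * (w x * w y) := by
    have hpos : ∀ z ∈ Icc x y, 0 < w x + k * (z - x) := fun z hz => by
      have : (w x + k * (z - x)) * (y - x) = w x * (y - z) + w y * (z - x) := by rw [hky]; ring
      have h2 : 0 < w x * (y - z) + w y * (z - x) := by
        rcases eq_or_lt_of_le hz.1 with h | h
        · rw [← h]; nlinarith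
        · nlinarith [hz.2, mul_pos hwy (sub_pos.2 h), mul_nonneg hwx.le (sub_nonneg.2 hz.2)]
      rw [← this] at h2
      exact (mul_pos_iff_of_pos_right (sub_pos.2 hxy)).1 h2
    have hd := compare x x y hpos
    have := sub_le_of_deriv_le (G := E) hxy.le
      (fun z hz => (hd z hz).continuousAt.continuousWithinAt) hEd.continuous.continuousOn
      (fun z hz => (hd z ⟨hz.1.le, hz.2.le⟩).differentiableAt) (fun z _ => hEd z) fun z hz => by
        rw [(hd z ⟨hz.1.le, hz.2.le⟩).deriv, hE' z ⟨by linarith [hz.1], by linarith [hz.2]⟩]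
        refine inv_anti₀ (pow_pos (hwpos z) 2) (pow_le_pow_left₀ (hwpos z).le ?_ 2)
        have := hconv.secant_mono_aux1 hx hy hz.1 hz.2
        have h3 : (w x + k * (z - x)) * (y - x) = w x * (y - z) + w y * (z - x) := by rw [hky]; ring
        have h4 : w z * (y - x) ≤ (w x + k * (z - x)) * (y - x) := by rw [h3]; linarith
        exact le_of_mul_le_mul_right h4 (sub_pos.2 hxy)
    simp only [sub_self, zero_div, sub_zero] at this
    rw [← hky] at this
    rwa [div_le_iff₀ (mul_pos hwx hwy)] at this
  have hAin : (E x - E s) * (w x * (w x - k * (x - s))) ≤ x - s := by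
    rcases le_or_gt (w x - k * (x - s)) 0 with h | h
    · have := mul_nonpos_of_nonneg_of_nonpos hA.le (mul_nonpos_of_nonneg_of_nonpos hwx.le h)
      linarith
    have hpos : ∀ z ∈ Icc s x, 0 < w x + k * (z - x) := fun z hz => by
      rcases le_or_gt k 0 with hk0 | hk0 <;> nlinarith [hz.1, hz.2]
    have hd := compare x s x hpos
    have := sub_le_of_deriv_le (F := E) hsx.le hEd.continuous.continuousOn
      (fun z hz => (hd z hz).continuousAt.continuousWithinAt) (fun z _ => hEd z)
      (fun z hz => (hd z ⟨hz.1.le, hz.2.le⟩).differentiableAt) fun z hz => by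
        have hz' : z ∈ Ioo a b := ⟨by linarith [hz.1], by linarith [hz.2]⟩
        rw [(hd z ⟨hz.1.le, hz.2.le⟩).deriv, hE' z hz']
        refine inv_anti₀ (pow_pos (hpos z ⟨hz.1.le, hz.2.le⟩) 2)
          (pow_le_pow_left₀ (hpos z ⟨hz.1.le, hz.2.le⟩).le ?_ 2)
        have := hconv.slope_mono_adjacent hz' hy hz.2 hxy
        rw [div_le_iff₀ (sub_pos.2 hz.2)] at this
        linarith
    simp only [sub_self, zero_div, zero_sub] at this
    rw [show w x + k * (s - x) = w x - k * (x - s) by ring, ← neg_div, neg_sub,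
      le_div_iff₀ (mul_pos hwx h)] at this
    exact this
  have hCin : (E t - E y) * (w y * (w y + k * (t - y))) ≤ t - y := by
    rcases le_or_gt (w y + k * (t - y)) 0 with h | h
    · have := mul_nonpos_of_nonneg_of_nonpos hC.le (mul_nonpos_of_nonneg_of_nonpos hwy.le h)
      linarith
    have hpos : ∀ z ∈ Icc y t, 0 < w y + k * (z - y) := fun z hz => by
      rcases le_or_gt k 0 with hk0 | hk0 <;> nlinarith [hz.1, hz.2]
    have hd := compare y y t hpos
    have := sub_le_of_deriv_le (F := E) hyt.le hEd.continuous.continuousOn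
      (fun z hz => (hd z hz).continuousAt.continuousWithinAt) (fun z _ => hEd z)
      (fun z hz => (hd z ⟨hz.1.le, hz.2.le⟩).differentiableAt) fun z hz => by
        have hz' : z ∈ Ioo a b := ⟨by linarith [hz.1], by linarith [hz.2]⟩
        rw [(hd z ⟨hz.1.le, hz.2.le⟩).deriv, hE' z hz']
        refine inv_anti₀ (pow_pos (hpos z ⟨hz.1.le, hz.2.le⟩) 2)
          (pow_le_pow_left₀ (hpos z ⟨hz.1.le, hz.2.le⟩).le ?_ 2)
        have := hconv.slope_mono_adjacent hx hz' hxy hz.1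
        rw [le_div_iff₀ (sub_pos.2 hz.1)] at this
        linarith
    simp only [sub_self, zero_div, sub_zero] at this
    rw [le_div_iff₀ (mul_pos hwy h)] at this
    exact this
  -- the two ratios
  set A := E x - E s with hAd
  set B := E y - E x with hBd
  set C := E t - E y with hCd
  set X := x - s with hX
  set Y := y - x with hY
  set T := t - y with hT
  have hX0 : 0 < X := sub_pos.2 hsx
  have hY0 : 0 < Y := sub_pos.2 hxy
  have hT0 : 0 < T := sub_pos.2 hyt
  have r1 : A * w x * (X + Y) ≤ (A + B) * w y * X := by
    have e : A * (w x * (w x - k * X)) * Y ≤ B * (w x * w y) * X := by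
      nlinarith [mul_le_mul_of_nonneg_right hAin hY0.le, mul_le_mul_of_nonneg_right hBin hX0.le]
    have e2 : A * (w x - k * X) * Y ≤ B * w y * X :=
      le_of_mul_le_mul_left (by linarith : w x * (A * (w x - k * X) * Y) ≤ w x * (B * w y * X)) hwx
    have e3 : A * w y * X = A * w x * X + A * k * X * Y := by rw [hky]; ring
    linarith
  have r2 : C * w y * (Y + T) ≤ (B + C) * w x * T := by
    have e : C * (w y * (w y + k * T)) * Y ≤ B * (w x * w y) * T := by
      nlinarith [mul_le_mul_of_nonneg_right hCin hY0.le, mul_le_mul_of_nonneg_right hBin hT0.le]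
    have e2 : C * (w y + k * T) * Y ≤ B * w x * T :=
      le_of_mul_le_mul_left (by linarith : w y * (C * (w y + k * T) * Y) ≤ w y * (B * w x * T)) hwy
    have e3 : C * w y * T = C * w x * T + C * k * Y * T := by rw [hky]; ring
    linarith
  have r3 : A * C * ((X + Y) * (Y + T)) ≤ (A + B) * (B + C) * (X * T) := by
    have := mul_le_mul r1 r2 (by positivity) (by positivity)
    refine le_of_mul_le_mul_left (a := w x * w y) ?_ (mul_pos hwx hwy)
    linarith
  unfold crossRatio
  rw [← hY, ← hBd, ← hX, ← hT, ← hAd, ← hCd, show t - s = X + Y + T by rw [hX, hY, hT]; ring,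
    show E t - E s = A + B + C by rw [hAd, hBd, hCd]; ring,
    div_le_div_iff₀ (mul_pos hX0 hT0) (mul_pos hA hC)]
  linarith

theorem modelDens_half_le (hα : 0 ≤ α) (hβ : 0 ≤ β) {x z : ℝ} (hx : x ∈ Ioo a b)
    (h1 : (x - a) / 2 ≤ z - a) (h2 : (b - x) / 2 ≤ b - z) :
    modelDens a b α β x ≤ 2 ^ (α + β) * modelDens a b α β z := by
  have hxa : 0 < x - a := sub_pos.2 hx.1
  have hxb : 0 < b - x := sub_pos.2 hx.2
  have e1 : (x - a) ^ α ≤ 2 ^ α * (z - a) ^ α := by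
    rw [← Real.mul_rpow (by norm_num) (by linarith)]
    exact Real.rpow_le_rpow hxa.le (by linarith) hα
  have e2 : (b - x) ^ β ≤ 2 ^ β * (b - z) ^ β := by
    rw [← Real.mul_rpow (by norm_num) (by linarith)]
    exact Real.rpow_le_rpow hxb.le (by linarith) hβ
  have := mul_le_mul e1 e2 (Real.rpow_nonneg hxb.le _)
    (mul_nonneg (by positivity) (Real.rpow_nonneg (by linarith) _))
  rw [modelDens, modelDens, Real.rpow_add two_pos]
  linarith

/-- The maximum of the model density is comparable to its mean. -/
theorem modelDens_le_mean (hα : 0 ≤ α) (hβ : 0 ≤ β) {s x t : ℝ} (hs : a ≤ s) (hsx : s < x)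
    (hxt : x < t) (ht : t ≤ b) :
    modelDens a b α β x * (t - s) ≤
      4 * 2 ^ (α + β) * (model a b α β t - model a b α β s) := by
  have hx : x ∈ Ioo a b := ⟨by linarith, by linarith⟩
  have hP : (0 : ℝ) < 2 ^ (α + β) := by positivity
  set E := model a b α β with hE
  have hEd := differentiable_model (a := a) (b := b) hα hβ
  have hmono : ∀ p q, a ≤ p → p ≤ q → q ≤ b → E p ≤ E q := fun p q hp hpq hq => by
    rcases eq_or_lt_of_le hpq with h | h
    · rw [h]
    · exact (model_lt hα hβ hp h hq).le
  have key : ∀ p q, a ≤ p → p ≤ q → q ≤ b → (t - s) / 4 ≤ q - p →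
      (∀ z ∈ Ioo p q, (x - a) / 2 ≤ z - a ∧ (b - x) / 2 ≤ b - z) →
      modelDens a b α β x * (t - s) ≤ 4 * 2 ^ (α + β) * (E q - E p) := by
    intro p q hp hpq hq hl h
    have h1 := mul_le_sub_of_le_deriv (F := E) (G := fun z => z) hpq hEd differentiable_id
      (modelDens a b α β x * (2 ^ (α + β))⁻¹) fun z hz => by
        rw [hE, deriv_model hα hβ, deriv_id'', mul_one, ← div_eq_mul_inv, div_le_iff₀' hP]
        exact modelDens_half_le hα hβ hx (h z hz).1 (h z hz).2
    have h2 : modelDens a b α β x * (2 ^ (α + β))⁻¹ * ((t - s) / 4) ≤ E q - E p :=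
      (mul_le_mul_of_nonneg_left hl (mul_nonneg (modelDens_pos hx).le (by positivity))).trans h1
    have h3 := mul_le_mul_of_nonneg_left h2 (show (0 : ℝ) ≤ 4 * 2 ^ (α + β) by positivity)
    refine le_trans (le_of_eq ?_) h3
    field_simp
  have h4 : (0 : ℝ) ≤ 4 * 2 ^ (α + β) := by positivity
  rcases le_total x ((s + t) / 2) with hm | hm
  · refine (key x (x + (t - s) / 4) hx.1.le (by linarith) (by linarith) (by linarith)
      fun z hz => ⟨by linarith [hz.1], by linarith [hz.2]⟩).trans
      (mul_le_mul_of_nonneg_left ?_ h4)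
    have e1 := hmono s x hs hsx.le hx.2.le
    have e2 := hmono (x + (t - s) / 4) t (by linarith) (by linarith) ht
    linarith
  · refine (key (x - (t - s) / 4) x (by linarith) (by linarith) hx.2.le (by linarith)
      fun z hz => ⟨by linarith [hz.1], by linarith [hz.2]⟩).trans
      (mul_le_mul_of_nonneg_left ?_ h4)
    have e1 := hmono s (x - (t - s) / 4) hs (by linarith) (by linarith)
    have e2 := hmono x t (by linarith) (by linarith) ht
    linarith

/-- A map whose derivative is `exp u` times the model density, with `u` Lipschitz, almost
expands cross ratios. -/
theorem crossRatio_le_of_deriv_eq (hα : 0 ≤ α) (hβ : 0 ≤ β) {F u : ℝ → ℝ} {Λ : ℝ} (hΛ : 0 ≤ Λ)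
    (hF : Differentiable ℝ F)
    (hF' : ∀ z ∈ Ioo a b, deriv F z = Real.exp (u z) * modelDens a b α β z)
    (hu : ∀ z ∈ Ioo a b, ∀ w ∈ Ioo a b, |u z - u w| ≤ Λ * |z - w|)
    {s x y t : ℝ} (hs : a ≤ s) (hsx : s < x) (hxy : x < y) (hyt : y < t) (ht : t ≤ b) :
    crossRatio s x y t ≤ Real.exp ((2 * Λ + 2 * Λ * (4 * 2 ^ (α + β))) * (y - s)) *
      crossRatio (F s) (F x) (F y) (F t) := by
  refine (crossRatio_le_model hα hβ hs hsx hxy hyt ht).trans ?_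
  set E := model a b α β with hE
  set P : ℝ := 4 * 2 ^ (α + β) with hP
  have hP0 : 0 < P := by positivity
  have hEd := differentiable_model (a := a) (b := b) hα hβ
  have hA : 0 < E x - E s := sub_pos.2 (model_lt hα hβ hs hsx (by linarith))
  have hB : 0 < E y - E x := sub_pos.2 (model_lt hα hβ (by linarith) hxy (by linarith))
  have hC : 0 < E t - E y := sub_pos.2 (model_lt hα hβ (by linarith) hyt ht)
  have hx : x ∈ Ioo a b := ⟨by linarith, by linarith⟩
  have hab : ∀ {z}, z ∈ Ioo s t → z ∈ Ioo a b := fun hz => ⟨by linarith [hz.1], by linarith [hz.2]⟩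
  have up : ∀ {p q c}, s ≤ p → p ≤ q → q ≤ t → (∀ z ∈ Ioo p q, |z - x| ≤ c) →
      F q - F p ≤ Real.exp (u x + Λ * c) * (E q - E p) := fun h1 h2 h3 h =>
    sub_le_mul_of_deriv_le h2 hF hEd _ fun z hz => by
      have hz' := hab (z := z) ⟨by linarith [hz.1], by linarith [hz.2]⟩
      rw [hF' z hz', deriv_model hα hβ]
      refine mul_le_mul_of_nonneg_right (Real.exp_le_exp.2 ?_) (modelDens_pos hz').le
      have e1 := (le_abs_self _).trans (hu z hz' x hx)
      have e2 := mul_le_mul_of_nonneg_left (h z hz) hΛ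
      linarith
  have low : ∀ {p q c}, s ≤ p → p ≤ q → q ≤ t → (∀ z ∈ Ioo p q, |z - x| ≤ c) →
      Real.exp (u x - Λ * c) * (E q - E p) ≤ F q - F p := fun h1 h2 h3 h =>
    mul_le_sub_of_le_deriv h2 hF hEd _ fun z hz => by
      have hz' := hab (z := z) ⟨by linarith [hz.1], by linarith [hz.2]⟩
      rw [hF' z hz', deriv_model hα hβ]
      refine mul_le_mul_of_nonneg_right (Real.exp_le_exp.2 ?_) (modelDens_pos hz').le
      have e1 := (neg_le_abs _).trans (hu z hz' x hx)
      have e2 := mul_le_mul_of_nonneg_left (h z hz) hΛ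
      linarith
  have fA := up (p := s) (q := x) (c := y - s) le_rfl hsx.le (by linarith) fun z hz =>
    abs_le.2 ⟨by linarith [hz.1], by linarith [hz.2]⟩
  have fB := low (p := x) (q := y) (c := y - s) hsx.le hxy.le hyt.le fun z hz =>
    abs_le.2 ⟨by linarith [hz.1], by linarith [hz.2]⟩
  have fC := up (p := y) (q := t) (c := t - s) (by linarith) hyt.le le_rfl fun z hz =>
    abs_le.2 ⟨by linarith [hz.1], by linarith [hz.2]⟩
  have fS := low (p := s) (q := y) (c := t - s) le_rfl (by linarith) hyt.le fun z hz =>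
    abs_le.2 ⟨by linarith [hz.1], by linarith [hz.2]⟩
  have fA0 := low (p := s) (q := x) (c := y - s) le_rfl hsx.le (by linarith) fun z hz =>
    abs_le.2 ⟨by linarith [hz.1], by linarith [hz.2]⟩
  have fC0 := low (p := y) (q := t) (c := t - s) (by linarith) hyt.le le_rfl fun z hz =>
    abs_le.2 ⟨by linarith [hz.1], by linarith [hz.2]⟩
  have hFA : 0 < F x - F s := (mul_pos (Real.exp_pos _) hA).trans_le fA0
  have hFC : 0 < F t - F y := (mul_pos (Real.exp_pos _) hC).trans_le fC0
  have hS : 0 < E y - E s := by linarith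
  have hT : 0 < E t - E s := by linarith
  -- the relative mass of `[s, y]`
  have hp : (E y - E s) * (t - s) ≤ P * (y - s) * (E t - E s) := by
    have := sub_le_mul_of_deriv_le (F := E) (G := fun z => z) (hsx.trans hxy).le hEd
      differentiable_id (P * (E t - E s) / (t - s)) fun z hz => by
        rw [hE, deriv_model hα hβ, deriv_id'', mul_one, le_div_iff₀ (by linarith)]
        exact modelDens_le_mean hα hβ hs hz.1 (hz.2.trans hyt) ht
    rw [div_mul_eq_mul_div, le_div_iff₀ (by linarith)] at this
    linarith
  set v := 2 * Λ * (t - s) with hv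
  have hts : 0 < t - s := by linarith
  have hv0 : 0 ≤ v := by positivity
  have hpv : (E y - E s) / (E t - E s) * v ≤ 2 * Λ * P * (y - s) := by
    rw [div_mul_eq_mul_div, div_le_iff₀ hT, hv]
    have := mul_le_mul_of_nonneg_left hp (show 0 ≤ 2 * Λ by linarith)
    linarith
  have jensen : Real.exp (-((E y - E s) / (E t - E s) * v)) ≤
      (E t - E y) / (E t - E s) + (E y - E s) / (E t - E s) * Real.exp (-v) := by
    have := convexOn_exp.2 (mem_univ 0) (mem_univ (-v))
      (show 0 ≤ (E t - E y) / (E t - E s) by positivity)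
      (show 0 ≤ (E y - E s) / (E t - E s) by positivity) (by field_simp; ring)
    simpa using this
  have hmass : Real.exp (-(2 * Λ * P * (y - s))) * (E t - E s) * (F t - F y) ≤
      (E t - E y) * (F t - F s) := by
    have e1 : Real.exp (-(2 * Λ * P * (y - s))) * (E t - E s) ≤
        (E t - E y) + (E y - E s) * Real.exp (-v) := by
      have := (Real.exp_le_exp.2 (neg_le_neg hpv)).trans jensen
      have := mul_le_mul_of_nonneg_right this hT.le
      rw [add_mul, div_mul_cancel₀ _ hT.ne', mul_right_comm (_ / _), div_mul_cancel₀ _ hT.ne'] at this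
      exact this
    have e2 : (E y - E s) * Real.exp (-v) * (F t - F y) ≤ (E t - E y) * (F y - F s) := by
      calc (E y - E s) * Real.exp (-v) * (F t - F y)
          ≤ (E y - E s) * Real.exp (-v) * (Real.exp (u x + Λ * (t - s)) * (E t - E y)) :=
            mul_le_mul_of_nonneg_left fC (by positivity)
        _ = (E t - E y) * (Real.exp (u x - Λ * (t - s)) * (E y - E s)) := by
            rw [show u x - Λ * (t - s) = -v + (u x + Λ * (t - s)) by rw [hv]; ring,
              Real.exp_add (-v)]; ring
        _ ≤ _ := mul_le_mul_of_nonneg_left fS hC.le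
    have := mul_le_mul_of_nonneg_right e1 hFC.le
    linarith
  have hmid : Real.exp (-(2 * Λ * (y - s))) * (E y - E x) * (F x - F s) ≤
      (E x - E s) * (F y - F x) := by
    calc Real.exp (-(2 * Λ * (y - s))) * (E y - E x) * (F x - F s)
        ≤ Real.exp (-(2 * Λ * (y - s))) * (E y - E x) *
          (Real.exp (u x + Λ * (y - s)) * (E x - E s)) :=
          mul_le_mul_of_nonneg_left fA (by positivity)
      _ = (E x - E s) * (Real.exp (u x - Λ * (y - s)) * (E y - E x)) := by
          rw [show u x - Λ * (y - s) = -(2 * Λ * (y - s)) + (u x + Λ * (y - s)) by ring,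
            Real.exp_add (-(2 * Λ * (y - s)))]; ring
      _ ≤ _ := mul_le_mul_of_nonneg_left fB hA.le
  unfold crossRatio
  rw [mul_div_assoc', div_le_div_iff₀ (mul_pos hA hC) (mul_pos hFA hFC)]
  have hprod := mul_le_mul hmid hmass (by positivity)
    (mul_nonneg hA.le ((mul_nonneg (Real.exp_pos _).le hB.le).trans fB))
  set c := Real.exp ((2 * Λ + 2 * Λ * P) * (y - s)) with hc
  have hexp : c * (Real.exp (-(2 * Λ * (y - s))) * Real.exp (-(2 * Λ * P * (y - s)))) = 1 := by
    rw [hc, ← Real.exp_add, ← Real.exp_add, ← Real.exp_zero]; congr 1; ring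
  have := mul_le_mul_of_nonneg_left hprod (Real.exp_pos ((2 * Λ + 2 * Λ * P) * (y - s))).le
  rw [← hc] at this
  calc (E y - E x) * (E t - E s) * ((F x - F s) * (F t - F y))
      = c * (Real.exp (-(2 * Λ * (y - s))) * Real.exp (-(2 * Λ * P * (y - s)))) *
        ((E y - E x) * (E t - E s) * ((F x - F s) * (F t - F y))) := by rw [hexp, one_mul]
    _ ≤ _ := by linarith

end model

/-- Near `a`, the function `F` is `F a` plus the `l`-th power of the modulus of a `C²` chart. -/
def NonFlatAt (F : ℝ → ℝ) (a l : ℝ) : Prop :=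
  ∃ ψ : ℝ → ℝ, ContDiff ℝ 2 ψ ∧ deriv ψ a ≠ 0 ∧ ψ a = 0 ∧ ∀ᶠ x in nhds a, F x = F a + |ψ x| ^ l

/-- A chart at a non-flat critical point, with its bounds on a neighbourhood of radius `η`. -/
structure CritChart (F : ℝ → ℝ) (a l : ℝ) where
  φ : ℝ → ℝ
  η : ℝ
  m : ℝ
  M : ℝ
  K : ℝ
  hη : 0 < η
  hm : 0 < m
  hC2 : ContDiff ℝ 2 φ
  map_a : φ a = 0
  eq : ∀ x ∈ Icc (a - η) (a + η), F x = F a + |φ x| ^ l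
  low : ∀ x ∈ Icc (a - η) (a + η), m ≤ deriv φ x
  up : ∀ x ∈ Icc (a - η) (a + η), deriv φ x ≤ M
  dd : ∀ x ∈ Icc (a - η) (a + η), |deriv (deriv φ) x| ≤ K

theorem ContDiff.continuous_deriv_deriv {φ : ℝ → ℝ} (h : ContDiff ℝ 2 φ) :
    ContDiff ℝ 1 (deriv φ) ∧ Continuous (deriv (deriv φ)) := by
  have h1 : ContDiff ℝ 1 (deriv φ) := (contDiff_succ_iff_deriv.1 (h.of_le (by norm_num))).2.2
  exact ⟨h1, h1.continuous_deriv le_rfl⟩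

theorem NonFlatAt.nonempty_critChart {F : ℝ → ℝ} {a l : ℝ} (h : NonFlatAt F a l) :
    Nonempty (CritChart F a l) := by
  obtain ⟨φ, hφ, hd, h0, hF⟩ : ∃ φ : ℝ → ℝ, ContDiff ℝ 2 φ ∧ 0 < deriv φ a ∧ φ a = 0 ∧
      ∀ᶠ x in nhds a, F x = F a + |φ x| ^ l := by
    obtain ⟨ψ, h1, h2, h3, h4⟩ := h
    rcases h2.lt_or_gt with h2 | h2
    · refine ⟨fun x => -ψ x, h1.neg, ?_, by simp [h3], by simpa using h4⟩
      rw [deriv.fun_neg]; linarith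
    · exact ⟨ψ, h1, h2, h3, h4⟩
  obtain ⟨hc1, hc2⟩ := hφ.continuous_deriv_deriv
  have e1 := hc1.continuous.continuousAt.eventually (lt_mem_nhds (half_lt_self hd))
  have e2 := hc1.continuous.continuousAt.eventually (gt_mem_nhds (lt_add_one (deriv φ a)))
  have e3 := hc2.abs.continuousAt.eventually (gt_mem_nhds (lt_add_one |deriv (deriv φ) a|))
  obtain ⟨ε, hε, hall⟩ := Metric.eventually_nhds_iff.1 (hF.and (e1.and (e2.and e3)))
  have key : ∀ x ∈ Icc (a - ε / 2) (a + ε / 2), dist x a < ε := fun x hx => by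
    rw [Real.dist_eq, abs_lt]; constructor <;> linarith [hx.1, hx.2]
  exact ⟨⟨φ, ε / 2, _, _, _, by positivity, half_pos hd, hφ, h0, fun x hx => (hall (key x hx)).1,
    fun x hx => (hall (key x hx)).2.1.le, fun x hx => (hall (key x hx)).2.2.1.le,
    fun x hx => (hall (key x hx)).2.2.2.le⟩⟩

namespace CritChart
variable {F : ℝ → ℝ} {a l : ℝ} (c : CritChart F a l)

theorem sub_le {x y : ℝ} (hx : a - c.η ≤ x) (hxy : x ≤ y) (hy : y ≤ a + c.η) :
    c.m * (y - x) ≤ c.φ y - c.φ x ∧ c.φ y - c.φ x ≤ c.M * (y - x) :=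
  ⟨mul_le_sub_of_le_deriv (G := fun z => z) hxy (c.hC2.differentiable two_ne_zero) differentiable_id _
    fun z hz => by rw [deriv_id'', mul_one]; exact c.low z ⟨by linarith [hz.1], by linarith [hz.2]⟩,
  sub_le_mul_of_deriv_le (G := fun z => z) hxy (c.hC2.differentiable two_ne_zero) differentiable_id _
    fun z hz => by rw [deriv_id'', mul_one]; exact c.up z ⟨by linarith [hz.1], by linarith [hz.2]⟩⟩

theorem M_pos : 0 < c.M :=
  c.hm.trans_le ((c.low a ⟨by linarith [c.hη], by linarith [c.hη]⟩).trans
    (c.up a ⟨by linarith [c.hη], by linarith [c.hη]⟩))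

theorem bounds {x : ℝ} (hx : a ≤ x) (hx' : x ≤ a + c.η) :
    c.m * (x - a) ≤ c.φ x ∧ c.φ x ≤ c.M * (x - a) := by
  have := c.sub_le (by linarith [c.hη]) hx hx'
  simpa [c.map_a] using this

theorem power (c : CritChart F a l) (hl : 1 < l) : ∃ η > 0, ∃ c₁ > 0, ∃ c₂ > 0, ∀ s ∈ Icc 0 η,
    c₁ * s ^ l ≤ F (a + s) - F a ∧ F (a + s) - F a ≤ c₂ * s ^ l := by
  refine ⟨c.η, c.hη, c.m ^ l, Real.rpow_pos_of_pos c.hm _, c.M ^ l, Real.rpow_pos_of_pos c.M_pos _,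
    fun s hs => ?_⟩
  obtain ⟨h1, h2⟩ := c.bounds (x := a + s) (by linarith [hs.1]) (by linarith [hs.2])
  rw [add_sub_cancel_left] at h1 h2
  have h0 : 0 ≤ c.m * s := mul_nonneg c.hm.le hs.1
  rw [c.eq _ ⟨by linarith [hs.1, c.hη], by linarith [hs.2]⟩, add_sub_cancel_left,
    abs_of_nonneg (h0.trans h1), ← Real.mul_rpow c.hm.le hs.1, ← Real.mul_rpow c.M_pos.le hs.1]
  exact ⟨Real.rpow_le_rpow h0 h1 (by linarith), Real.rpow_le_rpow (h0.trans h1) h2 (by linarith)⟩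

/-- The involution exchanging the two sides of the critical point. -/
theorem twin (c : CritChart F a l) {ε : ℝ} (hε : 0 < ε) : ∃ s₀ > 0, ∃ K > 0, ∃ τ : ℝ → ℝ, s₀ ≤ ε ∧ τ a = a ∧
    (∀ x ∈ Icc (a - s₀) a, τ x ∈ Icc a (a + ε) ∧ F (τ x) = F x) ∧
    ∀ x ∈ Icc (a - s₀) a, ∀ y ∈ Icc (a - s₀) a, x ≤ y →
      τ x - τ y ≤ K * (y - x) ∧ y - x ≤ K * (τ x - τ y) := by
  have hm := c.hm
  have hM := c.M_pos
  obtain ⟨r, hr0, hrη, hrε⟩ : ∃ r > 0, r ≤ c.η ∧ r ≤ ε :=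
    ⟨min c.η ε, lt_min c.hη hε, min_le_left _ _, min_le_right _ _⟩
  obtain ⟨s, hs0, hsr, hsm⟩ : ∃ s > 0, s ≤ r ∧ c.M * s ≤ c.m * r :=
    ⟨min r (c.m * r / c.M), lt_min hr0 (by positivity), min_le_left _ _, by
      have := mul_le_mul_of_nonneg_left (min_le_right r (c.m * r / c.M)) hM.le
      rwa [mul_div_cancel₀ _ hM.ne'] at this⟩
  have hex : ∀ x ∈ Icc (a - s) a, ∃ y ∈ Icc a (a + r), c.φ y = -c.φ x := fun x hx => by
    have h1 := (c.sub_le (by linarith [hx.1]) hx.2 (by linarith)).1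
    have h2 := (c.sub_le (by linarith [hx.1]) hx.2 (by linarith)).2
    have h3 := (c.bounds (x := a + r) (by linarith) (by linarith)).1
    rw [c.map_a, zero_sub] at h1 h2
    rw [add_sub_cancel_left] at h3
    have h4 : 0 ≤ c.m * (a - x) := mul_nonneg hm.le (by linarith [hx.2])
    have h5 : c.M * (a - x) ≤ c.M * s := mul_le_mul_of_nonneg_left (by linarith [hx.1]) hM.le
    exact intermediate_value_Icc (by linarith) c.hC2.continuous.continuousOn
      ⟨by rw [c.map_a]; linarith, by linarith⟩
  choose! τ hτ hφτ using hex
  refine ⟨s, hs0, c.M / c.m, by positivity, τ, by linarith, ?_, fun x hx => ⟨⟨(hτ x hx).1,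
    by linarith [(hτ x hx).2]⟩, ?_⟩, fun x hx y hy hxy => ?_⟩
  · have ha : a ∈ Icc (a - s) a := ⟨by linarith, le_rfl⟩
    have h1 := hτ a ha
    have h2 := (c.bounds h1.1 (by linarith [h1.2])).1
    rw [hφτ a ha, c.map_a, neg_zero] at h2
    have : τ a - a ≤ 0 := by
      by_contra hc
      nlinarith
    linarith [h1.1]
  · have h1 := hτ x hx
    rw [c.eq _ ⟨by linarith [h1.1, c.hη], by linarith [h1.2]⟩, hφτ x hx, abs_neg,
      c.eq x ⟨by linarith [hx.1], by linarith [hx.2, c.hη]⟩]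
  · have h1 := hτ x hx
    have h2 := hτ y hy
    have h3 := c.sub_le (by linarith [hx.1]) hxy (by linarith [hy.2, c.hη])
    have hle : τ y ≤ τ x := by
      by_contra hc
      have h4 := (c.sub_le (by linarith [h1.1, c.hη]) (not_le.1 hc).le (by linarith [h2.2])).1
      rw [hφτ x hx, hφτ y hy] at h4
      nlinarith [mul_nonneg hm.le (sub_nonneg.2 hxy)]
    have h4 := c.sub_le (by linarith [h2.1, c.hη]) hle (by linarith [h1.2])
    rw [hφτ x hx, hφτ y hy] at h4
    rw [div_mul_eq_mul_div, le_div_iff₀ hm, div_mul_eq_mul_div, le_div_iff₀ hm]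
    constructor <;> linarith [h3.1, h3.2, h4.1, h4.2]

theorem abs_deriv_le {x : ℝ} (hx : a < x) (hx' : x < a + c.η) (hl : 1 < l) :
    |deriv (fun z => Real.log (deriv F z) - (l - 1) * Real.log (z - a)) x| ≤
      c.K / c.m + (l - 1) * (c.K / c.m) := by
  have hm := c.hm
  have hd := c.hC2.differentiable two_ne_zero
  have hc1 := c.hC2.continuous_deriv_deriv.1
  have hI : ∀ z ∈ Ioo a (a + c.η), z ∈ Icc (a - c.η) (a + c.η) := fun z hz =>
    ⟨by linarith [hz.1, c.hη], hz.2.le⟩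
  have hφ : ∀ z ∈ Ioo a (a + c.η), 0 < c.φ z := fun z hz =>
    (mul_pos hm (sub_pos.2 hz.1)).trans_le (c.bounds hz.1.le hz.2.le).1
  have hφ' : ∀ z ∈ Ioo a (a + c.η), 0 < deriv c.φ z := fun z hz => hm.trans_le (c.low z (hI z hz))
  have hF' : ∀ z ∈ Ioo a (a + c.η), deriv F z = deriv c.φ z * l * c.φ z ^ (l - 1) := fun z hz => by
    have h1 : F =ᶠ[nhds z] fun w => F a + c.φ w ^ l := by
      filter_upwards [Ioo_mem_nhds hz.1 hz.2] with w hw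
      rw [c.eq w (hI w hw), abs_of_pos (hφ w hw)]
    rw [h1.deriv_eq]
    exact (((hd z).hasDerivAt.rpow_const (Or.inl (hφ z hz).ne')).const_add (F a)).deriv
  have hev : (fun z => Real.log (deriv F z) - (l - 1) * Real.log (z - a)) =ᶠ[nhds x]
      fun z => Real.log (deriv c.φ z) + Real.log l + (l - 1) * Real.log (c.φ z) -
        (l - 1) * Real.log (z - a) := by
    filter_upwards [Ioo_mem_nhds hx hx'] with z hz
    rw [hF' z hz, Real.log_mul (mul_pos (hφ' z hz) (by linarith)).ne'
      (Real.rpow_pos_of_pos (hφ z hz) _).ne', Real.log_mul (hφ' z hz).ne' (by linarith),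
      Real.log_rpow (hφ z hz)]
  have hxI : x ∈ Ioo a (a + c.η) := ⟨hx, hx'⟩
  have hxa : 0 < x - a := sub_pos.2 hx
  have h1 := (((hc1.differentiable one_ne_zero x).hasDerivAt.log (hφ' x hxI).ne').add_const
    (Real.log l)).add (((hd x).hasDerivAt.log (hφ x hxI).ne').const_mul (l - 1))
  have h2 := h1.sub ((((hasDerivAt_id x).sub_const a).log hxa.ne').const_mul (l - 1))
  rw [hev.deriv_eq]
  have h3 := h2.deriv
  simp only [id] at h3
  have h4 : deriv (fun z => Real.log (deriv c.φ z) + Real.log l + (l - 1) * Real.log (c.φ z) -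
        (l - 1) * Real.log (z - a)) x = deriv (deriv c.φ) x / deriv c.φ x +
        (l - 1) * (deriv c.φ x / c.φ x - 1 / (x - a)) := by
    rw [mul_sub, ← add_sub_assoc]; exact h3
  rw [h4]
  have hK : 0 ≤ c.K := (abs_nonneg _).trans (c.dd x (hI x hxI))
  have b1 : |deriv (deriv c.φ) x / deriv c.φ x| ≤ c.K / c.m := by
    rw [abs_div, abs_of_pos (hφ' x hxI)]
    exact div_le_div₀ hK (c.dd x (hI x hxI)) hm (c.low x (hI x hxI))
  have b2 : |deriv c.φ x / c.φ x - 1 / (x - a)| ≤ c.K / c.m := by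
    obtain ⟨ξ, hξ, hξe⟩ := exists_deriv_eq_slope c.φ hx c.hC2.continuous.continuousOn
      (fun z _ => (hd z).differentiableWithinAt)
    rw [c.map_a, sub_zero, eq_div_iff hxa.ne'] at hξe
    have hξI : ξ ∈ Ioo a (a + c.η) := ⟨hξ.1, hξ.2.trans hx'⟩
    have h5 : ‖deriv c.φ x - deriv c.φ ξ‖ ≤ c.K * ‖x - ξ‖ :=
      (convex_Ioo a (a + c.η)).norm_image_sub_le_of_norm_deriv_le
        (fun z _ => hc1.differentiable one_ne_zero z) (fun z hz => c.dd z (hI z hz)) hξI hxI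
    rw [Real.norm_eq_abs, Real.norm_eq_abs, abs_of_pos (sub_pos.2 hξ.2)] at h5
    have h6 : |deriv c.φ x * (x - a) - c.φ x| ≤ c.K * (x - a) * (x - a) := by
      rw [← hξe, ← sub_mul, abs_mul, abs_of_pos hxa]
      refine mul_le_mul_of_nonneg_right (h5.trans ?_) hxa.le
      exact mul_le_mul_of_nonneg_left (by linarith [hξ.1]) hK
    have h7 := (c.bounds hx.le hx'.le).1
    rw [div_sub_div _ _ (hφ x hxI).ne' hxa.ne', mul_one, abs_div,
      abs_of_pos (mul_pos (hφ x hxI) hxa), div_le_div_iff₀ (mul_pos (hφ x hxI) hxa) hm]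
    calc |deriv c.φ x * (x - a) - c.φ x| * c.m ≤ c.K * (x - a) * (x - a) * c.m :=
          mul_le_mul_of_nonneg_right h6 hm.le
      _ = c.K * (c.m * (x - a) * (x - a)) := by ring
      _ ≤ _ := mul_le_mul_of_nonneg_left (mul_le_mul_of_nonneg_right h7 hxa.le) hK
  refine (abs_add_le _ _).trans (add_le_add b1 ?_)
  rw [abs_mul, abs_of_pos (by linarith : 0 < l - 1)]
  exact mul_le_mul_of_nonneg_left b2 (by linarith)

end CritChart

theorem hasDerivAt_log_deriv {F : ℝ → ℝ} (hC2 : ContDiff ℝ 2 F) {x : ℝ} (hx : deriv F x ≠ 0) :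
    HasDerivAt (fun z => Real.log (deriv F z)) (deriv (deriv F) x / deriv F x) x :=
  (hC2.continuous_deriv_deriv.1.differentiable one_ne_zero x).hasDerivAt.log hx

theorem deriv_neg_comp_neg (F : ℝ → ℝ) : deriv (fun x => -F (-x)) = fun x => deriv F (-x) := by
  ext x; rw [deriv.fun_neg, deriv_comp_neg, neg_neg]

theorem CritChart.abs_logDeriv_sub_le {F : ℝ → ℝ} {a l : ℝ} (c : CritChart F a l) (hl : 1 < l)
    (hC2 : ContDiff ℝ 2 F) {x : ℝ} (hx : a < x) (hx' : x < a + c.η) (h0 : deriv F x ≠ 0) :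
    |deriv (deriv F) x / deriv F x - (l - 1) * (1 / (x - a))| ≤
      c.K / c.m + (l - 1) * (c.K / c.m) := by
  have h := c.abs_deriv_le hx hx' hl
  have h1 := (hasDerivAt_log_deriv hC2 h0).sub
    ((((hasDerivAt_id x).sub_const a).log (sub_pos.2 hx).ne').const_mul (l - 1))
  exact (congrArg abs h1.deriv).symm.le.trans h

theorem CritChart.power_Icc {F : ℝ → ℝ} {a b l : ℝ} (c : CritChart F a l) (hl : 1 < l)
    (hab : a < b) (hF : StrictMonoOn F (Icc a b)) : ∃ c₁ > 0, ∃ c₂ > 0, ∀ s ∈ Icc 0 (b - a),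
    c₁ * s ^ l ≤ F (a + s) - F a ∧ F (a + s) - F a ≤ c₂ * s ^ l := by
  obtain ⟨η', hη', k₁, hk₁, k₂, hk₂, H⟩ := c.power hl
  obtain ⟨η, hη, hle, hlb⟩ : ∃ η > 0, η ≤ η' ∧ η ≤ b - a :=
    ⟨min η' (b - a), lt_min hη' (by linarith), min_le_left _ _, min_le_right _ _⟩
  have hpη := Real.rpow_pos_of_pos hη l
  have hpb := Real.rpow_pos_of_pos (sub_pos.2 hab) l
  have hp : 0 < F (a + η) - F a := sub_pos.2 <|
    hF (left_mem_Icc.2 hab.le) ⟨by linarith, by linarith⟩ (by linarith)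
  have hq : 0 < F b - F a := sub_pos.2 <| hF (left_mem_Icc.2 hab.le) (right_mem_Icc.2 hab.le) hab
  refine ⟨min k₁ ((F (a + η) - F a) / (b - a) ^ l), lt_min hk₁ (by positivity),
    max k₂ ((F b - F a) / η ^ l), lt_max_of_lt_left hk₂, fun s hs => ?_⟩
  have hs0 : 0 ≤ s ^ l := Real.rpow_nonneg hs.1 _
  rcases le_total s η with h | h
  · obtain ⟨h1, h2⟩ := H s ⟨hs.1, h.trans hle⟩
    exact ⟨(mul_le_mul_of_nonneg_right (min_le_left _ _) hs0).trans h1,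
      h2.trans (mul_le_mul_of_nonneg_right (le_max_left _ _) hs0)⟩
  · have m1 : F (a + η) ≤ F (a + s) :=
      hF.monotoneOn ⟨by linarith, by linarith⟩ ⟨by linarith, by linarith [hs.2]⟩ (by linarith)
    have m2 : F (a + s) ≤ F b :=
      hF.monotoneOn ⟨by linarith, by linarith [hs.2]⟩ (right_mem_Icc.2 hab.le) (by linarith [hs.2])
    have r1 : s ^ l ≤ (b - a) ^ l := Real.rpow_le_rpow hs.1 hs.2 (by linarith)
    have r2 : η ^ l ≤ s ^ l := Real.rpow_le_rpow hη.le h (by linarith)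
    refine ⟨(mul_le_mul_of_nonneg_right (min_le_right _ _) hs0).trans ?_,
      le_trans ?_ (mul_le_mul_of_nonneg_right (le_max_right _ _) hs0)⟩
    · rw [div_mul_eq_mul_div, div_le_iff₀ hpb]
      exact mul_le_mul (by linarith) r1 hs0 (by linarith)
    · rw [div_mul_eq_mul_div, le_div_iff₀ hpη]
      exact mul_le_mul (by linarith) r2 hpη.le hq.le

theorem exists_abs_logDeriv_le {F : ℝ → ℝ} {a b : ℝ} (hC2 : ContDiff ℝ 2 F)
    (hpos : ∀ x ∈ Ioo a b, 0 < deriv F x) {δ : ℝ} (hδ : 0 < δ) :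
    ∃ Λ ≥ 0, ∀ x ∈ Icc (a + δ) (b - δ), |deriv (deriv F) x / deriv F x| ≤ Λ := by
  obtain ⟨h1, h2⟩ := hC2.continuous_deriv_deriv
  obtain ⟨Λ, hΛ⟩ := (isCompact_Icc (a := a + δ) (b := b - δ)).exists_bound_of_continuousOn
    (f := fun x => deriv (deriv F) x / deriv F x) (h2.continuousOn.div h1.continuous.continuousOn
      fun x hx => (hpos x ⟨by linarith [hx.1], by linarith [hx.2]⟩).ne')
  exact ⟨max Λ 0, le_max_right _ _, fun x hx => (hΛ x hx).trans (le_max_left _ _)⟩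

theorem exists_deriv_le_exp_mul {F : ℝ → ℝ} {a b : ℝ} (hC2 : ContDiff ℝ 2 F)
    (hpos : ∀ x ∈ Ioo a b, 0 < deriv F x) (δ : ℝ) (hδ : δ > 0) :
    ∃ Λ ≥ 0, ∀ x ∈ Icc (a + δ) (b - δ), ∀ y ∈ Icc (a + δ) (b - δ),
      deriv F x ≤ Real.exp (Λ * |x - y|) * deriv F y := by
  obtain ⟨Λ, h0, hΛ⟩ := exists_abs_logDeriv_le hC2 hpos hδ
  have hp : ∀ x ∈ Icc (a + δ) (b - δ), 0 < deriv F x := fun x hx =>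
    hpos x ⟨by linarith [hx.1], by linarith [hx.2]⟩
  refine ⟨Λ, h0, fun x hx y hy => ?_⟩
  have h := (convex_Icc (a + δ) (b - δ)).norm_image_sub_le_of_norm_hasDerivWithin_le
    (fun z hz => (hasDerivAt_log_deriv hC2 (hp z hz).ne').hasDerivWithinAt) hΛ hy hx
  have h1 := (le_abs_self _).trans h
  rw [← Real.log_le_log_iff (hp x hx) (mul_pos (Real.exp_pos _) (hp y hy)),
    Real.log_mul (Real.exp_pos _).ne' (hp y hy).ne', Real.log_exp]
  rw [Real.norm_eq_abs] at h1
  linarith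

/-- On an interval between two non-flat critical points the derivative is the model density up to
a factor with Lipschitz logarithm. -/
theorem exists_deriv_eq_exp_mul_modelDens {F : ℝ → ℝ} {a b l r : ℝ} (hab : a < b)
    (hC2 : ContDiff ℝ 2 F) (hpos : ∀ x ∈ Ioo a b, 0 < deriv F x) (hl : 1 < l) (hr : 1 < r)
    (c : CritChart F a l) (c' : CritChart (fun x => -F (-x)) (-b) r) :
    ∃ (u : ℝ → ℝ) (Λ : ℝ), 0 ≤ Λ ∧
      (∀ z ∈ Ioo a b, deriv F z = Real.exp (u z) * modelDens a b (l - 1) (r - 1) z) ∧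
      ∀ z ∈ Ioo a b, ∀ w ∈ Ioo a b, |u z - u w| ≤ Λ * |z - w| := by
  set D : ℝ → ℝ := fun x => deriv (deriv F) x / deriv F x with hD
  obtain ⟨δ, hδ, hδ1, hδ2, hδ3⟩ : ∃ δ > 0, δ ≤ c.η ∧ δ ≤ c'.η ∧ δ ≤ (b - a) / 2 :=
    ⟨min c.η (min c'.η ((b - a) / 2)), lt_min c.hη (lt_min c'.hη (by linarith)),
      min_le_left _ _, (min_le_right _ _).trans (min_le_left _ _),
      (min_le_right _ _).trans (min_le_right _ _)⟩
  obtain ⟨K₀, hK₀, H₀⟩ := exists_abs_logDeriv_le hC2 hpos hδ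
  set K₁ := c.K / c.m + (l - 1) * (c.K / c.m)
  set K₂ := c'.K / c'.m + (r - 1) * (c'.K / c'.m)
  have hδi : ∀ {t}, δ ≤ t → 0 < t ∧ 1 / t ≤ 1 / δ := fun ht =>
    ⟨hδ.trans_le ht, one_div_le_one_div_of_le hδ ht⟩
  have hl0 : 0 < l - 1 := by linarith
  have hr0 : 0 < r - 1 := by linarith
  have hder : ∀ x ∈ Ioo a b, |D x - (l - 1) * (1 / (x - a)) + (r - 1) * (1 / (b - x))| ≤
      |K₁| + |K₂| + K₀ + (l - 1) * (1 / δ) + (r - 1) * (1 / δ) := fun x hx => by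
    have hc : 0 ≤ (l - 1) * (1 / δ) := by positivity
    have hc' : 0 ≤ (r - 1) * (1 / δ) := by positivity
    have far1 : a + δ ≤ x → 0 ≤ (l - 1) * (1 / (x - a)) ∧
        (l - 1) * (1 / (x - a)) ≤ (l - 1) * (1 / δ) := fun h => by
      obtain ⟨h1, h2⟩ := hδi (le_sub_iff_add_le'.2 h)
      exact ⟨by positivity, mul_le_mul_of_nonneg_left h2 hl0.le⟩
    have far2 : x ≤ b - δ → 0 ≤ (r - 1) * (1 / (b - x)) ∧
        (r - 1) * (1 / (b - x)) ≤ (r - 1) * (1 / δ) := fun h => by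
      obtain ⟨h1, h2⟩ := hδi (le_sub_comm.1 h)
      exact ⟨by positivity, mul_le_mul_of_nonneg_left h2 hr0.le⟩
    have a1 := le_abs_self K₁
    have a2 := le_abs_self K₂
    have a3 := abs_nonneg K₁
    have a4 := abs_nonneg K₂
    rw [abs_le]
    rcases lt_or_ge x (a + δ) with h | h
    · have h1 := abs_le.1 (c.abs_logDeriv_sub_le hl hC2 hx.1 (by linarith) (hpos x hx).ne')
      have h2 := far2 (by linarith)
      constructor <;> linarith [h1.1, h1.2, h2.1, h2.2]
    · have h2 := far1 h
      rcases lt_or_ge (b - δ) x with h' | h'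
      · have hG := deriv_neg_comp_neg F
        have hG' : ContDiff ℝ 2 fun x => -F (-x) := (hC2.comp contDiff_neg).neg
        have h1 := c'.abs_logDeriv_sub_le (x := -x) hr hG' (by linarith [hx.2]) (by linarith)
          (by rw [hG]; simpa using (hpos x hx).ne')
        rw [hG, deriv_comp_neg, neg_sub_neg] at h1
        simp only [neg_neg, neg_div, abs_le] at h1
        constructor <;> linarith [h1.1, h1.2, h2.1, h2.2]
      · have h1 := abs_le.1 (H₀ x ⟨h, h'⟩)
        have h3 := far2 h'
        constructor <;> linarith [h1.1, h1.2, h2.1, h2.2, h3.1, h3.2]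
  set Λ := |K₁| + |K₂| + K₀ + (l - 1) * (1 / δ) + (r - 1) * (1 / δ)
  refine ⟨fun z => Real.log (deriv F z) - (l - 1) * Real.log (z - a) - (r - 1) * Real.log (b - z),
    Λ, by positivity, fun z hz => ?_, fun z hz w hw => ?_⟩
  · have h1 := sub_pos.2 hz.1
    have h2 := sub_pos.2 hz.2
    rw [modelDens, Real.rpow_def_of_pos h1, Real.rpow_def_of_pos h2, ← Real.exp_add,
      ← Real.exp_add]
    conv_lhs => rw [← Real.exp_log (hpos z hz)]
    congr 1; ring
  · refine Convex.norm_image_sub_le_of_norm_hasDerivWithin_le (f := fun z =>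
        Real.log (deriv F z) - (l - 1) * Real.log (z - a) - (r - 1) * Real.log (b - z))
      (f' := fun x => D x - (l - 1) * (1 / (x - a)) + (r - 1) * (1 / (b - x)))
      (fun x hx => ?_) hder (convex_Ioo a b) hw hz
    have h1 := ((hasDerivAt_log_deriv hC2 (hpos x hx).ne').sub
      ((((hasDerivAt_id x).sub_const a).log (sub_pos.2 hx.1).ne').const_mul (l - 1))).sub
      ((((hasDerivAt_id x).const_sub b).log (sub_pos.2 hx.2).ne').const_mul (r - 1))
    refine (h1.congr_deriv ?_).hasDerivWithinAt
    simp only [id]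
    ring

theorem le_of_le_on_period {G F : ℝ → ℝ} (hG : ∀ x, G (x + 1) = G x + 1)
    (hF : ∀ x, F (x + 1) = F x + 1) {d : ℝ} (h : ∀ y ∈ Icc d (d + 1), G y ≤ F y) (x : ℝ) :
    G x ≤ F x := by
  have hp : Function.Periodic (fun x => F x - G x) 1 := fun x => by simp [hG, hF]
  obtain ⟨y, hy, hxy⟩ := hp.exists_mem_Ico one_pos x d
  have := h y ⟨hy.1, hy.2.le⟩
  linarith

theorem CircleDeg1Lift.add_int_lt_iterate (f : CircleDeg1Lift) (n : ℕ) (m : ℤ)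
    (h : (m : ℝ) < n * f.translationNumber) (x : ℝ) : x + m < f^[n] x := by
  rw [← CircleDeg1Lift.translationNumber_pow] at h
  simpa only [CircleDeg1Lift.coe_pow] using (f ^ n).lt_map_of_int_lt_translationNumber h x

theorem CircleDeg1Lift.iterate_lt_add_int (f : CircleDeg1Lift) (n : ℕ) (m : ℤ)
    (h : n * f.translationNumber < (m : ℝ)) (x : ℝ) : f^[n] x < x + m := by
  rw [← CircleDeg1Lift.translationNumber_pow] at h
  simpa only [CircleDeg1Lift.coe_pow] using (f ^ n).map_lt_of_translationNumber_lt_int h x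

namespace BimodData
variable (B : BimodData)

theorem strictMonoOn : StrictMonoOn B.F (Icc B.ctm (B.ctp + 1)) :=
  strictMonoOn_of_deriv_pos (convex_Icc _ _) B.hC2.continuous.continuousOn
    (by simpa only [interior_Icc] using B.hincr)

theorem strictAntiOn : StrictAntiOn B.F (Icc B.ctp B.ctm) :=
  strictAntiOn_of_deriv_neg (convex_Icc _ _) B.hC2.continuous.continuousOn
    (by simpa only [interior_Icc] using B.hdecr)

theorem nonFlatAt_ctm : NonFlatAt B.F B.ctm B.lm :=
  ⟨B.psim, B.hpsimC2, B.hpsimD _, B.hpsim0, B.hpsimEq⟩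

theorem nonFlatAt_ctp : NonFlatAt (fun x => -B.F (-x)) (-(B.ctp + 1)) B.lp := by
  have hsh : ∀ x, B.F (-x) = B.F (-x - 1) + 1 := fun x => by rw [← B.hlift, sub_add_cancel]
  have hc : ContinuousAt (fun x : ℝ => -x - 1) (-(B.ctp + 1)) := by fun_prop
  have hat : -(-(B.ctp + 1)) - 1 = B.ctp := by ring
  refine ⟨fun x => B.psip (-x - 1), B.hpsipC2.comp (contDiff_neg.sub contDiff_const), ?_,
    by simp only [hat, B.hpsip0], ?_⟩
  · rw [deriv_comp_neg (fun y => B.psip (y - 1)), deriv_comp_sub_const]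
    exact neg_ne_zero.2 (B.hpsipD _)
  · rw [ContinuousAt, hat] at hc
    filter_upwards [hc.eventually B.hpsipEq] with x hx
    rw [hsh, hx, neg_neg, B.hlift]; ring

theorem Fm_le (x : ℝ) : B.Fm x ≤ B.F x := by
  refine le_of_le_on_period B.Fm.map_add_one B.hlift (d := B.dtm) (fun y hy => ?_) x
  have hd := B.hdtm
  rcases le_total B.ctm y with h | h
  · exact (B.hFm2 y ⟨h, hy.2⟩).le
  rw [B.hFm1 y ⟨hy.1, h⟩]
  rcases le_total B.ctp y with h' | h'
  · exact B.strictAntiOn.antitoneOn ⟨h', h⟩ (right_mem_Icc.2 B.h1.le) h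
  · have := B.strictMonoOn.monotoneOn (a := B.dtm + 1) (b := y + 1)
      ⟨by linarith [hd.1], by linarith [hd.2]⟩ ⟨by linarith [hd.1, hy.1], by linarith⟩
      (by linarith [hy.1])
    rw [B.hlift, B.hlift, B.hdtmF] at this
    linarith

theorem le_Fp (x : ℝ) : B.F x ≤ B.Fp x := by
  refine le_of_le_on_period B.hlift B.Fp.map_add_one (d := B.dtp - 1) (fun y hy => ?_) x
  have hd := B.hdtp
  rcases le_total y B.ctp with h | h
  · have := B.hFp2 (y + 1) ⟨by linarith [hy.1], by linarith⟩
    rw [B.Fp.map_add_one, B.hlift] at this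
    linarith
  rw [sub_add_cancel] at hy
  rw [B.hFp1 y ⟨h, hy.2⟩]
  rcases le_total y B.ctm with h' | h'
  · exact B.strictAntiOn.antitoneOn (left_mem_Icc.2 B.h1.le) ⟨h, h'⟩ h
  · rw [← B.hdtpF]
    exact B.strictMonoOn.monotoneOn ⟨h', by linarith [hy.2, hd.2]⟩ ⟨hd.1.le, hd.2.le⟩ hy.2

/-- The cross-ratio estimates, on either side, between the two critical points. -/
theorem exists_crossRatio_le : ∃ C ≥ 0, ∀ s x y t, B.ctm ≤ s → s < x → x < y → y < t →
    t ≤ B.ctp + 1 →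
    crossRatio s x y t ≤ Real.exp (C * (y - s)) * crossRatio (B.F s) (B.F x) (B.F y) (B.F t) ∧
    crossRatio s x y t ≤ Real.exp (C * (t - x)) * crossRatio (B.F s) (B.F x) (B.F y) (B.F t) := by
  obtain ⟨c⟩ := B.nonFlatAt_ctm.nonempty_critChart
  obtain ⟨c'⟩ := B.nonFlatAt_ctp.nonempty_critChart
  obtain ⟨u, Λ, hΛ, hF, hu⟩ := exists_deriv_eq_exp_mul_modelDens (by linarith [B.h0, B.h2]) B.hC2
    B.hincr B.hlm B.hlp c c'
  have h1 : 0 ≤ B.lm - 1 := by linarith [B.hlm]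
  have h2 : 0 ≤ B.lp - 1 := by linarith [B.hlp]
  have hd : Differentiable ℝ B.F := B.hC2.differentiable two_ne_zero
  refine ⟨2 * Λ + 2 * Λ * (4 * 2 ^ ((B.lm - 1) + (B.lp - 1))), by positivity,
    fun s x y t hs hsx hxy hyt ht =>
      ⟨crossRatio_le_of_deriv_eq h1 h2 hΛ hd hF hu hs hsx hxy hyt ht, ?_⟩⟩
  have hmem : ∀ z ∈ Ioo (-(B.ctp + 1)) (-B.ctm), -z ∈ Ioo B.ctm (B.ctp + 1) := fun z hz =>
    ⟨by linarith [hz.2], by linarith [hz.1]⟩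
  have := crossRatio_le_of_deriv_eq (F := fun x => -B.F (-x)) (u := fun z => u (-z))
    (a := -(B.ctp + 1)) (b := -B.ctm) (s := -t) (x := -y) (y := -x) (t := -s) h2 h1 hΛ
    (hd.comp differentiable_neg).neg (fun z hz => ?_) (fun z hz w hw => ?_) (by linarith)
    (by linarith) (by linarith) (by linarith) (by linarith)
  · simp only [neg_neg, Lorenz.crossRatio_neg] at this
    rwa [add_comm (B.lp - 1), show -x - -t = t - x by ring] at this
  · rw [deriv_neg_comp_neg]
    simp only [hF _ (hmem z hz), modelDens]
    rw [mul_comm ((-z - B.ctm) ^ _), show B.ctp + 1 - -z = z - -(B.ctp + 1) by ring,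
      show -z - B.ctm = -B.ctm - z by ring]
  · have := hu _ (hmem z hz) _ (hmem w hw)
    rwa [neg_sub_neg, abs_sub_comm w z] at this

/-- The lift, cut at its critical points, as Lorenz data. -/
def toLorenz : Lorenz where
  F := B.F
  a := B.ctm
  b := B.ctp + 1
  d := B.dtm
  e := B.dtp
  Fm := B.Fm
  Fp := B.Fp
  rm := B.rhom
  rp := B.rhop
  hab := by linarith [B.h0, B.h2]
  hba := by linarith [B.h1]
  per := B.hlift
  hC1 := B.hC2.of_le (by norm_num)
  dpos := B.hincr
  dneg := by simpa only [add_sub_cancel_right] using B.hdecr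
  hd1 := B.hdtm.1
  hd2 := by linarith [B.hdtm.2]
  hdF := B.hdtmF
  he1 := B.hdtp.1
  he2 := B.hdtp.2
  heF := by rw [B.hlift, B.hdtpF]; ring
  Fm_mono := B.Fm.monotone
  Fm_per := B.Fm.map_add_one
  Fm_le := B.Fm_le
  Fm_eq := B.hFm2
  Fm_flat := B.hFm1
  rm_irr := B.hirrm
  rm_lt := B.Fm.add_int_lt_iterate
  lt_rm := B.Fm.iterate_lt_add_int
  Fp_mono := B.Fp.monotone
  Fp_per := B.Fp.map_add_one
  le_Fp := B.le_Fp
  Fp_eq := B.hFp2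
  Fp_flat x hx := by
    have := B.Fp.map_add_one (x - 1)
    rw [sub_add_cancel] at this
    rw [this, B.hFp1 (x - 1) ⟨by linarith [hx.1], by linarith [hx.2]⟩, B.hlift]
  rp_irr := B.hirrp
  rp_lt := B.Fp.add_int_lt_iterate
  lt_rp := B.Fp.iterate_lt_add_int
  C := B.exists_crossRatio_le.choose
  hC := B.exists_crossRatio_le.choose_spec.1
  crL s x y t hs hsx hxy hyt ht := (B.exists_crossRatio_le.choose_spec.2 s x y t hs hsx hxy hyt ht).1
  crR s x y t hs hsx hxy hyt ht := (B.exists_crossRatio_le.choose_spec.2 s x y t hs hsx hxy hyt ht).2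
  distort := exists_deriv_le_exp_mul B.hC2 B.hincr
  la := B.lm
  hla := B.hlm
  powa := by
    obtain ⟨c⟩ := B.nonFlatAt_ctm.nonempty_critChart
    exact c.power_Icc B.hlm (by linarith [B.h0, B.h2]) B.strictMonoOn
  lb := B.lp
  hlb := B.hlp
  powb := by
    obtain ⟨c⟩ := B.nonFlatAt_ctp.nonempty_critChart
    obtain ⟨c₁, h1, c₂, h2, h⟩ := c.power_Icc (b := -B.ctm) B.hlp (by linarith [B.h0, B.h2])
      fun x hx y hy hxy => neg_lt_neg <| B.strictMonoOn ⟨by linarith [hy.2], by linarith [hy.1]⟩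
        ⟨by linarith [hx.2], by linarith [hx.1]⟩ (neg_lt_neg hxy)
    refine ⟨c₁, h1, c₂, h2, fun s hs => ?_⟩
    have := h s ⟨hs.1, by linarith [hs.2]⟩
    rwa [neg_neg, neg_sub_neg, neg_add, neg_neg, ← sub_eq_add_neg] at this
  twina := by
    obtain ⟨c⟩ := B.nonFlatAt_ctm.nonempty_critChart
    obtain ⟨s₀, h0, K, hK, τ, hs, ha, h1, h2⟩ := c.twin
      (lt_min (sub_pos.2 B.h1) (by linarith [B.h0, B.h2] : 0 < B.ctp + 1 - B.ctm))
    have hs1 := hs.trans (min_le_left _ _)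
    refine ⟨s₀, h0, K, hK, τ, by linarith, ha, fun x hx => ⟨⟨(h1 x hx).1.1, ?_⟩, (h1 x hx).2⟩, h2⟩
    linarith [(h1 x hx).1.2, min_le_right (B.ctm - B.ctp) (B.ctp + 1 - B.ctm)]
  twinb := by
    obtain ⟨c⟩ := B.nonFlatAt_ctp.nonempty_critChart
    obtain ⟨s₀, h0, K, hK, τ, hs, ha, h1, h2⟩ := c.twin
      (lt_min (sub_pos.2 B.h1) (by linarith [B.h0, B.h2] : 0 < B.ctp + 1 - B.ctm))
    have hs1 := hs.trans (min_le_left _ _)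
    have hmem : ∀ x ∈ Icc (B.ctp + 1) (B.ctp + 1 + s₀),
        -x ∈ Icc (-(B.ctp + 1) - s₀) (-(B.ctp + 1)) := fun x hx =>
      ⟨by linarith [hx.2], by linarith [hx.1]⟩
    refine ⟨s₀, h0, K, hK, fun x => -τ (-x), by linarith, by simp only [ha, neg_neg],
      fun x hx => ⟨⟨?_, ?_⟩, ?_⟩, fun x hx y hy hxy => ?_⟩
    · linarith [(h1 _ (hmem x hx)).1.2, min_le_right (B.ctm - B.ctp) (B.ctp + 1 - B.ctm)]
    · linarith [(h1 _ (hmem x hx)).1.1]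
    · simpa using (h1 _ (hmem x hx)).2
    · have := h2 _ (hmem y hy) _ (hmem x hx) (neg_le_neg hxy)
      constructor <;> linarith [this.1, this.2]
  repel x n m hn h := B.hA3 x n hn ⟨m, h⟩

end BimodData

/-- **Proposition (summability of the return time).** For every `f ∈ Bimod`, the first
return time `N⁰` to `𝕀` is integrable over `𝕀` with respect to the Lebesgue measure if
and only if conditions (C⁻) and (C⁺) are both satisfied. -/
theorem returnTime_summable_iff (B : BimodData) :
    (∫⁻ x in B.II, B.N0e x ∂volume) < ⊤ ↔ (B.CondCm ∧ B.CondCp) := by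
  exact BimodData.lintegral_N0e_lt_top_iff (L := B.toLorenz) rfl rfl rfl rfl rfl
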